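/- Assume (F1) and (F2). Then the porous media equation u_t = (u^m)_{xx} + f(x,u)(κ(x) − u) admits a periodic sharp traveling wave, i.e. there exist a tuple (T, δ*, U, B, p₀) with all the properties (1)–(6) listed in the definition of a periodic sharp traveling wave. -/

import Mathlib

open MeasureTheory Set Filter

noncomputable section

/-- Condition (F1): `f` and `κ` are `C²`, 1-periodic in `x`, `f(x,0)=0`, and there is `θ > 0`
with `f(x,u) > 0` for `u > θ` and `κ(x) > θ`. -/
def CondF1 (f : ℝ → ℝ → ℝ) (κ : ℝ → ℝ) (θ : ℝ) : Prop :=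
  ContDiff ℝ 2 (Function.uncurry f) ∧ ContDiff ℝ 2 κ ∧
  (∀ x u, f (x + 1) u = f x u) ∧ (∀ x, κ (x + 1) = κ x) ∧
  (∀ x, f x 0 = 0) ∧ 0 < θ ∧ (∀ x u, θ < u → 0 < f x u) ∧ (∀ x, θ < κ x)

/-- `κ₀ := min κ` (over a period). -/
def kappaMin (κ : ℝ → ℝ) : ℝ := sInf (κ '' Icc 0 1)

/-- `κ⁰ := max κ` (over a period). -/
def kappaMax (κ : ℝ → ℝ) : ℝ := sSup (κ '' Icc 0 1)

/-- Condition (F2): existence of a compactly supported traveling subsolution profile `φ₀`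
with speed `c₀`. -/
def CondF2 (m : ℝ) (f : ℝ → ℝ → ℝ) (κ : ℝ → ℝ) (c₀ l₀ : ℝ) (φ₀ : ℝ → ℝ) : Prop :=
  0 < c₀ ∧ 0 < l₀ ∧ ContDiffOn ℝ 2 φ₀ (Icc (-l₀) l₀) ∧
  φ₀ (-l₀) = 0 ∧ φ₀ l₀ = 0 ∧ (∀ z ∈ Ioo (-l₀) l₀, 0 < φ₀ z) ∧
  c₀ < -(derivWithin φ₀ (Icc (-l₀) l₀) l₀) ∧
  ∀ (x : ℝ), ∀ z ∈ Icc (-l₀) l₀,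
    0 ≤ derivWithin (derivWithin (fun w => φ₀ w ^ m) (Icc (-l₀) l₀)) (Icc (-l₀) l₀) z
        + c₀ * derivWithin φ₀ (Icc (-l₀) l₀) z
        + f x (φ₀ z) * (κ x - φ₀ z)

/-- A (bounded, continuous) very weak solution of `u_t = (u^m)_{xx} + f(x,u)(κ(x)-u)`
on `ℝ × (0,τ)` with initial data `u₀`. -/
def VeryWeakSol (m : ℝ) (f : ℝ → ℝ → ℝ) (κ : ℝ → ℝ) (τ : ℝ)
    (u₀ : ℝ → ℝ) (u : ℝ → ℝ → ℝ) : Prop :=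
  ContinuousOn (fun q : ℝ × ℝ => u q.1 q.2) (univ ×ˢ Ioc (0:ℝ) τ) ∧
  (∃ M : ℝ, ∀ x : ℝ, ∀ t ∈ Ioc (0:ℝ) τ, |u x t| ≤ M) ∧
  ∀ φ : ℝ → ℝ → ℝ, ContDiff ℝ (⊤ : ℕ∞) (Function.uncurry φ) →
    HasCompactSupport (Function.uncurry φ) →
    ∫ x : ℝ, u x τ * φ x τ =
      (∫ x : ℝ, u₀ x * φ x 0)
      + (∫ t in Ioo (0:ℝ) τ, ∫ x : ℝ, f x (u x t) * (κ x - u x t) * φ x t)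
      + (∫ t in Ioo (0:ℝ) τ, ∫ x : ℝ,
          (u x t * deriv (fun s => φ x s) t + u x t ^ m * deriv (deriv (fun y => φ y t)) x))

/-- A global very weak solution: a very weak solution on `ℝ × (0,τ)` for every `τ > 0`. -/
def GlobalVeryWeakSol (m : ℝ) (f : ℝ → ℝ → ℝ) (κ : ℝ → ℝ)
    (u₀ : ℝ → ℝ) (u : ℝ → ℝ → ℝ) : Prop :=
  ∀ τ > (0:ℝ), VeryWeakSol m f κ τ u₀ u

/-- A periodic sharp traveling wave `(T, δs, U, B, p₀)` of the PME
`u_t = (u^m)_{xx} + f(x,u)(κ(x)-u)`. -/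
def PeriodicSharpWave (m : ℝ) (f : ℝ → ℝ → ℝ) (κ : ℝ → ℝ)
    (T δs : ℝ) (U : ℝ → ℝ → ℝ) (B : ℝ → ℝ) (p₀ : ℝ → ℝ) : Prop :=
  0 < T ∧ 0 < δs ∧
  Continuous (fun q : ℝ × ℝ => U q.1 q.2) ∧ (∀ x t, 0 ≤ U x t) ∧
  ContDiff ℝ 1 B ∧
  ContDiff ℝ 2 p₀ ∧ (∀ x, 0 < p₀ x) ∧ (∀ x, p₀ (x + 1) = p₀ x) ∧
  (∀ x, deriv (deriv (fun y => p₀ y ^ m)) x + f x (p₀ x) * (κ x - p₀ x) = 0) ∧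
  -- (1) periodic traveling wave property
  (∀ x t, U x (t + T) = U (x - 1) t) ∧
  -- (2) positivity exactly on Q = {x < B t}
  (∀ x t, x < B t → 0 < U x t) ∧ (∀ x t, B t ≤ x → U x t = 0) ∧
  -- (3) C^{2,1} regularity on Q and the classical equation there
  (∀ x t, x < B t →
      DifferentiableAt ℝ (fun s => U x s) t ∧
      DifferentiableAt ℝ (fun y => U y t) x ∧
      DifferentiableAt ℝ (deriv (fun y => U y t)) x) ∧
  ContinuousOn (fun q : ℝ × ℝ => deriv (fun y => U y q.2) q.1) {q : ℝ × ℝ | q.1 < B q.2} ∧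
  ContinuousOn (fun q : ℝ × ℝ => deriv (deriv (fun y => U y q.2)) q.1)
    {q : ℝ × ℝ | q.1 < B q.2} ∧
  ContinuousOn (fun q : ℝ × ℝ => deriv (fun s => U q.1 s) q.2) {q : ℝ × ℝ | q.1 < B q.2} ∧
  (∀ x t, x < B t →
      deriv (fun s => U x s) t
        = deriv (deriv (fun y => U y t ^ m)) x + f x (U x t) * (κ x - U x t)) ∧
  -- (4) very weak solution on every time slab
  (∀ a τ : ℝ, a < τ →
      VeryWeakSol m f κ (τ - a) (fun x => U x a) (fun x t => U x (t + a))) ∧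
  -- (5) convergence to the periodic steady state at left infinity
  (∀ t, Tendsto (fun x => U x t - p₀ x) atBot (nhds 0)) ∧
  -- (6) Darcy's law with uniformly positive speed
  (∀ t, deriv B t
        = -(m / (m - 1)) * derivWithin (fun y => U y t ^ (m - 1)) (Iic (B t)) (B t) ∧
      δs ≤ deriv B t)

open Topology Real

/-- A positive power of the distance to the endpoint can only have a positive finite limit if
the exponent vanishes. -/
lemma rpow_exponent_eq_zero {e Y : ℝ} (hY : 0 < Y)
    (h : Tendsto (fun s : ℝ => s ^ e) (𝓝[>] 0) (𝓝 Y)) : e = 0 := by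
  rcases lt_trichotomy e 0 with he | he | he
  · have h1 := tendsto_rpow_neg_nhdsGT_zero he
    exact absurd h (not_tendsto_nhds_of_tendsto_atTop h1 Y)
  · exact he
  · have h1 : Tendsto (fun s : ℝ => s ^ e) (𝓝[>] 0) (𝓝 0) := by
      have := (Real.continuousAt_rpow_const 0 e (Or.inr he.le)).tendsto
      rw [Real.zero_rpow he.ne'] at this
      exact this.mono_left nhdsWithin_le_nhds
    exact absurd (tendsto_nhds_unique h h1) hY.ne'

/-- The endpoint inequality in (F2) forces the exponent to be quadratic. -/
lemma CondF2.exponent_eq_two {m : ℝ} (hm : 1 < m) {f : ℝ → ℝ → ℝ} {κ : ℝ → ℝ} {θ : ℝ}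
    (hF1 : CondF1 f κ θ) {c₀ l₀ : ℝ} {φ₀ : ℝ → ℝ} (hF2 : CondF2 m f κ c₀ l₀ φ₀) : m = 2 := by
  obtain ⟨hc, hl, hφ, -, h0, hpos, ha, hin⟩ := hF2
  set I := Icc (-l₀) l₀
  have hu : UniqueDiffOn ℝ I := uniqueDiffOn_Icc (by linarith)
  have hlI : l₀ ∈ I := ⟨by linarith, le_rfl⟩
  have hd : ∀ z ∈ I, HasDerivWithinAt φ₀ (derivWithin φ₀ I z) I z := fun z hz =>
    ((hφ.differentiableOn (by norm_num)) z hz).hasDerivWithinAt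
  have hcd : ContinuousOn (derivWithin φ₀ I) I := hφ.continuousOn_derivWithin hu (by norm_num)
  have hg : ∀ z ∈ I, derivWithin (fun w => φ₀ w ^ m) I z
      = derivWithin φ₀ I z * m * φ₀ z ^ (m - 1) := fun z hz =>
    ((hd z hz).rpow_const (Or.inr hm.le)).derivWithin (hu z hz)
  set a := -(derivWithin φ₀ I l₀) with haa
  set X := derivWithin (derivWithin (fun w => φ₀ w ^ m) I) I l₀ with hX
  have hXpos : 0 < X := by
    have := hin 0 l₀ hlI
    rw [h0, hF1.2.2.2.2.1] at this
    nlinarith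
  have hdiff : HasDerivWithinAt (derivWithin (fun w => φ₀ w ^ m) I) X I l₀ := by
    by_contra hne
    have : ¬ DifferentiableWithinAt ℝ (derivWithin (fun w => φ₀ w ^ m) I) I l₀ := fun h =>
      hne h.hasDerivWithinAt
    rw [hX, derivWithin_zero_of_not_differentiableWithinAt this] at hXpos
    exact lt_irrefl _ hXpos
  have hs1 := hasDerivWithinAt_iff_tendsto_slope.1 hdiff
  have hs2 := hasDerivWithinAt_iff_tendsto_slope.1 (hd l₀ hlI)
  have hs3 : Tendsto (derivWithin φ₀ I) (nhdsWithin l₀ (I \ {l₀})) (𝓝 (-a)) := by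
    have := (hcd l₀ hlI)
    rw [haa, neg_neg]
    exact this.mono_left (nhdsWithin_mono _ sdiff_subset)
  have hmap : Tendsto (fun s : ℝ => l₀ - s) (𝓝[>] 0) (nhdsWithin l₀ (I \ {l₀})) := by
    rw [tendsto_nhdsWithin_iff]
    constructor
    · have : Tendsto (fun s : ℝ => l₀ - s) (𝓝 0) (𝓝 (l₀ - 0)) :=
        (continuous_const.sub continuous_id).tendsto 0
      rw [sub_zero] at this
      exact this.mono_left nhdsWithin_le_nhds
    · filter_upwards [Ioo_mem_nhdsGT (show (0:ℝ) < l₀ by linarith)] with s hs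
      grind
  have t1 := hs1.comp hmap
  have t2 := hs2.comp hmap
  have t3 := hs3.comp hmap
  have hapos : 0 < a := by linarith
  have t2' := t2.neg
  rw [← haa] at t2'
  have t4 := (t2'.rpow_const (p := m - 1) (Or.inl hapos.ne'))
  have hlim := t1.div ((t3.neg.mul_const m).mul t4) (by rw [neg_neg]; positivity)
  have hfin := rpow_exponent_eq_zero (e := m - 2) (Y := X / (- -a * m * a ^ (m - 1)))
    (by rw [neg_neg]; positivity) (hlim.congr' ?_)
  · linarith
  filter_upwards [Ioo_mem_nhdsGT (show (0:ℝ) < l₀ by linarith),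
    t3.eventually_lt_const (show -a < -(a/2) by linarith)] with s hs hds
  have hsI : l₀ - s ∈ I := ⟨by linarith [hs.2], by linarith [hs.1]⟩
  have hp : 0 < φ₀ (l₀ - s) := hpos _ ⟨by linarith [hs.2], by linarith [hs.1]⟩
  simp only [Function.comp_apply, slope_def_field, hg _ hsI, hg _ hlI, h0, Pi.div_apply] at hds ⊢
  rw [Real.zero_rpow (by linarith)]
  have e1 : (l₀ - s - l₀) = -s := by ring
  have e2 : -((φ₀ (l₀ - s) - 0) / -s) = φ₀ (l₀ - s) / s := by ring
  rw [e1, e2, Real.div_rpow hp.le hs.1.le, show m - 2 = (m - 1) - 1 by ring,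
    Real.rpow_sub_one hs.1.ne' (m - 1)]
  have hp1 : 0 < φ₀ (l₀ - s) ^ (m - 1) := Real.rpow_pos_of_pos hp _
  have hp2 : 0 < s ^ (m - 1) := Real.rpow_pos_of_pos hs.1 _
  have hdn : derivWithin φ₀ I (l₀ - s) ≠ 0 := by linarith
  have hs0 := hs.1.ne'
  generalize φ₀ (l₀ - s) ^ (m - 1) = p at *
  generalize s ^ (m - 1) = q at *
  have hp3 := hp1.ne'
  grind

/-- A continuous function that starts nonnegative and has nonnegative right derivative wherever it
is negative stays nonnegative. -/
lemma nonneg_of_rightDeriv_nonneg {w : ℝ → ℝ} {a b : ℝ} (hab : a ≤ b)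
    (hc : ContinuousOn w (Icc a b)) (ha : 0 ≤ w a)
    (hd : ∀ r ∈ Ico a b, w r < 0 → ∃ w', HasDerivWithinAt w w' (Ici r) r ∧ 0 ≤ w') : 0 ≤ w b := by
  have key : ∀ δ > 0, -(δ * (1 + (b - a))) ≤ w b := by
    intro δ hδ
    have hcl : IsClosed ({r | -(δ * (1 + (r - a))) ≤ w r} ∩ Icc a b) := by
      have : {r | -(δ * (1 + (r - a))) ≤ w r} ∩ Icc a b
          = Icc a b ∩ {r | -(δ * (1 + (r - a))) ≤ w r} := inter_comm _ _
      rw [this]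
      have h2 : ContinuousOn (fun r => w r + δ * (1 + (r - a))) (Icc a b) :=
        hc.add (by fun_prop)
      have h3 := h2.preimage_isClosed_of_isClosed isClosed_Icc (isClosed_Ici (a := (0:ℝ)))
      convert h3 using 1
      grind
    refine hcl.Icc_subset_of_forall_exists_gt (by grind)
      ?_ (right_mem_Icc.2 hab)
    rintro x ⟨hx, hxI⟩ y hy
    rw [mem_ofPred_eq] at hx
    have hmem : Ioc x (min y b) ∈ 𝓝[>] x := Ioc_mem_nhdsGT (lt_min hy hxI.2)
    rcases lt_or_ge (w x) 0 with hneg | hpos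
    · obtain ⟨w', hw', hw0⟩ := hd x hxI hneg
      have h1 := hasDerivWithinAt_iff_tendsto_slope.1 hw'
      rw [Ici_sdiff_left] at h1
      have h2 := h1.eventually_const_lt (show -δ < w' by linarith)
      obtain ⟨z, hz, hzs⟩ := (h2.and hmem).exists
      refine ⟨z, ?_, hzs.1, hzs.2.trans (min_le_left _ _)⟩
      have hzx : 0 < z - x := sub_pos.2 hzs.1
      rw [slope_def_field, lt_div_iff₀ hzx] at hz
      rw [mem_ofPred_eq]
      nlinarith
    · have h2 : Tendsto w (𝓝[>] x) (𝓝 (w x)) := by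
        have h4 : ContinuousWithinAt w (Ioc x b) x :=
          (hc x ⟨hxI.1, hxI.2.le⟩).mono (fun z hz => ⟨hxI.1.trans hz.1.le, hz.2⟩)
        have : 𝓝[>] x = nhdsWithin x (Ioc x b) :=
          (nhdsWithin_Ioc_eq_nhdsGT hxI.2).symm
        rw [this]; exact h4
      have h3 := h2.eventually_const_lt (show -δ < w x by linarith)
      obtain ⟨z, hz, hzs⟩ := (h3.and hmem).exists
      refine ⟨z, ?_, hzs.1, hzs.2.trans (min_le_left _ _)⟩
      rw [mem_ofPred_eq]
      nlinarith [hxI.1]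
  refine le_of_forall_pos_lt_add fun ε hε => ?_
  have := key (ε / (2 * (1 + (b - a)))) (by positivity)
  have h1 : (1 + (b - a)) ≠ 0 := by linarith
  have h2 : ε / (2 * (1 + (b - a))) * (1 + (b - a)) = ε / 2 := by field_simp
  linarith

/-- Positivity principle for an arbitrary family of functions, each of whose derivatives is
controlled from below by the worst negative value of the family. -/
lemma nonneg_family {ι : Type*} {y : ι → ℝ → ℝ} {a b C Z : ℝ} (hC : 0 ≤ C)
    (hcont : ∀ i, ContinuousOn (y i) (Icc a b)) (h0 : ∀ i, 0 ≤ y i a)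
    (hZ : ∀ i, ∀ t ∈ Icc a b, -Z ≤ y i t)
    (hd : ∀ t ∈ Ico a b, ∀ B, 0 ≤ B → B ≤ Z → (∀ j, -B ≤ y j t) → ∀ i, y i t < 0 →
      ∃ y', HasDerivWithinAt (y i) y' (Ici t) t ∧ -(C * B) ≤ y') :
    ∀ i, ∀ t ∈ Icc a b, 0 ≤ y i t := by
  rcases lt_or_ge Z 0 with hZ0 | hZ0
  · intro i t ht; linarith [hZ i t ht]
  have key : ∀ n : ℕ, ∀ i, ∀ t ∈ Icc a b, -(Z * (C * (t - a)) ^ n / n.factorial) ≤ y i t := by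
    intro n
    induction n with
    | zero => intro i t ht; simpa using hZ i t ht
    | succ n ih =>
      intro i t ht
      have hw := nonneg_of_rightDeriv_nonneg
        (w := fun r => y i r + Z * (C * (r - a)) ^ (n + 1) / (n + 1).factorial) ht.1
        (((hcont i).mono (Icc_subset_Icc_right ht.2)).add (by fun_prop)) (by simpa using h0 i)
        (by
          intro r hr hneg
          have hra : 0 ≤ r - a := sub_nonneg.2 hr.1
          have hp : 0 ≤ Z * (C * (r - a)) ^ (n + 1) / (n + 1).factorial := by positivity
          have hp' : 0 ≤ Z * (C * (r - a)) ^ n / n.factorial := by positivity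
          have hrI : r ∈ Icc a b := ⟨hr.1, hr.2.le.trans ht.2⟩
          obtain ⟨y', hy', hyb⟩ := hd r ⟨hr.1, hr.2.trans_le ht.2⟩
            (min Z (Z * (C * (r - a)) ^ n / n.factorial)) (le_min hZ0 hp') (min_le_left _ _)
            (fun j => by
              grind) i (by linarith)
          have hder : HasDerivAt (fun r => Z * (C * (r - a)) ^ (n + 1) / (n + 1).factorial)
              (C * (Z * (C * (r - a)) ^ n / n.factorial)) r := by
            have h := ((((hasDerivAt_id r).sub_const a).const_mul C).fun_pow (n + 1)).const_mul Z
              |>.div_const ((n + 1).factorial : ℝ)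
            refine h.congr_deriv ?_
            rw [Nat.factorial_succ]
            push_cast
            have h1 : (n.factorial : ℝ) ≠ 0 := by positivity
            have h2 : ((n : ℝ) + 1) ≠ 0 := by positivity
            grind
          refine ⟨_, hy'.add hder.hasDerivWithinAt, ?_⟩
          have := mul_le_mul_of_nonneg_left
            (min_le_right Z (Z * (C * (r - a)) ^ n / n.factorial)) hC
          linarith)
      linarith
  intro i t ht
  have hlim : Tendsto (fun n : ℕ => -(Z * ((C * (t - a)) ^ n / n.factorial))) atTop
      (𝓝 (-(Z * 0))) :=
    ((FloorSemiring.tendsto_pow_div_factorial_atTop (C * (t - a))).const_mul Z).neg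
  rw [mul_zero, neg_zero] at hlim
  refine le_of_tendsto' hlim fun n => ?_
  have := key n i t ht
  rwa [mul_div_assoc] at this

/-- The data of a quadratic porous medium equation `u_t = (u²)_xx + g(x,u)` used in the
construction: quantitative bounds on `g`, and a compactly bounded travelling subsolution `φ`
of its lattice discretizations. -/
structure WaveData where
  g : ℝ → ℝ → ℝ
  M : ℝ
  L : ℝ
  σ₀ : ℝ
  c : ℝ
  us : ℝ
  zs : ℝ
  l : ℝ
  φ : ℝ → ℝ
  dφ : ℝ → ℝ
  one_le_M : 1 ≤ M
  one_le_L : 1 ≤ L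
  σ₀_pos : 0 < σ₀
  σ₀_le : σ₀ ≤ 1
  g_cont : Continuous (Function.uncurry g)
  g_diff : ∀ x u, DifferentiableAt ℝ (g x) u
  g_per : ∀ x u, g (x + 1) u = g x u
  g_zero : ∀ x, g x 0 = 0
  g_M : ∀ x, g x M ≤ -(σ₀ * M)
  lip : ∀ x, ∀ u ∈ Icc (-1) (M + 1), ∀ v ∈ Icc (-1) (M + 1), |g x u - g x v| ≤ L * |u - v|
  lipx : ∀ x y, ∀ u ∈ Icc (-1) (M + 1), |g x u - g y u| ≤ L * |x - y|
  sec : ∀ x h, 0 ≤ h → h ≤ 1 → ∀ u ∈ Icc (-1) (M + 1), ∀ b ∈ Icc (-1) (M + 1),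
    ∀ d ∈ Icc (-1) (M + 1), |g (x + h) b + g (x - h) d - 2 * g x u|
      ≤ L * |b + d - 2 * u| + L * (h ^ 2 + (b - u) ^ 2 + (d - u) ^ 2)
  c_pos : 0 < c
  us_pos : 0 < us
  us_le : us ≤ M
  φ_nonneg : ∀ z, 0 ≤ φ z
  φ_le : ∀ z, φ z ≤ us
  φ_left : ∀ z ≤ zs, φ z = us
  φ_right : ∀ z, l ≤ z → φ z = 0
  φ_cont : Continuous φ
  φ_deriv : ∀ z < l, HasDerivAt φ (dφ z) z
  φ_sub : ∀ σ, 0 < σ → σ ≤ σ₀ → ∃ h₀ > 0, ∀ h, 0 < h → h ≤ h₀ → ∀ x z, z < l →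
    -(c * dφ z) ≤ ((φ (z + h) ^ 2 + 2 * σ ^ 2 * φ (z + h)) - 2 * (φ z ^ 2 + 2 * σ ^ 2 * φ z)
      + (φ (z - h) ^ 2 + 2 * σ ^ 2 * φ (z - h))) / h ^ 2 + g x (φ z) + σ * φ z

/-- The discrete Laplacian on a lattice of mesh `h`. -/
def lap (h : ℝ) (a : ℤ → ℝ) (i : ℤ) : ℝ := (a (i + 1) - 2 * a i + a (i - 1)) / h ^ 2

/-- The regularized porous medium nonlinearity. -/
def Phi (σ u : ℝ) : ℝ := u ^ 2 + 2 * σ ^ 2 * u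

namespace WaveData
variable (D : WaveData)

/-- The perturbed reaction term. -/
def G (σ x u : ℝ) : ℝ := D.g x u + σ * u

/-- `u` is a `[0,M]`-valued solution, at time `t`, of the lattice equation. -/
def SolAt (σ h : ℝ) (u : ℤ → ℝ → ℝ) (t : ℝ) : Prop :=
  ∀ i, u i t ∈ Icc 0 D.M ∧
    HasDerivAt (u i) (lap h (fun j => Phi σ (u j t)) i + D.G σ (i * h) (u i t)) t

variable {D} {σ h : ℝ}

lemma M_pos : 0 < D.M := one_pos.trans_le D.one_le_M
lemma L_pos : 0 < D.L := one_pos.trans_le D.one_le_L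

lemma lip_Icc (x : ℝ) {u v : ℝ} (hu : u ∈ Icc 0 D.M) (hv : v ∈ Icc 0 D.M) :
    |D.g x u - D.g x v| ≤ D.L * |u - v| :=
  D.lip x u ⟨by linarith [hu.1], by linarith [hu.2]⟩ v ⟨by linarith [hv.1], by linarith [hv.2]⟩

lemma G_lip (hσ : 0 < σ) (hσ1 : σ ≤ D.σ₀) (x : ℝ) {u v : ℝ} (hu : u ∈ Icc 0 D.M)
    (hv : v ∈ Icc 0 D.M) : |D.G σ x u - D.G σ x v| ≤ (D.L + 1) * |u - v| := by
  have h1 := D.lip_Icc x hu hv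
  have h2 : D.G σ x u - D.G σ x v = (D.g x u - D.g x v) + σ * (u - v) := by unfold G; ring
  rw [h2]
  refine (abs_add_le _ _).trans ?_
  rw [abs_mul, abs_of_pos hσ]
  nlinarith [abs_nonneg (u - v), D.σ₀_le]

lemma G_abs_le (hσ : 0 < σ) (hσ1 : σ ≤ D.σ₀) (x : ℝ) {u : ℝ} (hu : u ∈ Icc 0 D.M) :
    |D.G σ x u| ≤ (D.L + 1) * u := by
  have := G_lip hσ hσ1 x hu (v := 0) ⟨le_rfl, D.M_pos.le⟩
  simpa [G, D.g_zero, abs_of_nonneg hu.1] using this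

lemma SolAt.continuousAt {u : ℤ → ℝ → ℝ} {t : ℝ} (hu : D.SolAt σ h u t) (i : ℤ) :
    ContinuousAt (u i) t := (hu i).2.continuousAt

/-- Comparison with nonnegative subsolutions. -/
lemma compare_sub (hσ : 0 < σ) (hσ1 : σ ≤ D.σ₀) {u v : ℤ → ℝ → ℝ} {a b : ℝ}
    (hu : ∀ t ∈ Icc a b, D.SolAt σ h u t)
    (hvI : ∀ t ∈ Icc a b, ∀ i, v i t ∈ Icc 0 D.M) (hvc : ∀ i, ContinuousOn (v i) (Icc a b))
    (h0 : ∀ i, v i a ≤ u i a)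
    (hv : ∀ t ∈ Ico a b, ∀ i, u i t < v i t → ∃ v', HasDerivWithinAt (v i) v' (Ici t) t ∧
      v' ≤ lap h (fun j => Phi σ (v j t)) i + D.G σ (i * h) (v i t)) :
    ∀ i, ∀ t ∈ Icc a b, v i t ≤ u i t := by
  have hσ2 : σ ≤ 1 := hσ1.trans D.σ₀_le
  have hM := D.M_pos
  have hL := D.L_pos
  have key := nonneg_family (y := fun i t => u i t - v i t) (a := a) (b := b)
    (C := 2 * (2 * D.M + 2) / h ^ 2 + (D.L + 1)) (Z := D.M) (by positivity)
    (fun i t ht => ((hu t ht).continuousAt i).continuousWithinAt.sub (hvc i t ht))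
    (fun i => sub_nonneg.2 (h0 i))
    (fun i t ht => by linarith [((hu t ht) i).1.1, (hvI t ht i).2])
    (by
      intro t ht B hB hBZ hlow i hneg
      have htI : t ∈ Icc a b := ⟨ht.1, ht.2.le⟩
      obtain ⟨v', hv', hvb⟩ := hv t ht i (by linarith)
      refine ⟨_, ((hu t htI) i).2.hasDerivWithinAt.sub hv', ?_⟩
      have hG := G_lip hσ hσ1 (i * h) ((hu t htI) i).1 (hvI t htI i)
      have hneg' : u i t - v i t < 0 := hneg
      rw [abs_of_neg hneg'] at hG
      have hG1 := (abs_le.1 hG).1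
      have hP : ∀ j, Phi σ (u j t) - Phi σ (v j t) ≥ -((2 * D.M + 2) * B) := by
        intro j
        have e : Phi σ (u j t) - Phi σ (v j t)
          = (u j t + v j t + 2 * σ ^ 2) * (u j t - v j t) := by unfold Phi; ring
        rw [e]
        have h1 := ((hu t htI) j).1
        have h2 := hvI t htI j
        have h3 := hlow j
        have h4 : 0 ≤ u j t + v j t + 2 * σ ^ 2 := by
          have := h1.1; have := h2.1; positivity
        have h5 : u j t + v j t + 2 * σ ^ 2 ≤ 2 * D.M + 2 := by
          nlinarith [h1.2, h2.2]
        nlinarith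
      have hPi : Phi σ (u i t) - Phi σ (v i t) ≤ 0 := by
        have e : Phi σ (u i t) - Phi σ (v i t)
          = (u i t + v i t + 2 * σ ^ 2) * (u i t - v i t) := by unfold Phi; ring
        rw [e]
        have h4 : 0 ≤ u i t + v i t + 2 * σ ^ 2 := by
          have := ((hu t htI) i).1.1; have := (hvI t htI i).1; positivity
        nlinarith
      have hlap : lap h (fun j => Phi σ (u j t)) i - lap h (fun j => Phi σ (v j t)) i
          ≥ -(2 * (2 * D.M + 2) / h ^ 2 * B) := by
        unfold lap
        rw [← sub_div, ge_iff_le, div_mul_eq_mul_div, ← neg_div]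
        gcongr
        linarith [hP (i + 1), hP (i - 1)]
      have h3 := hlow i
      nlinarith)
  intro i t ht
  have := key i t ht
  linarith

/-- `a` and `b` cross at most once, and `a - b` can only change sign from plus to minus. -/
def Crosses (a b : ℤ → ℝ) : Prop := ∀ i j, i < j → b i ≤ a i ∨ a j ≤ b j

lemma crossing_aux (hσ : 0 < σ) (hσ1 : σ ≤ D.σ₀) {U V : ℤ → ℝ} (hU : ∀ j, U j ∈ Icc 0 D.M)
    (hV : ∀ j, V j ∈ Icc 0 D.M) {i : ℤ} {q B : ℝ} (hq : 0 < q) (hi : U i - V i < 0)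
    (hlow : ∀ j, j = i ∨ j = i + 1 ∨ j = i - 1 → -B ≤ (U j - V j) * q) :
    -(2 * (2 * D.M + 2) / h ^ 2 + (D.L + 1)) * B
      ≤ (lap h (fun j => Phi σ (U j)) i + D.G σ (i * h) (U i)
        - (lap h (fun j => Phi σ (V j)) i + D.G σ (i * h) (V i))) * q := by
  have hσ2 : σ ≤ 1 := hσ1.trans D.σ₀_le
  have hL := D.L_pos
  have hB : 0 ≤ B := by nlinarith [hlow i (Or.inl rfl), mul_neg_of_neg_of_pos hi hq]
  have e : ∀ j, Phi σ (U j) - Phi σ (V j) = (U j + V j + 2 * σ ^ 2) * (U j - V j) := by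
    intro j; unfold Phi; ring
  have hA : ∀ j, 0 ≤ U j + V j + 2 * σ ^ 2 ∧ U j + V j + 2 * σ ^ 2 ≤ 2 * D.M + 2 := fun j =>
    ⟨by have := (hU j).1; have := (hV j).1; positivity, by nlinarith [(hU j).2, (hV j).2]⟩
  have hP : ∀ j, j = i ∨ j = i + 1 ∨ j = i - 1 →
      -((2 * D.M + 2) * B) ≤ (Phi σ (U j) - Phi σ (V j)) * q := by
    intro j hj
    rw [e j, mul_assoc]
    have := hlow j hj
    nlinarith [(hA j).1, (hA j).2]
  have hPi : (Phi σ (U i) - Phi σ (V i)) * q ≤ 0 := by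
    rw [e i, mul_assoc]
    nlinarith [(hA i).1, mul_neg_of_neg_of_pos hi hq]
  have hlap : -(2 * (2 * D.M + 2) / h ^ 2 * B) ≤
      (lap h (fun j => Phi σ (U j)) i - lap h (fun j => Phi σ (V j)) i) * q := by
    unfold lap
    rw [← sub_div, div_mul_eq_mul_div, div_mul_eq_mul_div, ← neg_div]
    gcongr
    linarith [hP (i + 1) (by tauto), hP (i - 1) (by tauto)]
  have hG := G_lip hσ hσ1 (i * h) (hU i) (hV i)
  rw [abs_of_neg hi] at hG
  have hG1 := (abs_le.1 hG).1
  nlinarith [hlow i (Or.inl rfl)]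

/-- The single-crossing relation is preserved by the lattice equation. -/
lemma Crosses.preserved (hσ : 0 < σ) (hσ1 : σ ≤ D.σ₀) {u v : ℤ → ℝ → ℝ} {a b : ℝ}
    (hu : ∀ t ∈ Icc a b, D.SolAt σ h u t) (hv : ∀ t ∈ Icc a b, D.SolAt σ h v t)
    (h0 : Crosses (fun i => u i a) (fun i => v i a)) :
    ∀ t ∈ Icc a b, Crosses (fun i => u i t) (fun i => v i t) := by
  have hM := D.M_pos
  have hL := D.L_pos
  have key := nonneg_family (ι := {p : ℤ × ℤ // p.1 < p.2})
    (y := fun p t => min (u p.1.1 t - v p.1.1 t) 0 * max (u p.1.2 t - v p.1.2 t) 0)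
    (a := a) (b := b) (C := 2 * (2 * (2 * D.M + 2) / h ^ 2 + (D.L + 1))) (Z := D.M * D.M)
    (by positivity) ?_ ?_ ?_ ?_
  · intro t ht i j hij
    have h1 := key ⟨(i, j), hij⟩ t ht
    by_contra! hcon
    have h2 : u i t - v i t < 0 := by linarith [hcon.1]
    have h3 : 0 < u j t - v j t := by linarith [hcon.2]
    simp only at h1
    rw [min_eq_left h2.le, max_eq_left h3.le] at h1
    nlinarith
  · intro p t ht
    have hc : ∀ i, ContinuousWithinAt (fun t => u i t - v i t) (Icc a b) t := fun i =>
      (((hu t ht).continuousAt i).sub ((hv t ht).continuousAt i)).continuousWithinAt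
    exact (ContinuousWithinAt.inf (hc _) continuousWithinAt_const).mul
      (ContinuousWithinAt.sup (hc _) continuousWithinAt_const)
  · rintro ⟨⟨i, j⟩, hij⟩
    rcases h0 i j hij with h | h
    · simp only at h ⊢; rw [min_eq_right (by linarith)]; simp
    · simp only at h ⊢; rw [max_eq_right (by linarith)]; simp
  · rintro ⟨⟨i, j⟩, hij⟩ t ht
    have h1 := ((hu t ht) i).1; have h2 := ((hv t ht) i).1
    have h3 := ((hu t ht) j).1; have h4 := ((hv t ht) j).1
    have h5 : -D.M ≤ min (u i t - v i t) 0 := le_min (by linarith [h1.1, h2.2]) (by linarith)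
    have h6 : max (u j t - v j t) 0 ≤ D.M := max_le (by linarith [h3.2, h4.1]) (by linarith)
    have h7 : 0 ≤ max (u j t - v j t) 0 := le_max_right _ _
    simp only
    nlinarith
  · rintro t ht B hB - hlow ⟨⟨i, j⟩, hij⟩ hneg
    have htI : t ∈ Icc a b := ⟨ht.1, ht.2.le⟩
    simp only at hneg hij ⊢
    have hi : u i t - v i t < 0 := by
      by_contra! hcon
      rw [min_eq_right hcon] at hneg
      simp at hneg
    have hj : 0 < u j t - v j t := by
      by_contra! hcon
      rw [max_eq_right hcon] at hneg
      simp at hneg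
    have di := ((hu t htI) i).2.sub ((hv t htI) i).2
    have dj := ((hu t htI) j).2.sub ((hv t htI) j).2
    have heq : (fun t => min (u i t - v i t) 0 * max (u j t - v j t) 0)
        =ᶠ[𝓝 t] ((u i - v i) * (u j - v j)) := by
      filter_upwards [di.continuousAt.eventually_lt_const hi,
        dj.continuousAt.eventually_const_lt hj] with s h1 h2
      simp only [Pi.sub_apply, Pi.mul_apply] at h1 h2 ⊢
      rw [min_eq_left h1.le, max_eq_left h2.le]
    refine ⟨_, ((di.mul dj).congr_of_eventuallyEq heq).hasDerivWithinAt, ?_⟩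
    simp only [Pi.sub_apply]
    have low : ∀ i' j', i' < j' → u i' t - v i' t ≤ 0 → 0 ≤ u j' t - v j' t →
        -B ≤ (u i' t - v i' t) * (u j' t - v j' t) := by
      intro i' j' h1 h2 h3
      have := hlow ⟨(i', j'), h1⟩
      simpa only [min_eq_left h2, max_eq_left h3] using this
    have A1 := crossing_aux (D := D) (h := h) hσ hσ1 (U := fun k => u k t) (V := fun k => v k t)
      (fun k => ((hu t htI) k).1) (fun k => ((hv t htI) k).1) (i := i) (B := B) hj hi (by
        intro k hk
        rcases le_or_gt 0 (u k t - v k t) with hk0 | hk0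
        · have := mul_nonneg hk0 hj.le; linarith
        · have hkj : k < j := by
            have : k ≠ j := by rintro rfl; linarith
            omega
          exact low k j hkj hk0.le hj.le)
    have A2 := crossing_aux (D := D) (h := h) hσ hσ1 (U := fun k => v k t) (V := fun k => u k t)
      (fun k => ((hv t htI) k).1) (fun k => ((hu t htI) k).1) (i := j) (B := B)
      (q := -(u i t - v i t)) (by linarith) (by linarith) (by
        intro k hk
        rcases le_or_gt (u k t - v k t) 0 with hk0 | hk0
        · nlinarith
        · have hkj : i < k := by
            have : k ≠ i := by rintro rfl; linarith
            omega
          have := low i k hkj hi.le hk0.le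
          nlinarith)
    nlinarith

end WaveData

lemma lap_neg_rev (h : ℝ) (a : ℤ → ℝ) (i : ℤ) :
    lap h (fun j => a (-j)) i = lap h a (-i) := by
  unfold lap
  dsimp only
  rw [show -(i + 1) = -i - 1 by ring, show -(i - 1) = -i + 1 by ring]
  ring

/-- One-sided slope bound for bounded semiconvex lattice functions. -/
lemma slope_sq_le_aux {h M P : ℝ} (hh : 0 < h) (hP : 0 < P) (hM : 0 ≤ M) (hsm : h ^ 2 * P ≤ M)
    {a : ℤ → ℝ} (ha : ∀ i, a i ∈ Icc 0 M) (hl : ∀ i, -P ≤ lap h a i) {i : ℤ}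
    (hs : 0 ≤ a (i + 1) - a i) : (a (i + 1) - a i) ^ 2 ≤ 4 * M * P * h ^ 2 := by
  set s := a (i + 1) - a i with hsdef
  have hh2 : 0 < h ^ 2 := by positivity
  have hl' : ∀ j, -(P * h ^ 2) ≤ a (j + 1) - 2 * a j + a (j - 1) := by
    intro j
    have := hl j
    unfold lap at this
    rw [le_div_iff₀ hh2] at this
    linarith
  have h1 : ∀ k : ℕ, s - k * (P * h ^ 2) ≤ a (i + k + 1) - a (i + k) := by
    intro k
    induction k with
    | zero => simp [hsdef]
    | succ k ih =>
      have := hl' (i + k + 1)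
      rw [show i + (k : ℤ) + 1 - 1 = i + k by ring] at this
      push_cast
      rw [← add_assoc]
      linarith
  have h2 : ∀ k : ℕ, k * s - (k * k) / 2 * (P * h ^ 2) ≤ a (i + k) - a i := by
    intro k
    induction k with
    | zero => simp
    | succ k ih =>
      have := h1 k
      push_cast
      rw [← add_assoc]
      have hPh : 0 < P * h ^ 2 := by positivity
      nlinarith
  have hPh : 0 < P * h ^ 2 := by positivity
  set r := s / (P * h ^ 2) with hr
  have hr0 : 0 ≤ r := by positivity
  have hsr : s = r * (P * h ^ 2) := by rw [hr]; field_simp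
  rcases le_or_gt r 1 with hr1 | hr1
  · have h5 : s ≤ P * h ^ 2 := by rw [hsr]; nlinarith
    nlinarith
  · set k := ⌊r⌋₊
    have hk1 : (k : ℝ) ≤ r := Nat.floor_le hr0
    have hk2 : r < k + 1 := Nat.lt_floor_add_one r
    have hk3 : (1 : ℝ) ≤ k := by exact_mod_cast Nat.le_floor (by simpa using hr1.le)
    have h6 := h2 k
    have h7 : a (i + k) - a i ≤ M := by linarith [(ha (i + k)).2, (ha i).1]
    have h8 : (k : ℝ) * r - k * k / 2 ≥ r * r / 4 := by nlinarith
    have h9 : r * r / 4 * (P * h ^ 2) ≤ M := by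
      nlinarith
    have e2 : s ^ 2 = 4 * (r * r / 4 * (P * h ^ 2)) * (P * h ^ 2) := by rw [hsr]; ring
    rw [e2]
    nlinarith

lemma slope_sq_le {h M P : ℝ} (hh : 0 < h) (hP : 0 < P) (hM : 0 ≤ M) (hsm : h ^ 2 * P ≤ M)
    {a : ℤ → ℝ} (ha : ∀ i, a i ∈ Icc 0 M) (hl : ∀ i, -P ≤ lap h a i) (i : ℤ) :
    (a (i + 1) - a i) ^ 2 ≤ 4 * M * P * h ^ 2 := by
  rcases le_total 0 (a (i + 1) - a i) with hs | hs
  · exact slope_sq_le_aux hh hP hM hsm ha hl hs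
  · have := slope_sq_le_aux hh hP hM hsm (a := fun j => a (-j)) (fun j => ha (-j))
      (fun j => by rw [lap_neg_rev]; exact hl _) (i := -(i + 1))
      (by simp only [neg_neg]; rw [show -(-(i + 1) + 1) = i by ring]; linarith)
    simp only [neg_neg] at this
    rw [show -(-(i + 1) + 1) = i by ring] at this
    linarith [show (a i - a (i + 1)) ^ 2 = (a (i + 1) - a i) ^ 2 by ring]

lemma lap_add (h : ℝ) (a b : ℤ → ℝ) (i : ℤ) :
    lap h (fun j => a j + b j) i = lap h a i + lap h b i := by unfold lap; ring

lemma lap_const_mul (h c : ℝ) (a : ℤ → ℝ) (i : ℤ) :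
    lap h (fun j => c * a j) i = c * lap h a i := by unfold lap; ring

/-- The second discrete Laplacian of a square. -/
lemma lap_lap_sq {h : ℝ} (hh : h ≠ 0) (a : ℤ → ℝ) (i : ℤ) :
    lap h (lap h (fun j => a j ^ 2)) i =
      ((4 * a (i + 1) - 2 * a i) * (lap h a (i + 1) - lap h a i)
        + (4 * a (i - 1) - 2 * a i) * (lap h a (i - 1) - lap h a i)) / h ^ 2
      + 4 * lap h a i ^ 2 + lap h a (i + 1) ^ 2 + lap h a (i - 1) ^ 2 := by
  unfold lap
  simp only [show i + 1 - 1 = i by ring, show i - 1 + 1 = i by ring]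
  field_simp
  ring

lemma hasDerivAt_lap {h : ℝ} {u : ℤ → ℝ → ℝ} {u' : ℤ → ℝ} {t : ℝ}
    (hu : ∀ i, HasDerivAt (u i) (u' i) t) (i : ℤ) :
    HasDerivAt (fun s => lap h (fun j => u j s) i) (lap h u' i) t := by
  unfold lap
  exact (((hu (i + 1)).sub ((hu i).const_mul 2)).add (hu (i - 1))).div_const _

namespace WaveData
variable {D : WaveData} {σ h : ℝ}

/-- The semiconvexity constant. -/
def P (D : WaveData) : ℝ := 2 + 3 * D.L + 32 * D.L * D.M

lemma P_pos : 0 < D.P := by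
  have := D.L_pos; have := D.M_pos; unfold P; positivity

lemma one_le_P : 1 ≤ D.P := by
  have := D.L_pos; have := D.M_pos
  have : 0 < D.L * D.M := by positivity
  unfold P; linarith

/-- Smallness of the mesh relative to the regularization. -/
def Mesh (D : WaveData) (σ h : ℝ) : Prop :=
  0 < σ ∧ σ ≤ D.σ₀ ∧ 0 < h ∧ h ≤ 1 ∧ 8 * D.M * D.P * h ^ 2 ≤ σ ^ 4

lemma Mesh.h_sq_P (H : D.Mesh σ h) : h ^ 2 * (2 * D.P) ≤ D.M := by
  obtain ⟨h1, h2, h3, h4, h5⟩ := H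
  have hM := D.one_le_M
  have hP := D.P_pos
  have h6 : σ ^ 4 ≤ 1 := pow_le_one₀ h1.le (h2.trans D.σ₀_le)
  have h7 : D.P * h ^ 2 ≤ D.M * (D.P * h ^ 2) := by
    have : 0 ≤ D.P * h ^ 2 := by positivity
    nlinarith
  nlinarith

lemma SolAt.deriv_bound (H : D.Mesh σ h) {u : ℤ → ℝ → ℝ} {t : ℝ} (hu : D.SolAt σ h u t) (i : ℤ) :
    |lap h (fun j => Phi σ (u j t)) i + D.G σ (i * h) (u i t)|
      ≤ 4 * (D.M ^ 2 + 2 * D.M) / h ^ 2 + (D.L + 1) * D.M := by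
  obtain ⟨h1, h2, h3, h4, h5⟩ := H
  have hM := D.M_pos
  have hσ1 := h2.trans D.σ₀_le
  have hPhi : ∀ j, 0 ≤ Phi σ (u j t) ∧ Phi σ (u j t) ≤ D.M ^ 2 + 2 * D.M := by
    intro j
    obtain ⟨a1, a2⟩ := (hu j).1
    unfold Phi
    refine ⟨by positivity, ?_⟩
    have : σ ^ 2 ≤ 1 := by nlinarith
    have : σ ^ 2 * u j t ≤ D.M := by nlinarith [sq_nonneg σ]
    nlinarith
  refine (abs_add_le _ _).trans (add_le_add ?_ ?_)
  · unfold lap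
    rw [abs_div, abs_of_pos (show (0:ℝ) < h ^ 2 by positivity)]
    gcongr
    rw [abs_le]
    constructor <;> linarith [(hPhi i).1, (hPhi i).2, (hPhi (i+1)).1, (hPhi (i+1)).2,
      (hPhi (i-1)).1, (hPhi (i-1)).2]
  · refine (D.G_abs_le h1 h2 _ (hu i).1).trans ?_
    have := D.L_pos
    have := (hu i).1.2
    gcongr

lemma lap_G_bound (H : D.Mesh σ h) {a : ℤ → ℝ} (ha : ∀ i, a i ∈ Icc 0 D.M) (i : ℤ) {S : ℝ}
    (hS : ∀ i, (a (i + 1) - a i) ^ 2 ≤ S * h ^ 2) :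
    |lap h (fun j => D.G σ (j * h) (a j)) i|
      ≤ (D.L + 1) * |lap h a i| + D.L * (1 + 2 * S) := by
  obtain ⟨h1, h2, h3, h4, h5⟩ := H
  have hh2 : 0 < h ^ 2 := by positivity
  have hL := D.L_pos
  have ha' : ∀ j, a j ∈ Icc (-1) (D.M + 1) := fun j => ⟨by linarith [(ha j).1], by linarith [(ha j).2]⟩
  have hs := D.sec (i * h) h h3.le h4 (a i) (ha' i) (a (i + 1)) (ha' _) (a (i - 1)) (ha' _)
  have e : lap h (fun j => D.G σ (j * h) (a j)) i
      = (D.g (i * h + h) (a (i + 1)) + D.g (i * h - h) (a (i - 1)) - 2 * D.g (i * h) (a i)) / h ^ 2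
        + σ * lap h a i := by
    unfold lap G
    push_cast
    rw [show ((i : ℝ) + 1) * h = i * h + h by ring, show ((i : ℝ) - 1) * h = i * h - h by ring]
    ring
  rw [e]
  refine (abs_add_le _ _).trans ?_
  rw [abs_div, abs_of_pos hh2, abs_mul, abs_of_pos h1]
  have e2 : |a (i + 1) + a (i - 1) - 2 * a i| = |lap h a i| * h ^ 2 := by
    unfold lap
    rw [abs_div, abs_of_pos hh2, div_mul_cancel₀ _ hh2.ne']
    congr 1; ring
  rw [e2] at hs
  have b1 := hS i
  have b2 := hS (i - 1)
  rw [show i - 1 + 1 = i by ring] at b2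
  have h6 : |D.g (i * h + h) (a (i + 1)) + D.g (i * h - h) (a (i - 1)) - 2 * D.g (i * h) (a i)|
      / h ^ 2 ≤ D.L * |lap h a i| + D.L * (1 + 2 * S) := by
    rw [div_le_iff₀ hh2]
    refine hs.trans ?_
    have : D.L * (h ^ 2 + (a (i + 1) - a i) ^ 2 + (a (i - 1) - a i) ^ 2)
      ≤ D.L * (1 + 2 * S) * h ^ 2 := by
      rw [mul_assoc]
      refine mul_le_mul_of_nonneg_left ?_ hL.le
      nlinarith
    nlinarith
  have h7 : σ * |lap h a i| ≤ |lap h a i| := by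
    nlinarith [abs_nonneg (lap h a i), h2.trans D.σ₀_le]
  linarith

lemma semiconvex_step (H : D.Mesh σ h) {a : ℤ → ℝ} (hI : ∀ j, a j ∈ Icc 0 D.M) {B : ℝ}
    (hB : 0 ≤ B) (hlow : ∀ j, -(2 * D.P) ≤ lap h a j) (hup : ∀ j, -D.P - B ≤ lap h a j) {i : ℤ}
    (hdneg : lap h a i < -D.P) :
    -(2 * (4 * D.M + 2) / h ^ 2 * B)
      ≤ lap h (fun i => lap h (fun j => Phi σ (a j)) i + D.G σ (i * h) (a i)) i := by
  have H' := H
  obtain ⟨h1, h2, h3, h4, h5⟩ := H'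
  have hM := D.M_pos
  have hL := D.L_pos
  have hPp := D.P_pos
  have hσ1 := h2.trans D.σ₀_le
  set F : ℤ → ℝ := fun i => lap h (fun j => Phi σ (a j)) i + D.G σ (i * h) (a i)
  have hS : ∀ j, (a (j + 1) - a j) ^ 2 ≤ (8 * D.M * D.P) * h ^ 2 := by
    intro j
    have := slope_sq_le h3 (show 0 < 2 * D.P by positivity) hM.le H.h_sq_P
      (a := a) hI (hlow) j
    linarith
  have hG := lap_G_bound H hI i hS
  set d := lap h a with hd
  have hlapF : lap h (F) i = lap h (lap h (fun j => a j ^ 2)) i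
      + 2 * σ ^ 2 * lap h d i + lap h (fun j => D.G σ (j * h) (a j)) i := by
    have e1 : F = fun j => (lap h (fun j => a j ^ 2) j + 2 * σ ^ 2 * d j)
        + D.G σ (j * h) (a j) := by
      funext j
      simp only [F, hd, Phi]
      rw [lap_add, lap_const_mul]
    rw [e1, lap_add, lap_add, lap_const_mul]
  rw [hlapF, lap_lap_sq h3.ne']
  have hσS : ∀ j, |a (j + 1) - a j| ≤ σ ^ 2 := by
    intro j
    refine abs_le_of_sq_le_sq ?_ (by positivity)
    calc (a (j + 1) - a j) ^ 2 ≤ _ := hS j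
      _ ≤ _ := h5
      _ = _ := by ring
  have c1 : 0 ≤ 4 * a (i + 1) - 2 * a i + 2 * σ ^ 2 := by
    have := (abs_le.1 (hσS i)).1
    linarith [(hI (i + 1)).1]
  have c2 : 0 ≤ 4 * a (i - 1) - 2 * a i + 2 * σ ^ 2 := by
    have := (abs_le.1 (hσS (i - 1))).2
    rw [show i - 1 + 1 = i by ring] at this
    linarith [(hI (i - 1)).1]
  have c1' : 4 * a (i + 1) - 2 * a i + 2 * σ ^ 2 ≤ 4 * D.M + 2 := by
    nlinarith [(hI (i + 1)).2, (hI i).1]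
  have c2' : 4 * a (i - 1) - 2 * a i + 2 * σ ^ 2 ≤ 4 * D.M + 2 := by
    nlinarith [(hI (i - 1)).2, (hI i).1]
  have e3 : ((4 * a (i + 1) - 2 * a i) * (d (i + 1) - d i)
      + (4 * a (i - 1) - 2 * a i) * (d (i - 1) - d i)) / h ^ 2 + 2 * σ ^ 2 * lap h d i
      = ((4 * a (i + 1) - 2 * a i + 2 * σ ^ 2) * (d (i + 1) - d i)
      + (4 * a (i - 1) - 2 * a i + 2 * σ ^ 2) * (d (i - 1) - d i)) / h ^ 2 := by
    unfold lap; ring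
  have e4 : -(2 * (4 * D.M + 2) / h ^ 2 * B) ≤
      ((4 * a (i + 1) - 2 * a i + 2 * σ ^ 2) * (d (i + 1) - d i)
      + (4 * a (i - 1) - 2 * a i + 2 * σ ^ 2) * (d (i - 1) - d i)) / h ^ 2 := by
    rw [div_mul_eq_mul_div, ← neg_div]
    gcongr
    have k1 : -B ≤ d (i + 1) - d i := by linarith [hup (i + 1)]
    have k2 : -B ≤ d (i - 1) - d i := by linarith [hup (i - 1)]
    nlinarith
  have hdabs : |lap h a i| = -d i := abs_of_neg (by linarith)
  rw [hdabs] at hG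
  have hG1 := (abs_le.1 hG).1
  have hPdef : D.P = 2 + 3 * D.L + 32 * D.L * D.M := rfl
  have q1 : (D.L + 1) * (-d i) + D.L * (1 + 2 * (8 * D.M * D.P)) ≤ 4 * d i ^ 2 := by
    have : 0 < D.L * D.M := by positivity
    have w1 : D.L * (1 + 2 * (8 * D.M * D.P)) ≤ (D.L + 16 * D.L * D.M) * (- d i) := by
      nlinarith
    nlinarith
  have e5 : lap h a (i + 1) = d (i + 1) := rfl
  have e6 : lap h a (i - 1) = d (i - 1) := rfl
  have e7 : lap h a i = d i := rfl
  rw [e5, e6, e7]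
  nlinarith [sq_nonneg (d (i + 1)), sq_nonneg (d (i - 1))]

/-- Semiconvexity propagates for a short time. -/
lemma semiconvex_short (H : D.Mesh σ h) {u : ℤ → ℝ → ℝ} {a b : ℝ}
    (hu : ∀ t ∈ Icc a b, D.SolAt σ h u t)
    (hab : 4 * (4 * (D.M ^ 2 + 2 * D.M) / h ^ 2 + (D.L + 1) * D.M) / h ^ 2 * (b - a) ≤ D.P)
    (h0 : ∀ i, -D.P ≤ lap h (fun j => u j a) i) :
    ∀ i, ∀ t ∈ Icc a b, -D.P ≤ lap h (fun j => u j t) i := by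
  have H' := H
  obtain ⟨h1, h2, h3, h4, h5⟩ := H'
  have hM := D.M_pos
  have hL := D.L_pos
  have hh2 : 0 < h ^ 2 := by positivity
  set Q := 4 * (D.M ^ 2 + 2 * D.M) / h ^ 2 + (D.L + 1) * D.M
  set F : ℝ → ℤ → ℝ := fun t i => lap h (fun j => Phi σ (u j t)) i + D.G σ (i * h) (u i t)
  have hder : ∀ t ∈ Icc a b, ∀ i,
      HasDerivAt (fun s => lap h (fun j => u j s) i) (lap h (F t) i) t := fun t ht i =>
    hasDerivAt_lap (fun j => ((hu t ht) j).2) i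
  have hFb : ∀ t ∈ Icc a b, ∀ i, |lap h (F t) i| ≤ 4 * Q / h ^ 2 := by
    intro t ht i
    have hb := fun j => abs_le.1 (SolAt.deriv_bound H (hu t ht) j)
    unfold lap
    rw [abs_div, abs_of_pos hh2]
    gcongr
    rw [abs_le]
    constructor <;> linarith [(hb i).1, (hb i).2, (hb (i+1)).1, (hb (i+1)).2,
      (hb (i-1)).1, (hb (i-1)).2]
  have hlow : ∀ i, ∀ t ∈ Icc a b, -(2 * D.P) ≤ lap h (fun j => u j t) i := by
    intro i t ht
    have := (convex_Icc a b).norm_image_sub_le_of_norm_hasDerivWithin_le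
      (f := fun s => lap h (fun j => u j s) i) (f' := fun t => lap h (F t) i) (C := 4 * Q / h ^ 2)
      (fun s hs => (hder s hs i).hasDerivWithinAt) (fun s hs => hFb s hs i)
      (left_mem_Icc.2 (ht.1.trans ht.2)) ht
    rw [norm_eq_abs, norm_eq_abs, abs_of_nonneg (sub_nonneg.2 ht.1)] at this
    have h6 := (abs_le.1 this).1
    have h7 : 4 * Q / h ^ 2 * (t - a) ≤ 4 * Q / h ^ 2 * (b - a) := by
      have := ht.2
      gcongr
    linarith [h0 i]
  have key := nonneg_family (y := fun i t => lap h (fun j => u j t) i + D.P) (a := a) (b := b)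
    (C := 2 * (4 * D.M + 2) / h ^ 2) (Z := D.P) (by positivity)
    (fun i t ht => (hder t ht i).continuousAt.continuousWithinAt.add continuousWithinAt_const)
    (fun i => by linarith [h0 i]) (fun i t ht => by linarith [hlow i t ht])
    (by
      intro t ht B hB hBZ hlo i hneg
      have htI : t ∈ Icc a b := ⟨ht.1, ht.2.le⟩
      refine ⟨_, ((hder t htI i).add_const _).hasDerivWithinAt, ?_⟩
      exact semiconvex_step H (fun j => ((hu t htI) j).1) hB (fun j => hlow j t htI)
        (fun j => by linarith [hlo j]) (by
          linarith))
  intro i t ht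
  have := key i t ht
  linarith

/-- Semiconvexity is preserved by the lattice equation. -/
lemma semiconvex (H : D.Mesh σ h) {u : ℤ → ℝ → ℝ} {a : ℝ} (hu : ∀ t, a ≤ t → D.SolAt σ h u t)
    (h0 : ∀ i, -D.P ≤ lap h (fun j => u j a) i) :
    ∀ i, ∀ t, a ≤ t → -D.P ≤ lap h (fun j => u j t) i := by
  have hM := D.M_pos
  have hL := D.L_pos
  have hh := H.2.2.1
  set C := 4 * (4 * (D.M ^ 2 + 2 * D.M) / h ^ 2 + (D.L + 1) * D.M) / h ^ 2 with hC
  have hC0 : 0 < C := by positivity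
  have key : ∀ n : ℕ, ∀ i, ∀ t ∈ Icc a (a + n * (D.P / C)), -D.P ≤ lap h (fun j => u j t) i := by
    intro n
    induction n with
    | zero =>
      intro i t ht
      simp only [Nat.cast_zero, zero_mul, add_zero, Icc_self, mem_singleton_iff] at ht
      rw [ht]; exact h0 i
    | succ n ih =>
      intro i t ht
      have hn : 0 ≤ n * (D.P / C) := by have := D.P_pos; positivity
      rcases le_total t (a + n * (D.P / C)) with h' | h'
      · exact ih i t ⟨ht.1, h'⟩
      · refine semiconvex_short (a := a + n * (D.P / C)) (b := a + (n + 1 : ℕ) * (D.P / C)) H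
          (fun s hs => hu s (by linarith [hs.1])) ?_ (fun j => ih j _ ⟨by linarith, le_rfl⟩) i t
          ⟨h', ht.2⟩
        rw [← hC]
        push_cast
        apply le_of_eq
        field_simp
        ring
  intro i t ht
  obtain ⟨n, hn⟩ := exists_nat_ge ((t - a) / (D.P / C))
  have : 0 < D.P / C := div_pos D.P_pos hC0
  rw [div_le_iff₀ this] at hn
  exact key n i t ⟨ht, by linarith⟩

lemma slope_le (H : D.Mesh σ h) {a : ℤ → ℝ} (ha : ∀ i, a i ∈ Icc 0 D.M)
    (hl : ∀ i, -D.P ≤ lap h a i) (i : ℤ) :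
    |a (i + 1) - a i| ≤ 2 * √(D.M * D.P) * h := by
  have hP := D.P_pos
  have hh := H.2.2.1
  have h1 := slope_sq_le hh hP D.M_pos.le (by have := H.h_sq_P; nlinarith) ha hl i
  refine abs_le_of_sq_le_sq ?_ (by positivity)
  rw [mul_pow, mul_pow, sq_sqrt (mul_pos D.M_pos hP).le]
  linarith

end WaveData

/-- Global solvability of an autonomous equation with bounded and Lipschitz right-hand side. -/
lemma exists_global_solution {E : Type*} [NormedAddCommGroup E] [NormedSpace ℝ E] [CompleteSpace E]
    {F : E → E} {K B : NNReal} (hK : LipschitzWith K F) (hB : ∀ x, ‖F x‖ ≤ B) (x₀ : E) :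
    ∃ y : ℝ → E, y 0 = x₀ ∧ ∀ t, HasDerivAt y (F (y t)) t := by
  have loc : ∀ n : ℕ, ∃ y : ℝ → E, y 0 = x₀ ∧
      ∀ t ∈ Ioo (-(n + 1 : ℝ)) (n + 1), HasDerivAt y (F (y t)) t := by
    intro n
    have hpl : IsPicardLindelof (fun _ => F) (tmin := -(n + 1 : ℝ)) (tmax := n + 1)
        ⟨0, by constructor <;> linarith⟩ x₀ (B * (n + 1 : NNReal)) 0 B K :=
      { lipschitzOnWith := fun t _ => hK.lipschitzOnWith
        continuousOn := fun x _ => continuousOn_const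
        norm_le := fun t _ x _ => hB x
        mul_max_le := by
          simp }
    obtain ⟨y, hy0, hy⟩ := hpl.exists_eq_forall_mem_Icc_hasDerivWithinAt₀
    exact ⟨y, hy0, fun t ht => (hy t (Ioo_subset_Icc_self ht)).hasDerivAt (Icc_mem_nhds ht.1 ht.2)⟩
  choose y hy0 hy using loc
  have huniq : ∀ n m : ℕ, n ≤ m → EqOn (y n) (y m) (Ioo (-(n + 1 : ℝ)) (n + 1)) := by
    intro n m hnm
    have hc : (n : ℝ) ≤ m := by exact_mod_cast hnm
    refine ODE_solution_unique_of_mem_Ioo (v := fun _ => F) (s := fun _ => univ) (K := K) (t₀ := 0)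
      (fun t _ => hK.lipschitzOnWith) ?_ (fun t ht => ⟨hy n t ht, trivial⟩)
      (fun t ht => ⟨hy m t ⟨by linarith [ht.1], by linarith [ht.2]⟩, trivial⟩) (by rw [hy0, hy0])
    grind
  refine ⟨fun t => y ⌈|t|⌉₊ t, hy0 _, fun t => ?_⟩
  set m := ⌈|t|⌉₊ + 1 with hm
  have hceil : |t| ≤ ⌈|t|⌉₊ := Nat.le_ceil _
  have habs := abs_lt.1 (show |t| < ⌈|t|⌉₊ + 1 by linarith)
  have htm : t ∈ Ioo (-(m + 1 : ℝ)) (m + 1) := by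
    grind
  have heq : (fun t => y ⌈|t|⌉₊ t) =ᶠ[𝓝 t] y m := by
    filter_upwards [Ioo_mem_nhds habs.1 habs.2] with s hs
    have hs1 : |s| ≤ ⌈|s|⌉₊ := Nat.le_ceil _
    have hs2 := abs_lt.1 (show |s| < ⌈|s|⌉₊ + 1 by linarith)
    refine huniq _ _ ?_ ⟨by linarith [hs2.1], hs2.2⟩
    rw [hm, Nat.ceil_le]
    grind
  have := (hy m t htm).congr_of_eventuallyEq heq
  rwa [← heq.eq_of_nhds] at this

namespace WaveData
variable {D : WaveData} {σ h : ℝ}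

/-- Truncation to the interval `[0,M]`. -/
def clamp (D : WaveData) (x : ℝ) : ℝ := max 0 (min D.M x)

lemma clamp_mem (x : ℝ) : D.clamp x ∈ Icc 0 D.M :=
  ⟨le_max_left _ _, max_le D.M_pos.le (min_le_left _ _)⟩

lemma clamp_of_mem {x : ℝ} (hx : x ∈ Icc 0 D.M) : D.clamp x = x := by
  unfold clamp; grind

lemma clamp_sub_le (x y : ℝ) : |D.clamp x - D.clamp y| ≤ |x - y| := by
  unfold clamp
  grind

/-- Right-hand side of the lattice equation. -/
def rhs (D : WaveData) (σ h : ℝ) (a : ℤ → ℝ) (i : ℤ) : ℝ :=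
  lap h (fun j => Phi σ (a j)) i + D.G σ (i * h) (a i)

lemma rhs_abs_le (H : D.Mesh σ h) {a : ℤ → ℝ} (ha : ∀ i, a i ∈ Icc 0 D.M) (i : ℤ) :
    |D.rhs σ h a i| ≤ 4 * (D.M ^ 2 + 2 * D.M) / h ^ 2 + (D.L + 1) * D.M := by
  obtain ⟨h1, h2, h3, h4, h5⟩ := H
  have hM := D.M_pos
  have hσ1 := h2.trans D.σ₀_le
  have hPhi : ∀ j, 0 ≤ Phi σ (a j) ∧ Phi σ (a j) ≤ D.M ^ 2 + 2 * D.M := by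
    intro j
    obtain ⟨a1, a2⟩ := ha j
    unfold Phi
    refine ⟨by positivity, ?_⟩
    have : σ ^ 2 ≤ 1 := by nlinarith
    have : σ ^ 2 * a j ≤ D.M := by nlinarith [sq_nonneg σ]
    nlinarith
  refine (abs_add_le _ _).trans (add_le_add ?_ ?_)
  · unfold lap
    rw [abs_div, abs_of_pos (show (0:ℝ) < h ^ 2 by positivity)]
    gcongr
    grind
  · refine (D.G_abs_le h1 h2 _ (ha i)).trans ?_
    have := D.L_pos
    have := (ha i).2
    gcongr

lemma Phi_lip (hσ : 0 < σ) (hσ1 : σ ≤ 1) {u v : ℝ} (hu : u ∈ Icc 0 D.M) (hv : v ∈ Icc 0 D.M) :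
    |Phi σ u - Phi σ v| ≤ (2 * D.M + 2) * |u - v| := by
  have e : Phi σ u - Phi σ v = (u + v + 2 * σ ^ 2) * (u - v) := by unfold Phi; ring
  rw [e, abs_mul]
  gcongr
  rw [abs_of_nonneg (by have := hu.1; have := hv.1; positivity)]
  nlinarith [hu.2, hv.2]

lemma rhs_lip (H : D.Mesh σ h) {a b : ℤ → ℝ} (ha : ∀ i, a i ∈ Icc 0 D.M)
    (hb : ∀ i, b i ∈ Icc 0 D.M) {δ : ℝ} (hab : ∀ i, |a i - b i| ≤ δ) (i : ℤ) :
    |D.rhs σ h a i - D.rhs σ h b i| ≤ (4 * (2 * D.M + 2) / h ^ 2 + (D.L + 1)) * δ := by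
  obtain ⟨h1, h2, h3, h4, h5⟩ := H
  have hM := D.M_pos
  have hL := D.L_pos
  have hσ1 := h2.trans D.σ₀_le
  have hp : ∀ j, |Phi σ (a j) - Phi σ (b j)| ≤ (2 * D.M + 2) * δ := fun j =>
    (Phi_lip h1 hσ1 (ha j) (hb j)).trans (mul_le_mul_of_nonneg_left (hab j) (by positivity))
  have e : D.rhs σ h a i - D.rhs σ h b i
      = (lap h (fun j => Phi σ (a j)) i - lap h (fun j => Phi σ (b j)) i)
        + (D.G σ (i * h) (a i) - D.G σ (i * h) (b i)) := by unfold rhs; ring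
  rw [e, add_mul]
  refine (abs_add_le _ _).trans (add_le_add ?_ ?_)
  · unfold lap
    rw [← sub_div, abs_div, abs_of_pos (show (0:ℝ) < h ^ 2 by positivity), div_mul_eq_mul_div]
    gcongr
    grind
  · exact (G_lip h1 h2 _ (ha i) (hb i)).trans (mul_le_mul_of_nonneg_left (hab i) (by positivity))

/-- Existence of forward lattice solutions. -/
lemma exists_sol (H : D.Mesh σ h) {u₀ : ℤ → ℝ} (hu₀ : ∀ i, u₀ i ∈ Icc 0 D.M) :
    ∃ u : ℤ → ℝ → ℝ, (∀ i, u i 0 = u₀ i) ∧ ∀ t, 0 ≤ t → D.SolAt σ h u t := by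
  have hM := D.M_pos
  have hL := D.L_pos
  have hh := H.2.2.1
  set B : ℝ := 4 * (D.M ^ 2 + 2 * D.M) / h ^ 2 + (D.L + 1) * D.M
  set K : ℝ := 4 * (2 * D.M + 2) / h ^ 2 + (D.L + 1)
  have hB0 : 0 ≤ B := by positivity
  have hK0 : 0 ≤ K := by positivity
  let F : BoundedContinuousFunction ℤ ℝ → BoundedContinuousFunction ℤ ℝ := fun X =>
    BoundedContinuousFunction.ofNormedAddCommGroupDiscrete
      (fun i => D.rhs σ h (fun j => D.clamp (X j)) i) B
      (fun i => rhs_abs_le H (fun j => D.clamp_mem _) i)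
  have hFl : LipschitzWith ⟨K, hK0⟩ F := by
    refine LipschitzWith.of_dist_le_mul fun X Y => ?_
    rw [BoundedContinuousFunction.dist_le (by positivity)]
    intro i
    exact rhs_lip H (fun j => D.clamp_mem _) (fun j => D.clamp_mem _)
      (fun j => (clamp_sub_le _ _).trans (X.dist_coe_le_dist (g := Y) j)) i
  have hFb : ∀ X, ‖F X‖ ≤ (⟨B, hB0⟩ : NNReal) := by
    intro X
    rw [BoundedContinuousFunction.norm_le (by positivity)]
    exact fun i => rhs_abs_le H (fun j => D.clamp_mem _) i
  obtain ⟨y, hy0, hy⟩ := exists_global_solution hFl hFb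
    (BoundedContinuousFunction.ofNormedAddCommGroupDiscrete u₀ D.M
      (fun i => by rw [norm_eq_abs, abs_of_nonneg (hu₀ i).1]; exact (hu₀ i).2))
  have hd : ∀ i t, HasDerivAt (fun t => y t i) (D.rhs σ h (fun j => D.clamp (y t j)) i) t :=
    fun i t => (BoundedContinuousFunction.evalCLM ℝ i :
      BoundedContinuousFunction ℤ ℝ →L[ℝ] ℝ).hasFDerivAt.comp_hasDerivAt t (hy t)
  have h0 : ∀ i, y 0 i = u₀ i := fun i => by rw [hy0]; rfl
  have hPhi : ∀ x, 0 ≤ Phi σ (D.clamp x) ∧ Phi σ (D.clamp x) ≤ Phi σ D.M := by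
    intro x
    obtain ⟨c1, c2⟩ := D.clamp_mem x
    unfold Phi
    constructor
    · positivity
    · gcongr
  have hlow : ∀ i t, 0 ≤ t → 0 ≤ y t i := by
    intro i t ht
    refine nonneg_of_rightDeriv_nonneg (w := fun t => y t i) ht
      (fun s _ => (hd i s).continuousAt.continuousWithinAt) (by rw [h0]; exact (hu₀ i).1) ?_
    intro r _ hr
    refine ⟨_, (hd i r).hasDerivWithinAt, ?_⟩
    have hc : D.clamp (y r i) = 0 := by
      unfold clamp; grind
    unfold rhs lap G
    dsimp only
    rw [hc, D.g_zero]
    have := (hPhi (y r (i + 1))).1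
    have := (hPhi (y r (i - 1))).1
    have e : Phi σ 0 = 0 := by unfold Phi; ring
    rw [e]
    simp only [mul_zero, sub_zero, add_zero]
    positivity
  have hup : ∀ i t, 0 ≤ t → 0 ≤ D.M - y t i := by
    intro i t ht
    refine nonneg_of_rightDeriv_nonneg (w := fun t => D.M - y t i) ht
      (fun s _ => ((hd i s).const_sub D.M).continuousAt.continuousWithinAt)
      (by rw [h0]; linarith [(hu₀ i).2]) ?_
    intro r _ hr
    refine ⟨_, ((hd i r).const_sub D.M).hasDerivWithinAt, ?_⟩
    have hc : D.clamp (y r i) = D.M := by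
      unfold clamp; grind
    unfold rhs lap G
    dsimp only
    rw [hc]
    have h1 := (hPhi (y r (i + 1))).2
    have h2 := (hPhi (y r (i - 1))).2
    have h3 : (Phi σ (D.clamp (y r (i + 1))) - 2 * Phi σ D.M + Phi σ (D.clamp (y r (i - 1)))) / h ^ 2
        ≤ 0 := div_nonpos_of_nonpos_of_nonneg (by linarith) (by positivity)
    have h4 := D.g_M (i * h)
    nlinarith [H.2.1]
  refine ⟨fun i t => y t i, h0, fun t ht i => ?_⟩
  have hmem : ∀ j, y t j ∈ Icc 0 D.M := fun j => ⟨hlow j t ht, by linarith [hup j t ht]⟩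
  refine ⟨hmem i, ?_⟩
  have := hd i t
  simp only [D.clamp_of_mem (hmem _)] at this
  exact this


lemma g_add_int (x : ℝ) (k : ℤ) (u : ℝ) : D.g (x + k) u = D.g x u := by
  have : Function.Periodic (fun x => D.g x u) 1 := fun x => D.g_per x u
  simpa using this.int_mul k x

/-- Translations by whole periods in space, and arbitrary translations in time. -/
lemma SolAt.shift {u : ℤ → ℝ → ℝ} {N : ℤ} (hN : N * h = 1) (k : ℤ) {s t : ℝ}
    (hu : D.SolAt σ h u (t + s)) : D.SolAt σ h (fun i t => u (i + k * N) (t + s)) t := by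
  intro i
  obtain ⟨h1, h2⟩ := hu (i + k * N)
  refine ⟨h1, ?_⟩
  have h3 := h2.comp_add_const t s
  refine h3.congr_deriv ?_
  have e : ((i + k * N : ℤ) : ℝ) * h = i * h + k := by
    grind
  rw [e]
  unfold lap G
  rw [g_add_int, show i + k * N + 1 = i + 1 + k * N by ring,
    show i + k * N - 1 = i - 1 + k * N by ring]

/-- The steepest semiconvex initial profile. -/
def cap (D : WaveData) (x : ℝ) : ℝ := max 0 (D.M - D.P / 2 * (max x 0) ^ 2)

lemma cap_mem (x : ℝ) : D.cap x ∈ Icc 0 D.M :=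
  ⟨le_max_left _ _, max_le D.M_pos.le (by have := D.P_pos; nlinarith [sq_nonneg (max x 0)])⟩

lemma cap_anti : Antitone D.cap := by
  intro x y hxy
  have := D.P_pos
  unfold cap
  gcongr

lemma cap_of_nonpos {x : ℝ} (hx : x ≤ 0) : D.cap x = D.M := by
  have := D.M_pos
  unfold cap
  rw [max_eq_right hx]
  simp [this.le]

lemma cap_of_ge {x : ℝ} (hx : 2 * D.M ≤ x) : D.cap x = 0 := by
  have h1 := D.one_le_M
  have h2 := D.one_le_P
  unfold cap
  rw [max_eq_left (by linarith : (0:ℝ) ≤ x)]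
  exact max_eq_left (by nlinarith)

lemma neg_P_le_lap_cap (hh : 0 < h) (i : ℤ) : -D.P ≤ lap h (fun i => D.cap (i * h)) i := by
  have hP := D.P_pos
  unfold lap
  dsimp only
  rw [le_div_iff₀ (by positivity)]
  push_cast
  rw [show ((i:ℝ) + 1) * h = i * h + h by ring, show ((i:ℝ) - 1) * h = i * h - h by ring]
  generalize (i:ℝ) * h = x
  have h1 := (D.cap_mem (x + h)).1
  have h2 := (D.cap_mem (x - h)).1
  by_cases hc : D.cap x = 0
  · rw [hc]; nlinarith [mul_pos hP (pow_pos hh 2)]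
  have hx : D.cap x = D.M - D.P / 2 * (max x 0) ^ 2 := by
    unfold cap at hc ⊢
    rcases max_choice 0 (D.M - D.P / 2 * (max x 0) ^ 2) with h | h
    · exact absurd h hc
    · exact h
  have h3 : D.M - D.P / 2 * (max (x + h) 0) ^ 2 ≤ D.cap (x + h) := le_max_right _ _
  have h4 : D.M - D.P / 2 * (max (x - h) 0) ^ 2 ≤ D.cap (x - h) := le_max_right _ _
  have key : (max (x + h) 0) ^ 2 + (max (x - h) 0) ^ 2 - 2 * (max x 0) ^ 2 ≤ 2 * h ^ 2 := by
    rcases le_total x 0 with c1 | c1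
    · rw [max_eq_right c1, max_eq_right (by linarith : x - h ≤ 0)]
      rcases le_total (x + h) 0 with c2 | c2
      · rw [max_eq_right c2]; nlinarith
      · rw [max_eq_left c2]; nlinarith
    · rw [max_eq_left c1, max_eq_left (by linarith : 0 ≤ x + h)]
      rcases le_total (x - h) 0 with c2 | c2
      · rw [max_eq_right c2]; nlinarith
      · rw [max_eq_left c2]; nlinarith
  rw [hx]
  nlinarith

/-- A discretely convex sequence that becomes positive after `0` stays positive. -/
lemma pos_of_convex {w : ℤ → ℝ} {i j : ℤ} (h0 : w 0 ≤ 0) (hi : 0 < i) (hij : i ≤ j)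
    (hw : ∀ k, 0 < k → k < j → 0 ≤ w (k + 1) - 2 * w k + w (k - 1)) (hwi : 0 < w i) :
    0 < w j := by
  have hne : ∃ n : ℕ, 0 < w n := ⟨i.toNat, by rwa [Int.toNat_of_nonneg hi.le]⟩
  classical
  obtain ⟨m, hm, hmin⟩ : ∃ m : ℕ, 0 < w m ∧ ∀ k < m, ¬ 0 < w (k : ℕ) :=
    ⟨Nat.find hne, Nat.find_spec hne, fun k hk => Nat.find_min hne hk⟩
  have hm0 : 0 < m := by
    grind
  have hmi : (m : ℤ) ≤ i := by
    by_contra! hc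
    refine hmin i.toNat (by omega) ?_
    rwa [Int.toNat_of_nonneg hi.le]
  have key : ∀ n : ℤ, (m:ℤ) ≤ n → n ≤ j → 0 < w n ∧ w (n - 1) ≤ w n := by
    intro n hn
    induction n, hn using Int.leInduction with
    | base =>
      intro _
      refine ⟨hm, ?_⟩
      have := hmin (m - 1) (by omega)
      grind
    | succ n hn ih =>
      grind
  grind

lemma crosses_cap (hh : 0 < h) {v : ℤ → ℝ} (hv : ∀ i, v i ∈ Icc 0 D.M)
    (hl : ∀ i, -D.P ≤ lap h v i) : Crosses (fun i => D.cap (i * h)) v := by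
  intro i j hij
  by_contra! hcon
  obtain ⟨h1, h2⟩ := hcon
  have hP := D.P_pos
  have hi : 0 < i := by
    by_contra! hc
    rw [cap_of_nonpos (mul_nonpos_of_nonpos_of_nonneg (by exact_mod_cast hc) hh.le)] at h1
    linarith [(hv i).2]
  have hcj : D.cap (j * h) = D.M - D.P / 2 * (j * h) ^ 2 := by
    have hp : 0 < D.cap (j * h) := (hv j).1.trans_lt h2
    have hj0 : (0:ℝ) ≤ j * h := mul_nonneg (by exact_mod_cast (hi.trans hij).le) hh.le
    unfold cap at hp ⊢
    rw [max_eq_left hj0] at hp ⊢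
    rcases max_choice 0 (D.M - D.P / 2 * (j * h) ^ 2) with h | h
    · rw [h] at hp; exact absurd hp (lt_irrefl _)
    · exact h
  have hck : ∀ k : ℤ, 0 ≤ k → k ≤ j → D.cap (k * h) = D.M - D.P / 2 * (k * h) ^ 2 := by
    intro k hk hkj
    have hk0 : (0:ℝ) ≤ k * h := mul_nonneg (by exact_mod_cast hk) hh.le
    have hkj' : (k:ℝ) * h ≤ j * h := by gcongr
    unfold cap
    rw [max_eq_left hk0, max_eq_right]
    have := (D.cap_mem (j * h)).1
    rw [hcj] at this
    have := pow_le_pow_left₀ hk0 hkj' 2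
    nlinarith
  have := pos_of_convex (w := fun k => v k - D.cap (k * h)) (i := i) (j := j)
    (by simpa [cap_of_nonpos] using (hv 0).2) hi hij.le ?_ (by linarith)
  · linarith
  · intro k hk hkj
    have e1 := hck (k + 1) (by omega) (by omega)
    have e2 := hck k (by omega) (by omega)
    have e3 := hck (k - 1) (by omega) (by omega)
    push_cast at e1 e3
    push_cast
    rw [e1, e2, e3]
    have := hl k
    unfold lap at this
    rw [le_div_iff₀ (by positivity)] at this
    nlinarith

/-- The solution issued from the steepest profile. -/
structure Front (D : WaveData) (σ h : ℝ) (N : ℤ) (u : ℤ → ℝ → ℝ) : Prop where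
  mesh : D.Mesh σ h
  N_mul : N * h = 1
  init : ∀ i, u i 0 = D.cap (i * h)
  sol : ∀ t, 0 ≤ t → D.SolAt σ h u t

variable {N : ℤ} {u : ℤ → ℝ → ℝ}

lemma exists_front (H : D.Mesh σ h) (hN : N * h = 1) : ∃ u, D.Front σ h N u := by
  obtain ⟨u, h0, hu⟩ := exists_sol H (u₀ := fun i => D.cap (i * h)) (fun i => D.cap_mem _)
  exact ⟨u, H, hN, h0, hu⟩

namespace Front
variable (F : D.Front σ h N u)
include F

lemma N_pos : 0 < N := by
  have h1 := F.N_mul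
  have h2 := F.mesh.2.2.1
  by_contra! hc
  have : (N:ℝ) * h ≤ 0 := mul_nonpos_of_nonpos_of_nonneg (by exact_mod_cast hc) h2.le
  linarith

lemma neg_P_le_lap (i : ℤ) {t : ℝ} (ht : 0 ≤ t) : -D.P ≤ lap h (fun j => u j t) i :=
  semiconvex F.mesh F.sol (fun i => by
    simp only [F.init]; exact neg_P_le_lap_cap F.mesh.2.2.1 i) i t ht

/-- The profile at time `t` is crossed by later translates from above to below. -/
lemma crosses (k : ℤ) {s t : ℝ} (hs : 0 ≤ s) (ht : 0 ≤ t) :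
    Crosses (fun i => u i t) (fun i => u (i + k * N) (t + s)) := by
  have := Crosses.preserved (u := u) (v := fun i t => u (i + k * N) (t + s)) F.mesh.1
    F.mesh.2.1 (a := 0) (b := t) (fun r hr => F.sol r hr.1)
    (fun r hr => (F.sol (r + s) (by linarith [hr.1])).shift F.N_mul k) ?_ t ⟨ht, le_rfl⟩
  · exact this
  · simp only [F.init, zero_add]
    refine crosses_cap F.mesh.2.2.1 (fun i => ((F.sol s hs) _).1) (fun i => ?_)
    have := F.neg_P_le_lap (i + k * N) hs
    unfold lap at this ⊢
    rwa [show i + k * N + 1 = i + 1 + k * N by ring,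
      show i + k * N - 1 = i - 1 + k * N by ring] at this

lemma shift_le (i : ℤ) {t : ℝ} (ht : 0 ≤ t) : u (i + N) t ≤ u i t := by
  have hs : ∀ r, 0 ≤ r → D.SolAt σ h (fun i t => u (i + 1 * N) (t + 0)) r := fun r hr =>
    (F.sol (r + 0) (by linarith)).shift F.N_mul 1
  have := compare_sub (u := u) (v := fun i t => u (i + 1 * N) (t + 0)) F.mesh.1 F.mesh.2.1
    (a := 0) (b := t) (fun r hr => F.sol r hr.1) (fun r hr i => ((hs r hr.1) i).1)
    (fun i r hr => ((hs r hr.1).continuousAt i).continuousWithinAt) ?_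
    (fun r hr i _ => ⟨_, ((hs r hr.1) i).2.hasDerivWithinAt, le_rfl⟩) i t ⟨ht, le_rfl⟩
  · simpa using this
  · intro i
    simp only [add_zero, F.init]
    refine cap_anti ?_
    have := F.N_pos
    have := F.mesh.2.2.1
    gcongr
    simp only [one_mul]; omega

end Front
end WaveData

/-- Exponential profile function `s ↦ eˢ + σ² s`, whose inverse gives the logarithm of a
travelling supersolution. -/
def expLin (σ s : ℝ) : ℝ := exp s + σ ^ 2 * s

lemma expLin_sub_le {σ s r : ℝ} (hrs : r ≤ s) : σ ^ 2 * (s - r) ≤ expLin σ s - expLin σ r := by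
  have := exp_le_exp.2 hrs
  unfold expLin
  linarith

lemma expLin_strictMono {σ : ℝ} (hσ : 0 < σ) : StrictMono (expLin σ) := fun r s hrs => by
  have h1 := expLin_sub_le (σ := σ) hrs.le
  have h2 : 0 < σ ^ 2 * (s - r) := mul_pos (by positivity) (by linarith)
  linarith

lemma expLin_continuous {σ : ℝ} : Continuous (expLin σ) := by unfold expLin; fun_prop

lemma expLin_surjective {σ : ℝ} (hσ : 0 < σ) : Function.Surjective (expLin σ) := by
  have h2 : (0:ℝ) < σ ^ 2 := by positivity
  refine expLin_continuous.surjective ?_ ?_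
  · refine tendsto_atTop_mono (fun s => ?_) (tendsto_id.const_mul_atTop h2)
    have := exp_pos s
    unfold expLin
    simp only [id]
    linarith
  · unfold expLin
    refine tendsto_atBot_mono' (f₁ := fun s => 1 + σ ^ 2 * s) _ ?_ ?_
    · filter_upwards [eventually_le_atBot 0] with s hs
      have := exp_le_one_iff.2 hs
      linarith
    · exact tendsto_atBot_add_const_left _ _ (tendsto_id.const_mul_atBot h2)

/-- The inverse of `expLin`. -/
def logLin (σ : ℝ) : ℝ → ℝ := Function.invFun (expLin σ)

lemma expLin_logLin {σ : ℝ} (hσ : 0 < σ) (y : ℝ) : expLin σ (logLin σ y) = y :=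
  Function.invFun_eq (expLin_surjective hσ y)

lemma logLin_strictMono {σ : ℝ} (hσ : 0 < σ) : StrictMono (logLin σ) := fun x y hxy => by
  rw [← (expLin_strictMono hσ).lt_iff_lt, expLin_logLin hσ, expLin_logLin hσ]
  exact hxy

lemma logLin_sub_le {σ x y : ℝ} (hσ : 0 < σ) (hxy : x ≤ y) :
    logLin σ y - logLin σ x ≤ (y - x) / σ ^ 2 := by
  rw [le_div_iff₀ (by positivity), mul_comm]
  have := expLin_sub_le (σ := σ) ((logLin_strictMono hσ).monotone hxy)
  rwa [expLin_logLin hσ, expLin_logLin hσ] at this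

lemma hasDerivAt_logLin {σ : ℝ} (hσ : 0 < σ) (y : ℝ) :
    HasDerivAt (logLin σ) (exp (logLin σ y) + σ ^ 2)⁻¹ y := by
  have hc : ContinuousAt (logLin σ) y := by
    refine (LipschitzWith.of_le_add_mul (1 / σ ^ 2).toNNReal
      fun x z => ?_).continuous.continuousAt
    rw [dist_eq, Real.coe_toNNReal _ (by positivity), div_mul_eq_mul_div, one_mul]
    rcases le_total z x with h | h
    · rw [abs_of_nonneg (sub_nonneg.2 h)]
      linarith [logLin_sub_le hσ h]
    · have := (logLin_strictMono hσ).monotone h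
      have : 0 ≤ |x - z| / σ ^ 2 := by positivity
      linarith
  refine HasDerivAt.of_local_left_inverse (f := expLin σ) hc ?_ (by positivity)
    (Eventually.of_forall fun z => expLin_logLin hσ z)
  have := (Real.hasDerivAt_exp (logLin σ y)).add ((hasDerivAt_id (logLin σ y)).const_mul (σ ^ 2))
  rw [mul_one] at this
  exact this

/-- The travelling supersolution profile, normalized to take the value `ν` at `0`. -/
def bar (σ a ν z : ℝ) : ℝ := exp (logLin σ (ν + σ ^ 2 * log ν - a * z))

section bar
variable {σ a ν : ℝ}

lemma bar_pos (z : ℝ) : 0 < bar σ a ν z := exp_pos _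

lemma bar_eq (hσ : 0 < σ) (z : ℝ) :
    bar σ a ν z + σ ^ 2 * log (bar σ a ν z) = ν + σ ^ 2 * log ν - a * z := by
  have := expLin_logLin hσ (ν + σ ^ 2 * log ν - a * z)
  unfold expLin at this
  unfold bar
  rwa [log_exp]

lemma bar_zero (hσ : 0 < σ) (hν : 0 < ν) : bar σ a ν 0 = ν := by
  have : ν + σ ^ 2 * log ν - a * 0 = expLin σ (log ν) := by
    unfold expLin; rw [exp_log hν]; ring
  unfold bar
  rw [this, logLin, Function.leftInverse_invFun (expLin_strictMono hσ).injective, exp_log hν]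

lemma bar_anti (hσ : 0 < σ) (ha : 0 < a) : Antitone (bar σ a ν) := fun x y hxy => by
  refine exp_le_exp.2 ((logLin_strictMono hσ).monotone ?_)
  nlinarith

lemma bar_le (hσ : 0 < σ) (hν : 0 < ν) (z : ℝ) :
    bar σ a ν z ≤ ν * exp ((ν - a * z) / σ ^ 2) := by
  have h1 := bar_eq (a := a) (ν := ν) hσ z
  have h2 := bar_pos (σ := σ) (a := a) (ν := ν) z
  rw [← log_le_log_iff h2 (by positivity), log_mul hν.ne' (exp_pos _).ne',
    log_exp, ← sub_le_iff_le_add', le_div_iff₀ (by positivity)]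
  nlinarith

lemma bar_sub_le (hσ : 0 < σ) (ha : 0 < a) {δ : ℝ} (hδ : 0 ≤ δ) (z : ℝ) :
    bar σ a ν (z - δ) ≤ bar σ a ν z * exp (a * δ / σ ^ 2) := by
  unfold bar
  rw [← exp_add]
  refine exp_le_exp.2 ?_
  have := logLin_sub_le hσ (x := ν + σ ^ 2 * log ν - a * z)
    (y := ν + σ ^ 2 * log ν - a * (z - δ)) (by nlinarith)
  rw [show ν + σ ^ 2 * log ν - a * (z - δ) - (ν + σ ^ 2 * log ν - a * z) = a * δ by ring]
    at this
  linarith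

lemma hasDerivAt_bar (hσ : 0 < σ) (z : ℝ) :
    HasDerivAt (bar σ a ν) (-(a * bar σ a ν z / (bar σ a ν z + σ ^ 2))) z := by
  have h1 : HasDerivAt (fun z => ν + σ ^ 2 * log ν - a * z) (-a) z := by
    simpa using ((hasDerivAt_id z).const_mul a).const_sub (ν + σ ^ 2 * log ν)
  have h2 := ((hasDerivAt_logLin hσ _).comp z h1).exp
  refine h2.congr_deriv ?_
  simp only [Function.comp, bar]
  field_simp

lemma hasDerivAt_Phi_bar (hσ : 0 < σ) (z : ℝ) :
    HasDerivAt (fun z => Phi σ (bar σ a ν z)) (-(2 * a * bar σ a ν z)) z := by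
  have h1 := hasDerivAt_bar (a := a) (ν := ν) hσ z
  have h2 := (h1.fun_pow 2).add (h1.const_mul (2 * σ ^ 2))
  refine h2.congr_deriv ?_
  have := bar_pos (σ := σ) (a := a) (ν := ν) z
  field_simp
  ring

/-- The profile is a supersolution of the pure diffusion with a surplus. -/
lemma lap_bar_le (hσ : 0 < σ) (ha : 0 < a) {h : ℝ} (hh : 0 < h)
    (hr : exp (a * h / σ ^ 2) ≤ 3 / 2) (z : ℝ) :
    (Phi σ (bar σ a ν (z + h)) - 2 * Phi σ (bar σ a ν z) + Phi σ (bar σ a ν (z - h))) / h ^ 2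
      ≤ 6 * a ^ 2 * bar σ a ν z / (bar σ a ν z + σ ^ 2) := by
  set w := bar σ a ν with hw
  have hd := fun z => hasDerivAt_Phi_bar (a := a) (ν := ν) hσ z
  have hanti := bar_anti (ν := ν) hσ ha
  have hp := fun z => bar_pos (σ := σ) (a := a) (ν := ν) z
  obtain ⟨x1, hx1, e1⟩ := exists_hasDerivAt_eq_slope (fun z => Phi σ (w z)) _
    (show z < z + h by linarith) (fun y _ => (hd y).continuousAt.continuousWithinAt)
    (fun y _ => hd y)
  obtain ⟨x2, hx2, e2⟩ := exists_hasDerivAt_eq_slope (fun z => Phi σ (w z)) _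
    (show z - h < z by linarith) (fun y _ => (hd y).continuousAt.continuousWithinAt)
    (fun y _ => hd y)
  obtain ⟨x3, hx3, e3⟩ := exists_hasDerivAt_eq_slope w _
    (show z - h < z + h by linarith) (fun y _ => (hasDerivAt_bar hσ y).continuousAt.continuousWithinAt)
    (fun y _ => hasDerivAt_bar hσ y)
  rw [← hw] at *
  rw [eq_div_iff (by linarith)] at e1 e2 e3
  have h1 : w (z + h) ≤ w x1 := hanti hx1.2.le
  have h2 : w x2 ≤ w (z - h) := hanti hx2.1.le
  have h3 : w x3 ≤ w (z - h) := hanti hx3.1.le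
  have h4 : w (z - h) ≤ w z * (3 / 2) :=
    (bar_sub_le hσ ha hh.le z).trans (mul_le_mul_of_nonneg_left hr (hp z).le)
  have h5 : w z ≤ w (z - h) := hanti (by linarith)
  have s2 : 0 < σ ^ 2 := by positivity
  have h6 : w x3 / (w x3 + σ ^ 2) ≤ w z * (3 / 2) / (w z + σ ^ 2) := by
    rw [div_le_div_iff₀ (by linarith [hp x3]) (by linarith [hp z])]
    have := hp z; have := hp x3
    nlinarith
  have h7 : w (z - h) - w (z + h) = 2 * h * (a * (w x3 / (w x3 + σ ^ 2))) := by
    have : w (z + h) - w (z - h) = -(a * w x3 / (w x3 + σ ^ 2)) * (z + h - (z - h)) := by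
      rw [e3]
    rw [mul_div_assoc] at this
    linarith
  rw [div_le_iff₀ (by positivity)]
  have h8 : Phi σ (w (z + h)) - 2 * Phi σ (w z) + Phi σ (w (z - h)) = 2 * a * h * (w x2 - w x1) := by
    linarith
  rw [h8]
  calc 2 * a * h * (w x2 - w x1) ≤ 2 * a * h * (w (z - h) - w (z + h)) := by gcongr
    _ ≤ 2 * a * h * (2 * h * (a * (w z * (3 / 2) / (w z + σ ^ 2)))) := by rw [h7]; gcongr
    _ = 6 * a ^ 2 * w z / (w z + σ ^ 2) * h ^ 2 := by ring

end bar

namespace WaveData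
variable {D : WaveData} {σ h : ℝ}

/-- Ahead of a moving point behind which `u ≤ ν` near the point, `u` is controlled by the
travelling supersolution. -/
lemma le_bar (H : D.Mesh σ h) {a ν y t₁ t₂ : ℝ} (ha : 0 < a) (hν : 0 < ν)
    (hr : exp (a * h / σ ^ 2) ≤ 3 / 2) (hνa : (D.L + 1) * (ν + σ ^ 2) ≤ 2 * a ^ 2)
    {u : ℤ → ℝ → ℝ} (hu : ∀ t ∈ Icc t₁ t₂, D.SolAt σ h u t)
    (hb : ∀ t ∈ Icc t₁ t₂, ∀ i : ℤ, y + 8 * a * t - h ≤ i * h → u i t ≤ ν)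
    (h0 : ∀ i : ℤ, y + 8 * a * t₁ ≤ i * h → u i t₁ ≤ bar σ a ν (i * h - y - 8 * a * t₁)) :
    ∀ t ∈ Icc t₁ t₂, ∀ i : ℤ, y + 8 * a * t ≤ i * h → u i t ≤ bar σ a ν (i * h - y - 8 * a * t) := by
  obtain ⟨hσ, hσ1, hh, -, -⟩ := H
  have hM := D.M_pos
  have hL := D.L_pos
  have hσ2 : σ ≤ 1 := hσ1.trans D.σ₀_le
  set w := bar σ a ν with hw
  have hp := fun z => bar_pos (σ := σ) (a := a) (ν := ν) z
  have hanti := bar_anti (ν := ν) hσ ha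
  have hw0 := bar_zero (a := a) hσ hν
  rw [← hw] at *
  let z : ℤ → ℝ → ℝ := fun i t => w (i * h - y - 8 * a * t) - u i t
  let e : ℤ → ℝ := fun i => (i * h - y) / (8 * a)
  have hle : ∀ i t, t ≤ e i ↔ y + 8 * a * t ≤ i * h := fun i t => by
    rw [le_div_iff₀ (by positivity)]; constructor <;> intro <;> linarith
  have hwd : ∀ i t, HasDerivAt (fun t => w (i * h - y - 8 * a * t))
      (8 * a * (a * w (i * h - y - 8 * a * t) / (w (i * h - y - 8 * a * t) + σ ^ 2))) t := by
    intro i t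
    have h1 : HasDerivAt (fun t => (i:ℝ) * h - y - 8 * a * t) (-(8 * a)) t := by
      simpa using ((hasDerivAt_id t).const_mul (8 * a)).const_sub ((i:ℝ) * h - y)
    refine ((hasDerivAt_bar (a := a) (ν := ν) hσ _).comp t h1).congr_deriv ?_
    ring
  have hzd : ∀ i, ∀ t ∈ Icc t₁ t₂, HasDerivAt (z i) _ t := fun i t ht =>
    (hwd i t).sub ((hu t ht) i).2
  have key := nonneg_family (ι := {i : ℤ // t₁ ≤ e i}) (y := fun i t => z i (min t (e i)))
    (a := t₁) (b := t₂) (C := 2 * (2 * D.M + 2) / h ^ 2 + (D.L + 1)) (Z := D.M) (by positivity)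
    ?_ ?_ ?_ ?_
  · intro t ht i hi
    have h1 : t ≤ e i := (hle i t).2 hi
    have := key ⟨i, ht.1.trans h1⟩ t ht
    simp only [min_eq_left h1] at this
    linarith
  · rintro ⟨i, hi⟩ t ht
    have hm : min t (e i) ∈ Icc t₁ t₂ := ⟨le_min ht.1 hi, (min_le_left _ _).trans ht.2⟩
    exact ((hzd i _ hm).continuousAt.comp (f := fun t => min t (e i))
      (by fun_prop)).continuousWithinAt
  · rintro ⟨i, hi⟩
    simp only [min_eq_left hi]
    have := h0 i ((hle i t₁).1 hi)
    simp only [z]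
    linarith
  · rintro ⟨i, hi⟩ t ht
    have hm : min t (e i) ∈ Icc t₁ t₂ := ⟨le_min ht.1 hi, (min_le_left _ _).trans ht.2⟩
    have h1 := ((hu _ hm) i).1.2
    have h2 := hp (i * h - y - 8 * a * min t (e i))
    simp only [z]
    linarith
  · rintro t ht B hB - hlow ⟨i, hi⟩ hneg
    have htI : t ∈ Icc t₁ t₂ := ⟨ht.1, ht.2.le⟩
    simp only at hneg ⊢
    rcases lt_or_ge t (e i) with hte | hte
    swap
    · refine ⟨0, ?_, by
        have : 0 ≤ (2 * (2 * D.M + 2) / h ^ 2 + (D.L + 1)) * B := by positivity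
        linarith⟩
      refine (hasDerivWithinAt_const t (Ici t) (z i (e i))).congr (fun s hs => ?_) ?_
      · rw [min_eq_right (hte.trans hs)]
      · rw [min_eq_right hte]
    have hev : (fun t => z i (min t (e i))) =ᶠ[𝓝 t] z i := by
      filter_upwards [eventually_lt_nhds hte] with s hs
      rw [min_eq_left hs.le]
    refine ⟨_, ((hzd i t htI).congr_of_eventuallyEq hev).hasDerivWithinAt, ?_⟩
    rw [min_eq_left hte.le] at hneg
    have hlowj : ∀ j, j = i ∨ j = i + 1 ∨ j = i - 1 → -B ≤ z j t := by
      intro j hj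
      rcases le_or_gt t (e j) with hj1 | hj1
      · have := hlow ⟨j, ht.1.trans hj1⟩
        simpa only [min_eq_left hj1] using this
      · have h1 : y + 8 * a * t ≤ i * h := (hle i t).1 hte.le
        have h2 : (j:ℝ) * h < y + 8 * a * t := by
          by_contra! hc; exact absurd ((hle j t).2 hc) (not_le.2 hj1)
        have h3 : (i:ℝ) * h - h ≤ j * h := by
          have : (i:ℝ) - 1 ≤ j := by
            rcases hj with rfl | rfl | rfl <;> push_cast <;> linarith
          nlinarith
        have h4 := hb t htI j (by linarith)
        have h5 : w 0 ≤ w (j * h - y - 8 * a * t) := hanti (by linarith)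
        simp only [z]
        linarith
    set W : ℤ → ℝ := fun j => w (j * h - y - 8 * a * t) with hW
    have hWp : ∀ j, 0 < W j := fun j => hp _
    have hP : ∀ j, -B ≤ z j t → -((2 * D.M + 2) * B) ≤ Phi σ (W j) - Phi σ (u j t) := by
      intro j hj
      have h1 := ((hu t htI) j).1
      have h2 := hWp j
      have hj' : -B ≤ W j - u j t := hj
      have eq : Phi σ (W j) - Phi σ (u j t) = (W j + u j t + 2 * σ ^ 2) * (W j - u j t) := by
        unfold Phi; ring
      rw [eq]
      have hA : 0 ≤ W j + u j t + 2 * σ ^ 2 := by have := h1.1; positivity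
      rcases le_or_gt (u j t) (W j) with hc | hc
      · have : 0 ≤ (2 * D.M + 2) * B := by positivity
        nlinarith [mul_nonneg hA (sub_nonneg.2 hc)]
      · have hA2 : W j + u j t + 2 * σ ^ 2 ≤ 2 * D.M + 2 := by nlinarith [h1.2]
        nlinarith
    have hneg' : W i - u i t < 0 := hneg
    have hPi : Phi σ (W i) - Phi σ (u i t) ≤ 0 := by
      have eq : Phi σ (W i) - Phi σ (u i t) = (W i + u i t + 2 * σ ^ 2) * (W i - u i t) := by
        unfold Phi; ring
      have hA : 0 ≤ W i + u i t + 2 * σ ^ 2 := by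
        have := ((hu t htI) i).1.1; have := hWp i; positivity
      rw [eq]
      nlinarith
    have hlap : -(2 * (2 * D.M + 2) / h ^ 2 * B) ≤
        lap h (fun j => Phi σ (W j)) i - lap h (fun j => Phi σ (u j t)) i := by
      unfold lap
      rw [← sub_div, div_mul_eq_mul_div, ← neg_div]
      gcongr
      linarith [hP (i + 1) (hlowj _ (by tauto)), hP (i - 1) (hlowj _ (by tauto))]
    have hbar := lap_bar_le (ν := ν) hσ ha hh hr (i * h - y - 8 * a * t)
    have hlapW : lap h (fun j => Phi σ (W j)) i ≤ 6 * a ^ 2 * W i / (W i + σ ^ 2) := by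
      refine le_trans (le_of_eq ?_) hbar
      unfold lap
      simp only [hW]
      push_cast
      rw [show ((i:ℝ) + 1) * h - y - 8 * a * t = i * h - y - 8 * a * t + h by ring,
        show ((i:ℝ) - 1) * h - y - 8 * a * t = i * h - y - 8 * a * t - h by ring]
    have hG := (abs_le.1 (G_abs_le (D := D) hσ hσ1 (i * h) ((hu t htI) i).1)).2
    have hWν : W i ≤ ν := by
      have : W i ≤ w 0 := hanti (by linarith [(hle i t).1 hte.le])
      linarith
    have hsur : (D.L + 1) * W i ≤ 2 * a ^ 2 * W i / (W i + σ ^ 2) := by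
      rw [le_div_iff₀ (by have := hWp i; positivity)]
      have : (D.L + 1) * (W i + σ ^ 2) ≤ 2 * a ^ 2 := le_trans (by gcongr) hνa
      nlinarith [hWp i]
    have hlz : -B ≤ W i - u i t := hlowj i (Or.inl rfl)
    have e1 : 8 * a * (a * W i / (W i + σ ^ 2))
        = 6 * a ^ 2 * W i / (W i + σ ^ 2) + 2 * a ^ 2 * W i / (W i + σ ^ 2) := by ring
    have e2 : 8 * a * (a * w (i * h - y - 8 * a * t) / (w (i * h - y - 8 * a * t) + σ ^ 2))
      = 8 * a * (a * W i / (W i + σ ^ 2)) := rfl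
    rw [e2, e1]
    nlinarith

/-- The compactly supported travelling profile is a lattice subsolution. -/
def SubOK (D : WaveData) (σ h : ℝ) : Prop := ∀ x z, z < D.l →
    -(D.c * D.dφ z) ≤ (Phi σ (D.φ (z + h)) - 2 * Phi σ (D.φ z) + Phi σ (D.φ (z - h))) / h ^ 2
      + D.G σ x (D.φ z)

lemma Front.spread {N : ℤ} {u : ℤ → ℝ → ℝ} (F : D.Front σ h N u) (hs : D.SubOK σ h) (i : ℤ)
    {t : ℝ} (ht : 0 ≤ t) : D.φ (i * h + D.l - D.c * t) ≤ u i t := by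
  have hφ : ∀ z, D.φ z ∈ Icc 0 D.M := fun z => ⟨D.φ_nonneg z, (D.φ_le z).trans D.us_le⟩
  refine compare_sub (v := fun i t => D.φ (i * h + D.l - D.c * t)) F.mesh.1 F.mesh.2.1
    (a := 0) (b := t) (fun r hr => F.sol r hr.1) (fun r _ i => hφ _)
    (fun i => (D.φ_cont.comp (by fun_prop)).continuousOn) ?_ ?_ i t ⟨ht, le_rfl⟩
  · intro i
    rw [F.init]
    rcases le_total ((i:ℝ) * h) 0 with hi | hi
    · rw [cap_of_nonpos hi]; exact (hφ _).2
    · rw [D.φ_right _ (by linarith)]; exact (D.cap_mem _).1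
  · intro r hr i hi
    have hz : (i:ℝ) * h + D.l - D.c * r < D.l := by
      by_contra! hc
      rw [D.φ_right _ hc] at hi
      linarith [((F.sol r hr.1) i).1.1]
    have h1 : HasDerivAt (fun r => (i:ℝ) * h + D.l - D.c * r) (-D.c) r := by
      simpa using ((hasDerivAt_id r).const_mul D.c).const_sub ((i:ℝ) * h + D.l)
    refine ⟨_, ((D.φ_deriv _ hz).comp r h1).hasDerivWithinAt, ?_⟩
    have h2 := hs (i * h) _ hz
    unfold lap
    push_cast
    rw [show ((i:ℝ) + 1) * h + D.l - D.c * r = i * h + D.l - D.c * r + h by ring,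
      show ((i:ℝ) - 1) * h + D.l - D.c * r = i * h + D.l - D.c * r - h by ring]
    linarith

end WaveData


/-- The limit of a real family along an ultrafilter. -/
def ulim {ι : Type*} (𝒰 : Ultrafilter ι) (f : ι → ℝ) : ℝ := limUnder (𝒰 : Filter ι) f

lemma tendsto_ulim {ι : Type*} {𝒰 : Ultrafilter ι} {f : ι → ℝ} {a b : ℝ}
    (hf : ∀ᶠ n in (𝒰 : Filter ι), f n ∈ Icc a b) : Tendsto f 𝒰 (𝓝 (ulim 𝒰 f)) := by
  obtain ⟨x, -, hx⟩ := (isCompact_Icc (a := a) (b := b)).ultrafilter_le_nhds (𝒰.map f)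
    (by rw [le_principal_iff]; exact hf)
  exact tendsto_nhds_limUnder ⟨x, hx⟩

lemma ulim_eq {ι : Type*} {𝒰 : Ultrafilter ι} {f : ι → ℝ} {x : ℝ} (h : Tendsto f 𝒰 (𝓝 x)) :
    ulim 𝒰 f = x := h.limUnder_eq

/-- Limits of functions whose derivatives converge and are asymptotically equicontinuous. -/
lemma hasDerivAt_of_tendsto {ι : Type*} {l : Filter ι} [NeBot l] {f f' : ι → ℝ → ℝ} {F : ℝ → ℝ}
    {F' α β t : ℝ} (ht : t ∈ Ioo α β)
    (hd : ∀ᶠ n in l, ∀ r ∈ Ioo α β, HasDerivAt (f n) (f' n r) r)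
    (hf : ∀ r ∈ Ioo α β, Tendsto (fun n => f n r) l (𝓝 (F r)))
    (hf' : Tendsto (fun n => f' n t) l (𝓝 F'))
    (heq : ∀ ε > 0, ∃ δ > 0, ∀ᶠ n in l, ∀ r ∈ Ioo α β, |r - t| < δ → |f' n r - f' n t| ≤ ε) :
    HasDerivAt F F' t := by
  rw [hasDerivAt_iff_isLittleO, Asymptotics.isLittleO_iff]
  intro ε hε
  obtain ⟨δ, hδ, hn⟩ := heq ε hε
  have hnb : ∀ᶠ r in 𝓝 t, r ∈ Ioo α β ∧ |r - t| < δ := by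
    filter_upwards [Ioo_mem_nhds ht.1 ht.2, Metric.ball_mem_nhds t hδ] with r h1 h2
    exact ⟨h1, by rwa [Metric.mem_ball, dist_eq] at h2⟩
  filter_upwards [hnb] with r hr
  have hlim : Tendsto (fun n => ‖f n r - f n t - (r - t) • f' n t‖) l
      (𝓝 ‖F r - F t - (r - t) • F'‖) :=
    (((hf r hr.1).sub (hf t ht)).sub (hf'.const_smul (r - t))).norm
  refine le_of_tendsto hlim ?_
  filter_upwards [hd, hn] with n h1 h2
  have hconv : Convex ℝ (Ioo α β ∩ {s | |s - t| < δ}) := by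
    refine (convex_Ioo α β).inter ?_
    have : {s : ℝ | |s - t| < δ} = Metric.ball t δ := by
      ext s; rw [Metric.mem_ball, dist_eq]; rfl
    rw [this]
    exact convex_ball t δ
  have := hconv.norm_image_sub_le_of_norm_hasDerivWithin_le
    (f := fun s => f n s - (s - t) • f' n t) (f' := fun s => f' n s - f' n t) (C := ε)
    (x := t) (y := r)
    (fun s hs => by
      have h3 : HasDerivAt (fun s => (s - t) • f' n t) (f' n t) s := by
        simpa using ((hasDerivAt_id s).sub_const t).smul_const (f' n t)
      exact ((h1 s hs.1).sub h3).hasDerivWithinAt)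
    (fun s hs => h2 s hs.1 hs.2) ⟨ht, by simpa using hδ⟩ hr
  simpa [sub_right_comm] using this

namespace WaveData
variable {D : WaveData} {σ h : ℝ}

/-- Lipschitz constants of the lattice equation (depending on the mesh). -/
def rate (D : WaveData) (h : ℝ) : ℝ := 4 * (2 * D.M + 2) / h ^ 2 + (D.L + 1)

def speed (D : WaveData) (h : ℝ) : ℝ := 4 * (D.M ^ 2 + 2 * D.M) / h ^ 2 + (D.L + 1) * D.M

lemma rate_nonneg : 0 ≤ D.rate h := by
  have := D.M_pos; have := D.L_pos; unfold rate; positivity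

lemma speed_nonneg : 0 ≤ D.speed h := by
  have := D.M_pos; have := D.L_pos; unfold speed; positivity

lemma SolAt.rhs_eq {u : ℤ → ℝ → ℝ} {t : ℝ} (hu : D.SolAt σ h u t) (i : ℤ) :
    HasDerivAt (u i) (D.rhs σ h (fun j => u j t) i) t := (hu i).2

lemma SolAt.lip {u : ℤ → ℝ → ℝ} {a b : ℝ} (H : D.Mesh σ h)
    (hu : ∀ t ∈ Icc a b, D.SolAt σ h u t) (i : ℤ) {s t : ℝ} (hs : s ∈ Icc a b)
    (ht : t ∈ Icc a b) : |u i t - u i s| ≤ D.speed h * |t - s| :=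
  (convex_Icc a b).norm_image_sub_le_of_norm_hasDerivWithin_le
    (fun r hr => ((hu r hr).rhs_eq i).hasDerivWithinAt)
    (fun r hr => rhs_abs_le H (fun j => ((hu r hr) j).1) i) hs ht

/-- Solutions that agree at one time agree at all times. -/
lemma SolAt.eq_of_le {u v : ℤ → ℝ → ℝ} (H : D.Mesh σ h) {a b : ℝ}
    (hu : ∀ t ∈ Icc a b, D.SolAt σ h u t) (hv : ∀ t ∈ Icc a b, D.SolAt σ h v t) {e : ℝ}
    (he : e = 1 ∨ e = -1) (h0 : ∀ i, u i (if e = 1 then a else b) = v i (if e = 1 then a else b)) :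
    ∀ i, ∀ t ∈ Icc a b, u i t = v i t := by
  rcases le_or_gt a b with hab | hab
  swap
  · grind
  have he2 : e * e = 1 := by grind
  have hmem : ∀ t ∈ Icc (min (e * a) (e * b)) (max (e * a) (e * b)), e * t ∈ Icc a b := by
    intro t ht
    rcases he with rfl | rfl
    · simpa [hab] using ht
    grind
  have hd : ∀ w : ℤ → ℝ → ℝ, (∀ t ∈ Icc a b, D.SolAt σ h w t) → ∀ i, ∀ t, e * t ∈ Icc a b →
      HasDerivAt (fun t => w i (e * t)) (e * D.rhs σ h (fun j => w j (e * t)) i) t := by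
    intro w hw i t ht
    have h1 : HasDerivAt (fun t => e * t) e t := by simpa using (hasDerivAt_id t).const_mul e
    refine ((((hw _ ht).rhs_eq i).comp t h1)).congr_deriv ?_
    ring
  have key := nonneg_family (ι := ℤ × Bool)
    (y := fun p t => (if p.2 then 1 else -1) * (u p.1 (e * t) - v p.1 (e * t)))
    (a := min (e * a) (e * b)) (b := max (e * a) (e * b)) (C := D.rate h) (Z := D.M)
    rate_nonneg ?_ ?_ ?_ ?_
  · intro i t ht
    have hm : e * t ∈ Icc (min (e * a) (e * b)) (max (e * a) (e * b)) := by
      rcases he with rfl | rfl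
      · simpa [hab] using ht
      grind
    have h1 := key (i, true) _ hm
    have h2 := key (i, false) _ hm
    grind
  · intro p t ht
    exact (((hd u hu p.1 t (hmem t ht)).continuousAt.sub
      (hd v hv p.1 t (hmem t ht)).continuousAt).const_mul _).continuousWithinAt
  · intro p
    have : e * min (e * a) (e * b) = if e = 1 then a else b := by
      rcases he with rfl | rfl
      · simp [hab]
      · norm_num [hab]
    rw [this, h0, sub_self, mul_zero]
  · intro p t ht
    have h1 := ((hu _ (hmem t ht)) p.1).1
    have h2 := ((hv _ (hmem t ht)) p.1).1
    split_ifs <;> linarith [h1.1, h1.2, h2.1, h2.2]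
  · rintro t ht B hB - hlow p -
    have ht' := hmem t ⟨ht.1, ht.2.le⟩
    refine ⟨_, (((hd u hu p.1 t ht').sub (hd v hv p.1 t ht')).const_mul _).hasDerivWithinAt, ?_⟩
    have h1 := rhs_lip H (fun j => ((hu _ ht') j).1) (fun j => ((hv _ ht') j).1) (δ := B)
      (fun j => by
        have h1 := hlow (j, true)
        have h2 := hlow (j, false)
        grind) p.1
    rw [← mul_sub]
    have h2 := abs_le.1 h1
    unfold rate
    rcases he with rfl | rfl <;> split_ifs <;> linarith [h2.1, h2.2]

lemma SolAt.eq_of_eq {u v : ℤ → ℝ → ℝ} (H : D.Mesh σ h)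
    (hu : ∀ t, D.SolAt σ h u t) (hv : ∀ t, D.SolAt σ h v t) {t₀ : ℝ}
    (h0 : ∀ i, u i t₀ = v i t₀) : ∀ i t, u i t = v i t := by
  intro i t
  rcases le_total t₀ t with h | h
  · exact eq_of_le H (a := t₀) (b := t) (fun t _ => hu t) (fun t _ => hv t) (Or.inl rfl)
      (by simpa using h0) i t ⟨h, le_rfl⟩
  · exact eq_of_le H (a := t) (b := t₀) (fun t _ => hu t) (fun t _ => hv t) (e := -1) (Or.inr rfl)
      (by norm_num; exact h0) i t ⟨le_rfl, h⟩

/-- Strong comparison principle for pairs of solutions that are ordered at each time. -/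
lemma touching_aux (H : D.Mesh σ h) {u v : ℤ → ℝ → ℝ} (hu : ∀ t, D.SolAt σ h u t)
    (hv : ∀ t, D.SolAt σ h v t) (hord : ∀ t, (∀ i, v i t ≤ u i t) ∨ (∀ i, u i t ≤ v i t))
    {t₀ : ℝ} (hle : ∀ i, v i t₀ ≤ u i t₀) {i : ℤ} (hi : u i t₀ = v i t₀) :
    u (i + 1) t₀ = v (i + 1) t₀ ∧ u (i - 1) t₀ = v (i - 1) t₀ := by
  by_contra hcon
  obtain ⟨j, hj, hjlt⟩ : ∃ j, (j = i + 1 ∨ j = i - 1) ∧ v j t₀ < u j t₀ := by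
    grind
  have hev : ∀ᶠ t in 𝓝 t₀, v j t < u j t :=
    ((hv t₀).continuousAt j).eventually_lt ((hu t₀).continuousAt j) hjlt
  have hmin : IsLocalMin (fun t => u i t - v i t) t₀ := by
    filter_upwards [hev] with t ht
    grind
  have hder := ((hu t₀ i).2.sub (hv t₀ i).2)
  have h0 := hmin.hasDerivAt_eq_zero hder
  rw [hi] at h0
  have hP : ∀ k, Phi σ (v k t₀) ≤ Phi σ (u k t₀) := by
    intro k
    have := ((hv t₀) k).1.1
    have := hle k
    unfold Phi
    gcongr
  have hPj : Phi σ (v j t₀) < Phi σ (u j t₀) := by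
    have := ((hv t₀) j).1.1
    have := H.1
    unfold Phi
    gcongr
  have hlap : lap h (fun j => Phi σ (v j t₀)) i < lap h (fun j => Phi σ (u j t₀)) i := by
    have := H.2.2.1
    unfold lap
    dsimp only
    rw [hi]
    refine div_lt_div_of_pos_right ?_ (by positivity)
    grind
  linarith

lemma touching (H : D.Mesh σ h) {u v : ℤ → ℝ → ℝ} (hu : ∀ t, D.SolAt σ h u t)
    (hv : ∀ t, D.SolAt σ h v t) (hord : ∀ t, (∀ i, v i t ≤ u i t) ∨ (∀ i, u i t ≤ v i t))
    {t₀ : ℝ} {i : ℤ} (hi : u i t₀ = v i t₀) : ∀ j, u j t₀ = v j t₀ := by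
  have step : ∀ k, u k t₀ = v k t₀ → u (k + 1) t₀ = v (k + 1) t₀ ∧ u (k - 1) t₀ = v (k - 1) t₀ := by
    intro k hk
    rcases hord t₀ with h1 | h1
    · exact touching_aux H hu hv hord h1 hk
    · have := touching_aux H hv hu (fun t => (hord t).symm) h1 hk.symm
      grind
  intro j
  exact Int.inductionOn' (motive := fun j => u j t₀ = v j t₀) j i hi
    (fun k _ hk => (step k hk).1) (fun k _ hk => (step k hk).2)

end WaveData

namespace WaveData
variable {D : WaveData} {σ h : ℝ} {N : ℤ} {u : ℤ → ℝ → ℝ}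

/-- The small level used to normalize wave fronts. -/
def ν (D : WaveData) : ℝ := min (D.us / 2) (D.c ^ 2 / (256 * (D.L + 1)))

lemma ν_pos : 0 < D.ν := by
  have := D.us_pos; have := D.c_pos; have := D.L_pos
  unfold ν; positivity

lemma ν_lt_us : D.ν < D.us :=
  (min_le_left _ _).trans_lt (by linarith [D.us_pos])

/-- A slope for which the travelling supersolution is admissible up to height `M`. -/
def aM (D : WaveData) : ℝ := (D.L + 1) * (D.M + 1)

lemma aM_pos : 0 < D.aM := by have := D.L_pos; have := D.M_pos; unfold aM; positivity

/-- Mesh parameters for which lattice waves are constructed. -/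
structure Good (D : WaveData) (σ h : ℝ) (N : ℤ) : Prop where
  mesh : D.Mesh σ h
  N_mul : N * h = 1
  sub : D.SubOK σ h
  ratio : exp ((D.aM + D.c) * h / σ ^ 2) ≤ 3 / 2
  σ_sq : σ ^ 2 ≤ D.c ^ 2 / (256 * (D.L + 1))

lemma Good.ratio_of_le (Gd : D.Good σ h N) {a : ℝ} (ha : a ≤ D.aM + D.c) :
    exp (a * h / σ ^ 2) ≤ 3 / 2 := by
  refine le_trans (exp_le_exp.2 ?_) Gd.ratio
  have := Gd.mesh.2.2.1
  gcongr

namespace Front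
variable (F : D.Front σ h N u) (Gd : D.Good σ h N)
include F

lemma shift_nat_le (k : ℕ) (i : ℤ) {t : ℝ} (ht : 0 ≤ t) : u (i + k * N) t ≤ u i t := by
  induction k with
  | zero => simp
  | succ k ih =>
    refine le_trans ?_ ih
    have := F.shift_le (i + k * N) ht
    grind

include Gd

/-- At bounded times the solution is small far to the right. -/
lemma tail (T : ℝ) : ∃ X : ℝ, ∀ i : ℤ, X ≤ i * h → ∀ t ∈ Icc 0 T, u i t < D.ν := by
  have hM := D.M_pos
  have hL := D.L_pos
  have ha := D.aM_pos
  have hν := D.ν_pos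
  obtain ⟨hσ, hσ1, hh, -, -⟩ := F.mesh
  have hσ2 : σ ≤ 1 := hσ1.trans D.σ₀_le
  have key : ∀ t ∈ Icc 0 T, ∀ i : ℤ, 2 * D.M + 8 * D.aM * t ≤ i * h →
      u i t ≤ bar σ D.aM D.M (i * h - 2 * D.M - 8 * D.aM * t) := by
    refine le_bar F.mesh ha hM (Gd.ratio_of_le (by linarith [D.c_pos])) ?_
      (fun t ht => F.sol t ht.1) (fun t ht i _ => ((F.sol t ht.1) i).1.2) ?_
    · have h1 : (D.L + 1) * (D.M + σ ^ 2) ≤ D.aM := by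
        unfold aM; gcongr; nlinarith
      have h2 : 1 ≤ D.aM := by unfold aM; nlinarith
      nlinarith
    · intro i hi
      rw [F.init, cap_of_ge (by linarith)]
      exact (bar_pos _).le
  set s := -log (D.ν / (2 * D.M)) with hs
  refine ⟨max (2 * D.M + 8 * D.aM * T) (2 * D.M + 8 * D.aM * T + (D.M + σ ^ 2 * s) / D.aM),
    fun i hi t ht => ?_⟩
  have h1 : 8 * D.aM * t ≤ 8 * D.aM * T := by have := ht.2; gcongr
  have h2 := (le_max_left _ _).trans hi
  have h3 := (le_max_right _ _).trans hi
  have h4 : (D.M + σ ^ 2 * s) / D.aM ≤ i * h - 2 * D.M - 8 * D.aM * t := by linarith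
  rw [div_le_iff₀ ha] at h4
  calc u i t ≤ bar σ D.aM D.M (i * h - 2 * D.M - 8 * D.aM * t) := key t ht i (by linarith)
    _ ≤ D.M * exp ((D.M - D.aM * (i * h - 2 * D.M - 8 * D.aM * t)) / σ ^ 2) :=
      bar_le hσ hM _
    _ ≤ D.M * exp (-s) := by
      gcongr
      rw [div_le_iff₀ (by positivity)]
      linarith
    _ = D.ν / 2 := by
      rw [hs, neg_neg, exp_log (by positivity)]
      field_simp
    _ < D.ν := by linarith

lemma us_le_of_le {i : ℤ} {t : ℝ} (ht : 0 ≤ t) (hi : i * h + D.l - D.zs ≤ D.c * t) :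
    D.us ≤ u i t := by
  have := F.spread Gd.sub i ht
  rwa [D.φ_left _ (by linarith)] at this

end Front

/-- Times at which the level `ν` is exceeded in the `n`-th cell. -/
def hitSet (D : WaveData) (N : ℤ) (u : ℤ → ℝ → ℝ) (n : ℕ) : Set ℝ :=
  {t | 0 ≤ t ∧ ∃ i, n * N ≤ i ∧ i < n * N + N ∧ D.ν ≤ u i t}

/-- The first time at which the level `ν` is attained in the `n`-th cell. -/
def hit (D : WaveData) (N : ℤ) (u : ℤ → ℝ → ℝ) (n : ℕ) : ℝ := sInf (D.hitSet N u n)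

lemma hitSet_bddBelow (n : ℕ) : BddBelow (D.hitSet N u n) := ⟨0, fun _ ht => ht.1⟩

lemma hit_nonneg (n : ℕ) : 0 ≤ D.hit N u n := Real.sInf_nonneg fun _ ht => ht.1

namespace Front
variable (F : D.Front σ h N u) (Gd : D.Good σ h N)
include F

lemma isClosed_hitSet (n : ℕ) : IsClosed (D.hitSet N u n) := by
  have : D.hitSet N u n = ⋃ i ∈ Finset.Ico (n * N) (n * N + N),
      (Ici 0 ∩ (u i) ⁻¹' (Ici D.ν)) := by
    ext t
    simp only [hitSet, mem_ofPred_eq, mem_iUnion, Finset.mem_Ico, mem_inter_iff, mem_Ici,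
      mem_preimage, exists_prop]
    grind
  rw [this]
  refine isClosed_biUnion_finset fun i _ => ?_
  exact ContinuousOn.preimage_isClosed_of_isClosed
    (fun t ht => ((F.sol t ht).continuousAt i).continuousWithinAt) isClosed_Ici isClosed_Ici

include Gd

lemma mem_hitSet (n : ℕ) : max 0 ((n + D.l - D.zs) / D.c) ∈ D.hitSet N u n := by
  have hN := F.N_pos
  refine ⟨le_max_left _ _, n * N, le_rfl, by omega, ?_⟩
  refine D.ν_lt_us.le.trans (F.us_le_of_le Gd (le_max_left _ _) ?_)
  have h1 := le_max_right 0 ((n + D.l - D.zs) / D.c)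
  rw [div_le_iff₀ D.c_pos] at h1
  have e : ((n * N : ℤ) : ℝ) * h = n := by push_cast; rw [mul_assoc, F.N_mul, mul_one]
  rw [e]
  linarith

lemma hit_mem (n : ℕ) : D.hit N u n ∈ D.hitSet N u n :=
  (F.isClosed_hitSet n).csInf_mem ⟨_, F.mem_hitSet Gd n⟩ (hitSet_bddBelow n)

lemma hit_le (n : ℕ) : D.hit N u n ≤ max 0 ((n + D.l - D.zs) / D.c) :=
  csInf_le (hitSet_bddBelow n) (F.mem_hitSet Gd n)

lemma hit_le_succ (n : ℕ) : D.hit N u n ≤ D.hit N u (n + 1) := by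
  obtain ⟨h0, i, h1, h2, h3⟩ := F.hit_mem Gd (n + 1)
  refine csInf_le (hitSet_bddBelow n) ⟨h0, i - N, ?_, ?_, h3.trans ?_⟩
  · push_cast at h1; linarith
  · push_cast at h2; linarith
  · simpa using F.shift_le (i - N) h0

omit Gd in
lemma lt_of_lt_hit {n : ℕ} {t : ℝ} (h0 : 0 ≤ t) (ht : t < D.hit N u n) {i : ℤ} (hi : n * N ≤ i) :
    u i t < D.ν := by
  by_contra! hc
  have hN := F.N_pos
  refine absurd ht (not_lt.2 (csInf_le (hitSet_bddBelow n) ⟨h0, n * N + (i - n * N) % N, ?_, ?_, ?_⟩))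
  · have := Int.emod_nonneg (i - n * N) hN.ne'; omega
  · have := Int.emod_lt_of_pos (i - n * N) hN; omega
  · have h1 := F.shift_nat_le ((i - n * N) / N).toNat (n * N + (i - n * N) % N) h0
    rw [Int.toNat_of_nonneg (Int.ediv_nonneg (by omega) hN.le)] at h1
    have h2 := Int.emod_add_mul_ediv (i - n * N) N
    grind

omit Gd in
lemma le_of_le_hit {n : ℕ} (hpos : 0 < D.hit N u n) {t : ℝ} (h0 : 0 ≤ t) (ht : t ≤ D.hit N u n)
    {i : ℤ} (hi : n * N ≤ i) : u i t ≤ D.ν := by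
  rcases ht.lt_or_eq with ht | rfl
  · exact (F.lt_of_lt_hit h0 ht hi).le
  · by_contra! hc
    have hev := ((F.sol _ h0).continuousAt i).eventually_const_lt hc
    have h2 : ∀ᶠ t in 𝓝[<] (D.hit N u n), D.ν < u i t ∧ 0 < t ∧ t < D.hit N u n := by
      filter_upwards [hev.filter_mono nhdsWithin_le_nhds,
        (eventually_gt_nhds hpos).filter_mono nhdsWithin_le_nhds, self_mem_nhdsWithin]
        with t h1 h2 h3
      exact ⟨h1, h2, h3⟩
    obtain ⟨t, h3, h4, h5⟩ := h2.exists
    exact absurd (F.lt_of_lt_hit h4.le h5 hi) (not_lt.2 h3.le)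

lemma tendsto_hit : Tendsto (D.hit N u) atTop atTop := by
  refine tendsto_atTop.2 fun T => ?_
  obtain ⟨X, hX⟩ := F.tail Gd (max T 0)
  filter_upwards [eventually_ge_atTop ⌈X⌉₊] with n hn
  by_contra! hc
  obtain ⟨h0, i, h1, h2, h3⟩ := F.hit_mem Gd n
  refine absurd h3 (not_le.2 (hX i ?_ _ ⟨h0, hc.le.trans (le_max_left _ _)⟩))
  have e : ((n * N : ℤ) : ℝ) * h = n := by push_cast; rw [mul_assoc, F.N_mul, mul_one]
  have h4 : ((n * N : ℤ) : ℝ) * h ≤ i * h := by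
    have := F.mesh.2.2.1
    gcongr
  rw [e] at h4
  exact (Nat.ceil_le.1 hn).trans h4

lemma tendsto_score : Tendsto (fun n : ℕ => D.hit N u n - n * (2 / D.c)) atTop atBot := by
  have hc := D.c_pos
  have h1 : Tendsto (fun n : ℕ => |D.l - D.zs| / D.c - (n : ℝ) * (1 / D.c)) atTop atBot := by
    refine tendsto_atBot_add_const_left _ _ (tendsto_neg_atTop_atBot.comp ?_)
    exact tendsto_natCast_atTop_atTop.atTop_mul_const (by positivity)
  refine tendsto_atBot_mono (fun n => ?_) h1
  have h2 := F.hit_le Gd n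
  have h3 : max 0 ((n + D.l - D.zs) / D.c) ≤ n * (1 / D.c) + |D.l - D.zs| / D.c := by
    refine max_le (by positivity) ?_
    rw [mul_one_div, ← add_div]
    gcongr
    linarith [le_abs_self (D.l - D.zs)]
  grind

end Front

/-- The index `n` is a record of the delayed hitting times. -/
def Record (D : WaveData) (N : ℤ) (u : ℤ → ℝ → ℝ) (n : ℕ) : Prop :=
  ∀ m < n, D.hit N u n - n * (2 / D.c) < D.hit N u m - m * (2 / D.c)

namespace Front
variable (F : D.Front σ h N u) (Gd : D.Good σ h N)
include F Gd

lemma exists_ultrafilter_record :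
    ∃ 𝒰 : Ultrafilter ℕ, (𝒰 : Filter ℕ) ≤ atTop ∧ ∀ᶠ n in (𝒰 : Filter ℕ), D.Record N u n := by
  have := frequently_low_scores (F.tendsto_score Gd)
  have hne : NeBot (atTop ⊓ 𝓟 {n | D.Record N u n}) := frequently_mem_iff_neBot.1 this
  refine ⟨Ultrafilter.of (atTop ⊓ 𝓟 {n | D.Record N u n}),
    (Ultrafilter.of_le (atTop ⊓ 𝓟 {n | D.Record N u n})).trans inf_le_left, ?_⟩
  exact (Ultrafilter.of_le (atTop ⊓ 𝓟 {n | D.Record N u n})).trans inf_le_right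
    (mem_principal_self _)

omit Gd in
lemma le_of_record {n : ℕ} (hn : D.Record N u n) (hpos : 0 < D.hit N u n)
    (hneg : D.hit N u n - n * (2 / D.c) ≤ 0) {t : ℝ} (h0 : 0 ≤ t) (ht : t ≤ D.hit N u n) {i : ℤ}
    (hi : n + 1 + D.c / 2 * (t - D.hit N u n) ≤ i * h) : u i t ≤ D.ν := by
  have hc := D.c_pos
  have hh := F.mesh.2.2.1
  set q := D.c / 2 * (D.hit N u n - t) with hq
  have hq0 : 0 ≤ q := mul_nonneg (by positivity) (by linarith)
  set k := ⌊q⌋₊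
  have hkq : (k:ℝ) ≤ q := Nat.floor_le hq0
  have hqk : q < k + 1 := Nat.lt_floor_add_one q
  have hqn : q ≤ n := by
    have : q ≤ D.c / 2 * (n * (2 / D.c)) := by rw [hq]; gcongr; linarith
    rwa [show D.c / 2 * (n * (2 / D.c)) = n by field_simp] at this
  have hkn : k ≤ n := by exact_mod_cast hkq.trans hqn
  have hi' : ((n - k : ℕ) : ℤ) * N ≤ i := by
    have e : (((n - k : ℕ) : ℤ) * N : ℝ) * h = n - k := by
      rw [mul_assoc, F.N_mul, mul_one]; push_cast [hkn]; ring
    have h1 : (((n - k : ℕ) : ℤ) * N : ℝ) * h ≤ i * h := by rw [e]; linarith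
    exact_mod_cast le_of_mul_le_mul_right h1 hh
  rcases Nat.eq_zero_or_pos k with hk0 | hk0
  · rw [hk0, Nat.sub_zero] at hi'
    exact F.le_of_le_hit hpos h0 ht hi'
  · refine (F.lt_of_lt_hit h0 ?_ hi').le
    have h1 := hn (n - k) (by omega)
    push_cast [hkn] at h1
    have h2 : (k:ℝ) * (2 / D.c) ≤ D.hit N u n - t := by
      have : (k:ℝ) * (2 / D.c) ≤ q * (2 / D.c) := by gcongr
      rwa [show q * (2 / D.c) = D.hit N u n - t by rw [hq]; field_simp] at this
    linarith

end Front
end WaveData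

namespace WaveData
variable {D : WaveData} {σ h : ℝ} {N : ℤ} {u : ℤ → ℝ → ℝ}

lemma Crosses.of_tendsto {ι : Type*} {l : Filter ι} [NeBot l] {a b : ι → ℤ → ℝ} {A B : ℤ → ℝ}
    (ha : ∀ i, Tendsto (fun n => a n i) l (𝓝 (A i))) (hb : ∀ i, Tendsto (fun n => b n i) l (𝓝 (B i)))
    (H : ∀ᶠ n in l, Crosses (a n) (b n)) : Crosses A B := by
  intro i j hij
  by_contra! hc
  obtain ⟨n, h1, h2, h3⟩ := (H.and (((ha i).eventually_lt (hb i) hc.1).and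
    ((hb j).eventually_lt (ha j) hc.2))).exists
  rcases h1 i j hij with h4 | h4 <;> linarith

lemma Crosses.ordered {a b : ℤ → ℝ} (h1 : Crosses a b) (h2 : Crosses b a) :
    (∀ i, a i ≤ b i) ∨ (∀ i, b i ≤ a i) := by
  by_contra! hc
  obtain ⟨⟨i, hi⟩, j, hj⟩ := hc
  rcases lt_trichotomy i j with h | rfl | h
  · rcases h2 i j h with h3 | h3 <;> linarith
  · linarith
  · rcases h1 j i h with h3 | h3 <;> linarith

/-- Ultralimit of a front along its hitting times. -/
def wave (D : WaveData) (𝒰 : Ultrafilter ℕ) (N : ℤ) (u : ℤ → ℝ → ℝ) (i : ℤ) (t : ℝ) : ℝ :=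
  ulim 𝒰 fun n : ℕ => u (i + n * N) (t + D.hit N u n)

/-- A pulsating wave of the lattice equation. -/
structure LatWave (D : WaveData) (σ h : ℝ) (N : ℤ) (T : ℝ) (u : ℤ → ℝ → ℝ) : Prop where
  mesh : D.Mesh σ h
  N_mul : N * h = 1
  sol : ∀ t, D.SolAt σ h u t
  convex : ∀ i t, -D.P ≤ lap h (fun j => u j t) i
  T_pos : 0 < T
  T_le : T ≤ 2 / D.c
  period : ∀ i t, u i (t + T) = u (i - N) t
  mono : ∀ i, Monotone (u i)
  tail : ∀ i : ℤ, 1 + h ≤ i * h → u i 0 ≤ bar σ (D.c / 16) D.ν (i * h - 1 - h)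
  norm : ∃ i, 0 ≤ i ∧ i < N ∧ u i 0 = D.ν

namespace Front
variable {𝒰 : Ultrafilter ℕ} (F : D.Front σ h N u) (Gd : D.Good σ h N)
  (h𝒰 : (𝒰 : Filter ℕ) ≤ atTop)
include F Gd h𝒰

lemma eventually_le_hit (T : ℝ) : ∀ᶠ n in (𝒰 : Filter ℕ), T ≤ D.hit N u n :=
  h𝒰 ((F.tendsto_hit Gd).eventually_ge_atTop T)

lemma tendsto_wave (i : ℤ) (t : ℝ) :
    Tendsto (fun n : ℕ => u (i + n * N) (t + D.hit N u n)) 𝒰 (𝓝 (D.wave 𝒰 N u i t)) := by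
  refine tendsto_ulim (a := 0) (b := D.M) ?_
  filter_upwards [F.eventually_le_hit Gd h𝒰 (-t)] with n hn
  exact (F.sol _ (by linarith) _).1

lemma wave_mem (i : ℤ) (t : ℝ) : D.wave 𝒰 N u i t ∈ Icc 0 D.M := by
  refine isClosed_Icc.mem_of_tendsto (F.tendsto_wave Gd h𝒰 i t) ?_
  filter_upwards [F.eventually_le_hit Gd h𝒰 (-t)] with n hn
  exact (F.sol _ (by linarith) _).1

lemma wave_convex (i : ℤ) (t : ℝ) : -D.P ≤ lap h (fun j => D.wave 𝒰 N u j t) i := by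
  have h1 : Tendsto (fun n : ℕ => lap h (fun j => u (j + n * N) (t + D.hit N u n)) i) 𝒰
      (𝓝 (lap h (fun j => D.wave 𝒰 N u j t) i)) := by
    unfold lap
    have := F.tendsto_wave Gd h𝒰 (t := t)
    exact (((this _).sub ((this _).const_mul 2)).add (this _)).div_const _
  refine ge_of_tendsto h1 ?_
  filter_upwards [F.eventually_le_hit Gd h𝒰 (-t)] with n hn
  have := F.neg_P_le_lap (i + n * N) (t := t + D.hit N u n) (by linarith)
  unfold lap at this ⊢
  grind

lemma wave_sol (t : ℝ) : D.SolAt σ h (D.wave 𝒰 N u) t := by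
  intro i
  refine ⟨F.wave_mem Gd h𝒰 i t, ?_⟩
  have hev := F.eventually_le_hit Gd h𝒰 (1 - t)
  have hsol : ∀ n : ℕ, 1 - t ≤ D.hit N u n → ∀ r ∈ Ioo (t - 1) (t + 1),
      D.SolAt σ h (fun i r => u (i + n * N) (r + D.hit N u n)) r := fun n hn r hr =>
    (F.sol _ (by linarith [hr.1])).shift F.N_mul n
  refine hasDerivAt_of_tendsto (l := (𝒰 : Filter ℕ)) (α := t - 1) (β := t + 1)
    (f := fun n r => u (i + n * N) (r + D.hit N u n))
    (f' := fun n r => D.rhs σ h (fun j => u (j + n * N) (r + D.hit N u n)) i)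
    ⟨by linarith, by linarith⟩ ?_ (fun r _ => F.tendsto_wave Gd h𝒰 i r) ?_ ?_
  · filter_upwards [hev] with n hn r hr
    exact (hsol n hn r hr).rhs_eq i
  · have h1 := F.tendsto_wave Gd h𝒰 (t := t)
    have hG : Continuous (fun x : ℝ => D.G σ (i * h) x) := by
      have := D.g_cont
      unfold G
      exact (this.comp (continuous_const.prodMk continuous_id)).add
        (continuous_const.mul continuous_id)
    have hP : Continuous (Phi σ) := by unfold Phi; fun_prop
    unfold rhs lap
    have h2 := fun j => (hP.tendsto _).comp (h1 j)
    exact ((((h2 _).sub ((h2 _).const_mul 2)).add (h2 _)).div_const _).add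
      ((hG.tendsto _).comp (h1 i))
  · intro ε hε
    have hr := rate_nonneg (D := D) (h := h)
    have hs := speed_nonneg (D := D) (h := h)
    refine ⟨ε / (D.rate h * D.speed h + 1), by positivity, ?_⟩
    filter_upwards [hev] with n hn r hr' hrt
    have hlip : ∀ j : ℤ, |u (j + n * N) (r + D.hit N u n) - u (j + n * N) (t + D.hit N u n)| ≤
        D.speed h * |r - t| := fun j => by
      have := SolAt.lip F.mesh (a := 0) (b := t + 1 + D.hit N u n)
        (fun s hs => F.sol s hs.1) (j + n * N) (s := t + D.hit N u n) (t := r + D.hit N u n)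
        ⟨by linarith, by linarith⟩ ⟨by linarith [hr'.1], by linarith [hr'.2]⟩
      grind
    refine (rhs_lip F.mesh (fun j => (hsol n hn r hr' j).1)
      (fun j => (hsol n hn t ⟨by linarith, by linarith⟩ j).1) hlip i).trans ?_
    change D.rate h * _ ≤ ε
    rw [lt_div_iff₀ (by positivity)] at hrt
    nlinarith [abs_nonneg (r - t)]

lemma wave_crosses (k : ℤ) (r t : ℝ) :
    Crosses (fun i => D.wave 𝒰 N u i t) (fun i => D.wave 𝒰 N u (i + k * N) r) := by
  refine Crosses.of_tendsto (fun i => F.tendsto_wave Gd h𝒰 i t) (fun i => tendsto_const_nhds) ?_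
  filter_upwards [F.eventually_le_hit Gd h𝒰 (-t)] with n hn
  refine Crosses.of_tendsto (l := (𝒰 : Filter ℕ)) (fun i => tendsto_const_nhds)
    (fun i => F.tendsto_wave Gd h𝒰 (i + k * N) r) ?_
  filter_upwards [F.eventually_le_hit Gd h𝒰 (t + D.hit N u n - r)] with m hm i j hij
  have := F.crosses (k + m - n) (s := r + D.hit N u m - (t + D.hit N u n)) (t := t + D.hit N u n)
    (by linarith) (by linarith) (i + n * N) (j + n * N) (by omega)
  grind

lemma wave_ordered (k : ℤ) (r t : ℝ) :
    (∀ i, D.wave 𝒰 N u i t ≤ D.wave 𝒰 N u (i + k * N) r) ∨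
    (∀ i, D.wave 𝒰 N u (i + k * N) r ≤ D.wave 𝒰 N u i t) := by
  refine (F.wave_crosses Gd h𝒰 k r t).ordered fun i j hij => ?_
  simpa using F.wave_crosses Gd h𝒰 (-k) t r (i + k * N) (j + k * N) (by omega)

omit h𝒰 in
lemma norm_of_tendsto {m : ℕ → ℕ} (hm : Tendsto m 𝒰 atTop) {V : ℤ → ℝ}
    (hV : ∀ i, Tendsto (fun n : ℕ => u (i + m n * N) (D.hit N u (m n))) 𝒰 (𝓝 (V i))) :
    (∀ i, 0 ≤ i → V i ≤ D.ν) ∧ ∃ i, 0 ≤ i ∧ i < N ∧ V i = D.ν := by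
  have hpos : ∀ᶠ n in (𝒰 : Filter ℕ), 0 < D.hit N u (m n) :=
    hm.eventually ((F.tendsto_hit Gd).eventually_gt_atTop 0)
  have hle : ∀ i, 0 ≤ i → V i ≤ D.ν := fun i hi => by
    refine le_of_tendsto (hV i) ?_
    filter_upwards [hpos] with n hn
    exact F.le_of_le_hit hn hn.le le_rfl (by linarith)
  refine ⟨hle, ?_⟩
  by_contra! hc
  have h1 : ∀ᶠ n in (𝒰 : Filter ℕ), ∀ i ∈ Finset.Ico 0 N,
      u (i + m n * N) (D.hit N u (m n)) < D.ν := by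
    rw [Filter.eventually_all_finset]
    intro i hi
    rw [Finset.mem_Ico] at hi
    exact (hV i).eventually_lt_const ((hle i hi.1).lt_of_ne (hc i hi.1 hi.2))
  obtain ⟨n, hn⟩ := h1.exists
  obtain ⟨-, i, h2, h3, h4⟩ := F.hit_mem Gd (m n)
  have := hn (i - m n * N) (Finset.mem_Ico.2 ⟨by linarith, by linarith⟩)
  grind

lemma exists_latWave (hR : ∀ᶠ n in (𝒰 : Filter ℕ), D.Record N u n) :
    ∃ T, D.LatWave σ h N T (D.wave 𝒰 N u) := by
  have hc := D.c_pos
  have hL := D.L_pos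
  have hν := D.ν_pos
  obtain ⟨hσ, hσ1, hh, -, -⟩ := F.mesh
  set U := D.wave 𝒰 N u
  have hsol := F.wave_sol Gd h𝒰
  have hid : Tendsto (fun n : ℕ => n) 𝒰 atTop := h𝒰
  have hpred : Tendsto (fun n : ℕ => n - 1) 𝒰 atTop := (tendsto_sub_atTop_nat 1).comp h𝒰
  obtain ⟨hle0, i₁, hi₁, hi₁N, hU₁⟩ := F.norm_of_tendsto Gd hid (V := fun i => U i 0)
    (fun i => by simpa using F.tendsto_wave Gd h𝒰 i 0)
  have hTmem : ∀ᶠ n in (𝒰 : Filter ℕ), D.hit N u n - D.hit N u (n - 1) ∈ Icc 0 (2 / D.c) := by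
    filter_upwards [hR, hid.eventually_ge_atTop 1] with n h1 h2
    obtain ⟨n, rfl⟩ : ∃ k, n = k + 1 := ⟨n - 1, by omega⟩
    have h3 := h1 n (by omega)
    have h4 := F.hit_le_succ Gd n
    rw [Nat.add_sub_cancel]
    push_cast at h3
    constructor
    · linarith
    · linarith
  have hTlim := tendsto_ulim hTmem
  set T := ulim 𝒰 fun n => D.hit N u n - D.hit N u (n - 1)
  have hTI : T ∈ Icc 0 (2 / D.c) := isClosed_Icc.mem_of_tendsto hTlim hTmem
  have hVlim : ∀ i : ℤ, Tendsto (fun n : ℕ => u (i + (n - 1 : ℕ) * N) (D.hit N u (n - 1))) 𝒰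
      (𝓝 (U (i - N) (-T))) := by
    intro i
    have h1 := F.tendsto_wave Gd h𝒰 (i - N) (-T)
    refine h1.congr_dist ?_
    have h2 : Tendsto (fun n => D.speed h * |(D.hit N u n - D.hit N u (n - 1)) - T|) 𝒰 (𝓝 0) := by
      have := ((hTlim.sub_const T).abs).const_mul (D.speed h)
      simpa using this
    refine squeeze_zero' (Eventually.of_forall fun n => dist_nonneg) ?_ h2
    filter_upwards [hid.eventually_ge_atTop 1, F.eventually_le_hit Gd h𝒰 T] with n hn hn2
    have e : i - N + n * N = i + (n - 1 : ℕ) * N := by push_cast [hn]; ring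
    rw [e, dist_eq]
    have h0 := hit_nonneg (D := D) (N := N) (u := u) (n - 1)
    have := SolAt.lip F.mesh (a := 0) (b := max (-T + D.hit N u n) (D.hit N u (n - 1)))
        (fun s hs => F.sol s hs.1) (i + (n - 1 : ℕ) * N) (s := D.hit N u (n - 1))
        (t := -T + D.hit N u n) ⟨h0, le_max_right _ _⟩ ⟨by linarith, le_max_left _ _⟩
    rwa [show -T + D.hit N u n - D.hit N u (n - 1) = D.hit N u n - D.hit N u (n - 1) - T by ring]
      at this
  obtain ⟨hleV, i₂, hi₂, hi₂N, hV₂⟩ := F.norm_of_tendsto Gd hpred hVlim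
  have hX : ∀ t, D.SolAt σ h (fun i t => U (i + (-1) * N) (t + (-T))) t := fun t =>
    (hsol (t + -T)).shift F.N_mul (-1)
  have e1 : ∀ i : ℤ, i + (-1) * N = i - N := fun i => by ring
  have hper0 : ∀ i t, U (i + (-1) * N) (t + (-T)) = U i t := by
    have hord := fun t => F.wave_ordered Gd h𝒰 (-1) (t + -T) t
    have : ∃ i, U (i + (-1) * N) (0 + (-T)) = U i 0 := by
      rcases hord 0 with h1 | h1
      · refine ⟨i₁, le_antisymm ?_ (h1 i₁)⟩
        rw [hU₁, e1, zero_add]; exact hleV i₁ hi₁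
      · refine ⟨i₂, le_antisymm (h1 i₂) ?_⟩
        rw [e1, zero_add, hV₂]; exact hle0 i₂ hi₂
    obtain ⟨i, hi⟩ := this
    exact SolAt.eq_of_eq F.mesh hX hsol (t₀ := 0) (touching F.mesh hX hsol hord hi)
  have hper : ∀ i t, U i (t + T) = U (i - N) t := fun i t => by
    rw [← hper0 i (t + T), e1, add_neg_cancel_right]
  have htail : ∀ i : ℤ, 1 + h ≤ i * h → U i 0 ≤ bar σ (D.c / 16) D.ν (i * h - 1 - h) := by
    intro i hi
    refine le_of_tendsto (F.tendsto_wave Gd h𝒰 i 0) ?_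
    filter_upwards [hR, F.eventually_le_hit Gd h𝒰 1,
      h𝒰 ((F.tendsto_score Gd).eventually_le_atBot 0),
      h𝒰 ((F.tendsto_score Gd).eventually_le_atBot (-(2 * D.M * (2 / D.c))))] with n h1 h2 h3 h4
    have key := le_bar F.mesh (a := D.c / 16) (ν := D.ν) (y := n + 1 + h - D.c / 2 * D.hit N u n)
      (t₁ := 0) (t₂ := D.hit N u n) (by positivity) hν
      (Gd.ratio_of_le (by linarith [D.aM_pos])) ?_ (u := u) (fun t ht => F.sol t ht.1) ?_ ?_
      (D.hit N u n) ⟨by linarith, le_rfl⟩ (i + n * N) ?_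
    · rw [zero_add]
      refine key.trans (le_of_eq ?_)
      congr 1
      push_cast
      rw [add_mul, mul_assoc (n:ℝ), F.N_mul]
      ring
    · have h5 : D.ν ≤ D.c ^ 2 / (256 * (D.L + 1)) := min_le_right _ _
      have h6 := Gd.σ_sq
      calc (D.L + 1) * (D.ν + σ ^ 2)
          ≤ (D.L + 1) * (D.c ^ 2 / (256 * (D.L + 1)) + D.c ^ 2 / (256 * (D.L + 1))) := by gcongr
        _ = 2 * (D.c / 16) ^ 2 := by field_simp; norm_num
    · intro t ht j hj
      refine F.le_of_record h1 (by linarith) h3 ht.1 ht.2 ?_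
      nlinarith
    · intro j hj
      rw [F.init, cap_of_ge ?_]
      · exact (bar_pos _).le
      · have h5 : D.c / 2 * (D.hit N u n - n * (2 / D.c)) ≤ D.c / 2 * (-(2 * D.M * (2 / D.c))) := by
          gcongr
        have e2 : D.c / 2 * (-(2 * D.M * (2 / D.c))) = - (2 * D.M) := by field_simp
        have e3 : D.c / 2 * (D.hit N u n - n * (2 / D.c)) = D.c / 2 * D.hit N u n - n := by
          field_simp
        linarith
    · push_cast
      rw [add_mul, mul_assoc (n:ℝ), F.N_mul]
      linarith
  have hT0 : 0 < T := by
    refine hTI.1.lt_of_ne fun hT0 => ?_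
    have h1 : ∀ k : ℕ, U (i₁ + k * N) 0 = D.ν := by
      intro k
      induction k with
      | zero => simpa using hU₁
      | succ k ih =>
        have := hper (i₁ + (k + 1 : ℕ) * N) 0
        rw [← hT0, add_zero, show i₁ + (k + 1 : ℕ) * N - N = i₁ + k * N by push_cast; ring] at this
        rw [this, ih]
    obtain ⟨k, hk⟩ := exists_nat_gt ((2 * D.ν) / (D.c / 16) + 1 + h)
    have e2 : ((i₁ + k * N : ℤ) : ℝ) * h = i₁ * h + k := by
      push_cast; rw [add_mul, mul_assoc (k:ℝ), F.N_mul, mul_one]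
    have h0 : 0 ≤ (i₁:ℝ) * h := mul_nonneg (by exact_mod_cast hi₁) hh.le
    have h2 : 0 < 2 * D.ν / (D.c / 16) := by positivity
    have h3 := htail (i₁ + k * N) (by rw [e2]; linarith)
    rw [h1, e2] at h3
    have h4 := h3.trans (bar_le hσ hν _)
    have h5 : exp ((D.ν - D.c / 16 * (i₁ * h + k - 1 - h)) / σ ^ 2) < 1 := by
      rw [exp_lt_one_iff]
      refine div_neg_of_neg_of_pos ?_ (by positivity)
      have h6 : 2 * D.ν / (D.c / 16) < i₁ * h + k - 1 - h := by linarith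
      rw [div_lt_iff₀ (by positivity)] at h6
      linarith
    nlinarith
  have hmono0 : ∀ s, 0 ≤ s → ∀ i, U i (-s) ≤ U i 0 := by
    intro s hs i
    have hY : ∀ t, D.SolAt σ h (fun i t => U (i + 0 * N) (t + (-s))) t := fun t =>
      (hsol (t + -s)).shift F.N_mul 0
    have hord := fun t => F.wave_ordered Gd h𝒰 0 (t + -s) t
    rcases hord 0 with h1 | h1
    · have h2 : U i₁ (-s) ≤ D.ν := by
        refine le_of_tendsto (F.tendsto_wave Gd h𝒰 i₁ (-s)) ?_
        filter_upwards [F.eventually_le_hit Gd h𝒰 (s + 1)] with n hn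
        exact F.le_of_le_hit (by linarith) (by linarith) (by linarith) (by linarith)
      have h3 : U (i₁ + 0 * N) (0 + -s) = U i₁ 0 := by
        refine le_antisymm ?_ (h1 i₁)
        rw [hU₁]; simpa using h2
      have := touching F.mesh hY hsol hord (t₀ := 0) h3 i
      simp only [zero_mul, add_zero, zero_add] at this
      exact this.le
    · simpa using h1 i
  have hmono1 : ∀ s, 0 ≤ s → ∀ t, 0 ≤ t → ∀ i, U i (t - s) ≤ U i t := by
    intro s hs t ht i
    have hY : ∀ t, D.SolAt σ h (fun i t => U (i + 0 * N) (t + (-s))) t := fun t =>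
      (hsol (t + -s)).shift F.N_mul 0
    have := compare_sub (u := U) (v := fun i t => U (i + 0 * N) (t + (-s))) F.mesh.1 F.mesh.2.1
      (a := 0) (b := t) (fun r _ => hsol r) (fun r _ i => ((hY r) i).1)
      (fun i r _ => ((hY r).continuousAt i).continuousWithinAt) (by simpa using hmono0 s hs)
      (fun r _ i _ => ⟨_, ((hY r) i).2.hasDerivWithinAt, le_rfl⟩) i t ⟨ht, le_rfl⟩
    simpa [sub_eq_add_neg] using this
  have hiter : ∀ (k : ℕ) i t, U i t = U (i + k * N) (t + k * T) := by
    intro k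
    induction k with
    | zero => simp
    | succ k ih =>
      intro i t
      rw [ih, show t + ((k + 1 : ℕ) : ℝ) * T = t + k * T + T by push_cast; ring, hper]
      congr 1
      push_cast; ring
  refine ⟨T, F.mesh, F.N_mul, hsol, F.wave_convex Gd h𝒰, hT0, hTI.2, hper, ?_, htail,
    i₁, hi₁, hi₁N, hU₁⟩
  intro i s t hst
  obtain ⟨k, hk⟩ := exists_nat_ge (-t / T)
  rw [div_le_iff₀ hT0] at hk
  rw [hiter k i s, hiter k i t]
  have := hmono1 (t - s) (by linarith) (t + k * T) (by linarith) (i + k * N)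
  rwa [show t + k * T - (t - s) = s + k * T by ring] at this

end Front

lemma Good.exists_latWave (Gd : D.Good σ h N) : ∃ T u, D.LatWave σ h N T u := by
  obtain ⟨u, F⟩ := exists_front Gd.mesh Gd.N_mul
  obtain ⟨𝒰, h1, h2⟩ := F.exists_ultrafilter_record Gd
  obtain ⟨T, hT⟩ := F.exists_latWave Gd h1 h2
  exact ⟨T, _, hT⟩

end WaveData

lemma sum_lap_range (F : ℤ → ℝ) (i : ℤ) (n : ℕ) :
    ∑ m ∈ Finset.range n, (F (i + m + 1) - 2 * F (i + m) + F (i + m - 1))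
      = (F (i + n) - F (i + n - 1)) - (F i - F (i - 1)) := by
  induction n with
  | zero => simp
  | succ n ih =>
    rw [Finset.sum_range_succ, ih]
    grind

lemma abs_sub_le_of_step {a : ℤ → ℝ} {K : ℝ} (hK : ∀ i, |a (i + 1) - a i| ≤ K) (i j : ℤ) :
    |a i - a j| ≤ K * |(i:ℝ) - j| := by
  have key : ∀ (n : ℕ) (i : ℤ), |a (i + n) - a i| ≤ K * n := by
    intro n i
    induction n with
    | zero => simp
    | succ n ih =>
      grind
  rcases le_total j i with h | h
  · obtain ⟨n, hn⟩ := Int.le.dest h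
    have := key n j
    rw [hn] at this
    rw [← hn]
    push_cast
    rwa [add_sub_cancel_left, Nat.abs_cast, hn]
  · obtain ⟨n, hn⟩ := Int.le.dest h
    have := key n i
    rw [hn] at this
    rw [← hn]
    push_cast
    grind

/-- Chords of convex sequences. -/
lemma convex_seq_chord {b : ℤ → ℝ} (hb : ∀ i, 0 ≤ b (i + 1) - 2 * b i + b (i - 1)) {i j l : ℤ}
    (hij : i ≤ j) (hjl : j ≤ l) : (b j - b i) * (l - j) ≤ (b l - b j) * (j - i) := by
  have hmono : ∀ (n : ℕ) (i : ℤ), b i - b (i - 1) ≤ b (i + n) - b (i + n - 1) := by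
    intro n i
    induction n with
    | zero => simp
    | succ n ih =>
      grind
  have h1 : ∀ n : ℕ, b j - b (j - n) ≤ n * (b j - b (j - 1)) := by
    intro n
    induction n with
    | zero => simp
    | succ n ih =>
      have := hmono n (j - n)
      grind
  have h2 : ∀ n : ℕ, n * (b j - b (j - 1)) ≤ b (j + n) - b j := by
    intro n
    induction n with
    | zero => simp
    | succ n ih =>
      grind
  obtain ⟨p, hp⟩ := Int.le.dest hij
  obtain ⟨q, hq⟩ := Int.le.dest hjl
  have e1 : (j:ℝ) - i = p := by rw [← hp]; push_cast; ring
  have e2 : (l:ℝ) - j = q := by rw [← hq]; push_cast; ring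
  have h3 := h1 p
  have h4 := h2 q
  rw [show j - p = i by linarith] at h3
  rw [hq] at h4
  rw [e1, e2]
  have hp0 : (0:ℝ) ≤ p := by positivity
  have hq0 : (0:ℝ) ≤ q := by positivity
  nlinarith [mul_le_mul_of_nonneg_right h3 hq0, mul_le_mul_of_nonneg_left h4 hp0]

namespace WaveData
variable {D : WaveData} {σ h T : ℝ} {N : ℤ} {u : ℤ → ℝ → ℝ}

/-- Lipschitz constant of the waves in space. -/
def S (D : WaveData) : ℝ := 2 * √(D.M * D.P)

lemma S_pos : 0 < D.S := by
  have := D.M_pos; have := D.P_pos; unfold S; positivity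

/-- Hölder constant of the waves in time. -/
def Ct (D : WaveData) : ℝ := 4 * D.S + 2 * (2 * D.M + 2) * D.S + (D.L + 1) * D.M + D.M

lemma Ct_pos : 0 < D.Ct := by
  have := D.M_pos; have := D.S_pos; have := D.L_pos; unfold Ct; positivity

lemma G_abs_le_Icc (H : D.Mesh σ h) {x u : ℝ} (hu : u ∈ Icc 0 D.M) :
    |D.G σ x u| ≤ (D.L + 1) * D.M := by
  have h1 := G_lip H.1 H.2.1 x hu (v := 0) ⟨le_rfl, D.M_pos.le⟩
  have h2 : D.G σ x 0 = 0 := by simp [G, D.g_zero]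
  rw [h2, sub_zero, sub_zero, abs_of_nonneg hu.1] at h1
  have := D.L_pos
  exact h1.trans (by gcongr; exact hu.2)

lemma Phi_step (H : D.Mesh σ h) {x y : ℝ} (hx : x ∈ Icc 0 D.M) (hy : y ∈ Icc 0 D.M) :
    |Phi σ x - Phi σ y| ≤ (2 * D.M + 2) * |x - y| := by
  obtain ⟨h1, h2, -, -, -⟩ := H
  have h3 := h2.trans D.σ₀_le
  have e : Phi σ x - Phi σ y = (x + y + 2 * σ ^ 2) * (x - y) := by unfold Phi; ring
  rw [e, abs_mul]
  gcongr
  have := hx.1; have := hy.1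
  rw [abs_of_nonneg (by positivity)]
  nlinarith [hx.2, hy.2]

namespace LatWave
variable (W : D.LatWave σ h N T u)
include W

lemma mem (i : ℤ) (t : ℝ) : u i t ∈ Icc 0 D.M := (W.sol t i).1

lemma h_pos : 0 < h := W.mesh.2.2.1

lemma N_pos : 0 < N := by
  have h1 := W.N_mul
  have h2 := W.h_pos
  by_contra! hc
  have h3 : (N:ℝ) ≤ 0 := by exact_mod_cast hc
  nlinarith

lemma step_le (i : ℤ) (t : ℝ) : |u (i + 1) t - u i t| ≤ D.S * h :=
  slope_le W.mesh (a := fun j => u j t) (fun j => W.mem j t) (fun j => W.convex j t) i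

lemma lip_x (i j : ℤ) (t : ℝ) : |u i t - u j t| ≤ D.S * |i * h - j * h| := by
  have := abs_sub_le_of_step (a := fun j => u j t) (fun i => W.step_le i t) i j
  rw [← sub_mul, abs_mul, abs_of_pos W.h_pos]
  linarith

lemma period_nat (k : ℕ) (i : ℤ) (t : ℝ) : u i (t + k * T) = u (i - k * N) t := by
  induction k generalizing i with
  | zero => simp
  | succ k ih =>
    rw [show t + ((k + 1 : ℕ) : ℝ) * T = t + k * T + T by push_cast; ring, W.period, ih]
    congr 1; push_cast; ring

lemma period_int (k : ℤ) (i : ℤ) (t : ℝ) : u i (t + k * T) = u (i - k * N) t := by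
  rcases Int.eq_nat_or_neg k with ⟨n, rfl | rfl⟩
  · exact_mod_cast W.period_nat n i t
  · have := W.period_nat n (i + n * N) (t + (-(n:ℤ) : ℤ) * T)
    rw [add_sub_cancel_right] at this
    rw [← this, show i - -(n:ℤ) * N = i + n * N by ring]
    congr 1; push_cast; ring

lemma shift_le (i : ℤ) (t : ℝ) : u (i + N) t ≤ u i t := by
  have h1 := W.period (i + N) t
  rw [add_sub_cancel_right] at h1
  rw [← h1]
  exact W.mono _ (by linarith [W.T_pos])

lemma window_sum (i : ℤ) (n : ℕ) {s t : ℝ} (hst : s ≤ t) :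
    ∑ m ∈ Finset.range n, (u (i + m) t - u (i + m) s) * h
      ≤ (2 * (2 * D.M + 2) * D.S + (D.L + 1) * D.M * (n * h)) * (t - s) := by
  have hh := W.h_pos
  have hM := D.M_pos
  have hd : ∀ r, HasDerivAt (fun r => ∑ m ∈ Finset.range n, u (i + m) r * h)
      (∑ m ∈ Finset.range n, (lap h (fun j => Phi σ (u j r)) (i + m)
        + D.G σ ((i + m : ℤ) * h) (u (i + m) r)) * h) r := fun r =>
    HasDerivAt.fun_sum fun m _ => ((W.sol r (i + m)).2).mul_const h
  have hb : ∀ r, |∑ m ∈ Finset.range n, (lap h (fun j => Phi σ (u j r)) (i + m)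
        + D.G σ ((i + m : ℤ) * h) (u (i + m) r)) * h|
        ≤ 2 * (2 * D.M + 2) * D.S + (D.L + 1) * D.M * (n * h) := by
    intro r
    have e : ∀ m ∈ Finset.range n, (lap h (fun j => Phi σ (u j r)) (i + m)
        + D.G σ ((i + m : ℤ) * h) (u (i + m) r)) * h =
        (Phi σ (u (i + m + 1) r) - 2 * Phi σ (u (i + m) r) + Phi σ (u (i + m - 1) r)) * h⁻¹
        + D.G σ ((i + m : ℤ) * h) (u (i + m) r) * h := by
      intro m _
      unfold lap
      field_simp
    rw [Finset.sum_congr rfl e, Finset.sum_add_distrib, ← Finset.sum_mul,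
      sum_lap_range (fun j => Phi σ (u j r))]
    have hf : ∀ j : ℤ, |Phi σ (u j r) - Phi σ (u (j - 1) r)| ≤ (2 * D.M + 2) * (D.S * h) := by
      intro j
      refine (Phi_step W.mesh (W.mem _ _) (W.mem _ _)).trans ?_
      have := W.step_le (j - 1) r
      rw [sub_add_cancel] at this
      gcongr
    have h1 : |((Phi σ (u (i + n) r) - Phi σ (u (i + n - 1) r)) -
        (Phi σ (u i r) - Phi σ (u (i - 1) r))) * h⁻¹| ≤ 2 * (2 * D.M + 2) * D.S := by
      rw [abs_mul, abs_of_pos (inv_pos.2 hh)]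
      rw [← div_eq_mul_inv, div_le_iff₀ hh]
      grind
    have h2 : |∑ m ∈ Finset.range n, D.G σ ((i + m : ℤ) * h) (u (i + m) r) * h|
        ≤ (D.L + 1) * D.M * (n * h) := by
      refine (Finset.abs_sum_le_sum_abs _ _).trans ?_
      calc ∑ m ∈ Finset.range n, |D.G σ ((i + m : ℤ) * h) (u (i + m) r) * h|
          ≤ ∑ m ∈ Finset.range n, (D.L + 1) * D.M * h := by
            refine Finset.sum_le_sum fun m _ => ?_
            rw [abs_mul, abs_of_pos hh]
            gcongr
            exact G_abs_le_Icc W.mesh (W.mem _ _)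
        _ = (D.L + 1) * D.M * (n * h) := by
            rw [Finset.sum_const, Finset.card_range, nsmul_eq_mul]; ring
    exact (abs_add_le _ _).trans (add_le_add h1 h2)
  have key := (convex_univ (𝕜 := ℝ) (E := ℝ)).norm_image_sub_le_of_norm_hasDerivWithin_le
    (fun r _ => (hd r).hasDerivWithinAt) (fun r _ => hb r) (mem_univ s) (mem_univ t)
  rw [norm_eq_abs, norm_eq_abs, abs_of_nonneg (sub_nonneg.2 hst),
    ← Finset.sum_sub_distrib] at key
  grind

lemma holder_aux (i : ℤ) {s t : ℝ} (hst : s < t) (ht1 : t - s ≤ 1) :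
    u i t - u i s ≤ D.Ct * (√(t - s) + h) := by
  have hh := W.h_pos
  have hS := D.S_pos
  have hM := D.M_pos
  have hL := D.L_pos
  set q := √(t - s)
  have hq0 : 0 < q := Real.sqrt_pos.2 (by linarith)
  have hqq : q * q = t - s := Real.mul_self_sqrt (by linarith)
  have hq1 : q ≤ 1 := by nlinarith
  set n := ⌈q / h⌉₊
  have hn1 : q ≤ n * h := by
    have := Nat.le_ceil (q / h); rwa [div_le_iff₀ hh] at this
  have hn2 : n * h ≤ q + h := by
    have := (Nat.ceil_lt_add_one (a := q / h) (by positivity)).le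
    calc n * h ≤ (q / h + 1) * h := by gcongr
      _ = q + h := by field_simp
  have key := W.window_sum i n hst.le
  have hlow : ((u i t - u i s) - 2 * D.S * (n * h)) * (n * h) ≤
      ∑ m ∈ Finset.range n, (u (i + m) t - u (i + m) s) * h := by
    calc ((u i t - u i s) - 2 * D.S * (n * h)) * (n * h)
        = ∑ m ∈ Finset.range n, ((u i t - u i s) - 2 * D.S * (n * h)) * h := by
          rw [Finset.sum_const, Finset.card_range, nsmul_eq_mul]; ring
      _ ≤ _ := by
        refine Finset.sum_le_sum fun m hm => ?_
        refine mul_le_mul_of_nonneg_right ?_ hh.le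
        have hm' : (m:ℝ) ≤ n := by exact_mod_cast (Finset.mem_range.1 hm).le
        have h1 := W.lip_x (i + m) i t
        have h2 := W.lip_x (i + m) i s
        have e : |((i + m : ℤ) : ℝ) * h - i * h| = m * h := by
          rw [show ((i + m : ℤ) : ℝ) * h - i * h = m * h by push_cast; ring]
          exact abs_of_nonneg (by positivity)
        rw [e] at h1 h2
        have h3 : D.S * (m * h) ≤ D.S * (n * h) := by gcongr
        have := abs_le.1 h1
        have := abs_le.1 h2
        linarith
  have hd : (u i t - u i s) - 2 * D.S * (n * h) ≤
      2 * (2 * D.M + 2) * D.S * q + (D.L + 1) * D.M * q := by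
    have h1 := hlow.trans key
    by_contra! hc
    have h2 : (2 * (2 * D.M + 2) * D.S * q + (D.L + 1) * D.M * q) * (n * h) <
      ((u i t - u i s) - 2 * D.S * (n * h)) * (n * h) := by gcongr
    rw [← hqq] at h1
    have h3 : 2 * (2 * D.M + 2) * D.S * q * q ≤ 2 * (2 * D.M + 2) * D.S * q * (n * h) := by gcongr
    have h4 : (D.L + 1) * D.M * (n * h) * (q * q) ≤ (D.L + 1) * D.M * (n * h) * q := by
      gcongr; nlinarith
    linarith
  have h5 : 2 * D.S * (n * h) ≤ 2 * D.S * (q + h) := by gcongr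
  unfold Ct
  have : 0 ≤ (2 * (2 * D.M + 2) * D.S + (D.L + 1) * D.M) * h := by positivity
  have : 0 ≤ (2 * D.S + D.M) * (q + h) := by positivity
  linarith

lemma holder (i : ℤ) (s t : ℝ) : |u i t - u i s| ≤ D.Ct * (√|t - s| + h) := by
  wlog hst : s ≤ t generalizing s t
  · rw [abs_sub_comm, abs_sub_comm t]
    exact this t s (by linarith)
  have hh := W.h_pos
  have hC := D.Ct_pos
  rw [abs_of_nonneg (sub_nonneg.2 (W.mono i hst)), abs_of_nonneg (sub_nonneg.2 hst)]
  rcases hst.eq_or_lt with rfl | hst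
  · simp; positivity
  rcases le_or_gt (t - s) 1 with h1 | h1
  · exact W.holder_aux i hst h1
  · have h2 : 1 ≤ √(t - s) := Real.one_le_sqrt.2 h1.le
    have h3 : D.M ≤ D.Ct := by
      have := D.M_pos; have := D.S_pos; have := D.L_pos
      unfold Ct
      have : 0 ≤ 4 * D.S + 2 * (2 * D.M + 2) * D.S + (D.L + 1) * D.M := by positivity
      linarith
    have := (W.mem i t).2
    have := (W.mem i s).1
    nlinarith

lemma tail_time (n : ℤ) {t : ℝ} (ht : t ≤ n * T) {i : ℤ} (hi : 1 + h + n ≤ i * h) :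
    u i t ≤ bar σ (D.c / 16) D.ν (i * h - n - 1 - h) := by
  have h1 := W.mono i ht
  have h2 := W.period_int n i 0
  have e : ((i - n * N : ℤ) : ℝ) * h = i * h - n := by
    push_cast; rw [sub_mul, mul_assoc, W.N_mul, mul_one]
  have h3 := W.tail (i - n * N) (by rw [e]; linarith)
  grind

lemma chord {i j l : ℤ} (hij : i ≤ j) (hjl : j ≤ l) (t : ℝ) :
    ((u j t + D.P / 2 * (j * h) ^ 2) - (u i t + D.P / 2 * (i * h) ^ 2)) * (l * h - j * h) ≤
    ((u l t + D.P / 2 * (l * h) ^ 2) - (u j t + D.P / 2 * (j * h) ^ 2)) * (j * h - i * h) := by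
  have hh := W.h_pos
  have := convex_seq_chord (b := fun j : ℤ => u j t + D.P / 2 * (j * h) ^ 2) (fun i => by
    have h1 := W.convex i t
    unfold lap at h1
    rw [le_div_iff₀ (by positivity)] at h1
    grind) hij hjl
  rw [← sub_mul, ← sub_mul]
  nlinarith

end LatWave
end WaveData

namespace WaveData
variable {D : WaveData}

/-- A sequence of lattice waves with vanishing regularization. -/
structure Approx (D : WaveData) where
  σ : ℕ → ℝ
  h : ℕ → ℝ
  T : ℕ → ℝ
  N : ℕ → ℤ
  u : ℕ → ℤ → ℝ → ℝ
  wave : ∀ k, D.LatWave (σ k) (h k) (N k) (T k) (u k)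
  σ_le : ∀ k, σ k ≤ 1 / (k + 1)
  h_le : ∀ k, h k ≤ 1 / (k + 1)

/-- The nonprincipal ultrafilter along which limits are taken. -/
abbrev 𝒱 : Ultrafilter ℕ := hyperfilter ℕ

lemma 𝒱_le : (𝒱 : Filter ℕ) ≤ atTop := Nat.hyperfilter_le_atTop

lemma exists_approx (hsub : ∀ σ, 0 < σ → σ ≤ D.σ₀ → ∃ h₀ > 0, ∀ h, 0 < h → h ≤ h₀ → D.SubOK σ h) :
    Nonempty D.Approx := by
  have hc := D.c_pos
  have hL := D.L_pos
  have hM := D.M_pos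
  have hP := D.P_pos
  have hσ₀ := D.σ₀_pos
  have key : ∀ k : ℕ, ∃ (σ h T : ℝ) (N : ℤ) (u : ℤ → ℝ → ℝ), D.LatWave σ h N T u ∧
      σ ≤ 1 / (k + 1) ∧ h ≤ 1 / (k + 1) := by
    intro k
    have hA := D.aM_pos
    set s := min D.σ₀ (min (1 / (k + 1)) (D.c / (16 * (D.L + 1))))
    have hs0 : 0 < s := by positivity
    have hs1 : s ≤ D.σ₀ := min_le_left _ _
    have hs2 : s ≤ 1 / (k + 1) := (min_le_right _ _).trans (min_le_left _ _)
    have hs3 : s ≤ D.c / (16 * (D.L + 1)) := (min_le_right _ _).trans (min_le_right _ _)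
    obtain ⟨h₀, hh₀, hsubh⟩ := hsub s hs0 hs1
    set b := min h₀ (min (1 / (k + 1)) (min (s ^ 2 / (8 * D.M * D.P + 1))
      (s ^ 2 / (4 * (D.aM + D.c)))))
    have hb0 : 0 < b := by positivity
    obtain ⟨n, hn⟩ := exists_nat_gt (1 / b)
    have hn0 : (0:ℝ) < n := lt_trans (by positivity) hn
    have hh : (1 / n : ℝ) ≤ b := by
      rw [div_le_iff₀ hn0]; rw [div_lt_iff₀ hb0] at hn; linarith
    have hh0 : (0:ℝ) < 1 / n := by positivity
    have h1 : (1 / n : ℝ) ≤ h₀ := hh.trans (min_le_left _ _)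
    have h2 : (1 / n : ℝ) ≤ 1 / (k + 1) := hh.trans ((min_le_right _ _).trans (min_le_left _ _))
    have h3 : (1 / n : ℝ) ≤ s ^ 2 / (8 * D.M * D.P + 1) := hh.trans ((min_le_right _ _).trans
      ((min_le_right _ _).trans (min_le_left _ _)))
    have h4 : (1 / n : ℝ) ≤ s ^ 2 / (4 * (D.aM + D.c)) := hh.trans ((min_le_right _ _).trans
      ((min_le_right _ _).trans (min_le_right _ _)))
    have h5 : (1 / (k + 1) : ℝ) ≤ 1 := by
      rw [div_le_one (by positivity)]; linarith [(Nat.cast_nonneg k : (0:ℝ) ≤ k)]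
    set d : ℝ := 1 / n with hd
    have Gd : D.Good s d n := by
      refine ⟨⟨hs0, hs1, hh0, h2.trans h5, ?_⟩, ?_, hsubh d hh0 h1, ?_, ?_⟩
      · rw [le_div_iff₀ (by positivity)] at h3
        have h7 : (d * (8 * D.M * D.P + 1)) ^ 2 ≤ (s ^ 2) ^ 2 := by gcongr
        have h9 : 0 ≤ d ^ 2 * (8 * D.M * D.P) * (8 * D.M * D.P) := by positivity
        nlinarith
      · rw [hd]; push_cast; field_simp
      · have h6 : (D.aM + D.c) * d / s ^ 2 ≤ 1 / 4 := by
          rw [le_div_iff₀ (by positivity)] at h4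
          rw [div_le_iff₀ (by positivity)]
          linarith
        refine (exp_le_exp.2 h6).trans ?_
        have h7 := Real.exp_bound' (x := 1 / 4) (by norm_num) (by norm_num) (n := 2) (by norm_num)
        refine h7.trans ?_
        norm_num [Finset.sum_range_succ]
      · have h6 : s ^ 2 ≤ (D.c / (16 * (D.L + 1))) ^ 2 := by gcongr
        refine h6.trans ?_
        rw [div_pow]
        gcongr
        nlinarith
    obtain ⟨T, u, W⟩ := Gd.exists_latWave
    exact ⟨s, d, T, n, u, W, hs2, h2⟩
  choose σ h T N u hw h1 h2 using key
  exact ⟨⟨σ, h, T, N, u, hw, h1, h2⟩⟩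

namespace Approx
variable (A : D.Approx)

/-- The limiting wave. -/
def U (x t : ℝ) : ℝ := ulim 𝒱 fun k => A.u k ⌊x * A.N k⌋ t

/-- The period of the limiting wave. -/
def per : ℝ := ulim 𝒱 A.T

lemma h_pos (k : ℕ) : 0 < A.h k := (A.wave k).h_pos

lemma tendsto_h : Tendsto A.h 𝒱 (𝓝 0) :=
  (squeeze_zero (fun k => (A.h_pos k).le) A.h_le tendsto_one_div_add_atTop_nhds_zero_nat).mono_left
    𝒱_le

lemma tendsto_σ : Tendsto A.σ 𝒱 (𝓝 0) :=
  (squeeze_zero (fun k => (A.wave k).mesh.1.le) A.σ_le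
    tendsto_one_div_add_atTop_nhds_zero_nat).mono_left 𝒱_le

lemma floor_le (k : ℕ) (x : ℝ) : ⌊x * A.N k⌋ * A.h k ≤ x := by
  have h1 := Int.floor_le (x * A.N k)
  have h2 := (A.wave k).N_mul
  calc ⌊x * A.N k⌋ * A.h k ≤ x * A.N k * A.h k := by gcongr; exact (A.h_pos k).le
    _ = x := by rw [mul_assoc, h2, mul_one]

lemma lt_floor (k : ℕ) (x : ℝ) : x < ⌊x * A.N k⌋ * A.h k + A.h k := by
  have h1 := Int.lt_floor_add_one (x * A.N k)
  have h2 := (A.wave k).N_mul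
  calc x = x * A.N k * A.h k := by rw [mul_assoc, h2, mul_one]
    _ < (⌊x * A.N k⌋ + 1) * A.h k := by gcongr; exact A.h_pos k
    _ = _ := by ring

lemma tendsto_floor (x : ℝ) : Tendsto (fun k => ⌊x * A.N k⌋ * A.h k) 𝒱 (𝓝 x) := by
  refine tendsto_of_tendsto_of_tendsto_of_le_of_le (g := fun k => x - A.h k) (h := fun _ => x)
    (by simpa using A.tendsto_h.const_sub x) tendsto_const_nhds (fun k => ?_) (fun k => A.floor_le k x)
  have := A.lt_floor k x
  dsimp only; linarith

lemma tendsto_U_floor (x t : ℝ) : Tendsto (fun k => A.u k ⌊x * A.N k⌋ t) 𝒱 (𝓝 (A.U x t)) :=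
  tendsto_ulim (Eventually.of_forall fun k => (A.wave k).mem _ _)

lemma tendsto_U {i : ℕ → ℤ} {s : ℕ → ℝ} {x t : ℝ}
    (hi : Tendsto (fun k => i k * A.h k) 𝒱 (𝓝 x)) (hs : Tendsto s 𝒱 (𝓝 t)) :
    Tendsto (fun k => A.u k (i k) (s k)) 𝒱 (𝓝 (A.U x t)) := by
  refine (A.tendsto_U_floor x t).congr_dist ?_
  have h1 : Tendsto (fun k => D.S * |⌊x * A.N k⌋ * A.h k - i k * A.h k|
      + D.Ct * (√|t - s k| + A.h k)) 𝒱 (𝓝 0) := by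
    have e1 := (((A.tendsto_floor x).sub hi).abs).const_mul D.S
    have e2 := (((Real.continuous_sqrt.tendsto _).comp
      ((tendsto_const_nhds (x := t)).sub hs).abs).add A.tendsto_h).const_mul D.Ct
    simpa using e1.add e2
  refine squeeze_zero (fun _ => dist_nonneg) (fun k => ?_) h1
  rw [dist_eq]
  calc |A.u k ⌊x * A.N k⌋ t - A.u k (i k) (s k)|
      ≤ |A.u k ⌊x * A.N k⌋ t - A.u k (i k) t| + |A.u k (i k) t - A.u k (i k) (s k)| :=
        abs_sub_le _ _ _
    _ ≤ _ := add_le_add ((A.wave k).lip_x _ _ _) ((A.wave k).holder _ _ _)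

lemma U_mem (x t : ℝ) : A.U x t ∈ Icc 0 D.M :=
  isClosed_Icc.mem_of_tendsto (A.tendsto_U_floor x t)
    (Eventually.of_forall fun k => (A.wave k).mem _ _)

lemma U_nonneg (x t : ℝ) : 0 ≤ A.U x t := (A.U_mem x t).1

lemma U_lip (x y t : ℝ) : |A.U x t - A.U y t| ≤ D.S * |x - y| :=
  le_of_tendsto_of_tendsto ((A.tendsto_U_floor x t).sub (A.tendsto_U_floor y t)).abs
    ((((A.tendsto_floor x).sub (A.tendsto_floor y)).abs).const_mul D.S)
    (Eventually.of_forall fun k => (A.wave k).lip_x _ _ _)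

lemma U_holder (x s t : ℝ) : |A.U x t - A.U x s| ≤ D.Ct * √|t - s| := by
  have h1 : Tendsto (fun k => D.Ct * (√|t - s| + A.h k)) 𝒱
      (𝓝 (D.Ct * √|t - s|)) := by
    simpa using (A.tendsto_h.const_add (√|t - s|)).const_mul D.Ct
  exact le_of_tendsto_of_tendsto ((A.tendsto_U_floor x t).sub (A.tendsto_U_floor x s)).abs h1
    (Eventually.of_forall fun k => (A.wave k).holder _ _ _)

lemma U_mono (x : ℝ) : Monotone (A.U x) := fun s t hst =>
  le_of_tendsto_of_tendsto' (A.tendsto_U_floor x s) (A.tendsto_U_floor x t)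
    fun k => (A.wave k).mono _ hst

lemma continuous_U : Continuous (fun q : ℝ × ℝ => A.U q.1 q.2) := by
  rw [continuous_iff_continuousAt]
  rintro ⟨x, t⟩
  have h1 : Tendsto (fun q : ℝ × ℝ => D.S * |q.1 - x| + D.Ct * √|q.2 - t|) (𝓝 (x, t))
      (𝓝 0) := by
    have : Continuous (fun q : ℝ × ℝ => D.S * |q.1 - x| + D.Ct * √|q.2 - t|) := by fun_prop
    simpa using this.tendsto (x, t)
  refine tendsto_iff_dist_tendsto_zero.2 (squeeze_zero (fun _ => dist_nonneg) (fun q => ?_) h1)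
  rw [dist_eq]
  calc |A.U q.1 q.2 - A.U x t| ≤ |A.U q.1 q.2 - A.U x q.2| + |A.U x q.2 - A.U x t| :=
        abs_sub_le _ _ _
    _ ≤ _ := add_le_add (A.U_lip _ _ _) (A.U_holder _ _ _)

lemma continuous_U_x (t : ℝ) : Continuous (fun x => A.U x t) :=
  A.continuous_U.comp (continuous_id.prodMk continuous_const)

lemma continuous_U_t (x : ℝ) : Continuous (A.U x) :=
  A.continuous_U.comp (continuous_const.prodMk continuous_id)

lemma T_mem (k : ℕ) : A.T k ∈ Icc 0 (2 / D.c) := ⟨(A.wave k).T_pos.le, (A.wave k).T_le⟩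

lemma tendsto_T : Tendsto A.T 𝒱 (𝓝 A.per) := tendsto_ulim (Eventually.of_forall A.T_mem)

lemma U_period (x t : ℝ) : A.U x (t + A.per) = A.U (x - 1) t := by
  refine tendsto_nhds_unique (A.tendsto_U (A.tendsto_floor x) (A.tendsto_T.const_add t))
    ((A.tendsto_U_floor (x - 1) t).congr fun k => ?_)
  rw [(A.wave k).period, sub_mul, one_mul, Int.floor_sub_intCast]

lemma U_norm : ∃ x ∈ Icc (0:ℝ) 1, A.U x 0 = D.ν := by
  choose i h0 h1 h2 using fun k => (A.wave k).norm
  have hI : ∀ k, i k * A.h k ∈ Icc (0:ℝ) 1 := fun k => by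
    have h3 : (0:ℝ) ≤ i k := by exact_mod_cast h0 k
    have h4 : (i k : ℝ) ≤ A.N k := by exact_mod_cast (h1 k).le
    have h5 := A.h_pos k
    refine ⟨by positivity, ?_⟩
    rw [← (A.wave k).N_mul]; gcongr
  have hl := tendsto_ulim (𝒰 := 𝒱) (Eventually.of_forall hI)
  refine ⟨_, isClosed_Icc.mem_of_tendsto hl (Eventually.of_forall hI), ?_⟩
  refine tendsto_nhds_unique (A.tendsto_U hl tendsto_const_nhds) ?_
  simp only [h2]
  exact tendsto_const_nhds

/-- Right of this point the wave vanishes at nonpositive times. -/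
def X₀ (_ : D.Approx) : ℝ := 1 + D.ν / (D.c / 16)

lemma U_zero_aux {n : ℤ} {x t : ℝ} (ht : ∀ᶠ k in (𝒱 : Filter ℕ), t ≤ n * A.T k)
    (hx : A.X₀ + n < x) : A.U x t = 0 := by
  have hc := D.c_pos
  have hν := D.ν_pos
  unfold X₀ at hx
  refine le_antisymm ?_ (A.U_nonneg x t)
  set q := D.c / 16 * (x - n - 1) - D.ν with hq
  have hq0 : 0 < q := by
    have : D.ν / (D.c / 16) < x - n - 1 := by linarith
    rw [div_lt_iff₀ (by positivity)] at this
    linarith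
  have hlim : Tendsto (fun k => D.ν * (A.σ k ^ 2 / (q / 2))) 𝒱 (𝓝 0) := by
    simpa using ((A.tendsto_σ.pow 2).div_const (q / 2)).const_mul D.ν
  refine le_of_tendsto_of_tendsto (A.tendsto_U_floor x t) hlim ?_
  have hz : ∀ᶠ k in (𝒱 : Filter ℕ), q / 2 < D.c / 16 * (⌊x * A.N k⌋ * A.h k - n - 1 - A.h k) - D.ν := by
    have : Tendsto (fun k => D.c / 16 * (⌊x * A.N k⌋ * A.h k - n - 1 - A.h k) - D.ν) 𝒱
        (𝓝 (D.c / 16 * (x - n - 1 - 0) - D.ν)) :=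
      (((((A.tendsto_floor x).sub_const _).sub_const _).sub A.tendsto_h).const_mul _).sub_const _
    rw [sub_zero] at this
    exact this.eventually_const_lt (by linarith)
  filter_upwards [ht, hz] with k hk1 hk2
  have hσ := (A.wave k).mesh.1
  have hpos : 0 ≤ ⌊x * A.N k⌋ * A.h k - n - 1 - A.h k := by
    by_contra! hcon
    have := mul_neg_of_pos_of_neg (show 0 < D.c / 16 by positivity) hcon
    linarith
  have h1 := (A.wave k).tail_time n hk1 (i := ⌊x * A.N k⌋) (by linarith)
  refine h1.trans ((bar_le hσ hν _).trans ?_)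
  gcongr
  calc exp ((D.ν - D.c / 16 * (⌊x * A.N k⌋ * A.h k - n - 1 - A.h k)) / A.σ k ^ 2)
      ≤ exp (-(q / 2 / A.σ k ^ 2)) := by
        rw [← neg_div]; gcongr; linarith
    _ ≤ A.σ k ^ 2 / (q / 2) := by
      rw [exp_neg, ← one_div, div_le_div_iff₀ (by positivity) (by positivity), one_mul]
      have := add_one_le_exp (q / 2 / A.σ k ^ 2)
      have h2 : q / 2 = A.σ k ^ 2 * (q / 2 / A.σ k ^ 2) := by field_simp
      calc q / 2 = A.σ k ^ 2 * (q / 2 / A.σ k ^ 2) := h2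
        _ ≤ _ := by gcongr; linarith

lemma T_pos : 0 < A.per := by
  have h0 : 0 ≤ A.per := (isClosed_Icc.mem_of_tendsto A.tendsto_T (Eventually.of_forall A.T_mem)).1
  refine h0.lt_of_ne fun h => ?_
  obtain ⟨x, hx, hU⟩ := A.U_norm
  have h1 : ∀ n : ℕ, A.U (x + n) 0 = D.ν := by
    intro n
    induction n with
    | zero => simpa using hU
    | succ n ih =>
      have := A.U_period (x + (n + 1 : ℕ)) 0
      grind
  obtain ⟨n, hn⟩ := exists_nat_gt A.X₀
  have h2 := A.U_zero_aux (n := 0) (x := x + n) (t := 0) (by simp) (by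
    push_cast; linarith [hx.1])
  rw [h1] at h2
  exact D.ν_pos.ne' h2

lemma U_period_int (n : ℤ) (x t : ℝ) : A.U x (t + n * A.per) = A.U (x - n) t := by
  have key : ∀ (n : ℕ) (x t : ℝ), A.U x (t + n * A.per) = A.U (x - n) t := by
    intro n
    induction n with
    | zero => simp
    | succ n ih =>
      intro x t
      rw [show t + ((n + 1 : ℕ) : ℝ) * A.per = t + n * A.per + A.per by push_cast; ring, A.U_period,
        ih]
      congr 1; push_cast; ring
  rcases Int.eq_nat_or_neg n with ⟨m, rfl | rfl⟩
  · exact_mod_cast key m x t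
  · have := key m (x + m) (t + (-(m:ℤ) : ℤ) * A.per)
    rw [add_sub_cancel_right] at this
    rw [← this]
    simp

lemma U_zero {n : ℤ} {x t : ℝ} (ht : t ≤ n * A.per) (hx : A.X₀ + n < x) : A.U x t = 0 := by
  refine le_antisymm ?_ (A.U_nonneg x t)
  refine (A.U_mono x ht).trans ?_
  have := A.U_period_int n x 0
  rw [zero_add] at this
  rw [this]
  exact (A.U_zero_aux (n := 0) (x := x - n) (t := 0) (by simp) (by push_cast; linarith)).le

lemma U_convex (t : ℝ) : ConvexOn ℝ univ (fun x => A.U x t + D.P / 2 * x ^ 2) := by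
  refine convexOn_of_slope_mono_adjacent convex_univ fun {x y z} _ _ hxy hyz => ?_
  rw [div_le_div_iff₀ (by linarith) (by linarith)]
  have hl : ∀ x : ℝ, Tendsto (fun k => A.u k ⌊x * A.N k⌋ t + D.P / 2 * (⌊x * A.N k⌋ * A.h k) ^ 2) 𝒱
      (𝓝 (A.U x t + D.P / 2 * x ^ 2)) := fun x =>
    (A.tendsto_U_floor x t).add (((A.tendsto_floor x).pow 2).const_mul _)
  refine le_of_tendsto_of_tendsto (((hl y).sub (hl x)).mul ((A.tendsto_floor z).sub (A.tendsto_floor y)))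
    (((hl z).sub (hl y)).mul ((A.tendsto_floor y).sub (A.tendsto_floor x)))
    (Eventually.of_forall fun k => ?_)
  have hN : (0:ℝ) ≤ A.N k := by exact_mod_cast (A.wave k).N_pos.le
  refine (A.wave k).chord ?_ ?_ t
  · exact Int.floor_mono (by gcongr)
  · exact Int.floor_mono (by gcongr)

end Approx
end WaveData

/-- A function with quadratically small increments is constant. -/
lemma eq_of_quadratic {E : ℝ → ℝ} {p q K : ℝ} (hpq : p ≤ q)
    (hE : ∀ x ∈ Icc p q, ∀ y ∈ Icc p q, x ≤ y → |E y - E x| ≤ K * (y - x) ^ 2) : E q = E p := by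
  have key : ∀ n : ℕ, 0 < n → |E q - E p| ≤ K * (q - p) ^ 2 / n := by
    intro n hn
    have hn' : (0:ℝ) < n := by exact_mod_cast hn
    set d := (q - p) / n with hd
    have hd0 : 0 ≤ d := div_nonneg (by linarith) hn'.le
    have hnd : n * d = q - p := by rw [hd]; field_simp
    have h1 : ∀ m : ℕ, m ≤ n → |E (p + m * d) - E p| ≤ m * (K * d ^ 2) := by
      intro m
      induction m with
      | zero => simp
      | succ m ih =>
        intro hm
        have hm' : ((m + 1 : ℕ) : ℝ) ≤ n := by exact_mod_cast hm
        have h2 : ((m + 1 : ℕ) : ℝ) * d ≤ n * d := by gcongr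
        have h0 : 0 ≤ (m:ℝ) * d := by positivity
        push_cast at h2
        have h3 := hE (p + m * d) ⟨by linarith, by linarith⟩ (p + (m + 1 : ℕ) * d)
          ⟨by push_cast; linarith, by push_cast; linarith⟩ (by push_cast; linarith)
        rw [show p + (m + 1 : ℕ) * d - (p + m * d) = d by push_cast; ring] at h3
        have h4 := abs_sub_le (E (p + (m + 1 : ℕ) * d)) (E (p + m * d)) (E p)
        have h5 := ih (by omega)
        push_cast at *
        linarith
    have h2 := h1 n le_rfl
    rw [hnd, add_sub_cancel] at h2
    refine h2.trans (le_of_eq ?_)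
    rw [hd]; field_simp
  have h0 : |E q - E p| ≤ 0 := by
    refine ge_of_tendsto (tendsto_const_div_atTop_nhds_zero_nat (K * (q - p) ^ 2)) ?_
    filter_upwards [eventually_gt_atTop 0] with n hn using key n hn
  linarith [abs_eq_zero.1 (le_antisymm h0 (abs_nonneg _))]

lemma integral_sub_const_quadratic {F : ℝ → ℝ} {K x y : ℝ} (hxy : x ≤ y)
    (hF : ContinuousOn F (Icc x y)) (hK : ∀ z ∈ Icc x y, |F z - F x| ≤ K * (y - x)) :
    |(∫ z in x..y, F z) - F x * (y - x)| ≤ K * (y - x) ^ 2 := by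
  have hi : IntervalIntegrable F volume x y := hF.intervalIntegrable_of_Icc hxy
  have e : (∫ z in x..y, F z) - F x * (y - x) = ∫ z in x..y, (F z - F x) := by
    rw [intervalIntegral.integral_sub hi (by simp)]
    simp [mul_comm]
  rw [e]
  have := intervalIntegral.norm_integral_le_of_norm_le_const (f := fun z => F z - F x) (a := x)
    (b := y) (C := K * (y - x)) (fun z hz => by
      rw [uIoc_of_le hxy] at hz
      exact hK z ⟨hz.1.le, hz.2⟩)
  rw [norm_eq_abs, abs_of_nonneg (sub_nonneg.2 hxy)] at this
  linarith [sq (y - x)]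

lemma sum_moment_lap (F : ℤ → ℝ) (j : ℤ) (n : ℕ) :
    ∑ i ∈ Finset.Ioc j (j + n), ((i:ℝ) - j) * (F (i + 1) - 2 * F i + F (i - 1))
      = F j - F (j + n) + n * (F (j + n + 1) - F (j + n)) := by
  induction n with
  | zero => simp
  | succ n ih =>
    have e : Finset.Ioc j (j + (n + 1 : ℕ)) = insert (j + (n + 1 : ℕ)) (Finset.Ioc j (j + n)) := by
      ext i; simp only [Finset.mem_insert, Finset.mem_Ioc]; push_cast; omega
    rw [e, Finset.sum_insert (by simp), ih]
    push_cast
    rw [show j + ((n:ℤ) + 1) - 1 = j + n by ring, show j + ((n:ℤ) + 1) = j + n + 1 by ring]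
    ring

namespace WaveData
variable {D : WaveData}
namespace Approx
variable (A : D.Approx)

lemma floor_mono (k : ℕ) {x y : ℝ} (hxy : x ≤ y) : ⌊x * A.N k⌋ ≤ ⌊y * A.N k⌋ := by
  have hN : (0:ℝ) ≤ A.N k := by exact_mod_cast (A.wave k).N_pos.le
  exact Int.floor_mono (by gcongr)

set_option maxHeartbeats 1000000 in
/-- Convergence of Riemann sums of equi-Lipschitz lattice functions. -/
lemma tendsto_riemann {a : ℕ → ℤ → ℝ} {F : ℝ → ℝ} {K C p q : ℝ} (hpq : p ≤ q) (hK : 0 ≤ K)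
    (hbd : ∀ k, ∀ i ∈ Icc ⌊p * A.N k⌋ ⌊q * A.N k⌋, |a k i| ≤ C)
    (hlip : ∀ k, ∀ i ∈ Icc ⌊p * A.N k⌋ ⌊q * A.N k⌋, ∀ j ∈ Icc ⌊p * A.N k⌋ ⌊q * A.N k⌋,
      |a k i - a k j| ≤ K * |i * A.h k - j * A.h k|)
    (hlim : ∀ x ∈ Icc p q, Tendsto (fun k => a k ⌊(x : ℝ) * A.N k⌋) 𝒱 (𝓝 (F x))) :
    Tendsto (fun k => ∑ i ∈ Finset.Ioc ⌊p * A.N k⌋ ⌊q * A.N k⌋, a k i * A.h k) 𝒱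
      (𝓝 (∫ x in p..q, F x)) := by
  have hfl : ∀ {x y : ℝ}, Tendsto (fun k => ⌊y * A.N k⌋ * A.h k - ⌊x * A.N k⌋ * A.h k) 𝒱 (𝓝 (y - x)) :=
    fun {x y} => (A.tendsto_floor y).sub (A.tendsto_floor x)
  have hmem : ∀ k, ∀ x ∈ Icc p q, ⌊x * A.N k⌋ ∈ Icc ⌊p * A.N k⌋ ⌊q * A.N k⌋ := fun k x hx =>
    ⟨A.floor_mono k hx.1, A.floor_mono k hx.2⟩
  have hFlip : ∀ x ∈ Icc p q, ∀ y ∈ Icc p q, |F x - F y| ≤ K * |x - y| := fun x hx y hy =>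
    le_of_tendsto_of_tendsto ((hlim x hx).sub (hlim y hy)).abs ((hfl.abs).const_mul K)
      (Eventually.of_forall fun k => hlip k _ (hmem k x hx) _ (hmem k y hy))
  have hFc : ContinuousOn F (Icc p q) := by
    have : LipschitzOnWith K.toNNReal F (Icc p q) := by
      refine LipschitzOnWith.of_dist_le_mul fun x hx y hy => ?_
      rw [Real.coe_toNNReal _ hK, dist_eq, dist_eq]
      exact hFlip x hx y hy
    exact this.continuousOn
  have hcard : ∀ k {i j : ℤ}, i ≤ j → ((Finset.Ioc i j).card : ℝ) * A.h k = j * A.h k - i * A.h k := by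
    intro k i j hij
    rw [Int.card_Ioc, ← sub_mul]
    congr 1
    have : (((j - i).toNat : ℤ) : ℝ) = ((j - i : ℤ) : ℝ) := by rw [Int.toNat_of_nonneg (by omega)]
    push_cast at this
    exact_mod_cast this
  have hsumbd : ∀ x ∈ Icc p q, ∀ k,
      (∑ i ∈ Finset.Ioc ⌊p * A.N k⌋ ⌊x * A.N k⌋, a k i * A.h k) ∈
        Icc (-(|C| * (q - p + 1))) (|C| * (q - p + 1)) := by
    intro x hx k
    have hh := A.h_pos k
    refine abs_le.1 ((Finset.abs_sum_le_sum_abs _ _).trans ?_)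
    calc ∑ i ∈ Finset.Ioc ⌊p * A.N k⌋ ⌊x * A.N k⌋, |a k i * A.h k|
        ≤ ∑ i ∈ Finset.Ioc ⌊p * A.N k⌋ ⌊x * A.N k⌋, |C| * A.h k := by
          refine Finset.sum_le_sum fun i hi => ?_
          rw [Finset.mem_Ioc] at hi
          rw [abs_mul, abs_of_pos hh]
          exact mul_le_mul_of_nonneg_right
            ((hbd k i ⟨hi.1.le, hi.2.trans (hmem k x hx).2⟩).trans (le_abs_self _)) hh.le
      _ = |C| * (⌊x * A.N k⌋ * A.h k - ⌊p * A.N k⌋ * A.h k) := by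
          rw [Finset.sum_const, nsmul_eq_mul, ← hcard k (hmem k x hx).1]; ring
      _ ≤ |C| * (q - p + 1) := by
          have h1 := A.floor_le k x
          have h2 := A.lt_floor k p
          have h3 := (A.wave k).mesh.2.2.2.1
          gcongr
          linarith [hx.2]
  set Sm : ℝ → ℝ := fun x => ulim 𝒱 fun k => ∑ i ∈ Finset.Ioc ⌊p * A.N k⌋ ⌊x * A.N k⌋, a k i * A.h k
    with hSm
  have hS : ∀ x ∈ Icc p q, Tendsto (fun k => ∑ i ∈ Finset.Ioc ⌊p * A.N k⌋ ⌊x * A.N k⌋, a k i * A.h k)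
      𝒱 (𝓝 (Sm x)) := fun x hx => tendsto_ulim (Eventually.of_forall (hsumbd x hx))
  have hSp : Sm p = 0 := by simp only [hSm, Finset.Ioc_self, Finset.sum_empty]; exact ulim_eq tendsto_const_nhds
  have hquad : ∀ x ∈ Icc p q, ∀ y ∈ Icc p q, x ≤ y →
      |Sm y - Sm x - F x * (y - x)| ≤ K * (y - x) ^ 2 := by
    intro x hx y hy hxy
    refine le_of_tendsto_of_tendsto ((((hS y hy).sub (hS x hx)).sub ((hlim x hx).mul hfl)).abs)
      ((hfl.pow 2).const_mul K) (Eventually.of_forall fun k => ?_)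
    have hh := A.h_pos k
    have hij := A.floor_mono k hxy
    have e1 : ∑ i ∈ Finset.Ioc ⌊p * A.N k⌋ ⌊y * A.N k⌋, a k i * A.h k =
        ∑ i ∈ Finset.Ioc ⌊p * A.N k⌋ ⌊x * A.N k⌋, a k i * A.h k +
        ∑ i ∈ Finset.Ioc ⌊x * A.N k⌋ ⌊y * A.N k⌋, a k i * A.h k := by
      rw [← Finset.sum_union]
      · rw [Finset.Ioc_union_Ioc_eq_Ioc (hmem k x hx).1 hij]
      · exact Finset.Ioc_disjoint_Ioc_of_le le_rfl
    dsimp only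
    rw [e1, add_sub_cancel_left, ← hcard k hij]
    have e2 : ∑ i ∈ Finset.Ioc ⌊x * A.N k⌋ ⌊y * A.N k⌋, a k i * A.h k -
        a k ⌊x * A.N k⌋ * (((Finset.Ioc ⌊x * A.N k⌋ ⌊y * A.N k⌋).card : ℝ) * A.h k) =
        ∑ i ∈ Finset.Ioc ⌊x * A.N k⌋ ⌊y * A.N k⌋, (a k i - a k ⌊x * A.N k⌋) * A.h k := by
      rw [← Finset.sum_mul, ← Finset.sum_mul, Finset.sum_sub_distrib, Finset.sum_const,
        nsmul_eq_mul]
      ring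
    rw [e2]
    refine (Finset.abs_sum_le_sum_abs _ _).trans ?_
    calc _ ≤ ∑ i ∈ Finset.Ioc ⌊x * A.N k⌋ ⌊y * A.N k⌋,
          K * (⌊y * A.N k⌋ * A.h k - ⌊x * A.N k⌋ * A.h k) * A.h k := by
          refine Finset.sum_le_sum fun i hi => ?_
          rw [Finset.mem_Ioc] at hi
          rw [abs_mul, abs_of_pos hh]
          gcongr
          refine (hlip k i ⟨(hmem k x hx).1.trans hi.1.le, hi.2.trans (hmem k y hy).2⟩ _
            (hmem k x hx)).trans ?_
          have h1 : (⌊x * A.N k⌋ : ℝ) ≤ i := by exact_mod_cast hi.1.le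
          have h2 : (i : ℝ) ≤ ⌊y * A.N k⌋ := by exact_mod_cast hi.2
          have h3 : (⌊x * A.N k⌋ : ℝ) * A.h k ≤ i * A.h k := by gcongr
          rw [abs_of_nonneg (by linarith)]
          gcongr
      _ = _ := by rw [Finset.sum_const, nsmul_eq_mul, ← hcard k hij]; ring
  have hE := eq_of_quadratic (E := fun x => Sm x - ∫ z in p..x, F z) (K := 2 * K) hpq (by
    intro x hx y hy hxy
    have h1 := hquad x hx y hy hxy
    have hsub : Icc x y ⊆ Icc p q := Icc_subset_Icc hx.1 hy.2
    have h2 := integral_sub_const_quadratic (K := K) hxy (hFc.mono hsub) (fun z hz => by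
      refine (hFlip z (hsub hz) x hx).trans ?_
      rw [abs_of_nonneg (by linarith [hz.1])]
      gcongr
      exact hz.2)
    have h3 : (∫ z in p..y, F z) - ∫ z in p..x, F z = ∫ z in x..y, F z := by
      rw [intervalIntegral.integral_interval_sub_left]
      · exact (hFc.mono (Icc_subset_Icc le_rfl hy.2)).intervalIntegrable_of_Icc hy.1
      · exact (hFc.mono (Icc_subset_Icc le_rfl hx.2)).intervalIntegrable_of_Icc hx.1
    have h4 := abs_le.1 h1
    have h5 := abs_le.1 h2
    rw [abs_le]
    constructor <;> linarith)
  simp only [intervalIntegral.integral_same, sub_zero, hSp] at hE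
  rw [show (∫ x in p..q, F x) = Sm q by linarith]
  exact hS q ⟨hpq, le_rfl⟩

/-- Convergence of first moments. -/
lemma tendsto_moment {w : ℕ → ℤ → ℝ} {F : ℝ → ℝ} {K C y R : ℝ} (hyR : y ≤ R) (hK : 0 ≤ K)
    (hbd : ∀ k i, |w k i| ≤ C)
    (hlip : ∀ k i j, |w k i - w k j| ≤ K * |i * A.h k - j * A.h k|)
    (hlim : ∀ x : ℝ, Tendsto (fun k => w k ⌊x * A.N k⌋) 𝒱 (𝓝 (F x))) :
    Tendsto (fun k => ∑ i ∈ Finset.Ioc ⌊y * A.N k⌋ ⌊R * A.N k⌋,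
      ((i:ℝ) - ⌊y * A.N k⌋) * A.h k * w k i * A.h k) 𝒱 (𝓝 (∫ x in y..R, (x - y) * F x)) := by
  have hC : 0 ≤ C := (abs_nonneg _).trans (hbd 0 0)
  have hwin : ∀ k, ∀ i ∈ Icc ⌊y * A.N k⌋ ⌊R * A.N k⌋,
      |((i:ℝ) - ⌊y * A.N k⌋) * A.h k| ≤ R - y + 1 := by
    intro k i hi
    have hh := A.h_pos k
    have h1 : (⌊y * A.N k⌋ : ℝ) ≤ i := by exact_mod_cast hi.1
    have h2 : (i : ℝ) * A.h k ≤ ⌊R * A.N k⌋ * A.h k := by gcongr; exact_mod_cast hi.2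
    have h3 := A.floor_le k R
    have h4 := A.lt_floor k y
    have h5 := (A.wave k).mesh.2.2.2.1
    rw [abs_of_nonneg (mul_nonneg (by linarith) hh.le)]
    linarith
  refine A.tendsto_riemann (K := (R - y + 1) * K + C) (C := (R - y + 1) * C) hyR ?_ ?_ ?_ ?_
  · positivity
  · intro k i hi
    rw [abs_mul]
    exact mul_le_mul (hwin k i hi) (hbd k i) (abs_nonneg _) (by linarith)
  · intro k i hi j hj
    have e : ((i:ℝ) - ⌊y * A.N k⌋) * A.h k * w k i - ((j:ℝ) - ⌊y * A.N k⌋) * A.h k * w k j =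
      ((i:ℝ) - ⌊y * A.N k⌋) * A.h k * (w k i - w k j) + (i * A.h k - j * A.h k) * w k j := by ring
    rw [e]
    refine (abs_add_le _ _).trans ?_
    rw [abs_mul (((i:ℝ) - ⌊y * A.N k⌋) * A.h k), abs_mul (i * A.h k - j * A.h k), add_mul]
    have h1 := mul_le_mul (hwin k i hi) (hlip k i j) (abs_nonneg _) (by linarith)
    have h2 := mul_le_mul_of_nonneg_left (hbd k j) (abs_nonneg (i * A.h k - j * A.h k))
    linarith
  · intro x hx
    have h1 := ((A.tendsto_floor x).sub (A.tendsto_floor y)).mul (hlim x)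
    exact h1.congr fun k => by ring

lemma tendsto_Phi {i : ℕ → ℤ} {s : ℕ → ℝ} {x t : ℝ}
    (hi : Tendsto (fun k => i k * A.h k) 𝒱 (𝓝 x)) (hs : Tendsto s 𝒱 (𝓝 t)) :
    Tendsto (fun k => Phi (A.σ k) (A.u k (i k) (s k))) 𝒱 (𝓝 (A.U x t ^ 2)) := by
  have h1 := A.tendsto_U hi hs
  have h2 := (h1.pow 2).add (((A.tendsto_σ.pow 2).const_mul 2).mul h1)
  simpa [Phi] using h2

lemma tendsto_G {i : ℕ → ℤ} {s : ℕ → ℝ} {x t : ℝ}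
    (hi : Tendsto (fun k => i k * A.h k) 𝒱 (𝓝 x)) (hs : Tendsto s 𝒱 (𝓝 t)) :
    Tendsto (fun k => D.G (A.σ k) (i k * A.h k) (A.u k (i k) (s k))) 𝒱 (𝓝 (D.g x (A.U x t))) := by
  have h1 := A.tendsto_U hi hs
  have h2 := (D.g_cont.tendsto (x, A.U x t)).comp (hi.prodMk_nhds h1)
  have h3 := h2.add (A.tendsto_σ.mul h1)
  simpa [G, Function.uncurry] using h3

lemma G_lip_lattice (k : ℕ) (t : ℝ) (i j : ℤ) :
    |D.G (A.σ k) (i * A.h k) (A.u k i t) - D.G (A.σ k) (j * A.h k) (A.u k j t)|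
      ≤ (D.L + (D.L + 1) * D.S) * |i * A.h k - j * A.h k| := by
  have W := A.wave k
  have hi := W.mem i t
  have hL := D.L_pos
  have h1 := G_lip W.mesh.1 W.mesh.2.1 (j * A.h k) (W.mem i t) (W.mem j t)
  have h2 := D.lipx (i * A.h k) (j * A.h k) (A.u k i t) ⟨by linarith [hi.1], by linarith [hi.2]⟩
  have h3 := W.lip_x i j t
  have h4 : (D.L + 1) * |A.u k i t - A.u k j t| ≤ (D.L + 1) * (D.S * |i * A.h k - j * A.h k|) := by
    gcongr
  have e : D.G (A.σ k) (i * A.h k) (A.u k i t) - D.G (A.σ k) (j * A.h k) (A.u k j t) =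
      (D.g (i * A.h k) (A.u k i t) - D.g (j * A.h k) (A.u k i t)) +
      (D.G (A.σ k) (j * A.h k) (A.u k i t) - D.G (A.σ k) (j * A.h k) (A.u k j t)) := by
    unfold G; ring
  grind

lemma tendsto_moment_G {y R : ℝ} (hyR : y ≤ R) (t : ℝ) :
    Tendsto (fun k => ∑ i ∈ Finset.Ioc ⌊y * A.N k⌋ ⌊R * A.N k⌋,
      ((i:ℝ) - ⌊y * A.N k⌋) * A.h k * D.G (A.σ k) (i * A.h k) (A.u k i t) * A.h k) 𝒱
      (𝓝 (∫ x in y..R, (x - y) * D.g x (A.U x t))) := by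
  have hL := D.L_pos
  have hS := D.S_pos
  refine A.tendsto_moment (w := fun k i => D.G (A.σ k) (i * A.h k) (A.u k i t))
    (F := fun x => D.g x (A.U x t)) hyR (K := D.L + (D.L + 1) * D.S) (C := (D.L + 1) * D.M)
    (by positivity) (fun k i => G_abs_le_Icc (A.wave k).mesh ((A.wave k).mem i t))
    (fun k i j => A.G_lip_lattice k t i j)
    (fun x => A.tendsto_G (A.tendsto_floor x) tendsto_const_nhds)

/-- The first moment of the lattice waves. -/
def mom (y R : ℝ) (k : ℕ) (r : ℝ) : ℝ := ∑ i ∈ Finset.Ioc ⌊y * A.N k⌋ ⌊R * A.N k⌋,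
  ((i:ℝ) - ⌊y * A.N k⌋) * A.h k * A.u k i r * A.h k

/-- The boundary term of the first moment identity. -/
def bdry (y R : ℝ) (k : ℕ) (r : ℝ) : ℝ := ((⌊R * A.N k⌋ : ℝ) - ⌊y * A.N k⌋) *
  (Phi (A.σ k) (A.u k (⌊R * A.N k⌋ + 1) r) - Phi (A.σ k) (A.u k ⌊R * A.N k⌋ r))

lemma hasDerivAt_mom {y R : ℝ} (hyR : y ≤ R) (k : ℕ) (r : ℝ) :
    HasDerivAt (A.mom y R k)
      (Phi (A.σ k) (A.u k ⌊y * A.N k⌋ r) - Phi (A.σ k) (A.u k ⌊R * A.N k⌋ r) + A.bdry y R k r +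
        ∑ i ∈ Finset.Ioc ⌊y * A.N k⌋ ⌊R * A.N k⌋,
          ((i:ℝ) - ⌊y * A.N k⌋) * A.h k * D.G (A.σ k) (i * A.h k) (A.u k i r) * A.h k) r := by
  have hh := (A.h_pos k).ne'
  have hjl := A.floor_mono k hyR
  obtain ⟨n, hn⟩ := Int.eq_ofNat_of_zero_le (sub_nonneg.2 hjl)
  have hl : ⌊R * A.N k⌋ = ⌊y * A.N k⌋ + n := by omega
  have h1 : HasDerivAt (A.mom y R k) (∑ i ∈ Finset.Ioc ⌊y * A.N k⌋ ⌊R * A.N k⌋,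
      ((i:ℝ) - ⌊y * A.N k⌋) * A.h k * (lap (A.h k) (fun j => Phi (A.σ k) (A.u k j r)) i +
        D.G (A.σ k) (i * A.h k) (A.u k i r)) * A.h k) r :=
    HasDerivAt.fun_sum fun i _ => ((((A.wave k).sol r i).2.const_mul _).mul_const _)
  refine h1.congr_deriv ?_
  have h2 := sum_moment_lap (fun i => Phi (A.σ k) (A.u k i r)) ⌊y * A.N k⌋ n
  unfold bdry
  rw [hl]
  push_cast
  rw [add_sub_cancel_left, ← h2, ← Finset.sum_add_distrib]
  refine Finset.sum_congr rfl fun i _ => ?_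
  unfold lap
  field_simp

lemma bdry_le {y R r s : ℝ} (hyR : y ≤ R) (k : ℕ) (hrs : r ≤ s) :
    |A.bdry y R k r| ≤ (R - y + 1) * (D.S * (A.u k (⌊R * A.N k⌋ + 1) s + A.u k ⌊R * A.N k⌋ s +
      2 * A.σ k ^ 2)) := by
  have W := A.wave k
  have hS := D.S_pos
  have h1 := W.mono (⌊R * A.N k⌋ + 1) hrs
  have h2 := W.mono ⌊R * A.N k⌋ hrs
  have h3 := W.step_le ⌊R * A.N k⌋ r
  have h4 := W.mem (⌊R * A.N k⌋ + 1) r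
  have h5 := W.mem ⌊R * A.N k⌋ r
  have h6 := A.floor_le k R
  have h7 := A.lt_floor k y
  have h8 := W.mesh.2.2.2.1
  have h9 : (⌊y * A.N k⌋ : ℝ) ≤ ⌊R * A.N k⌋ := by exact_mod_cast A.floor_mono k hyR
  have e : Phi (A.σ k) (A.u k (⌊R * A.N k⌋ + 1) r) - Phi (A.σ k) (A.u k ⌊R * A.N k⌋ r) =
      (A.u k (⌊R * A.N k⌋ + 1) r + A.u k ⌊R * A.N k⌋ r + 2 * A.σ k ^ 2) *
      (A.u k (⌊R * A.N k⌋ + 1) r - A.u k ⌊R * A.N k⌋ r) := by unfold Phi; ring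
  have h10 : 0 ≤ A.u k (⌊R * A.N k⌋ + 1) r + A.u k ⌊R * A.N k⌋ r + 2 * A.σ k ^ 2 := by
    have := h4.1; have := h5.1; positivity
  unfold bdry
  rw [e, abs_mul, abs_mul, abs_of_nonneg h10, abs_of_nonneg (by linarith)]
  calc _ ≤ ((⌊R * A.N k⌋ : ℝ) - ⌊y * A.N k⌋) * ((A.u k (⌊R * A.N k⌋ + 1) s + A.u k ⌊R * A.N k⌋ s +
      2 * A.σ k ^ 2) * (D.S * A.h k)) := by
        refine mul_le_mul_of_nonneg_left ?_ (by linarith)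
        refine mul_le_mul (by linarith) h3 (abs_nonneg _) (by linarith)
    _ = (⌊R * A.N k⌋ * A.h k - ⌊y * A.N k⌋ * A.h k) * (D.S * (A.u k (⌊R * A.N k⌋ + 1) s
        + A.u k ⌊R * A.N k⌋ s + 2 * A.σ k ^ 2)) := by ring
    _ ≤ _ := mul_le_mul_of_nonneg_right (by linarith) (mul_nonneg hS.le (by linarith))

lemma moment_G_sub_le {y R : ℝ} (hyR : y ≤ R) (k : ℕ) (r t : ℝ) :
    |(∑ i ∈ Finset.Ioc ⌊y * A.N k⌋ ⌊R * A.N k⌋,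
        ((i:ℝ) - ⌊y * A.N k⌋) * A.h k * D.G (A.σ k) (i * A.h k) (A.u k i r) * A.h k) -
      ∑ i ∈ Finset.Ioc ⌊y * A.N k⌋ ⌊R * A.N k⌋,
        ((i:ℝ) - ⌊y * A.N k⌋) * A.h k * D.G (A.σ k) (i * A.h k) (A.u k i t) * A.h k|
      ≤ (R - y + 1) ^ 2 * (D.L + 1) * (D.Ct * (√|r - t| + A.h k)) := by
  have W := A.wave k
  have hL := D.L_pos
  have hC := D.Ct_pos
  have hh := A.h_pos k
  have h6 := A.floor_le k R
  have h7 := A.lt_floor k y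
  have h8 := W.mesh.2.2.2.1
  have hjl := A.floor_mono k hyR
  rw [← Finset.sum_sub_distrib]
  refine (Finset.abs_sum_le_sum_abs _ _).trans ?_
  calc _ ≤ ∑ i ∈ Finset.Ioc ⌊y * A.N k⌋ ⌊R * A.N k⌋,
        (R - y + 1) * ((D.L + 1) * (D.Ct * (√|r - t| + A.h k))) * A.h k := by
        refine Finset.sum_le_sum fun i hi => ?_
        rw [Finset.mem_Ioc] at hi
        have h1 : (⌊y * A.N k⌋ : ℝ) ≤ i := by exact_mod_cast hi.1.le
        have h2 : (i : ℝ) * A.h k ≤ ⌊R * A.N k⌋ * A.h k := by gcongr; exact_mod_cast hi.2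
        rw [← sub_mul, ← mul_sub, abs_mul, abs_mul, abs_of_pos hh,
          abs_of_nonneg (mul_nonneg (by linarith) hh.le)]
        refine mul_le_mul_of_nonneg_right ?_ hh.le
        refine mul_le_mul (by linarith) ?_ (abs_nonneg _) (by linarith)
        refine (G_lip W.mesh.1 W.mesh.2.1 _ (W.mem i r) (W.mem i t)).trans ?_
        exact mul_le_mul_of_nonneg_left (W.holder i t r) (by linarith)
    _ = (⌊R * A.N k⌋ * A.h k - ⌊y * A.N k⌋ * A.h k) *
        ((R - y + 1) * ((D.L + 1) * (D.Ct * (√|r - t| + A.h k)))) := by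
        rw [Finset.sum_const, nsmul_eq_mul, Int.card_Ioc]
        have : (((⌊R * A.N k⌋ - ⌊y * A.N k⌋).toNat : ℤ) : ℝ) =
          ((⌊R * A.N k⌋ - ⌊y * A.N k⌋ : ℤ) : ℝ) := by rw [Int.toNat_of_nonneg (by omega)]
        push_cast at this
        rw [this]; ring
    _ ≤ (R - y + 1) *
        ((R - y + 1) * ((D.L + 1) * (D.Ct * (√|r - t| + A.h k)))) := by
        refine mul_le_mul_of_nonneg_right (by linarith) (by positivity)
    _ = _ := by ring

/-- The first moment to the right of `y` of the limiting wave. -/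
def mass (y R t : ℝ) : ℝ := ∫ x in y..R, (x - y) * A.U x t

lemma hasDerivAt_mass {y R t : ℝ} {n : ℤ} (hyR : y ≤ R) (ht : t < n * A.per)
    (hR : A.X₀ + n < R) :
    HasDerivAt (A.mass y R) (A.U y t ^ 2 + ∫ x in y..R, (x - y) * D.g x (A.U x t)) t := by
  have hL := D.L_pos
  have hS := D.S_pos
  have hM := D.M_pos
  have hC := D.Ct_pos
  set e : ℕ → ℝ := fun k => (R - y + 1) * (D.S * (A.u k (⌊R * A.N k⌋ + 1) (n * A.per) +
    A.u k ⌊R * A.N k⌋ (n * A.per) + 2 * A.σ k ^ 2)) with he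
  have hi1 : Tendsto (fun k => ((⌊R * A.N k⌋ + 1 : ℤ) : ℝ) * A.h k) 𝒱 (𝓝 R) := by
    have := (A.tendsto_floor R).add A.tendsto_h
    rw [add_zero] at this
    exact this.congr fun k => by push_cast; ring
  have he0 : Tendsto e 𝒱 (𝓝 0) := by
    have h1 := A.tendsto_U hi1 (tendsto_const_nhds (x := n * A.per))
    have h2 := A.tendsto_U (A.tendsto_floor R) (tendsto_const_nhds (x := n * A.per))
    rw [A.U_zero le_rfl hR] at h1 h2
    have h3 := (((h1.add h2).add ((A.tendsto_σ.pow 2).const_mul 2)).const_mul D.S).const_mul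
      (R - y + 1)
    simpa using h3
  refine hasDerivAt_of_tendsto (l := (𝒱 : Filter ℕ)) (f := A.mom y R) (α := t - 1)
    (β := n * A.per) ⟨by linarith, ht⟩
    (Eventually.of_forall fun k r _ => A.hasDerivAt_mom hyR k r)
    (fun r _ => A.tendsto_moment hyR (K := D.S) (C := D.M) hS.le (fun k i => ?_)
      (fun k i j => (A.wave k).lip_x i j r) (fun x => A.tendsto_U_floor x r)) ?_ ?_
  · have := (A.wave k).mem i r
    rw [abs_of_nonneg this.1]; exact this.2
  · have h1 := A.tendsto_Phi (A.tendsto_floor y) (tendsto_const_nhds (x := t))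
    have h2 := A.tendsto_Phi (A.tendsto_floor R) (tendsto_const_nhds (x := t))
    rw [A.U_zero ht.le hR] at h2
    have h3 : Tendsto (fun k => A.bdry y R k t) 𝒱 (𝓝 0) :=
      squeeze_zero_norm (fun k => A.bdry_le hyR k ht.le) he0
    have h4 := ((h1.sub h2).add h3).add (A.tendsto_moment_G hyR t)
    simpa using h4
  · intro ε hε
    set K := 2 * ((2 * D.M + 2) * D.Ct) + (R - y + 1) ^ 2 * (D.L + 1) * D.Ct with hK
    have hK0 : 0 < K := by positivity
    refine ⟨(ε / (2 * K)) ^ 2, by positivity, ?_⟩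
    have h5 : Tendsto (fun k => K * A.h k + 2 * e k) 𝒱 (𝓝 0) := by
      simpa using (A.tendsto_h.const_mul K).add (he0.const_mul 2)
    filter_upwards [h5.eventually_le_const (half_pos hε)] with k hk r hr hrt
    have W := A.wave k
    have hsq : √|r - t| ≤ ε / (2 * K) := by
      rw [Real.sqrt_le_left (by positivity)]; exact hrt.le
    have h6 : ∀ i, |Phi (A.σ k) (A.u k i r) - Phi (A.σ k) (A.u k i t)| ≤
        (2 * D.M + 2) * (D.Ct * (√|r - t| + A.h k)) := fun i =>
      (Phi_step W.mesh (W.mem i r) (W.mem i t)).trans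
        (mul_le_mul_of_nonneg_left (W.holder i t r) (by positivity))
    have h7 := abs_le.1 (h6 ⌊y * A.N k⌋)
    have h8 := abs_le.1 (h6 ⌊R * A.N k⌋)
    have h9 := abs_le.1 (A.bdry_le hyR k hr.2.le)
    have h10 := abs_le.1 (A.bdry_le hyR k ht.le)
    have h11 := abs_le.1 (A.moment_G_sub_le hyR k r t)
    have h12 : K * √|r - t| ≤ ε / 2 := by
      calc K * √|r - t| ≤ K * (ε / (2 * K)) := by gcongr
        _ = ε / 2 := by field_simp
    have h13 : K * (√|r - t| + A.h k) + 2 * e k ≤ ε := by linarith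
    simp only [he] at h13
    rw [abs_le]
    constructor <;> linarith

end Approx
end WaveData

lemma intervalIntegral_swap {F : ℝ → ℝ → ℝ} (hF : Continuous (Function.uncurry F)) {a b c d : ℝ}
    (hab : a ≤ b) (hcd : c ≤ d) :
    ∫ y in a..b, ∫ t in c..d, F y t = ∫ t in c..d, ∫ y in a..b, F y t := by
  simp only [intervalIntegral.integral_of_le hab, intervalIntegral.integral_of_le hcd]
  refine integral_integral_swap ?_
  rw [Measure.prod_restrict]
  exact (hF.continuousOn.integrableOn_compact (isCompact_Icc.prod isCompact_Icc)).mono_set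
    (prod_mono Ioc_subset_Icc_self Ioc_subset_Icc_self)

lemma continuous_integral_upper {a : ℝ} {F : ℝ × ℝ → ℝ → ℝ} (hF : Continuous (Function.uncurry F)) :
    Continuous (fun q : ℝ × ℝ => ∫ x in q.1..a, F q x) := by
  have := (intervalIntegral.continuous_parametric_intervalIntegral_of_continuous (μ := volume)
    (a₀ := a) hF (continuous_fst (X := ℝ) (Y := ℝ))).neg
  exact this.congr fun q => (intervalIntegral.integral_symm _ _).symm

/-- Two integrations by parts against the second primitive. -/
lemma integral_mul_eq_integral_moment {W ψ ψ₁ ψ₂ : ℝ → ℝ} {a b : ℝ} (hW : Continuous W)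
    (h1 : ∀ x, HasDerivAt ψ (ψ₁ x) x) (h2 : ∀ x, HasDerivAt ψ₁ (ψ₂ x) x) (hc : Continuous ψ₂)
    (ha : ψ a = 0) (ha1 : ψ₁ a = 0) :
    ∫ x in a..b, W x * ψ x = ∫ y in a..b, (∫ x in y..b, (x - y) * W x) * ψ₂ y := by
  have hxW : Continuous fun x => x * W x := continuous_id.mul hW
  have hV : ∀ y, HasDerivAt (fun y => ∫ x in y..b, W x) (-W y) y := fun y =>
    intervalIntegral.integral_hasDerivAt_left (hW.intervalIntegrable _ _)
      (hW.stronglyMeasurableAtFilter _ _) hW.continuousAt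
  have hX : ∀ y, HasDerivAt (fun y => ∫ x in y..b, x * W x) (-(y * W y)) y := fun y =>
    intervalIntegral.integral_hasDerivAt_left (hxW.intervalIntegrable _ _)
      (hxW.stronglyMeasurableAtFilter _ _) hxW.continuousAt
  have hNe : ∀ y, (∫ x in y..b, (x - y) * W x) =
      (∫ x in y..b, x * W x) - y * ∫ x in y..b, W x := fun y => by
    have hyW : Continuous fun x => y * W x := continuous_const.mul hW
    rw [← intervalIntegral.integral_const_mul, ← intervalIntegral.integral_sub
      (hxW.intervalIntegrable _ _) (hyW.intervalIntegrable _ _)]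
    exact intervalIntegral.integral_congr fun x _ => by ring
  have hN : ∀ y, HasDerivAt (fun y => ∫ x in y..b, (x - y) * W x) (-∫ x in y..b, W x) y := fun y => by
    have := (hX y).sub ((hasDerivAt_id y).mul (hV y))
    refine (this.congr_of_eventuallyEq (Eventually.of_forall hNe)).congr_deriv ?_
    simp
  have hψ : Continuous ψ := continuous_iff_continuousAt.2 fun x => (h1 x).continuousAt
  have hNc : Continuous (fun y => ∫ x in y..b, (x - y) * W x) :=
    continuous_iff_continuousAt.2 fun x => (hN x).continuousAt
  have key := intervalIntegral.integral_eq_sub_of_hasDerivAt (a := a) (b := b)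
    (f := fun y => (∫ x in y..b, (x - y) * W x) * ψ₁ y + (∫ x in y..b, W x) * ψ y)
    (f' := fun y => (∫ x in y..b, (x - y) * W x) * ψ₂ y - W y * ψ y)
    (fun y _ => (((hN y).mul (h2 y)).add ((hV y).mul (h1 y))).congr_deriv (by ring))
    (((hNc.mul hc).sub (hW.mul hψ)).intervalIntegrable _ _)
  have c1 : Continuous fun y => (∫ x in y..b, (x - y) * W x) * ψ₂ y := hNc.mul hc
  have c2 : Continuous fun y => W y * ψ y := hW.mul hψ
  rw [intervalIntegral.integral_sub (c1.intervalIntegrable _ _) (c2.intervalIntegrable _ _)] at key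
  simp only [intervalIntegral.integral_same, ha, ha1] at key
  linarith

/-- A directional derivative of a function of two variables. -/
def pd (v : ℝ × ℝ) (Φ : ℝ × ℝ → ℝ) (q : ℝ × ℝ) : ℝ := fderiv ℝ Φ q v

lemma pd_contDiff {Φ : ℝ × ℝ → ℝ} (h : ContDiff ℝ (⊤ : ℕ∞) Φ) (v : ℝ × ℝ) :
    ContDiff ℝ (⊤ : ℕ∞) (pd v Φ) :=
  (h.fderiv_right (m := (⊤ : ℕ∞)) (by norm_cast)).clm_apply contDiff_const

lemma pd_comm {Φ : ℝ × ℝ → ℝ} (h : ContDiff ℝ (⊤ : ℕ∞) Φ) (v w : ℝ × ℝ) :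
    pd v (pd w Φ) = pd w (pd v Φ) := by
  have h1 : ContDiff ℝ (⊤ : ℕ∞) (fderiv ℝ Φ) := h.fderiv_right (m := (⊤ : ℕ∞)) (by norm_cast)
  have key : ∀ v w q, pd v (pd w Φ) q = fderiv ℝ (fderiv ℝ Φ) q v w := by
    intro v w q
    have h2 := ((h1.differentiable (by norm_num)) q).hasFDerivAt.clm_apply (hasFDerivAt_const w q)
    unfold pd
    rw [h2.fderiv]
    simp
  funext q
  rw [key, key]
  exact ((h.contDiffAt (x := q)).isSymmSndFDerivAt (by
    rw [minSmoothness_of_isRCLikeNormedField]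
    exact WithTop.coe_le_coe.2 (le_top (a := (2 : ℕ∞))))) v w

lemma hasDerivAt_pd_fst {Φ : ℝ × ℝ → ℝ} (h : ContDiff ℝ (⊤ : ℕ∞) Φ) (x t : ℝ) :
    HasDerivAt (fun y => Φ (y, t)) (pd (1, 0) Φ (x, t)) x :=
  ((h.differentiable (by norm_num)) (x, t)).hasFDerivAt.comp_hasDerivAt x
    ((hasDerivAt_id x).prodMk (hasDerivAt_const x t))

lemma hasDerivAt_pd_snd {Φ : ℝ × ℝ → ℝ} (h : ContDiff ℝ (⊤ : ℕ∞) Φ) (x t : ℝ) :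
    HasDerivAt (fun s => Φ (x, s)) (pd (0, 1) Φ (x, t)) t :=
  ((h.differentiable (by norm_num)) (x, t)).hasFDerivAt.comp_hasDerivAt t
    ((hasDerivAt_const t x).prodMk (hasDerivAt_id t))

lemma pd_support {Φ : ℝ × ℝ → ℝ} {K : ℝ} (hK : ∀ q, K ≤ |q.1| → Φ q = 0) (v : ℝ × ℝ) :
    ∀ q : ℝ × ℝ, K + 1 ≤ |q.1| → pd v Φ q = 0 := by
  intro q hq
  have : Φ =ᶠ[𝓝 q] fun _ => 0 := by
    have : ∀ᶠ p : ℝ × ℝ in 𝓝 q, K < |p.1| :=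
      (continuous_fst.abs.continuousAt).eventually_const_lt (by linarith)
    filter_upwards [this] with p hp using hK p hp.le
  unfold pd
  rw [this.fderiv_eq]
  simp

namespace WaveData
variable {D : WaveData}
namespace Approx
variable (A : D.Approx)

lemma continuous_g_U : Continuous (fun q : ℝ × ℝ => D.g q.1 (A.U q.1 q.2)) :=
  D.g_cont.comp (continuous_fst.prodMk A.continuous_U)

set_option maxHeartbeats 1000000 in
lemma weak_identity {Φ : ℝ × ℝ → ℝ} (hΦ : ContDiff ℝ (⊤ : ℕ∞) Φ) {K : ℝ}
    (hK : ∀ q : ℝ × ℝ, K ≤ |q.1| → Φ q = 0) {R s t : ℝ} {n : ℤ} (hKR : K + 2 ≤ R) (hK0 : 0 ≤ K)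
    (hst : s ≤ t)
    (ht : t < n * A.per) (hR : A.X₀ + n < R) :
    (∫ x in -R..R, A.U x t * Φ (x, t)) - ∫ x in -R..R, A.U x s * Φ (x, s) =
      ∫ r in s..t, ∫ x in -R..R, (A.U x r ^ 2 * pd (1, 0) (pd (1, 0) Φ) (x, r) +
        D.g x (A.U x r) * Φ (x, r) + A.U x r * pd (0, 1) Φ (x, r)) := by
  have h1 := pd_contDiff hΦ (1, 0)
  have h11 := pd_contDiff h1 (1, 0)
  have hτ := pd_contDiff hΦ (0, 1)
  have h11τ := pd_contDiff h11 (0, 1)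
  have hRR : -R ≤ R := by linarith
  have slice : ∀ {W : ℝ → ℝ} {Ψ : ℝ × ℝ → ℝ} (_ : Continuous W) (_ : ContDiff ℝ (⊤ : ℕ∞) Ψ)
      (_ : ∀ q : ℝ × ℝ, K + 1 ≤ |q.1| → Ψ q = 0) (r : ℝ), ∫ x in -R..R, W x * Ψ (x, r) =
      ∫ y in -R..R, (∫ x in y..R, (x - y) * W x) * pd (1, 0) (pd (1, 0) Ψ) (y, r) := by
    intro W Ψ hW hΨ hΨK r
    have e1 := pd_contDiff hΨ (1, 0)
    refine integral_mul_eq_integral_moment hW (fun x => hasDerivAt_pd_fst hΨ x r)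
      (fun x => hasDerivAt_pd_fst e1 x r)
      ((pd_contDiff e1 (1, 0)).continuous.comp (continuous_id.prodMk continuous_const)) ?_ ?_
    · exact hΨK _ (by rw [abs_neg]; exact (by linarith : K + 1 ≤ R).trans (le_abs_self _))
    · exact pd_support hΨK _ _ (by rw [abs_neg]; exact (by linarith : K + 1 + 1 ≤ R).trans (le_abs_self _))
  have hgc : ∀ r, Continuous fun x => D.g x (A.U x r) := fun r =>
    A.continuous_g_U.comp (continuous_id.prodMk continuous_const)
  have hmc : Continuous fun q : ℝ × ℝ => A.mass q.1 R q.2 :=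
    continuous_integral_upper (((continuous_snd.sub continuous_fst.fst)).mul
      (A.continuous_U.comp (continuous_snd.prodMk continuous_fst.snd)))
  have hIc : Continuous fun q : ℝ × ℝ => ∫ x in q.1..R, (x - q.1) * D.g x (A.U x q.2) :=
    continuous_integral_upper (((continuous_snd.sub continuous_fst.fst)).mul
      (A.continuous_g_U.comp (continuous_snd.prodMk continuous_fst.snd)))
  set F' : ℝ → ℝ → ℝ := fun y r => (A.U y r ^ 2 + ∫ x in y..R, (x - y) * D.g x (A.U x r)) *
    pd (1, 0) (pd (1, 0) Φ) (y, r) + A.mass y R r * pd (0, 1) (pd (1, 0) (pd (1, 0) Φ)) (y, r)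
    with hF'
  have hF'c : Continuous (Function.uncurry F') :=
    (((A.continuous_U.pow 2).add hIc).mul h11.continuous).add (hmc.mul h11τ.continuous)
  have hFTC : ∀ y ∈ uIcc (-R) R, A.mass y R t * pd (1, 0) (pd (1, 0) Φ) (y, t) -
      A.mass y R s * pd (1, 0) (pd (1, 0) Φ) (y, s) = ∫ r in s..t, F' y r := by
    intro y hy
    rw [uIcc_of_le hRR] at hy
    refine (intervalIntegral.integral_eq_sub_of_hasDerivAt
      (f := fun r => A.mass y R r * pd (1, 0) (pd (1, 0) Φ) (y, r)) (fun r hr => ?_) ?_).symm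
    · rw [uIcc_of_le hst] at hr
      exact (A.hasDerivAt_mass hy.2 (hr.2.trans_lt ht) hR).mul (hasDerivAt_pd_snd h11 y r)
    · exact (hF'c.comp (continuous_const.prodMk continuous_id)).intervalIntegrable _ _
  have hKK : ∀ q : ℝ × ℝ, K + 1 ≤ |q.1| → Φ q = 0 := fun q hq => hK q (by linarith)
  have hc2 : ∀ r, Continuous fun y => pd (1, 0) (pd (1, 0) Φ) (y, r) := fun r =>
    h11.continuous.comp (continuous_id.prodMk continuous_const)
  have hm1 : ∀ r, Continuous fun y => A.mass y R r := fun r =>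
    hmc.comp (continuous_id.prodMk continuous_const)
  have hmc2 : ∀ r, Continuous fun y => A.mass y R r * pd (1, 0) (pd (1, 0) Φ) (y, r) := fun r =>
    (hm1 r).mul (hc2 r)
  have e1 := slice (A.continuous_U_x t) hΦ hKK t
  have e2 := slice (A.continuous_U_x s) hΦ hKK s
  change _ = ∫ y in -R..R, A.mass y R t * _ at e1
  change _ = ∫ y in -R..R, A.mass y R s * _ at e2
  rw [e1, e2, ← intervalIntegral.integral_sub ((hmc2 t).intervalIntegrable _ _)
      ((hmc2 s).intervalIntegrable _ _), intervalIntegral.integral_congr hFTC,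
    intervalIntegral_swap hF'c hRR hst]
  refine intervalIntegral.integral_congr fun r _ => ?_
  have hI1 : Continuous fun y => ∫ x in y..R, (x - y) * D.g x (A.U x r) :=
    hIc.comp (continuous_id.prodMk continuous_const)
  have hτc : ∀ r, Continuous fun y => pd (0, 1) (pd (1, 0) (pd (1, 0) Φ)) (y, r) := fun r =>
    h11τ.continuous.comp (continuous_id.prodMk continuous_const)
  have c1 : Continuous fun x => A.U x r ^ 2 * pd (1, 0) (pd (1, 0) Φ) (x, r) :=
    ((A.continuous_U_x r).pow 2).mul (hc2 r)
  have c2 : Continuous fun x => D.g x (A.U x r) * Φ (x, r) :=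
    (hgc r).mul (hΦ.continuous.comp (continuous_id.prodMk continuous_const))
  have c3 : Continuous fun x => A.U x r * pd (0, 1) Φ (x, r) :=
    (A.continuous_U_x r).mul (hτ.continuous.comp (continuous_id.prodMk continuous_const))
  have c4 : Continuous fun y => (∫ x in y..R, (x - y) * D.g x (A.U x r)) *
    pd (1, 0) (pd (1, 0) Φ) (y, r) := hI1.mul (hc2 r)
  have c5 : Continuous fun y => A.mass y R r * pd (0, 1) (pd (1, 0) (pd (1, 0) Φ)) (y, r) :=
    (hm1 r).mul (hτc r)
  have e3 := slice (hgc r) hΦ hKK r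
  have e4 := slice (A.continuous_U_x r) hτ (pd_support hK _) r
  rw [pd_comm hΦ (1, 0) (0, 1), pd_comm h1 (1, 0) (0, 1)] at e4
  change _ = ∫ y in -R..R, A.mass y R r * _ at e4
  have e5 : ∀ {a b c : ℝ → ℝ} (_ : Continuous a) (_ : Continuous b) (_ : Continuous c),
      ∫ y in -R..R, (a y + b y + c y) =
      (∫ y in -R..R, a y) + (∫ y in -R..R, b y) + ∫ y in -R..R, c y := fun {a b c} ha hb hc => by
    have hab : Continuous fun y => a y + b y := ha.add hb
    rw [intervalIntegral.integral_add (hab.intervalIntegrable _ _) (hc.intervalIntegrable _ _),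
      intervalIntegral.integral_add (ha.intervalIntegrable _ _) (hb.intervalIntegrable _ _)]
  have e6 := e5 c1 c4 c5
  rw [e5 c1 c2 c3, e3, e4, ← e6]
  refine intervalIntegral.integral_congr fun y _ => ?_
  simp only [hF', mass]
  ring

end Approx
end WaveData

lemma integral_eq_intervalIntegral {F : ℝ → ℝ} {R : ℝ} (hF : ∀ x, R ≤ |x| → F x = 0) :
    ∫ x, F x = ∫ x in -R..R, F x := by
  refine (intervalIntegral.integral_eq_integral_of_support_subset fun x hx => ?_).symm
  have : |x| < R := by
    by_contra! h
    exact hx (hF x h)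
  grind

namespace WaveData
variable {D : WaveData}
namespace Approx
variable (A : D.Approx)

set_option maxHeartbeats 1000000 in
lemma veryWeakSol {f : ℝ → ℝ → ℝ} {κ : ℝ → ℝ} (hg : ∀ x u, D.g x u = f x u * (κ x - u)) {a τ : ℝ}
    (haτ : a < τ) :
    VeryWeakSol 2 f κ (τ - a) (fun x => A.U x a) (fun x t => A.U x (t + a)) := by
  have hUs : Continuous fun q : ℝ × ℝ => A.U q.1 (q.2 + a) :=
    A.continuous_U.comp (continuous_fst.prodMk (continuous_snd.add continuous_const))
  refine ⟨hUs.continuousOn, ⟨D.M, fun x t _ => ?_⟩, fun φ hφ hcs => ?_⟩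
  · have := A.U_mem x (t + a)
    grind
  set Φ : ℝ × ℝ → ℝ := fun q => Function.uncurry φ (q.1, q.2 - a) with hΦd
  have hΦ : ContDiff ℝ (⊤ : ℕ∞) Φ := hφ.comp (contDiff_fst.prodMk (contDiff_snd.sub contDiff_const))
  obtain ⟨K, hK0, hK⟩ : ∃ K : ℝ, 0 ≤ K ∧ ∀ q : ℝ × ℝ, K ≤ |q.1| → Function.uncurry φ q = 0 := by
    obtain ⟨r, hr⟩ := hcs.isCompact.isBounded.subset_closedBall 0
    refine ⟨|r| + 1, by positivity, fun q hq => image_eq_zero_of_notMem_tsupport fun hm => ?_⟩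
    have h1 := hr hm
    rw [mem_closedBall_zero_iff] at h1
    have h2 := norm_fst_le q
    rw [norm_eq_abs] at h2
    linarith [le_abs_self r]
  have hKΦ : ∀ q : ℝ × ℝ, K ≤ |q.1| → Φ q = 0 := fun q hq => hK _ hq
  obtain ⟨n, hn⟩ := exists_nat_gt (τ / A.per)
  rw [div_lt_iff₀ A.T_pos] at hn
  set R := max (K + 2) (A.X₀ + n + 1)
  have hKR : K + 2 ≤ R := le_max_left _ _
  have key := A.weak_identity hΦ hKΦ hKR hK0 haτ.le (n := n) (by exact_mod_cast hn)
    (by push_cast; grind)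
  have h1 := pd_contDiff hΦ (1, 0)
  have h11 := pd_contDiff h1 (1, 0)
  have hτ := pd_contDiff hΦ (0, 1)
  have hz : ∀ x, R ≤ |x| → ∀ t, φ x t = 0 := fun x hx t =>
    hK (x, t) (by dsimp only; linarith)
  have hz1 : ∀ x, R ≤ |x| → ∀ t, pd (0, 1) Φ (x, t) = 0 := fun x hx t =>
    pd_support hKΦ _ (x, t) (by dsimp only; linarith)
  have hz2 : ∀ x, R ≤ |x| → ∀ t, pd (1, 0) (pd (1, 0) Φ) (x, t) = 0 := fun x hx t =>
    pd_support (pd_support hKΦ _) _ (x, t) (by dsimp only; linarith)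
  have ed : ∀ x t, deriv (fun s => φ x s) t = pd (0, 1) Φ (x, t + a) := fun x t => by
    have h2 := (hasDerivAt_pd_snd hΦ x (t + a)).comp_add_const t a
    refine (h2.congr_of_eventuallyEq (Eventually.of_forall fun s => ?_)).deriv
    simp [hΦd]
  have e1 : ∀ x t, deriv (fun y => φ y t) x = pd (1, 0) Φ (x, t + a) := fun x t => by
    refine ((hasDerivAt_pd_fst hΦ x (t + a)).congr_of_eventuallyEq
      (Eventually.of_forall fun s => ?_)).deriv
    simp [hΦd]
  have edd : ∀ x t, deriv (deriv (fun y => φ y t)) x = pd (1, 0) (pd (1, 0) Φ) (x, t + a) :=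
    fun x t => by
      rw [show deriv (fun y => φ y t) = fun y => pd (1, 0) Φ (y, t + a) from funext fun y => e1 y t]
      exact (hasDerivAt_pd_fst h1 x (t + a)).deriv
  have eφ : ∀ x t, φ x t = Φ (x, t + a) := fun x t => by simp [hΦd]
  have hτa : 0 ≤ τ - a := by linarith
  have cU : Continuous fun q : ℝ × ℝ => A.U q.2 q.1 := A.continuous_U.comp continuous_swap
  have cΦ : ∀ {Ψ : ℝ × ℝ → ℝ} (_ : ContDiff ℝ (⊤ : ℕ∞) Ψ), Continuous fun q : ℝ × ℝ => Ψ (q.2, q.1) :=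
    fun h => h.continuous.comp continuous_swap
  have c1 : Continuous (Function.uncurry fun r x => D.g x (A.U x r) * Φ (x, r)) :=
    (A.continuous_g_U.comp continuous_swap).mul (cΦ hΦ)
  have c2 : Continuous (Function.uncurry fun r x => A.U x r * pd (0, 1) Φ (x, r) +
      A.U x r ^ 2 * pd (1, 0) (pd (1, 0) Φ) (x, r)) :=
    (cU.mul (cΦ hτ)).add ((cU.pow 2).mul (cΦ h11))
  have I1 := intervalIntegral.continuous_parametric_intervalIntegral_of_continuous' (μ := volume)
    c1 (-R) R
  have I2 := intervalIntegral.continuous_parametric_intervalIntegral_of_continuous' (μ := volume)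
    c2 (-R) R
  have eτ : ∫ x, A.U x (τ - a + a) * φ x (τ - a) = ∫ x in -R..R, A.U x τ * Φ (x, τ) := by
    rw [integral_eq_intervalIntegral (R := R) fun x hx => by rw [hz x hx, mul_zero]]
    simp [hΦd]
  have e0 : ∫ x, A.U x a * φ x 0 = ∫ x in -R..R, A.U x a * Φ (x, a) := by
    rw [integral_eq_intervalIntegral (R := R) fun x hx => by rw [hz x hx, mul_zero]]
    simp [hΦd]
  have eA : ∫ t in Ioo (0:ℝ) (τ - a), ∫ x, f x (A.U x (t + a)) * (κ x - A.U x (t + a)) * φ x t =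
      ∫ r in a..τ, ∫ x in -R..R, D.g x (A.U x r) * Φ (x, r) := by
    rw [← integral_Ioc_eq_integral_Ioo, ← intervalIntegral.integral_of_le hτa]
    have := intervalIntegral.integral_comp_add_right (a := 0) (b := τ - a)
      (fun r => ∫ x in -R..R, D.g x (A.U x r) * Φ (x, r)) a
    rw [zero_add, sub_add_cancel] at this
    rw [← this]
    refine intervalIntegral.integral_congr fun t _ => ?_
    rw [integral_eq_intervalIntegral (R := R) fun x hx => by rw [hz x hx, mul_zero]]
    grind
  have eB : ∫ t in Ioo (0:ℝ) (τ - a), ∫ x, (A.U x (t + a) * deriv (fun s => φ x s) t +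
        A.U x (t + a) ^ (2:ℝ) * deriv (deriv (fun y => φ y t)) x) =
      ∫ r in a..τ, ∫ x in -R..R, (A.U x r * pd (0, 1) Φ (x, r) +
        A.U x r ^ 2 * pd (1, 0) (pd (1, 0) Φ) (x, r)) := by
    rw [← integral_Ioc_eq_integral_Ioo, ← intervalIntegral.integral_of_le hτa]
    have := intervalIntegral.integral_comp_add_right (a := 0) (b := τ - a)
      (fun r => ∫ x in -R..R, (A.U x r * pd (0, 1) Φ (x, r) +
        A.U x r ^ 2 * pd (1, 0) (pd (1, 0) Φ) (x, r))) a
    rw [zero_add, sub_add_cancel] at this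
    rw [← this]
    refine intervalIntegral.integral_congr fun t _ => ?_
    simp only [ed, edd, Real.rpow_two]
    rw [integral_eq_intervalIntegral (R := R) fun x hx => by rw [hz1 x hx, hz2 x hx]; simp]
  rw [eτ, e0, eA, eB, add_assoc, ← intervalIntegral.integral_add (I1.intervalIntegrable _ _)
    (I2.intervalIntegrable _ _), ← sub_eq_iff_eq_add', key]
  refine intervalIntegral.integral_congr fun r _ => ?_
  have cx : ∀ {Ψ : ℝ × ℝ → ℝ} (_ : ContDiff ℝ (⊤ : ℕ∞) Ψ), Continuous fun x => Ψ (x, r) :=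
    fun h => h.continuous.comp (continuous_id.prodMk continuous_const)
  have cg : Continuous fun x => D.g x (A.U x r) :=
    A.continuous_g_U.comp (continuous_id.prodMk continuous_const)
  have d1 : Continuous fun x => D.g x (A.U x r) * Φ (x, r) := cg.mul (cx hΦ)
  have d2 : Continuous fun x => A.U x r * pd (0, 1) Φ (x, r) +
      A.U x r ^ 2 * pd (1, 0) (pd (1, 0) Φ) (x, r) :=
    ((A.continuous_U_x r).mul (cx hτ)).add (((A.continuous_U_x r).pow 2).mul (cx h11))
  rw [← intervalIntegral.integral_add (d1.intervalIntegrable _ _) (d2.intervalIntegrable _ _)]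
  grind

end Approx
end WaveData

/-- Grönwall's inequality in differential form. -/
lemma antitoneOn_exp_mul {y y' : ℝ → ℝ} {a b L : ℝ} (hd : ∀ t ∈ Icc a b, HasDerivAt y (y' t) t)
    (hy : ∀ t ∈ Icc a b, y' t ≤ L * y t) :
    AntitoneOn (fun t => exp (-(L * t)) * y t) (Icc a b) := by
  have hd' : ∀ t ∈ Icc a b, HasDerivAt (fun t => exp (-(L * t)) * y t)
      (exp (-(L * t)) * (y' t - L * y t)) t := fun t ht => by
    have h1 := (((hasDerivAt_id t).const_mul L).neg.exp).mul (hd t ht)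
    refine h1.congr_deriv ?_
    simp only [id, Pi.neg_apply]
    ring
  refine antitoneOn_of_deriv_nonpos (convex_Icc a b)
    (fun t ht => (hd' t ht).continuousAt.continuousWithinAt)
    (fun t ht => (hd' t (interior_subset ht)).differentiableAt.differentiableWithinAt) fun t ht => ?_
  rw [(hd' t (interior_subset ht)).deriv]
  exact mul_nonpos_of_nonneg_of_nonpos (exp_pos _).le
    (by linarith [hy t (interior_subset ht)])

namespace WaveData
variable {D : WaveData}

lemma g_abs_le (x : ℝ) {u : ℝ} (hu : u ∈ Icc 0 D.M) : |D.g x u| ≤ D.L * u := by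
  have := D.lip_Icc x hu (v := 0) ⟨le_rfl, D.M_pos.le⟩
  simpa [D.g_zero, abs_of_nonneg hu.1] using this

namespace Approx
variable (A : D.Approx)

lemma continuous_moment {W : ℝ → ℝ} (hW : Continuous W) (y : ℝ) :
    Continuous fun x => (x - y) * W x := (continuous_id.sub continuous_const).mul hW

lemma continuous_g_U_x (t : ℝ) : Continuous fun x => D.g x (A.U x t) :=
  A.continuous_g_U.comp (continuous_id.prodMk continuous_const)

lemma moment_g_le {y R : ℝ} (hyR : y ≤ R) (t : ℝ) :
    |∫ x in y..R, (x - y) * D.g x (A.U x t)| ≤ D.L * A.mass y R t := by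
  unfold mass
  rw [← intervalIntegral.integral_const_mul]
  refine (intervalIntegral.abs_integral_le_integral_abs hyR).trans ?_
  refine intervalIntegral.integral_mono_on hyR
    ((continuous_moment (A.continuous_g_U_x t) y).abs.intervalIntegrable _ _)
    ((continuous_const.mul (continuous_moment (A.continuous_U_x t) y)).intervalIntegrable _ _)
    fun x hx => ?_
  rw [abs_mul, abs_of_nonneg (by linarith [hx.1])]
  have := mul_le_mul_of_nonneg_left (g_abs_le x (A.U_mem x t)) (by linarith [hx.1] : 0 ≤ x - y)
  linarith

/-- Every time lies below, and every position beyond, some multiple of the period. -/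
lemma exists_bounds (t y : ℝ) : ∃ (n : ℤ) (R : ℝ), t < n * A.per ∧ A.X₀ + n < R ∧ y < R := by
  obtain ⟨n, hn⟩ := exists_nat_gt (t / A.per)
  rw [div_lt_iff₀ A.T_pos] at hn
  refine ⟨n, max (A.X₀ + n) y + 1, by exact_mod_cast hn, ?_, ?_⟩
  · push_cast; grind
  grind

lemma U_zero_early (y : ℝ) : ∃ s₀, ∀ s ≤ s₀, ∀ x, y ≤ x → A.U x s = 0 := by
  obtain ⟨n, hn⟩ := exists_nat_gt (A.X₀ - y)
  refine ⟨(-(n:ℤ) : ℤ) * A.per, fun s hs x hx => A.U_zero hs ?_⟩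
  push_cast
  linarith

lemma integral_mul_U_eq_zero {z R t : ℝ} (hzR : z ≤ R) (h : ∀ x, z ≤ x → A.U x t = 0)
    (w : ℝ → ℝ) : ∫ x in z..R, w x * A.U x t = 0 := by
  rw [intervalIntegral.integral_congr (g := fun _ => 0), intervalIntegral.integral_zero]
  intro x hx
  rw [uIcc_of_le hzR] at hx
  simp only [h x hx.1, mul_zero]

lemma mass_eq_zero_early (y R : ℝ) (hyR : y ≤ R) : ∃ s₀, ∀ s ≤ s₀, A.mass y R s = 0 :=
  (A.U_zero_early y).imp fun _ h s hs => A.integral_mul_U_eq_zero hyR (h s hs) fun x => x - y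

lemma U_eq_zero_of_mass {y R t : ℝ} (hm : A.mass y R t ≤ 0) {x : ℝ} (hx : x ∈ Ioo y R) :
    A.U x t = 0 := by
  by_contra hne
  have hpos : 0 < A.U x t := (A.U_nonneg x t).lt_of_ne' hne
  have : 0 < A.mass y R t := by
    refine intervalIntegral.integral_pos (hx.1.trans hx.2)
      (continuous_moment (A.continuous_U_x t) y).continuousOn
      (fun z hz => mul_nonneg (by linarith [hz.1]) (A.U_nonneg z t))
      ⟨x, ⟨hx.1.le, hx.2.le⟩, mul_pos (by linarith [hx.1]) hpos⟩
  linarith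

/-- The positivity set is a half-line. -/
lemma U_zero_right {x₀ t₀ : ℝ} (h0 : A.U x₀ t₀ = 0) {x : ℝ} (hx : x₀ ≤ x) : A.U x t₀ = 0 := by
  rcases hx.eq_or_lt with rfl | hx
  · exact h0
  obtain ⟨n, R, hn, hR, hxR⟩ := A.exists_bounds t₀ x
  have hyR : x₀ ≤ R := by linarith
  obtain ⟨s₀, hs₀⟩ := A.mass_eq_zero_early x₀ R hyR
  set s := min s₀ t₀
  have hst : s ≤ t₀ := min_le_right _ _
  have hU0 : ∀ r ≤ t₀, A.U x₀ r = 0 := fun r hr =>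
    le_antisymm (h0 ▸ A.U_mono x₀ hr) (A.U_nonneg _ _)
  have key := antitoneOn_exp_mul (a := s) (b := t₀) (L := D.L) (y := A.mass x₀ R)
    (fun r hr => A.hasDerivAt_mass hyR (hr.2.trans_lt hn) hR) (fun r hr => by
      rw [hU0 r hr.2]
      have := (abs_le.1 (A.moment_g_le hyR r)).2
      simpa using this) ⟨le_rfl, hst⟩ ⟨hst, le_rfl⟩ hst
  dsimp only at key
  rw [hs₀ s (min_le_left _ _), mul_zero] at key
  have hm : A.mass x₀ R t₀ ≤ 0 := by
    by_contra! h
    linarith [mul_pos (exp_pos (-(D.L * t₀))) h]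
  exact A.U_eq_zero_of_mass hm ⟨hx, hxR⟩

lemma U_pos_of_le_zero {x : ℝ} (hx : x ≤ 0) : 0 < A.U x 0 := by
  obtain ⟨z, hz, hU⟩ := A.U_norm
  refine (A.U_nonneg x 0).lt_of_ne' fun h => ?_
  have := A.U_zero_right h (x := z) (by linarith [hz.1])
  linarith [D.ν_pos]

/-- The free boundary. -/
def B (t : ℝ) : ℝ := sInf {x | A.U x t = 0}

lemma zero_nonempty (t : ℝ) : {x | A.U x t = 0}.Nonempty := by
  obtain ⟨n, R, hn, hR, -⟩ := A.exists_bounds t 0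
  exact ⟨R, A.U_zero hn.le hR⟩

lemma zero_bddBelow (t : ℝ) : BddBelow {x | A.U x t = 0} := by
  obtain ⟨n, hn⟩ := exists_nat_gt (-t / A.per)
  rw [div_lt_iff₀ A.T_pos] at hn
  refine ⟨-n, fun x hx => ?_⟩
  by_contra! hxn
  have h1 := A.U_pos_of_le_zero (x := x + n) (by linarith)
  have h2 := A.U_period_int (-(n:ℤ)) x 0
  push_cast at h2
  rw [sub_neg_eq_add] at h2
  have h3 := A.U_mono x (by linarith : 0 + -(n:ℝ) * A.per ≤ t)
  grind

lemma U_eq_zero_iff {x t : ℝ} : A.U x t = 0 ↔ A.B t ≤ x := by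
  refine ⟨fun h => csInf_le (A.zero_bddBelow t) h, fun h => ?_⟩
  have hcl : IsClosed {x | A.U x t = 0} := isClosed_eq (A.continuous_U_x t) continuous_const
  exact A.U_zero_right (hcl.csInf_mem (A.zero_nonempty t) (A.zero_bddBelow t)) h

lemma U_pos_iff {x t : ℝ} : 0 < A.U x t ↔ x < A.B t := by
  rw [← not_le (a := A.B t), ← A.U_eq_zero_iff]
  exact ⟨fun h => h.ne', fun h => (A.U_nonneg x t).lt_of_ne' h⟩

lemma B_mono : Monotone A.B := fun s t hst => by
  by_contra! h
  have h1 := A.U_pos_iff.2 h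
  have h2 := A.U_mono (A.B t) hst
  rw [A.U_eq_zero_iff.2 le_rfl] at h2
  linarith

lemma B_period (t : ℝ) : A.B (t + A.per) = A.B t + 1 := by
  have : ∀ x, A.B (t + A.per) ≤ x ↔ A.B t + 1 ≤ x := fun x => by
    rw [← A.U_eq_zero_iff, A.U_period, A.U_eq_zero_iff, le_sub_iff_add_le]
  exact le_antisymm ((this _).2 le_rfl) ((this _).1 le_rfl)

end Approx
end WaveData

/-- The discrete Laplacian of the nonlinearity evaluated on a quadratic profile. -/
lemma lap_Phi_parabola {σ h a k b : ℝ} (hh : h ≠ 0) (i : ℤ) :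
    lap h (fun j : ℤ => Phi σ (a * (b - j * h) - k / 2 * (b - j * h) ^ 2 - σ ^ 2)) i =
      -(2 * k) * (a * (b - i * h) - k / 2 * (b - i * h) ^ 2 - σ ^ 2) - 2 * σ ^ 2 * k
        + 2 * (a - k * (b - i * h)) ^ 2 + k ^ 2 * h ^ 2 / 2 := by
  unfold lap Phi
  grind

/-- A parabola cut off at zero is a subsolution of the lattice equation. -/
lemma parabola_sub {σ h q k β L : ℝ} (hh : 0 < h) (hq : 0 < q) (hk : 0 < k) (hL : 0 ≤ L)
    (hqh : q * h ≤ σ ^ 2) (hkh : k * h ^ 2 ≤ σ ^ 2) (i : ℤ)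
    (hw : 0 < q * (β - i * h) - k / 2 * (β - i * h) ^ 2 - σ ^ 2) :
    -(4 * k + L) * (q * (β - i * h)) + q * (2 * q) - k * (β - i * h) * (2 * q)
      ≤ lap h (fun j : ℤ => Phi σ (max (q * (β - j * h) - k / 2 * (β - j * h) ^ 2 - σ ^ 2) 0)) i
        + -(L * (q * (β - i * h) - k / 2 * (β - i * h) ^ 2 - σ ^ 2)) := by
  have hζ0 : 0 ≤ β - i * h := by
    by_contra! hneg
    nlinarith [mul_pos hq (neg_pos.2 hneg), mul_nonneg hk.le (sq_nonneg (β - i * h)), sq_nonneg σ]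
  have hζ1 : k * (β - i * h) ≤ 2 * q := by
    by_contra! hgt
    nlinarith [mul_nonneg hζ0 (sub_nonneg.2 hgt.le), sq_nonneg σ]
  have hnb : ∀ z, -(2 * σ ^ 2) ≤ z → Phi σ z ≤ Phi σ (max z 0) := by
    intro z hz
    rcases le_total 0 z with h | h
    · rw [max_eq_left h]
    · rw [max_eq_right h]; unfold Phi; nlinarith
  have e1 : -(2 * σ ^ 2) ≤ q * (β - (i + 1 : ℤ) * h) - k / 2 * (β - (i + 1 : ℤ) * h) ^ 2 - σ ^ 2 := by
    have : q * (β - (i + 1 : ℤ) * h) - k / 2 * (β - (i + 1 : ℤ) * h) ^ 2 - σ ^ 2 =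
        (q * (β - i * h) - k / 2 * (β - i * h) ^ 2 - σ ^ 2) - q * h + k * (β - i * h) * h
          - k * h ^ 2 / 2 := by push_cast; ring
    have h2 : 0 ≤ k * (β - i * h) * h := by positivity
    rw [this]
    linarith [sq_nonneg σ]
  have e2 : -(2 * σ ^ 2) ≤ q * (β - (i - 1 : ℤ) * h) - k / 2 * (β - (i - 1 : ℤ) * h) ^ 2 - σ ^ 2 := by
    have : q * (β - (i - 1 : ℤ) * h) - k / 2 * (β - (i - 1 : ℤ) * h) ^ 2 - σ ^ 2 =
        (q * (β - i * h) - k / 2 * (β - i * h) ^ 2 - σ ^ 2) + (2 * q - k * (β - i * h)) * h - q * h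
          - k * h ^ 2 / 2 := by push_cast; ring
    have h2 : 0 ≤ (2 * q - k * (β - i * h)) * h := mul_nonneg (by linarith) hh.le
    rw [this]
    linarith [sq_nonneg σ]
  have hlap : lap h (fun j : ℤ => Phi σ (q * (β - j * h) - k / 2 * (β - j * h) ^ 2 - σ ^ 2)) i
      ≤ lap h (fun j : ℤ => Phi σ (max (q * (β - j * h) - k / 2 * (β - j * h) ^ 2 - σ ^ 2) 0)) i := by
    unfold lap
    dsimp only
    have := hnb _ e1
    have := hnb _ e2
    rw [max_eq_left hw.le]
    gcongr
  rw [lap_Phi_parabola hh.ne'] at hlap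
  set ζ := β - i * h
  have h1 : 0 ≤ k ^ 2 * h ^ 2 := by positivity
  have h2 : 0 ≤ k ^ 2 * ζ ^ 2 := by positivity
  have h3 : 0 ≤ L * k * ζ ^ 2 := by positivity
  have h4 : 0 ≤ L * σ ^ 2 := by positivity
  linarith

namespace WaveData
variable {D : WaveData}

namespace Approx
variable (A : D.Approx)

/-- The parabola barrier moves to the right at twice its slope. -/
lemma parabola_le {a k b s t : ℝ} (ha : 0 < a) (haS : a ≤ D.S) (hk : 2 * D.P ≤ k) (hst : s ≤ t)
    (h0 : ∀ x ∈ Icc (b - 2 * a / k) b, a * (b - x) - k / 2 * (b - x) ^ 2 < A.U x s) (x : ℝ) :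
    a * exp (-((4 * k + D.L) * (t - s)))
        * (b + 2 * a * (1 - exp (-((4 * k + D.L) * (t - s)))) / (4 * k + D.L) - x)
      - k / 2 * (b + 2 * a * (1 - exp (-((4 * k + D.L) * (t - s)))) / (4 * k + D.L) - x) ^ 2
      ≤ A.U x t := by
  have hP := D.P_pos
  have hL := D.L_pos
  have hM := D.M_pos
  have hk0 : 0 < k := by linarith
  set C := 4 * k + D.L with hC
  have hC0 : 0 < C := by positivity
  set E : ℝ → ℝ := fun r => exp (-(C * (r - s))) with hE
  have hES : ∀ r, HasDerivAt E (-C * E r) r := fun r => by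
    have := ((((hasDerivAt_id r).sub_const s).const_mul C).neg).exp
    refine this.congr_deriv ?_
    simp only [hE, id, Pi.neg_apply]; ring
  have hE0 : ∀ r, 0 < E r := fun r => exp_pos _
  have hE1 : ∀ r, s ≤ r → E r ≤ 1 := fun r hr =>
    exp_le_one_iff.2 (by have := mul_nonneg hC0.le (sub_nonneg.2 hr); linarith)
  set β : ℝ → ℝ := fun r => b + 2 * a * (1 - E r) / C with hβ
  have hβd : ∀ r, HasDerivAt β (2 * (a * E r)) r := fun r => by
    have := ((((hES r).const_sub 1).const_mul (2 * a)).div_const C).const_add b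
    refine this.congr_deriv ?_
    field_simp
  set w : ℕ → ℤ → ℝ → ℝ := fun n i r =>
    a * E r * (β r - i * A.h n) - k / 2 * (β r - i * A.h n) ^ 2 - A.σ n ^ 2 with hw
  have hwd : ∀ n i r, HasDerivAt (w n i) (a * (-C * E r) * (β r - i * A.h n)
      + a * E r * (2 * (a * E r)) - k * (β r - i * A.h n) * (2 * (a * E r))) r := fun n i r => by
    have h1 := (hβd r).sub_const (i * A.h n)
    have h2 := ((((hES r).const_mul a).mul h1).sub ((h1.fun_pow 2).const_mul (k / 2))).sub_const
      (A.σ n ^ 2)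
    refine h2.congr_deriv ?_
    push_cast
    ring
  have hwM : ∀ n i r, s ≤ r → w n i r ≤ D.M := fun n i r hr => by
    have hS2 : D.S ^ 2 = 4 * (D.M * D.P) := by
      unfold S; rw [mul_pow, sq_sqrt (by positivity)]; norm_num
    have h1 : a * E r ≤ D.S := by nlinarith [hE1 r hr, hE0 r]
    have h2 : (a * E r) ^ 2 ≤ D.S ^ 2 := pow_le_pow_left₀ (by positivity [hE0 r]) h1 2
    have h3 : (a * E r) ^ 2 ≤ 2 * k * D.M := by nlinarith
    simp only [hw]
    have h4 : 0 ≤ (a * E r - k * (β r - i * A.h n)) ^ 2 := sq_nonneg _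
    have h5 : 2 * k * (a * E r * (β r - i * A.h n) - k / 2 * (β r - i * A.h n) ^ 2)
        ≤ 2 * k * D.M := by nlinarith
    have h6 := le_of_mul_le_mul_left h5 (by positivity)
    linarith [sq_nonneg (A.σ n)]
  -- initial ordering
  have hinit : ∀ᶠ n in (𝒱 : Filter ℕ), ∀ i, max (w n i s) 0 ≤ A.u n i s := by
    by_contra hcon
    rw [← Ultrafilter.eventually_not] at hcon
    have hcon' : ∀ᶠ n in (𝒱 : Filter ℕ), ∃ i, A.u n i s < max (w n i s) 0 := by
      filter_upwards [hcon] with n hn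
      push Not at hn; exact hn
    have hch : ∀ n, ∃ i : ℤ, (∃ i, A.u n i s < max (w n i s) 0) → A.u n i s < max (w n i s) 0 :=
      fun n => by
        by_cases h : ∃ i, A.u n i s < max (w n i s) 0
        · exact h.imp fun i hi _ => hi
        · exact ⟨0, fun h' => absurd h' h⟩
    choose i hi using hch
    have hEs : E s = 1 := by simp [hE]
    have hβs : β s = b := by simp [hβ, hEs]
    have hws : ∀ n i, w n i s = a * (b - i * A.h n) - k / 2 * (b - i * A.h n) ^ 2 - A.σ n ^ 2 :=
      fun n i => by simp only [hw, hEs, hβs, mul_one]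
    have hlt : ∀ᶠ n in (𝒱 : Filter ℕ), A.u n (i n) s < w n (i n) s := by
      filter_upwards [hcon'] with n hn
      have h1 := hi n hn
      have h2 := ((A.wave n).mem (i n) s).1
      rcases lt_max_iff.1 h1 with h | h
      · exact h
      · linarith
    have hmem : ∀ᶠ n in (𝒱 : Filter ℕ), i n * A.h n ∈ Icc (b - 2 * a / k) b := by
      filter_upwards [hlt] with n hn
      rw [hws] at hn
      have h2 := ((A.wave n).mem (i n) s).1
      have h3 : 0 < (b - i n * A.h n) * (a - k / 2 * (b - i n * A.h n)) := by
        nlinarith [sq_nonneg (A.σ n)]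
      have h4 : 0 ≤ b - i n * A.h n := by
        by_contra! h
        nlinarith
      refine ⟨?_, by linarith⟩
      have h5 : 0 < a - k / 2 * (b - i n * A.h n) := pos_of_mul_pos_right h3 h4
      have : b - i n * A.h n ≤ 2 * a / k := by rw [le_div_iff₀ hk0]; linarith
      linarith
    have hx := tendsto_ulim hmem
    set z := ulim 𝒱 fun n => (i n : ℝ) * A.h n
    have hz : z ∈ Icc (b - 2 * a / k) b := isClosed_Icc.mem_of_tendsto hx hmem
    have h1 := A.tendsto_U hx (tendsto_const_nhds (x := s))
    have h2 : Tendsto (fun n => w n (i n) s) 𝒱 (𝓝 (a * (b - z) - k / 2 * (b - z) ^ 2 - 0 ^ 2)) := by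
      simp only [hws]
      exact (((hx.const_sub b).const_mul a).sub (((hx.const_sub b).pow 2).const_mul _)).sub
        (A.tendsto_σ.pow 2)
    have h3 := le_of_tendsto_of_tendsto h1 h2 (hlt.mono fun n hn => hn.le)
    linarith [h0 z hz]
  have hsmall : ∀ᶠ n in (𝒱 : Filter ℕ), k * A.σ n ^ 2 ≤ 1 := by
    have h1 : Tendsto (fun n => k * A.σ n ^ 2) 𝒱 (𝓝 (k * 0 ^ 2)) := (A.tendsto_σ.pow 2).const_mul k
    rw [zero_pow two_ne_zero, mul_zero] at h1
    exact h1.eventually_le_const one_pos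
  have hfin : ∀ᶠ n in (𝒱 : Filter ℕ), w n ⌊x * A.N n⌋ t ≤ A.u n ⌊x * A.N n⌋ t := by
    filter_upwards [hinit, hsmall] with n hn hkσ
    obtain ⟨m1, m2, m3, m4, m5⟩ := (A.wave n).mesh
    have hSh : D.S * A.h n ≤ A.σ n ^ 2 := by
      have hS2 : D.S ^ 2 = 4 * (D.M * D.P) := by
        unfold S; rw [mul_pow, sq_sqrt (by positivity)]; norm_num
      refine abs_le_of_sq_le_sq' ?_ (by positivity) |>.2
      rw [mul_pow, hS2]
      nlinarith
    have hkh : k * A.h n ^ 2 ≤ A.σ n ^ 2 := by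
      have h1 : 1 ≤ 8 * D.M * D.P := by nlinarith [D.one_le_M, D.one_le_P]
      have h2 : A.h n ^ 2 ≤ A.σ n ^ 4 := by nlinarith [sq_nonneg (A.h n)]
      have h3 : k * A.h n ^ 2 ≤ k * A.σ n ^ 4 := mul_le_mul_of_nonneg_left h2 hk0.le
      nlinarith [sq_nonneg (A.σ n)]
    refine (le_max_left _ _).trans (compare_sub (v := fun i r => max (w n i r) 0) (a := s) (b := t)
      m1 m2 (fun r _ => (A.wave n).sol r) (fun r hr i => ⟨le_max_right _ _, max_le ?_ hM.le⟩)
      (fun i r hr => ?_) hn (fun r hr i hlt => ?_) _ t ⟨hst, le_rfl⟩)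
    · exact hwM n i r hr.1
    · exact ContinuousAt.continuousWithinAt (Tendsto.max (hwd n i r).continuousAt tendsto_const_nhds)
    · have hu0 := ((A.wave n).mem i r).1
      have hwpos : 0 < w n i r := by
        rcases lt_max_iff.1 hlt with h | h
        · linarith
        · linarith
      have hev : (fun r => max (w n i r) 0) =ᶠ[𝓝 r] w n i := by
        filter_upwards [(hwd n i r).continuousAt.eventually (eventually_gt_nhds hwpos)] with q hq
        exact max_eq_left hq.le
      refine ⟨_, ((hwd n i r).congr_of_eventuallyEq hev).hasDerivWithinAt, ?_⟩
      have hG : -(D.L * w n i r) ≤ D.G (A.σ n) (i * A.h n) (w n i r) := by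
        have := (abs_le.1 (D.g_abs_le (i * A.h n) ⟨hwpos.le, hwM n i r hr.1⟩)).1
        have := mul_pos m1 hwpos
        unfold G
        linarith
      have hqS : a * E r ≤ D.S :=
        (mul_le_of_le_one_right ha.le (hE1 r hr.1)).trans haS
      have key := parabola_sub (β := β r) (L := D.L) m3 (mul_pos ha (hE0 r)) hk0 hL.le
        ((mul_le_mul_of_nonneg_right hqS m3.le).trans hSh) hkh i hwpos
      rw [max_eq_left hwpos.le]
      refine (le_of_eq ?_).trans (key.trans (add_le_add_right hG _))
      rw [hC]; ring
  have hlim : Tendsto (fun n => w n ⌊x * A.N n⌋ t) 𝒱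
      (𝓝 (a * E t * (β t - x) - k / 2 * (β t - x) ^ 2 - 0 ^ 2)) :=
    ((((A.tendsto_floor x).const_sub (β t)).const_mul _).sub
      ((((A.tendsto_floor x).const_sub (β t)).pow 2).const_mul _)).sub (A.tendsto_σ.pow 2)
  have := le_of_tendsto_of_tendsto hlim (A.tendsto_U_floor x t) hfin
  simpa using this

/-- The slope of the wave at the free boundary. -/
def α (t : ℝ) : ℝ := -derivWithin (fun x => A.U x t) (Iic (A.B t)) (A.B t)

lemma U_B (t : ℝ) : A.U (A.B t) t = 0 := A.U_eq_zero_iff.2 le_rfl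

lemma hasDerivWithinAt_U_B (t : ℝ) :
    HasDerivWithinAt (fun x => A.U x t) (-A.α t) (Iic (A.B t)) (A.B t) := by
  have h1 := (A.U_convex t).hasDerivWithinAt_leftDeriv_of_mem_interior (x := A.B t) (by simp)
  have h2 := h1.sub ((((hasDerivAt_id (A.B t)).pow 2).const_mul (D.P / 2)).hasDerivWithinAt
    (s := Iio (A.B t)))
  have h3 : DifferentiableWithinAt ℝ (fun x => A.U x t) (Iic (A.B t)) (A.B t) := by
    have := h2.Iic_of_Iio.differentiableWithinAt
    refine this.congr (fun x _ => ?_) ?_ <;> simp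
  rw [α, neg_neg]
  exact h3.hasDerivWithinAt

lemma tendsto_quot (t : ℝ) :
    Tendsto (fun ζ => A.U (A.B t - ζ) t / ζ) (𝓝[>] 0) (𝓝 (A.α t)) := by
  have h1 := hasDerivWithinAt_iff_tendsto_slope.1 (A.hasDerivWithinAt_U_B t)
  rw [Iic_sdiff_right] at h1
  have h2 : Tendsto (fun ζ : ℝ => A.B t - ζ) (𝓝[>] 0) (𝓝[<] (A.B t)) := by
    refine tendsto_nhdsWithin_iff.2 ⟨?_, ?_⟩
    · have : Tendsto (fun ζ : ℝ => A.B t - ζ) (𝓝 0) (𝓝 (A.B t - 0)) := tendsto_id.const_sub _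
      rw [sub_zero] at this
      exact this.mono_left nhdsWithin_le_nhds
    · filter_upwards [self_mem_nhdsWithin] with ζ hζ
      grind
  have h3 := (h1.comp h2).neg
  rw [neg_neg] at h3
  refine h3.congr fun ζ => ?_
  simp only [Function.comp, slope_def_field, A.U_B]
  grind

lemma U_ge (t : ℝ) {ζ : ℝ} (hζ : 0 ≤ ζ) : A.α t * ζ - D.P / 2 * ζ ^ 2 ≤ A.U (A.B t - ζ) t := by
  rcases hζ.eq_or_lt with rfl | hζ
  · simp [A.U_B]
  refine le_of_tendsto (((A.tendsto_quot t).mul_const ζ).sub_const _) ?_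
  filter_upwards [Ioo_mem_nhdsGT hζ] with r hr
  have := (A.U_convex t).2 (mem_univ (A.B t - ζ)) (mem_univ (A.B t))
    (div_nonneg hr.1.le hζ.le) (sub_nonneg.2 ((div_le_one hζ).2 hr.2.le))
    (add_sub_cancel (r / ζ) 1)
  simp only [smul_eq_mul, A.U_B] at this
  have e : r / ζ * (A.B t - ζ) + (1 - r / ζ) * A.B t = A.B t - r := by field_simp; ring
  rw [e] at this
  have hr0 : 0 < r := hr.1
  have h2 : A.U (A.B t - r) t ≤ r / ζ * A.U (A.B t - ζ) t + D.P / 2 * (ζ * r) := by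
    have e2 : r / ζ * (D.P / 2 * (A.B t - ζ) ^ 2) + (1 - r / ζ) * (D.P / 2 * A.B t ^ 2)
        - D.P / 2 * (A.B t - r) ^ 2 = D.P / 2 * (ζ * r) - D.P / 2 * r ^ 2 := by
      field_simp; ring
    nlinarith [D.P_pos, sq_nonneg r]
  have h3 : A.U (A.B t - r) t / r * ζ ≤ A.U (A.B t - ζ) t + D.P / 2 * ζ ^ 2 := by
    rw [div_mul_eq_mul_div, div_le_iff₀ hr0]
    have := mul_le_mul_of_nonneg_right h2 hζ.le
    have e3 : (r / ζ * A.U (A.B t - ζ) t + D.P / 2 * (ζ * r)) * ζ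
      = (A.U (A.B t - ζ) t + D.P / 2 * ζ ^ 2) * r := by field_simp
    linarith
  linarith

lemma α_nonneg (t : ℝ) : 0 ≤ A.α t :=
  ge_of_tendsto (A.tendsto_quot t) (by
    filter_upwards [self_mem_nhdsWithin] with ζ hζ
    exact div_nonneg (A.U_nonneg _ _) (le_of_lt hζ))

lemma U_le_S (t : ℝ) {ζ : ℝ} (hζ : 0 ≤ ζ) : A.U (A.B t - ζ) t ≤ D.S * ζ := by
  have := (abs_le.1 (A.U_lip (A.B t - ζ) (A.B t) t)).2
  rw [A.U_B, sub_sub_cancel_left, abs_neg, abs_of_nonneg hζ] at this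
  linarith

lemma α_le (t : ℝ) : A.α t ≤ D.S :=
  le_of_tendsto (A.tendsto_quot t) (by
    filter_upwards [self_mem_nhdsWithin] with ζ hζ
    exact (div_le_iff₀ hζ).2 (A.U_le_S t (le_of_lt hζ)))

/-- The rate at which slopes may decay. -/
def _root_.WaveData.C (D : WaveData) : ℝ := 8 * D.P + D.L

lemma _root_.WaveData.C_pos (D : WaveData) : 0 < D.C := by
  have := D.P_pos; have := D.L_pos; unfold WaveData.C; positivity

/-- The free boundary advances at least as fast as Darcy's law predicts. -/
lemma B_ge {s t : ℝ} (hst : s ≤ t) :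
    A.B s + 2 * A.α s * (1 - exp (-(D.C * (t - s)))) / D.C ≤ A.B t := by
  have hP := D.P_pos
  have hC' : 4 * (2 * D.P) + D.L = D.C := by unfold WaveData.C; ring
  rcases (A.α_nonneg s).eq_or_lt with h0 | hα
  · rw [← h0]; simpa using A.B_mono hst
  have key : ∀ a, 0 < a → a < A.α s →
      A.B s + 2 * a * (1 - exp (-(D.C * (t - s)))) / D.C ≤ A.B t := by
    intro a ha0 ha
    have key2 : ∀ᶠ δ in 𝓝[>] (0:ℝ),
        A.B s - δ + 2 * a * (1 - exp (-(D.C * (t - s)))) / D.C ≤ A.B t := by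
      have hδ : 0 < min ((A.α s - a) / D.P) (A.α s / D.P) :=
        lt_min (div_pos (by linarith) hP) (div_pos hα hP)
      filter_upwards [Ioo_mem_nhdsGT hδ] with δ hδ
      have hδ0 : 0 < δ := hδ.1
      have h1 : δ * D.P < A.α s - a := (lt_div_iff₀ hP).1 (hδ.2.trans_le (min_le_left _ _))
      have h2 : δ * D.P < A.α s := (lt_div_iff₀ hP).1 (hδ.2.trans_le (min_le_right _ _))
      have hpar := A.parabola_le (a := a) (k := 2 * D.P) (b := A.B s - δ) ha0
        (ha.le.trans (A.α_le s)) le_rfl hst (fun x hx => by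
          have hζ : 0 ≤ A.B s - δ - x := by linarith [hx.2]
          have h3 := A.U_ge s (ζ := A.B s - x) (by linarith)
          rw [sub_sub_cancel] at h3
          have e : A.B s - x = (A.B s - δ - x) + δ := by ring
          rw [e] at h3
          set ζ := A.B s - δ - x
          nlinarith [mul_nonneg hζ (sub_nonneg.2 h1.le), mul_pos hδ0 (sub_pos.2 h2), sq_nonneg ζ])
      rw [hC'] at hpar
      set E := exp (-(D.C * (t - s)))
      have hE : 0 < E := exp_pos _
      set b' := A.B s - δ + 2 * a * (1 - E) / D.C
      refine le_of_forall_pos_sub_le fun ε hε => ?_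
      set ρ := min ε (a * E / (2 * D.P))
      have hρ : 0 < ρ := lt_min hε (by positivity)
      have hρ2 : ρ * (2 * D.P) ≤ a * E := (le_div_iff₀ (by positivity)).1 (min_le_right _ _)
      have h4 := hpar (b' - ρ)
      rw [sub_sub_cancel] at h4
      have h5 : 0 < A.U (b' - ρ) t := by
        refine lt_of_lt_of_le ?_ h4
        nlinarith [mul_pos hρ (mul_pos ha0 hE)]
      have := A.U_pos_iff.1 h5
      linarith [min_le_left ε (a * E / (2 * D.P))]
    refine le_of_tendsto ?_ key2
    have : Tendsto (fun δ : ℝ => A.B s - δ + 2 * a * (1 - exp (-(D.C * (t - s)))) / D.C)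
        (𝓝 0) (𝓝 (A.B s - 0 + 2 * a * (1 - exp (-(D.C * (t - s)))) / D.C)) :=
      (tendsto_id.const_sub _).add_const _
    rw [sub_zero] at this
    exact this.mono_left nhdsWithin_le_nhds
  have hlim : Tendsto (fun a : ℝ => A.B s + 2 * a * (1 - exp (-(D.C * (t - s)))) / D.C)
      (𝓝[<] (A.α s)) (𝓝 (A.B s + 2 * A.α s * (1 - exp (-(D.C * (t - s)))) / D.C)) := by
    refine Tendsto.mono_left ?_ nhdsWithin_le_nhds
    exact (((tendsto_id.const_mul 2).mul_const _).div_const _).const_add _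
  refine le_of_tendsto hlim ?_
  filter_upwards [Ioo_mem_nhdsLT hα] with a ha
  exact key a ha.1 ha.2

end Approx
end WaveData

/-- The first moment of `w` over `[y, R]` relative to `y`. -/
def moment (w : ℝ → ℝ) (R y : ℝ) : ℝ := ∫ x in y..R, (x - y) * w x

theorem hasDerivAt_integral_left {w : ℝ → ℝ} (hw : Continuous w) (R y : ℝ) :
    HasDerivAt (fun y => ∫ x in y..R, w x) (-w y) y :=
  intervalIntegral.integral_hasDerivAt_left (hw.intervalIntegrable _ _)
    (hw.stronglyMeasurableAtFilter _ _) hw.continuousAt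

theorem hasDerivAt_moment {w : ℝ → ℝ} (hw : Continuous w) (R y : ℝ) :
    HasDerivAt (moment w R) (-∫ x in y..R, w x) y := by
  have hc : Continuous fun x => x * w x := continuous_id.mul hw
  have h2 := (hasDerivAt_integral_left hc R y).sub
    ((hasDerivAt_id y).mul (hasDerivAt_integral_left hw R y))
  have e : moment w R = fun y => (∫ x in y..R, x * w x) - y * ∫ x in y..R, w x := by
    funext y
    have hc2 : Continuous fun x => y * w x := continuous_const.mul hw
    rw [moment, ← intervalIntegral.integral_const_mul, ← intervalIntegral.integral_sub
      (hc.intervalIntegrable _ _) (hc2.intervalIntegrable _ _)]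
    grind
  rw [e]
  refine h2.congr_deriv ?_
  simp only [id]
  ring

namespace WaveData
variable {D : WaveData}
namespace Approx
variable (A : D.Approx)

/-- Beyond the free boundary at an earlier time the mass is controlled by the density. -/
lemma mass_le_sq {s t y R : ℝ} {n : ℤ} (hst : s ≤ t) (hn : t < n * A.per) (hR : A.X₀ + n < R)
    (hyR : y ≤ R) (hy : A.B s ≤ y) :
    A.mass y R t ≤ A.U y t ^ 2 * ((exp (D.L * (t - s)) - 1) / D.L) := by
  have hL := D.L_pos
  have h0 : A.mass y R s = 0 :=
    A.integral_mul_U_eq_zero hyR (fun _ hx => A.U_eq_zero_iff.2 (hy.trans hx)) _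
  have key := antitoneOn_exp_mul (a := s) (b := t) (L := D.L)
    (y := fun r => A.mass y R r + A.U y t ^ 2 / D.L)
    (fun r hr => (A.hasDerivAt_mass hyR (hr.2.trans_lt hn) hR).add_const _) (fun r hr => by
      have h1 := (abs_le.1 (A.moment_g_le hyR r)).2
      have h2 : A.U y r ^ 2 ≤ A.U y t ^ 2 := pow_le_pow_left₀ (A.U_nonneg _ _) (A.U_mono y hr.2) 2
      have h3 : D.L * (A.U y t ^ 2 / D.L) = A.U y t ^ 2 := by field_simp
      rw [mul_add, h3]
      linarith) ⟨le_rfl, hst⟩ ⟨hst, le_rfl⟩ hst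
  dsimp only at key
  rw [h0, zero_add, exp_neg, exp_neg, inv_mul_le_iff₀ (exp_pos _)] at key
  have e : exp (D.L * t) * ((exp (D.L * s))⁻¹ * (A.U y t ^ 2 / D.L)) =
      exp (D.L * (t - s)) * (A.U y t ^ 2 / D.L) := by
    rw [mul_sub, exp_sub]; field_simp
  grind

lemma B_modulus {s t : ℝ} (hst : s < t) :
    (A.B t - A.B s) ^ 2 ≤ 12 * A.U (A.B s) t * ((exp (D.L * (t - s)) - 1) / D.L) := by
  have hL := D.L_pos
  set K := (exp (D.L * (t - s)) - 1) / D.L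
  have hK0 : 0 < K := by
    have : 1 < exp (D.L * (t - s)) := one_lt_exp_iff.2 (mul_pos hL (by linarith))
    exact div_pos (by linarith) hL
  rcases (A.B_mono hst.le).eq_or_lt with h | hlt
  · rw [h, sub_self, zero_pow two_ne_zero]
    exact mul_nonneg (mul_nonneg (by norm_num) (A.U_nonneg _ _)) hK0.le
  obtain ⟨n, R, hn, hR, hBR⟩ := A.exists_bounds t (A.B t)
  set J : ℝ → ℝ := fun y => ∫ x in y..R, A.U x t
  set Z : ℝ → ℝ := fun y => √(A.mass y R t)
  set k := √K with hk
  have hk0 : 0 < k := Real.sqrt_pos.2 hK0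
  have hJ0 : ∀ y ∈ Icc (A.B s) (A.B t), 0 ≤ J y := fun y hy =>
    intervalIntegral.integral_nonneg (by linarith [hy.2]) fun x _ => A.U_nonneg x t
  have hpos : ∀ y ∈ Ioo (A.B s) (A.B t), 0 < A.mass y R t := fun y hy => by
    by_contra! h
    have := A.U_eq_zero_of_mass h (x := (y + A.B t) / 2) ⟨by linarith [hy.2], by linarith [hy.2]⟩
    linarith [A.U_eq_zero_iff.1 this, hy.2]
  have hZU : ∀ y ∈ Icc (A.B s) (A.B t), Z y ≤ k * A.U y t := fun y hy => by
    have := A.mass_le_sq hst.le hn hR (by linarith [hy.2]) hy.1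
    rw [← Real.sqrt_sq (A.U_nonneg y t), hk, ← Real.sqrt_mul hK0.le]
    exact Real.sqrt_le_sqrt (by linarith)
  have hJB : J (A.B t) = 0 := by
    simpa using A.integral_mul_U_eq_zero hBR.le (fun _ => A.U_eq_zero_iff.2) fun _ => 1
  have hZB : Z (A.B t) = 0 :=
    Real.sqrt_eq_zero'.2 (A.integral_mul_U_eq_zero hBR.le (fun _ => A.U_eq_zero_iff.2) _).le
  have hZc : Continuous Z := Real.continuous_sqrt.comp
    (continuous_iff_continuousAt.2 fun y => (hasDerivAt_moment (A.continuous_U_x t) R y).continuousAt)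
  have hJc : Continuous J := continuous_iff_continuousAt.2 fun y =>
    (hasDerivAt_integral_left (A.continuous_U_x t) R y).continuousAt
  have hZd : ∀ y ∈ Ioo (A.B s) (A.B t), HasDerivAt Z (-J y / (2 * Z y)) y := fun y hy =>
    (hasDerivAt_moment (A.continuous_U_x t) R y).sqrt (hpos y hy).ne'
  have hZ0 : ∀ y ∈ Ioo (A.B s) (A.B t), 0 < Z y := fun y hy => Real.sqrt_pos.2 (hpos y hy)
  -- energy inequality
  have hE : ∀ y ∈ Icc (A.B s) (A.B t), 4 / (3 * k) * Z y ^ 3 ≤ J y ^ 2 := by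
    have hd : ∀ y ∈ Ioo (A.B s) (A.B t), HasDerivAt (fun y => J y ^ 2 - 4 / (3 * k) * Z y ^ 3)
        (2 * J y * (Z y / k - A.U y t)) y := fun y hy => by
      have h1 := ((hasDerivAt_integral_left (A.continuous_U_x t) R y).fun_pow 2).sub
        (((hZd y hy).fun_pow 3).const_mul (4 / (3 * k)))
      refine h1.congr_deriv ?_
      have := (hZ0 y hy).ne'
      field_simp
      push_cast
      ring
    have hanti : AntitoneOn (fun y => J y ^ 2 - 4 / (3 * k) * Z y ^ 3) (Icc (A.B s) (A.B t)) := by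
      refine antitoneOn_of_deriv_nonpos (convex_Icc _ _)
        ((hJc.pow 2).sub (continuous_const.mul (hZc.pow 3))).continuousOn ?_ ?_
      · rw [interior_Icc]
        exact fun y hy => (hd y hy).differentiableAt.differentiableWithinAt
      · rw [interior_Icc]
        intro y hy
        rw [(hd y hy).deriv]
        have h1 := hZU y (Ioo_subset_Icc_self hy)
        have h2 : Z y / k ≤ A.U y t := by rw [div_le_iff₀ hk0]; linarith
        exact mul_nonpos_of_nonneg_of_nonpos
          (mul_nonneg two_pos.le (hJ0 y (Ioo_subset_Icc_self hy))) (by linarith)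
    intro y hy
    have := hanti hy ⟨hlt.le, le_rfl⟩ hy.2
    dsimp only at this
    rw [hJB, hZB] at this
    linarith
  set c := √(4 / (3 * k))
  have hc2 : c ^ 2 = 4 / (3 * k) := sq_sqrt (by positivity)
  have hanti : AntitoneOn (fun y => √(Z y) + c / 4 * y) (Icc (A.B s) (A.B t)) := by
    have hd : ∀ y ∈ Ioo (A.B s) (A.B t), HasDerivAt (fun y => √(Z y) + c / 4 * y)
        (-J y / (2 * Z y) / (2 * √(Z y)) + c / 4 * 1) y := fun y hy =>
      ((hZd y hy).sqrt (hZ0 y hy).ne').add ((hasDerivAt_id y).const_mul (c / 4))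
    refine antitoneOn_of_deriv_nonpos (convex_Icc _ _)
      ((Real.continuous_sqrt.comp hZc).add (continuous_const.mul continuous_id)).continuousOn ?_ ?_
    · rw [interior_Icc]
      exact fun y hy => (hd y hy).differentiableAt.differentiableWithinAt
    · rw [interior_Icc]
      intro y hy
      rw [(hd y hy).deriv]
      have hz := hZ0 y hy
      have hw2 : √(Z y) ^ 2 = Z y := sq_sqrt hz.le
      have h1 : c * (Z y * √(Z y)) ≤ J y := by
        refine abs_le_of_sq_le_sq' ?_ (hJ0 y (Ioo_subset_Icc_self hy)) |>.2
        have := hE y (Ioo_subset_Icc_self hy)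
        calc (c * (Z y * √(Z y))) ^ 2 = c ^ 2 * (Z y ^ 2 * √(Z y) ^ 2) := by ring
          _ = 4 / (3 * k) * Z y ^ 3 := by rw [hw2, hc2]; ring
          _ ≤ _ := this
      have h2 : -J y / (2 * Z y) / (2 * √(Z y)) = -(J y / (Z y * √(Z y))) / 4 := by
        field_simp; ring
      have h3 : c ≤ J y / (Z y * √(Z y)) := (le_div_iff₀ (by positivity)).2 h1
      rw [h2]
      linarith
  have h1 := hanti ⟨le_rfl, hlt.le⟩ ⟨hlt.le, le_rfl⟩ hlt.le
  dsimp only at h1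
  rw [hZB, Real.sqrt_zero, zero_add] at h1
  have h2 : c / 4 * (A.B t - A.B s) ≤ √(Z (A.B s)) := by linarith
  have h3 := pow_le_pow_left₀ (mul_nonneg (by positivity) (by linarith)) h2 2
  rw [sq_sqrt (Real.sqrt_nonneg _), mul_pow, div_pow, hc2] at h3
  have h4 := hZU (A.B s) ⟨le_rfl, hlt.le⟩
  have h6 : 4 / (3 * k) / 4 ^ 2 * (A.B t - A.B s) ^ 2 ≤ k * A.U (A.B s) t := by linarith
  have h7 : 4 / (3 * k) / 4 ^ 2 * (A.B t - A.B s) ^ 2 = (A.B t - A.B s) ^ 2 / (12 * k) := by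
    field_simp; norm_num
  rw [h7, div_le_iff₀ (by positivity)] at h6
  have h8 : k * k = K := Real.mul_self_sqrt hK0.le
  calc _ ≤ _ := h6
    _ = 12 * A.U (A.B s) t * (k * k) := by ring
    _ = _ := by rw [h8]

lemma continuous_B : Continuous A.B := by
  have hL := D.L_pos
  have hb : ∀ s t, |A.B t - A.B s| ≤
      √(12 * D.M * ((exp (D.L * |t - s|) - 1) / D.L)) := by
    have hb' : ∀ s t, s < t → (A.B t - A.B s) ^ 2 ≤
        12 * D.M * ((exp (D.L * |t - s|) - 1) / D.L) := fun s t h => by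
      have h1 : 1 < exp (D.L * (t - s)) := one_lt_exp_iff.2 (mul_pos hL (by linarith))
      rw [abs_of_pos (sub_pos.2 h)]
      refine (A.B_modulus h).trans (mul_le_mul_of_nonneg_right ?_ (div_nonneg (by linarith) hL.le))
      linarith [(A.U_mem (A.B s) t).2]
    intro s t
    rcases lt_trichotomy s t with h | rfl | h
    · exact Real.abs_le_sqrt (hb' s t h)
    · simp
    · rw [abs_sub_comm, abs_sub_comm t]
      exact Real.abs_le_sqrt (hb' t s h)
  refine continuous_iff_continuousAt.2 fun s => ?_
  rw [ContinuousAt, tendsto_iff_dist_tendsto_zero]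
  refine squeeze_zero (fun _ => dist_nonneg) (fun t => hb s t) ?_
  have : Continuous fun t => √(12 * D.M * ((exp (D.L * |t - s|) - 1) / D.L)) := by
    fun_prop
  simpa using this.tendsto s

end Approx
end WaveData

lemma integral_sub_left (y z : ℝ) : ∫ x in y..z, (x - y) = (z - y) ^ 2 / 2 := by
  rw [intervalIntegral.integral_sub (by simp) (by simp), integral_id,
    intervalIntegral.integral_const, smul_eq_mul]
  ring

namespace WaveData
variable {D : WaveData}
namespace Approx
variable (A : D.Approx)

lemma integrable_mass (y t : ℝ) {a b : ℝ} :
    IntervalIntegrable (fun x => (x - y) * A.U x t) volume a b :=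
  (continuous_moment (A.continuous_U_x t) y).intervalIntegrable _ _

lemma mass_add {y z R t : ℝ} :
    A.mass y R t = (∫ x in y..z, (x - y) * A.U x t) + ∫ x in z..R, (x - y) * A.U x t :=
  (intervalIntegral.integral_add_adjacent_intervals (A.integrable_mass y t)
    (A.integrable_mass y t)).symm

/-- Upper bound for the mass ahead of `y` by a linear profile. -/
lemma mass_le_linear {y R t c : ℝ} (hy : y ≤ A.B t) (hR : A.B t ≤ R)
    (hc : ∀ ζ ∈ Ioc 0 (A.B t - y), A.U (A.B t - ζ) t ≤ c * ζ) :
    A.mass y R t ≤ c * (A.B t - y) ^ 3 / 6 := by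
  rw [A.mass_add (z := A.B t)]
  have h2 : ∫ x in A.B t..R, (x - y) * A.U x t = 0 :=
    A.integral_mul_U_eq_zero hR (fun _ => A.U_eq_zero_iff.2) _
  have hcc : Continuous fun x : ℝ => (x - y) * (c * (A.B t - x)) := by fun_prop
  have h1 : ∫ x in y..A.B t, (x - y) * A.U x t ≤ ∫ x in y..A.B t, (x - y) * (c * (A.B t - x)) := by
    refine intervalIntegral.integral_mono_on hy (A.integrable_mass y t)
      (hcc.intervalIntegrable _ _) fun x hx => ?_
    refine mul_le_mul_of_nonneg_left ?_ (by linarith [hx.1])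
    rcases hx.2.eq_or_lt with h | h
    · rw [h, A.U_B, sub_self, mul_zero]
    · have := hc (A.B t - x) ⟨by linarith, by linarith [hx.1]⟩
      rwa [sub_sub_cancel] at this
  have h3 : ∫ x in y..A.B t, (x - y) * (c * (A.B t - x)) = c * (A.B t - y) ^ 3 / 6 := by
    have hd : ∀ x ∈ uIcc y (A.B t), HasDerivAt
        (fun x => c * ((A.B t - y) * (x - y) ^ 2 / 2 - (x - y) ^ 3 / 3))
        ((x - y) * (c * (A.B t - x))) x := fun x _ => by
      have h4 := (hasDerivAt_id x).sub_const y
      refine ((((h4.pow 2).const_mul (A.B t - y)).div_const 2).sub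
        ((h4.pow 3).div_const 3)).const_mul c |>.congr_deriv ?_
      grind
    rw [intervalIntegral.integral_eq_sub_of_hasDerivAt hd (hcc.intervalIntegrable _ _)]
    ring
  linarith

lemma mass_le_cube {y R t : ℝ} (hy : y ≤ A.B t) (hR : A.B t ≤ R) :
    A.mass y R t ≤ D.S * (A.B t - y) ^ 3 := by
  have := mul_nonneg D.S_pos.le (pow_nonneg (sub_nonneg.2 hy) 3)
  linarith [A.mass_le_linear hy hR fun ζ hζ => A.U_le_S t hζ.1.le]

lemma mass_mono {y R : ℝ} (hyR : y ≤ R) : Monotone (A.mass y R) := fun s t hst =>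
  intervalIntegral.integral_mono_on hyR (A.integrable_mass y s)
    (A.integrable_mass y t) fun x hx =>
      mul_le_mul_of_nonneg_left (A.U_mono x hst) (by linarith [hx.1])

lemma le_mass_sub {y z R s t c : ℝ} (hst : s ≤ t) (hyz : y ≤ z) (hzR : z ≤ R)
    (hc : ∀ x ∈ Icc y z, c ≤ A.U x t - A.U x s) :
    c * ((z - y) ^ 2 / 2) ≤ A.mass y R t - A.mass y R s := by
  rw [A.mass_add (z := z), A.mass_add (z := z) (t := s)]
  have h1 : ∫ x in z..R, (x - y) * A.U x s ≤ ∫ x in z..R, (x - y) * A.U x t :=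
    intervalIntegral.integral_mono_on hzR (A.integrable_mass y s)
      (A.integrable_mass y t) fun x hx =>
        mul_le_mul_of_nonneg_left (A.U_mono x hst) (by linarith [hx.1])
  have hcc : Continuous fun x : ℝ => c * (x - y) := by fun_prop
  have h2 : ∫ x in y..z, ((x - y) * A.U x s + c * (x - y)) ≤ ∫ x in y..z, (x - y) * A.U x t :=
    intervalIntegral.integral_mono_on hyz
      ((A.integrable_mass y s).add (hcc.intervalIntegrable _ _)) (A.integrable_mass y t) fun x hx => by
        have := mul_le_mul_of_nonneg_left (hc x hx) (by linarith [hx.1] : 0 ≤ x - y)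
        linarith
  rw [intervalIntegral.integral_add (A.integrable_mass y s)
    (hcc.intervalIntegrable _ _), intervalIntegral.integral_const_mul, integral_sub_left] at h2
  linarith

lemma mass_sub_le {y R s t : ℝ} {n : ℤ} (hst : s ≤ t) (hn : t < n * A.per) (hR : A.X₀ + n < R)
    (hyR : y ≤ R) :
    A.mass y R t - A.mass y R s ≤ (A.U y t ^ 2 + D.L * A.mass y R t) * (t - s) := by
  have hd : ∀ r ∈ Icc s t, HasDerivAt (A.mass y R) _ r := fun r hr =>
    A.hasDerivAt_mass hyR (hr.2.trans_lt hn) hR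
  refine (convex_Icc s t).image_sub_le_mul_sub_of_deriv_le
    (fun r hr => (hd r hr).continuousAt.continuousWithinAt)
    (fun r hr => (hd r (interior_subset hr)).differentiableAt.differentiableWithinAt)
    (fun r hr => ?_) s ⟨le_rfl, hst⟩ t ⟨hst, le_rfl⟩ hst
  have hr' := interior_subset hr
  rw [(hd r hr').deriv]
  have h1 := (abs_le.1 (A.moment_g_le hyR r)).2
  have h2 : A.U y r ^ 2 ≤ A.U y t ^ 2 := pow_le_pow_left₀ (A.U_nonneg _ _) (A.U_mono y hr'.2) 2
  have h3 := mul_le_mul_of_nonneg_left (A.mass_mono hyR hr'.2) D.L_pos.le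
  linarith

/-- Quantitative lower bound for the wave shortly before a given time. -/
lemma past_lower_aux {t η K Λ ρ : ℝ} (hη : 0 < η) (hΛ : 0 < Λ) (hK1 : 1 ≤ K) (hK : Λ < K)
    (hρ : ρ ∈ Icc 0 (Λ * η)) :
    A.α t * ρ - A.U (A.B t - ρ) (t - η) ≤ η *
      (K * |A.U (A.B t - K ^ 2 * η) t / (K ^ 2 * η) * (K ^ 2 / (K ^ 2 - Λ)) - A.α t|
        + D.P * K ^ 4 * η + 2 * ((A.U (A.B t - K * η) t / (K * η)) ^ 2 * K ^ 2
          + D.L * D.S * K ^ 3 * η) / (K - Λ) ^ 2) := by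
  have hP := D.P_pos
  have hL := D.L_pos
  have hS := D.S_pos
  have hK0 : 0 < K := by linarith
  have hKK : K ≤ K ^ 2 := by nlinarith
  set B := A.B t
  set α := A.α t
  set w := A.U (B - ρ) (t - η)
  have hw0 : 0 ≤ w := A.U_nonneg _ _
  set Q := A.U (B - K ^ 2 * η) t / (K ^ 2 * η) * (K ^ 2 / (K ^ 2 - Λ)) with hQ
  set r := A.U (B - K * η) t / (K * η) with hr
  have hrU : A.U (B - K * η) t = r * K * η := by rw [hr]; field_simp
  set R' := K ^ 2 * η with hR'
  have hR'0 : 0 < R' := by positivity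
  have hρ1 : ρ ≤ Λ * η := hρ.2
  have hΛη : Λ * η < K * η := mul_lt_mul_of_pos_right hK hη
  have hKη : K * η ≤ R' := mul_le_mul_of_nonneg_right hKK hη.le
  have hD : ∀ ζ ∈ Icc ρ (K * η),
      α * ρ - w - η * (K * |Q - α| + D.P * K ^ 4 * η) ≤ A.U (B - ζ) t - A.U (B - ζ) (t - η) := by
    intro ζ hζ
    have hζ0 : 0 ≤ ζ := hρ.1.trans hζ.1
    have hden : 0 < R' - ρ := by linarith
    have hconv := (A.U_convex (t - η)).2 (mem_univ (B - ρ)) (mem_univ (B - R'))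
      (div_nonneg (sub_nonneg.2 (hζ.2.trans hKη)) hden.le)
      (div_nonneg (sub_nonneg.2 hζ.1) hden.le) (by field_simp; ring)
    simp only [smul_eq_mul] at hconv
    have e : (R' - ζ) / (R' - ρ) * (B - ρ) + (ζ - ρ) / (R' - ρ) * (B - R') = B - ζ := by
      field_simp; ring
    rw [e] at hconv
    have e2 : (R' - ζ) / (R' - ρ) * (D.P / 2 * (B - ρ) ^ 2)
        + (ζ - ρ) / (R' - ρ) * (D.P / 2 * (B - R') ^ 2) - D.P / 2 * (B - ζ) ^ 2
        = D.P / 2 * ((ζ - ρ) * (R' - ζ)) := by field_simp; ring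
    have h1 : (R' - ζ) / (R' - ρ) * w ≤ w :=
      mul_le_of_le_one_left hw0 ((div_le_one hden).2 (by linarith [hζ.1]))
    have h2 : (ζ - ρ) / (R' - ρ) * A.U (B - R') (t - η) ≤ (ζ - ρ) * Q := by
      have h3 : A.U (B - R') (t - η) ≤ A.U (B - R') t := A.U_mono _ (by linarith)
      have h4 : A.U (B - R') t / (R' - ρ) ≤ Q := by
        have : Q = A.U (B - R') t / (R' - Λ * η) := by
          have : K ^ 2 - Λ ≠ 0 := by linarith
          have e5 : R' - Λ * η = (K ^ 2 - Λ) * η := by rw [hR']; ring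
          rw [hQ, e5, hR']; field_simp
        rw [this]
        exact div_le_div_of_nonneg_left (A.U_nonneg _ _) (by linarith) (by linarith)
      calc _ = (ζ - ρ) * (A.U (B - R') (t - η) / (R' - ρ)) := by ring
        _ ≤ (ζ - ρ) * Q := mul_le_mul_of_nonneg_left
          ((div_le_div_of_nonneg_right h3 hden.le).trans h4) (by linarith [hζ.1])
    have h5 : (ζ - ρ) * (R' - ζ) ≤ R' * R' :=
      mul_le_mul (by linarith [hζ.2, hρ.1]) (by linarith) (by linarith [hζ.2]) hR'0.le
    have h6 := A.U_ge t hζ0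
    have h7 : ζ ^ 2 ≤ R' * R' := by rw [sq]; exact mul_self_le_mul_self hζ0 (hζ.2.trans hKη)
    have h8 : (ζ - ρ) * Q ≤ (ζ - ρ) * α + η * (K * |Q - α|) := by
      have h9 := mul_le_mul_of_nonneg_left (le_abs_self (Q - α)) (by linarith [hζ.1] : 0 ≤ ζ - ρ)
      have h10 := mul_le_mul_of_nonneg_right (by linarith [hζ.2, hρ.1] : ζ - ρ ≤ K * η)
        (abs_nonneg (Q - α))
      linarith
    have h12 := mul_le_mul_of_nonneg_left h5 hP.le
    have h13 := mul_le_mul_of_nonneg_left h7 hP.le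
    linarith
  set c := α * ρ - w - η * (K * |Q - α| + D.P * K ^ 4 * η) with hc
  set X := 2 * (r ^ 2 * K ^ 2 + D.L * D.S * K ^ 3 * η) / (K - Λ) ^ 2 with hX
  suffices h : c ≤ η * X by rw [hc] at h; linarith
  rcases le_total c 0 with h | hc0
  · exact h.trans (by positivity)
  obtain ⟨n, R, hn, hR, hBR⟩ := A.exists_bounds t B
  have hKη0 : 0 < K * η := mul_pos hK0 hη
  have h1 := A.le_mass_sub (y := B - K * η) (z := B - ρ) (R := R) (s := t - η) (t := t) (c := c)
    (by linarith) (by linarith) (by linarith [hρ.1]) (fun x hx => by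
      have := hD (B - x) ⟨by linarith [hx.2], by linarith [hx.1]⟩
      rwa [sub_sub_cancel] at this)
  have h2 := A.mass_sub_le (y := B - K * η) (s := t - η) (by linarith) hn hR (by linarith)
  have h3 := A.mass_le_cube (y := B - K * η) (by linarith) hBR.le
  have hKΛ : 0 < K - Λ := by linarith
  have h4 : c * (((K - Λ) * η) ^ 2 / 2) ≤ c * ((B - ρ - (B - K * η)) ^ 2 / 2) := by
    refine mul_le_mul_of_nonneg_left ?_ hc0
    have := pow_le_pow_left₀ (by positivity) (by linarith : (K - Λ) * η ≤ B - ρ - (B - K * η)) 2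
    linarith
  have e3 : B - (B - K * η) = K * η := by ring
  rw [show A.B t = B from rfl, e3] at h3
  rw [hrU, sub_sub_cancel] at h2
  have h5 : ((r * K * η) ^ 2 + D.L * A.mass (B - K * η) R t) * η ≤
      ((r * K * η) ^ 2 + D.L * (D.S * (K * η) ^ 3)) * η := by gcongr
  have h6 : c * (((K - Λ) * η) ^ 2 / 2) ≤ ((r * K * η) ^ 2 + D.L * (D.S * (K * η) ^ 3)) * η := by
    linarith
  have h7 : ((r * K * η) ^ 2 + D.L * (D.S * (K * η) ^ 3)) * η =
      (η * X) * (((K - Λ) * η) ^ 2 / 2) := by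
    rw [hX]; field_simp
  rw [h7] at h6
  exact le_of_mul_le_mul_right h6 (by positivity)

/-- Shortly before time `t` the wave lies above the linear profile moving with speed `2α`. -/
lemma past_lower (t : ℝ) {Λ ε : ℝ} (hΛ : 0 < Λ) (hε : 0 < ε) :
    ∀ᶠ η in 𝓝[>] (0:ℝ), ∀ ρ ∈ Icc 0 (Λ * η),
      A.α t * ρ - 2 * A.α t ^ 2 * η - ε * η ≤ A.U (A.B t - ρ) (t - η) := by
  set α := A.α t
  have hα0 : 0 ≤ α := A.α_nonneg t
  have h1 : ∀ᶠ κ in 𝓝[>] (0:ℝ),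
      α * Λ * κ / (1 - Λ * κ ^ 2) + 2 * α ^ 2 / (1 - Λ * κ) ^ 2 < 2 * α ^ 2 + ε := by
    have hc : ContinuousAt
        (fun κ : ℝ => α * Λ * κ / (1 - Λ * κ ^ 2) + 2 * α ^ 2 / (1 - Λ * κ) ^ 2) 0 := by
      refine ContinuousAt.add (ContinuousAt.div ?_ ?_ ?_) (ContinuousAt.div ?_ ?_ ?_)
      all_goals first | fun_prop | norm_num
    have h2 := hc.tendsto
    norm_num at h2
    exact (h2.mono_left nhdsWithin_le_nhds).eventually_lt_const (by linarith)
  obtain ⟨κ, hκ, hκ0, hκ1⟩ := (h1.and (Ioo_mem_nhdsGT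
    (lt_min one_pos (by positivity : 0 < 1 / Λ)))).exists
  have hκ2 : κ < 1 := hκ1.trans_le (min_le_left _ _)
  have hκ3 : κ * Λ < 1 := (lt_div_iff₀ hΛ).1 (hκ1.trans_le (min_le_right _ _))
  have hκ4 : Λ * κ ^ 2 < 1 := by nlinarith
  set K := 1 / κ with hK
  have hK1 : 1 ≤ K := by rw [hK, le_div_iff₀ hκ0]; linarith
  have hKΛ : Λ < K := by rw [hK, lt_div_iff₀ hκ0]; linarith
  have hK0 : 0 < K := by linarith
  have hq : ∀ c, 0 < c → Tendsto (fun η => A.U (A.B t - c * η) t / (c * η)) (𝓝[>] 0) (𝓝 α) := by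
    intro c hc
    refine (A.tendsto_quot t).comp (tendsto_nhdsWithin_iff.2 ⟨?_, ?_⟩)
    · have : Tendsto (fun η : ℝ => c * η) (𝓝 0) (𝓝 (c * 0)) := tendsto_id.const_mul c
      rw [mul_zero] at this
      exact this.mono_left nhdsWithin_le_nhds
    · filter_upwards [self_mem_nhdsWithin] with η hη
      exact mul_pos hc hη
  have hid : Tendsto (fun η : ℝ => η) (𝓝[>] 0) (𝓝 0) := tendsto_id.mono_left nhdsWithin_le_nhds
  have hlim := (((((hq (K ^ 2) (by positivity)).mul_const (K ^ 2 / (K ^ 2 - Λ))).sub_const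
    α).abs.const_mul K).add (hid.const_mul (D.P * K ^ 4))).add
    ((((((hq K hK0).pow 2).mul_const (K ^ 2)).add (hid.const_mul (D.L * D.S * K ^ 3))).const_mul
      2).div_const ((K - Λ) ^ 2))
  have hval : K * |α * (K ^ 2 / (K ^ 2 - Λ)) - α| + D.P * K ^ 4 * 0
      + 2 * (α ^ 2 * K ^ 2 + D.L * D.S * K ^ 3 * 0) / (K - Λ) ^ 2 < 2 * α ^ 2 + ε := by
    have hd1 : 1 - Λ * κ ^ 2 ≠ 0 := by linarith
    have e1 : α * (K ^ 2 / (K ^ 2 - Λ)) - α = α * Λ * κ ^ 2 / (1 - Λ * κ ^ 2) := by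
      have : K ^ 2 - Λ = (1 - Λ * κ ^ 2) / κ ^ 2 := by rw [hK]; field_simp
      rw [this, hK, div_div_eq_mul_div, one_div, inv_pow, inv_mul_cancel₀ (by positivity),
        mul_one_div, eq_div_iff hd1, sub_mul, div_mul_cancel₀ _ hd1]
      ring
    have e2 : K - Λ = (1 - Λ * κ) / κ := by rw [hK]; field_simp
    rw [e1, abs_of_nonneg (by have : 0 < 1 - Λ * κ ^ 2 := by linarith
                              positivity)]
    rw [e2]
    refine lt_of_eq_of_lt ?_ hκ
    rw [hK]
    field_simp
    ring
  filter_upwards [hlim.eventually_lt_const hval, self_mem_nhdsWithin] with η hη hη0 ρ hρ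
  have h3 := A.past_lower_aux (t := t) hη0 hΛ hK1 hKΛ hρ
  have h4 := h3.trans (mul_le_mul_of_nonneg_left hη.le (le_of_lt hη0))
  linarith

/-- Upper bound for the left upper Dini derivative of the free boundary. -/
lemma B_left_le (t : ℝ) {γ : ℝ} (hγ : 2 * A.α t < γ) :
    ∀ᶠ η in 𝓝[>] (0:ℝ), A.B t - A.B (t - η) ≤ γ * η := by
  rcases (A.α_nonneg t).eq_or_lt with h0 | h0
  · have hγ0 : 0 < γ := by linarith
    have hL := D.L_pos
    have hexp : ∀ᶠ η in 𝓝[>] (0:ℝ), (exp (D.L * η) - 1) / D.L ≤ 2 * η := by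
      filter_upwards [Ioo_mem_nhdsGT (inv_pos.2 hL)] with η hη
      have h1 : D.L * η < 1 := by
        have := mul_lt_mul_of_pos_left hη.2 hL
        rwa [mul_inv_cancel₀ hL.ne'] at this
      have h2 := Real.abs_exp_sub_one_le (x := D.L * η)
        (by rw [abs_of_nonneg (mul_nonneg hL.le hη.1.le)]; exact h1.le)
      rw [abs_of_nonneg (mul_nonneg hL.le hη.1.le)] at h2
      rw [div_le_iff₀ hL]
      linarith [le_abs_self (exp (D.L * η) - 1)]
    have hq : ∀ᶠ ζ in 𝓝[>] (0:ℝ), A.U (A.B t - ζ) t ≤ γ / 24 * ζ := by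
      have h1 := (A.tendsto_quot t).eventually_lt_const (u := γ / 24) (by rw [← h0]; positivity)
      filter_upwards [h1, self_mem_nhdsWithin] with ζ h2 hζ
      exact ((div_lt_iff₀ hζ).1 h2).le
    obtain ⟨δ, hδ, hδq⟩ := mem_nhdsGT_iff_exists_Ioo_subset.1 hq
    have hB : ∀ᶠ η in 𝓝[>] (0:ℝ), A.B t - A.B (t - η) < δ := by
      have h1 : ContinuousAt (fun η => A.B t - A.B (t - η)) 0 :=
        (continuous_const.sub (A.continuous_B.comp (continuous_const.sub continuous_id))).continuousAt
      refine (h1.tendsto.mono_left nhdsWithin_le_nhds).eventually_lt_const ?_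
      simpa using hδ
    filter_upwards [hexp, hB, self_mem_nhdsWithin] with η h1 h2 hη
    have hη' : 0 < η := hη
    rcases (sub_nonneg.2 (A.B_mono (by linarith : t - η ≤ t))).eq_or_lt with h3 | h3
    · rw [← h3]; positivity
    have h4 : A.U (A.B t - (A.B t - A.B (t - η))) t ≤ γ / 24 * (A.B t - A.B (t - η)) := hδq ⟨h3, h2⟩
    rw [sub_sub_cancel] at h4
    have h5 := A.B_modulus (by linarith : t - η < t)
    rw [sub_sub_cancel] at h5
    have h6 := mul_le_mul h4 h1 (div_nonneg (by linarith [one_le_exp (mul_nonneg hL.le hη'.le)])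
      hL.le) (by positivity)
    refine le_of_mul_le_mul_right ?_ h3
    linarith
  · set ε := A.α t * (γ - 2 * A.α t) / 2 with hε
    have hε0 : 0 < ε := by have := sub_pos.2 hγ; positivity
    filter_upwards [A.past_lower t (by linarith : 0 < γ) hε0, self_mem_nhdsWithin] with η h1 hη
    have hη' : 0 < η := hη
    have h2 := h1 (γ * η) ⟨by have : 0 < γ := by linarith
                              positivity, le_rfl⟩
    have h3 : A.α t * (γ * η) - 2 * A.α t ^ 2 * η - ε * η = ε * η := by rw [hε]; ring
    have h4 : 0 < A.U (A.B t - γ * η) (t - η) := by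
      rw [h3] at h2
      exact (mul_pos hε0 hη').trans_le h2
    linarith [A.U_pos_iff.1 h4]

end Approx
end WaveData

/-- A continuous function that is somewhere larger at arbitrarily close earlier times decreases. -/
lemma le_of_left_local {F : ℝ → ℝ} {s t : ℝ} (hst : s ≤ t) (hF : Continuous F)
    (h : ∀ r ∈ Ioc s t, ∀ᶠ η in 𝓝[>] (0:ℝ), F r ≤ F (r - η)) : F t ≤ F s := by
  have hK : IsCompact {r | r ∈ Icc s t ∧ F t ≤ F r} :=
    isCompact_Icc.inter_right (isClosed_le continuous_const hF)
  obtain ⟨r, ⟨hr, hrt⟩, hmin⟩ := hK.exists_isLeast ⟨t, ⟨hst, le_rfl⟩, le_rfl⟩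
  rcases hr.1.eq_or_lt with h0 | h0
  · rwa [h0]
  · obtain ⟨η, h1, h2⟩ := ((h r ⟨h0, hr.2⟩).and (Ioo_mem_nhdsGT (sub_pos.2 h0))).exists
    have := hmin ⟨⟨by linarith [h2.2], by linarith [hr.2, h2.1]⟩, hrt.trans h1⟩
    linarith [h2.1]

namespace WaveData
variable {D : WaveData}
namespace Approx
variable (A : D.Approx)

lemma B_sub_le {s t γ : ℝ} (hst : s ≤ t) (h : ∀ r ∈ Ioc s t, 2 * A.α r < γ) :
    A.B t - A.B s ≤ γ * (t - s) := by
  have := le_of_left_local (F := fun r => A.B r - γ * r) hst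
    (A.continuous_B.sub (continuous_const.mul continuous_id)) fun r hr => by
      filter_upwards [A.B_left_le r (h r hr)] with η hη
      linarith
  linarith

/-- The front speed cannot decrease faster than exponentially. -/
lemma α_exp_le {s t : ℝ} (hst : s ≤ t) : A.α s * exp (-(D.C * (t - s))) ≤ A.α t := by
  have hC := D.C_pos
  rcases hst.eq_or_lt with rfl | hlt
  · simp
  set c := 2 * A.α s * exp (D.C * s) with hc
  have hcr : ∀ r, c * exp (-(D.C * r)) = 2 * (A.α s * exp (-(D.C * (r - s)))) := fun r => by
    rw [hc, mul_assoc, ← exp_add, mul_assoc]; ring_nf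
  set F : ℝ → ℝ := fun r => A.B r + c * exp (-(D.C * r)) / D.C with hF
  have hstep : ∀ r ∈ Ioc s t, (∀ q ∈ Icc s t, F q ≤ F r) → c * exp (-(D.C * r)) ≤ 2 * A.α r := by
    intro r hr hmax
    by_contra! hlt
    obtain ⟨η, h1, h2⟩ := ((A.B_left_le r hlt).and (Ioo_mem_nhdsGT (sub_pos.2 hr.1))).exists
    have h3 := hmax (r - η) ⟨by linarith [h2.2], by linarith [hr.2, h2.1]⟩
    have h4 : exp (-(D.C * (r - η))) = exp (-(D.C * r)) * exp (D.C * η) := by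
      rw [← exp_add]; ring_nf
    have h5 := Real.add_one_lt_exp (mul_pos hC h2.1).ne'
    have h6 : 0 < c * exp (-(D.C * r)) := by linarith [A.α_nonneg r]
    have h7 := mul_lt_mul_of_pos_left h5 (div_pos h6 hC)
    have h8 : c * exp (-(D.C * r)) / D.C * (D.C * η + 1) =
      c * exp (-(D.C * r)) * η + c * exp (-(D.C * r)) / D.C := by field_simp
    have h9 : F (r - η) = A.B (r - η) + c * exp (-(D.C * r)) / D.C * exp (D.C * η) := by
      simp only [hF, h4]; ring
    linarith
  have hdom : ∀ r ∈ Icc s t, c * exp (-(D.C * r)) ≤ 2 * A.α r → F r ≤ F t := by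
    intro r hr h
    have h1 := A.B_ge hr.2
    have h2 : exp (-(D.C * t)) = exp (-(D.C * r)) * exp (-(D.C * (t - r))) := by
      rw [← exp_add]; ring_nf
    have h3 : 0 ≤ (1 - exp (-(D.C * (t - r)))) / D.C := by
      refine div_nonneg (sub_nonneg.2 (exp_le_one_iff.2 ?_)) hC.le
      have := mul_nonneg hC.le (sub_nonneg.2 hr.2)
      linarith
    have h4 := mul_le_mul_of_nonneg_right h h3
    simp only [hF, h2]
    grind
  have hFc : Continuous F := A.continuous_B.add (by fun_prop)
  obtain ⟨r, hr, hmax⟩ := isCompact_Icc.exists_isMaxOn ⟨s, le_rfl, hst⟩ hFc.continuousOn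
  have hrt : F r ≤ F t := by
    refine hdom r hr ?_
    rcases hr.1.eq_or_lt with h0 | h0
    · rw [← h0, hcr]; simp
    · exact hstep r ⟨h0, hr.2⟩ fun q hq => hmax hq
  have := hstep t ⟨hlt, le_rfl⟩ fun q hq => (hmax hq).trans hrt
  rw [hcr] at this
  linarith

lemma α_pos (t : ℝ) : 0 < A.α t := by
  by_contra! h0
  have hz : ∀ r ≤ t, A.α r = 0 := fun r hr => by
    refine le_antisymm ?_ (A.α_nonneg r)
    exact nonpos_of_mul_nonpos_left ((A.α_exp_le hr).trans h0) (exp_pos _)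
  have hT := A.T_pos
  have h1 := A.B_sub_le (γ := 1 / (2 * A.per)) (by linarith : t - A.per ≤ t) fun r hr => by
    rw [hz r hr.2]; simpa using hT
  have h2 := A.B_period (t - A.per)
  grind

lemma α_period (t : ℝ) : A.α (t + A.per) = A.α t := by
  refine tendsto_nhds_unique (A.tendsto_quot (t + A.per)) ((A.tendsto_quot t).congr fun ζ => ?_)
  have := A.U_period_int 1 (A.B t + 1 - ζ) t
  rw [A.B_period]
  grind

lemma α_lt {t ε : ℝ} (hε : A.α t < ε) : ∀ᶠ r in 𝓝 t, A.α r < ε := by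
  have h1 : Tendsto (fun ζ => A.U (A.B t - ζ) t / ζ + D.P / 2 * ζ) (𝓝[>] 0) (𝓝 (A.α t)) := by
    have : Tendsto (fun ζ : ℝ => D.P / 2 * ζ) (𝓝[>] 0) (𝓝 0) := by
      have h2 : Tendsto (fun ζ : ℝ => D.P / 2 * ζ) (𝓝 0) (𝓝 (D.P / 2 * 0)) := tendsto_id.const_mul _
      rw [mul_zero] at h2
      exact h2.mono_left nhdsWithin_le_nhds
    simpa using (A.tendsto_quot t).add this
  obtain ⟨ζ, h2, hζ⟩ := ((h1.eventually_lt_const hε).and self_mem_nhdsWithin).exists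
  have hζ0 : 0 < ζ := hζ
  have h3 : Continuous fun r => A.U (A.B r - ζ) r / ζ + D.P / 2 * ζ := by
    have hU := A.continuous_U
    have hB := A.continuous_B
    generalize A.B = B at hB
    generalize A.U = U at hU
    have hc : Continuous fun r => (B r - ζ, r) := by fun_prop
    exact ((hU.comp hc).div_const _).add continuous_const
  filter_upwards [(h3.tendsto t).eventually_lt_const h2] with r hr
  have h4 := A.U_ge r hζ0.le
  refine lt_of_le_of_lt ?_ hr
  have h5 := div_le_div_of_nonneg_right h4 hζ0.le
  have h6 : (A.α r * ζ - D.P / 2 * ζ ^ 2) / ζ = A.α r - D.P / 2 * ζ := by field_simp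
  linarith

/-- Lower bound for the mass ahead of `y` from the slope of the profile at the front. -/
lemma le_mass {y R t b d η : ℝ} (hη : 0 ≤ η) (hd : 0 ≤ d) (hb : 0 ≤ b) (hbα : b ≤ A.α t)
    (hyB : y + d * η ≤ A.B t) (hR : A.B t ≤ R) (hP : D.P * (A.B t - y) ≤ b) :
    b * d ^ 3 / 32 * η ^ 3 ≤ A.mass y R t := by
  have hdη : 0 ≤ d * η := mul_nonneg hd hη
  obtain ⟨s₀, hs⟩ := A.mass_eq_zero_early y R (by linarith)
  obtain ⟨s₁, hs₁⟩ := A.U_zero_early y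
  have h1 := A.le_mass_sub (y := y) (z := y + d * η / 2) (R := R) (s := min t (min s₀ s₁)) (t := t)
    (c := b * (d * η) / 4) (min_le_left _ _) (by linarith) (by linarith) fun x hx => by
      rw [hs₁ _ ((min_le_right _ _).trans (min_le_right _ _)) x hx.1, sub_zero]
      have h2 := A.U_ge t (ζ := A.B t - x) (by linarith [hx.2])
      rw [sub_sub_cancel] at h2
      have h3 : D.P * (A.B t - x) ≤ b := le_trans
        (mul_le_mul_of_nonneg_left (by linarith [hx.1]) D.P_pos.le) hP
      have h4 := mul_le_mul_of_nonneg_right h3 (by linarith [hx.2] : 0 ≤ A.B t - x)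
      have h5 := mul_le_mul_of_nonneg_right hbα (by linarith [hx.2] : 0 ≤ A.B t - x)
      have h6 := mul_le_mul_of_nonneg_left (by linarith [hx.2] : d * η / 2 ≤ A.B t - x) hb
      linarith
  grind

/-- The flux through `y` over a time interval on which the profile at `y` grows at a linear rate. -/
lemma flux_le {y R s t k e : ℝ} {n : ℤ} (hst : s ≤ t) (hn : t < n * A.per) (hR : A.X₀ + n < R)
    (hyR : y ≤ R) (hk : 0 ≤ k) (he : 0 ≤ e) (h : ∀ r ∈ Icc s t, k * (r - s) - e ≤ A.U y r) :
    k ^ 2 * (t - s) ^ 3 / 3 - (2 * e * k * (t - s) + D.L * A.mass y R t) * (t - s) + A.mass y R s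
      ≤ A.mass y R t := by
  set E := 2 * e * k * (t - s) + D.L * A.mass y R t
  have hd : ∀ r ∈ Icc s t, HasDerivAt (fun r => A.mass y R r - k ^ 2 * (r - s) ^ 3 / 3 + E * (r - s))
      (A.U y r ^ 2 + (∫ x in y..R, (x - y) * D.g x (A.U x r)) - k ^ 2 * (r - s) ^ 2 + E) r := by
    intro r hr
    have h4 := (hasDerivAt_id r).sub_const s
    refine (((A.hasDerivAt_mass hyR (hr.2.trans_lt hn) hR).sub
      (((h4.pow 3).const_mul (k ^ 2)).div_const 3)).add (h4.const_mul E)).congr_deriv ?_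
    grind
  have hm : MonotoneOn (fun r => A.mass y R r - k ^ 2 * (r - s) ^ 3 / 3 + E * (r - s)) (Icc s t) := by
    refine monotoneOn_of_deriv_nonneg (convex_Icc _ _)
      (fun r hr => (hd r hr).continuousAt.continuousWithinAt)
      (fun r hr => (hd r (interior_subset hr)).differentiableAt.differentiableWithinAt) fun r hr => ?_
    have hr' := interior_subset hr
    rw [(hd r hr').deriv]
    have h1 := (abs_le.1 (A.moment_g_le hyR r)).1
    have h2 := mul_le_mul_of_nonneg_left (A.mass_mono hyR hr'.2) D.L_pos.le
    have h3 := h r hr'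
    have h4 : k ^ 2 * (r - s) ^ 2 - 2 * e * k * (r - s) ≤ A.U y r ^ 2 := by
      have h5 : 0 ≤ k * (r - s) := mul_nonneg hk (by linarith [hr'.1])
      nlinarith [sq_nonneg (A.U y r - k * (r - s))]
    have h6 := mul_le_mul_of_nonneg_left (by linarith [hr'.2] : r - s ≤ t - s)
      (mul_nonneg (mul_nonneg two_pos.le he) hk)
    linarith
  have := hm ⟨le_rfl, hst⟩ ⟨hst, le_rfl⟩ hst
  linarith

end Approx
end WaveData

lemma mass_balance_contradiction {a e δ η m L m₁ m₂ m₃ : ℝ} (ha : 0 < a) (he : 0 < e) (hea : e ≤ a)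
    (hδ : 0 < δ) (hδ1 : δ < 1) (hη : 0 < η) (hm : 0 < m) (hL : 0 < L)
    (h1 : m₁ ≤ (a + e) * (2 * a * η) ^ 3 / 6) (h21 : m₂ ≤ m₁) (h3 : m * η ^ 3 ≤ m₃)
    (h2 : (2 * a ^ 2) ^ 2 * ((1 - δ) * η) ^ 3 / 3
      - (2 * (e * η) * (2 * a ^ 2) * ((1 - δ) * η) + L * m₂) * ((1 - δ) * η) + m₃ ≤ m₂)
    (hcδ : 4 * a ^ 4 * δ ≤ m / 8) (hce : (4 / 3 * a ^ 3 + 4 * a ^ 2) * e ≤ m / 8)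
    (hcη : 8 / 3 * L * a ^ 4 * η ≤ m / 8) : False := by
  have hη3 : 0 < η ^ 3 := by positivity
  have k1 : 1 - 3 * δ ≤ (1 - δ) ^ 3 := by nlinarith [mul_pos hδ hδ, mul_pos (mul_pos hδ hδ) (by linarith : 0 < 3 - δ)]
  have k2 : (1 - 3 * δ) * (4 / 3 * a ^ 4 * η ^ 3) ≤ (1 - δ) ^ 3 * (4 / 3 * a ^ 4 * η ^ 3) :=
    mul_le_mul_of_nonneg_right k1 (by positivity)
  have k3 : (1 - δ) ^ 2 ≤ 1 := by nlinarith
  have k4 : (1 - δ) ^ 2 * (4 * e * a ^ 2 * η ^ 3) ≤ 1 * (4 * e * a ^ 2 * η ^ 3) :=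
    mul_le_mul_of_nonneg_right k3 (by positivity)
  have k5 : (a + e) * (2 * a * η) ^ 3 / 6 ≤ 8 / 3 * a ^ 4 * η ^ 3 := by
    have := mul_le_mul_of_nonneg_right hea (by positivity : 0 ≤ 4 / 3 * a ^ 3 * η ^ 3)
    linarith
  have k6 : L * m₂ * ((1 - δ) * η) ≤ 8 / 3 * L * a ^ 4 * η * η ^ 3 := by
    calc L * m₂ * ((1 - δ) * η) = L * ((1 - δ) * η) * m₂ := by ring
      _ ≤ L * ((1 - δ) * η) * (8 / 3 * a ^ 4 * η ^ 3) :=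
        mul_le_mul_of_nonneg_left (by linarith) (by positivity)
      _ = (1 - δ) * (8 / 3 * L * a ^ 4 * η * η ^ 3) := by ring
      _ ≤ 1 * (8 / 3 * L * a ^ 4 * η * η ^ 3) :=
        mul_le_mul_of_nonneg_right (by linarith) (by positivity)
      _ = _ := one_mul _
  have j1 := mul_le_mul_of_nonneg_right hcδ hη3.le
  have j2 := mul_le_mul_of_nonneg_right hce hη3.le
  have j3 := mul_le_mul_of_nonneg_right hcη hη3.le
  have j4 := mul_pos hm hη3
  linarith

namespace WaveData
variable {D : WaveData}
namespace Approx
variable (A : D.Approx)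

lemma lt_α_left {t ε : ℝ} (hε : ε < A.α t) : ∀ᶠ r in 𝓝[<] t, ε < A.α r := by
  by_contra hcon
  have hfr : ∃ᶠ r in 𝓝[<] t, A.α r ≤ ε := by
    rw [Filter.not_eventually] at hcon
    exact hcon.mono fun r hr => not_lt.1 hr
  have hC := D.C_pos
  have hP := D.P_pos
  have hL := D.L_pos
  have hε0 : 0 < ε := by
    obtain ⟨r, hr⟩ := hfr.exists
    exact (A.α_pos r).trans_le hr
  set a := A.α t with ha
  have ha0 : 0 < a := A.α_pos t
  set β := (a + ε) / 2 with hβ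
  set b := A.α (t - 1) * exp (-D.C)
  have hb0 : 0 < b := mul_pos (A.α_pos _) (exp_pos _)
  have hbα : ∀ r ∈ Icc (t - 1) t, b ≤ A.α r := fun r hr => by
    refine le_trans ?_ (A.α_exp_le hr.1)
    refine mul_le_mul_of_nonneg_left (exp_le_exp.2 ?_) (A.α_nonneg _)
    have := mul_le_mul_of_nonneg_left (by linarith [hr.2] : r - (t - 1) ≤ 1) hC.le
    linarith
  have hnear : ∀ᶠ r in 𝓝[<] t, A.α r < β := by
    have h1 : Continuous fun r => ε * exp (D.C * (t - r)) := by fun_prop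
    have h2 : Tendsto (fun r => ε * exp (D.C * (t - r))) (𝓝[<] t) (𝓝 ε) := by
      simpa using (h1.tendsto t).mono_left nhdsWithin_le_nhds
    filter_upwards [h2.eventually_lt_const (by rw [hβ]; linarith : ε < β), self_mem_nhdsWithin]
      with r hr hrt
    obtain ⟨q, hq, hq1, hq2⟩ := (hfr.and_eventually (Ioo_mem_nhdsLT hrt)).exists
    refine lt_of_le_of_lt ?_ hr
    have h3 := (A.α_exp_le hq1.le).trans hq
    rw [exp_neg, ← div_eq_mul_inv, div_le_iff₀ (exp_pos _)] at h3
    refine h3.trans (mul_le_mul_of_nonneg_left (exp_le_exp.2 ?_) hε0.le)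
    exact mul_le_mul_of_nonneg_left (by linarith) hC.le
  obtain ⟨τ, hτ, hτβ⟩ := mem_nhdsLT_iff_exists_Ioo_subset.1 hnear
  have hτ' : τ < t := hτ
  have hBη : ∀ s ∈ Ioo τ t, A.B t - A.B s ≤ 2 * β * (t - s) := by
    intro s hs
    have h1 : Tendsto (fun q => A.B q - A.B s) (𝓝[<] t) (𝓝 (A.B t - A.B s)) :=
      ((A.continuous_B.tendsto t).mono_left nhdsWithin_le_nhds).sub_const _
    refine le_of_tendsto h1 ?_
    filter_upwards [Ioo_mem_nhdsLT hs.2] with q hq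
    have h2 := A.B_sub_le (γ := 2 * β) hq.1.le fun r hr => by
      have : A.α r < β := hτβ ⟨hs.1.trans hr.1, hr.2.trans_lt hq.2⟩
      linarith
    have h3 : 2 * β * (q - s) ≤ 2 * β * (t - s) :=
      mul_le_mul_of_nonneg_left (by linarith [hq.2]) (by rw [hβ]; linarith)
    linarith
  set d := 2 * a - 2 * β with hd
  have hd0 : 0 < d := by rw [hd, hβ]; linarith
  set m := b * d ^ 3 / 32
  have hm0 : 0 < m := by positivity
  set δ := min (1 / 2) (m / (32 * a ^ 4))
  have hδ0 : 0 < δ := lt_min (by norm_num) (by positivity)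
  have hδ1 : δ < 1 := (min_le_left _ _).trans_lt (by norm_num)
  have hcδ : 4 * a ^ 4 * δ ≤ m / 8 := by
    have := mul_le_mul_of_nonneg_left (min_le_right (1 / 2) (m / (32 * a ^ 4)))
      (by positivity : 0 ≤ 4 * a ^ 4)
    refine this.trans (le_of_eq ?_)
    field_simp
    norm_num
  set e := min a (m / (8 * (4 / 3 * a ^ 3 + 4 * a ^ 2)))
  have he0 : 0 < e := lt_min ha0 (by positivity)
  have hce : (4 / 3 * a ^ 3 + 4 * a ^ 2) * e ≤ m / 8 := by
    have := mul_le_mul_of_nonneg_left (min_le_right a (m / (8 * (4 / 3 * a ^ 3 + 4 * a ^ 2))))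
      (by positivity : 0 ≤ 4 / 3 * a ^ 3 + 4 * a ^ 2)
    refine this.trans (le_of_eq ?_)
    field_simp
  have hq : ∀ᶠ ζ in 𝓝[>] (0:ℝ), A.U (A.B t - ζ) t ≤ (a + e) * ζ := by
    filter_upwards [(A.tendsto_quot t).eventually_lt_const (by linarith : A.α t < a + e),
      self_mem_nhdsWithin] with ζ h2 hζ
    exact ((div_lt_iff₀ hζ).1 h2).le
  obtain ⟨ζ₀, hζ₀, hζq⟩ := mem_nhdsGT_iff_exists_Ioo_subset.1 hq
  obtain ⟨η₀, hη₀, hpast⟩ := mem_nhdsGT_iff_exists_Ioo_subset.1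
    (A.past_lower t (by positivity : 0 < 2 * a / δ) he0)
  have hζ₀' : 0 < ζ₀ := hζ₀
  have hη₀' : 0 < η₀ := hη₀
  have hmin : ∃ η > 0, η < η₀ ∧ η < 1 ∧ η < t - τ ∧ η * (2 * a) < ζ₀ ∧ η * (D.P * (2 * a)) ≤ b ∧
      8 / 3 * D.L * a ^ 4 * η ≤ m / 8 := by
    have hlin : ∀ c B : ℝ, 0 < B → ∀ᶠ η in 𝓝[>] (0:ℝ), η * c < B := fun c B hB => by
      have : Tendsto (fun η : ℝ => η * c) (𝓝[>] 0) (𝓝 0) := by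
        have h2 : Tendsto (fun η : ℝ => η * c) (𝓝 0) (𝓝 (0 * c)) := tendsto_id.mul_const _
        rw [zero_mul] at h2
        exact h2.mono_left nhdsWithin_le_nhds
      exact this.eventually_lt_const hB
    have hev : ∀ᶠ η in 𝓝[>] (0:ℝ), η < min η₀ (min 1 (t - τ)) := by
      filter_upwards [Ioo_mem_nhdsGT (lt_min hη₀' (lt_min one_pos (sub_pos.2 hτ')))] with η h
      exact h.2
    obtain ⟨η, h1, h2, h3, h4, h5⟩ := (hev.and ((hlin (2 * a) ζ₀ hζ₀').and
      ((hlin (D.P * (2 * a)) b hb0).and ((hlin (8 / 3 * D.L * a ^ 4) (m / 8) (by positivity)).and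
        self_mem_nhdsWithin)))).exists
    rw [lt_min_iff, lt_min_iff] at h1
    exact ⟨η, h5, h1.1, h1.2.1, h1.2.2, h2, h3.le, by linarith⟩
  obtain ⟨η, hη, hηη, hη1, hητ, hηζ, hηb, hcη⟩ := hmin
  obtain ⟨n, R, hn, hR, hBR⟩ := A.exists_bounds t (A.B t)
  set y := A.B t - 2 * a * η with hy
  have haη : 0 < 2 * a * η := by positivity
  have hδη : δ * η < η := by nlinarith
  have hδη0 : 0 < δ * η := by positivity
  have hB1 := hBη (t - η) ⟨by linarith, by linarith⟩
  have hB2 := A.B_mono (by linarith : t - η ≤ t)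
  refine mass_balance_contradiction (m₁ := A.mass y R t) (m₂ := A.mass y R (t - δ * η))
    (m₃ := A.mass y R (t - η)) ha0 he0 (min_le_left _ _) hδ0 hδ1 hη hm0 hL ?_ ?_ ?_ ?_ hcδ hce hcη
  · have := A.mass_le_linear (y := y) (R := R) (t := t) (c := a + e) (by linarith) hBR.le
      fun ζ hζ => hζq ⟨hζ.1, by linarith [hζ.2]⟩
    rwa [hy, sub_sub_cancel] at this
  · exact A.mass_mono (by linarith) (by linarith)
  · refine A.le_mass hη.le hd0.le hb0.le (hbα _ ⟨by linarith, by linarith⟩) ?_ (by linarith) ?_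
    · rw [sub_sub_cancel] at hB1
      rw [hd]; linarith
    · refine le_trans (mul_le_mul_of_nonneg_left (?_ : _ ≤ 2 * a * η) hP.le) (by linarith)
      linarith
  · have h1 := A.flux_le (y := y) (R := R) (s := t - η) (t := t - δ * η) (k := 2 * a ^ 2)
      (e := e * η) (by linarith) (by linarith) hR (by linarith) (by positivity) (by positivity)
      fun r hr => by
        have h2 := hpast ⟨by linarith [hr.2], by linarith [hr.1]⟩ (2 * a * η) (show _ ∈ Icc 0 (2 * a / δ * (t - r)) from ⟨haη.le, ?_⟩)
        · rw [sub_sub_cancel] at h2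
          have h3 := mul_le_mul_of_nonneg_left (by linarith [hr.1] : t - r ≤ η) he0.le
          refine le_trans ?_ h2
          rw [← ha]
          linarith
        · rw [div_mul_eq_mul_div, le_div_iff₀ hδ0]
          have := mul_le_mul_of_nonneg_left (by linarith [hr.2] : δ * η ≤ t - r) (by positivity : 0 ≤ 2 * a)
          linarith
    have e1 : t - δ * η - (t - η) = (1 - δ) * η := by ring
    rwa [e1] at h1

lemma continuous_α : Continuous A.α := by
  have hlow : ∀ t ε, ε < A.α t → ∀ᶠ r in 𝓝 t, ε < A.α r := by
    intro t ε h
    rw [← nhdsLT_sup_nhdsGE, eventually_sup]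
    refine ⟨A.lt_α_left h, ?_⟩
    have h1 : Continuous fun r => A.α t * exp (-(D.C * (r - t))) := by fun_prop
    have h2 : Tendsto (fun r => A.α t * exp (-(D.C * (r - t)))) (𝓝[≥] t) (𝓝 (A.α t)) := by
      simpa using (h1.tendsto t).mono_left nhdsWithin_le_nhds
    filter_upwards [h2.eventually_const_lt h, self_mem_nhdsWithin] with r h3 hr
    exact h3.trans_le (A.α_exp_le hr)
  exact continuous_iff_continuousAt.2 fun t => tendsto_order.2
    ⟨fun ε h => hlow t ε h, fun ε h => A.α_lt h⟩

lemma hasDerivAt_B (t : ℝ) : HasDerivAt A.B (2 * A.α t) t := by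
  have hC := D.C_pos
  have hb : ∀ s r, s < r → 2 * A.α s * exp (-(D.C * (r - s))) ≤ (A.B r - A.B s) / (r - s) ∧
      (A.B r - A.B s) / (r - s) ≤ 2 * A.α r * exp (D.C * (r - s)) := by
    intro s r h
    have h0 : 0 < r - s := sub_pos.2 h
    rw [le_div_iff₀ h0, div_le_iff₀ h0]
    constructor
    · have h1 := A.B_ge h.le
      have h2 : exp (-(D.C * (r - s))) * (r - s) ≤ (1 - exp (-(D.C * (r - s)))) / D.C := by
        rw [le_div_iff₀ hC]
        have h3 := mul_le_mul_of_nonneg_left (add_one_le_exp (D.C * (r - s)))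
          (exp_pos (-(D.C * (r - s)))).le
        rw [← exp_add, neg_add_cancel, exp_zero] at h3
        linarith
      have h3 := mul_le_mul_of_nonneg_left h2 (mul_nonneg two_pos.le (A.α_nonneg s))
      grind
    · refine le_of_forall_pos_le_add fun ε hε => ?_
      have h1 := A.B_sub_le (γ := 2 * A.α r * exp (D.C * (r - s)) + ε / (r - s)) h.le
        fun q hq => by
          have h2 := A.α_exp_le hq.2
          rw [exp_neg, ← div_eq_mul_inv, div_le_iff₀ (exp_pos _)] at h2
          have h3 : exp (D.C * (r - q)) ≤ exp (D.C * (r - s)) :=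
            exp_le_exp.2 (mul_le_mul_of_nonneg_left (by linarith [hq.1]) hC.le)
          have h4 := mul_le_mul_of_nonneg_left h3 (A.α_nonneg r)
          have h5 := div_pos hε h0
          linarith
      rw [add_mul, div_mul_cancel₀ _ h0.ne'] at h1
      exact h1
  rw [hasDerivAt_iff_tendsto_slope]
  have hlo : Tendsto (fun r => 2 * min (A.α t) (A.α r) * exp (-(D.C * |r - t|))) (𝓝[≠] t)
      (𝓝 (2 * A.α t)) := by
    have h := A.continuous_α
    have h1 : Continuous fun r => 2 * min (A.α t) (A.α r) * exp (-(D.C * |r - t|)) := by fun_prop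
    simpa using (h1.tendsto t).mono_left nhdsWithin_le_nhds
  have hhi : Tendsto (fun r => 2 * max (A.α t) (A.α r) * exp (D.C * |r - t|)) (𝓝[≠] t)
      (𝓝 (2 * A.α t)) := by
    have h := A.continuous_α
    have h1 : Continuous fun r => 2 * max (A.α t) (A.α r) * exp (D.C * |r - t|) := by fun_prop
    simpa using (h1.tendsto t).mono_left nhdsWithin_le_nhds
  have hboth : ∀ r, r ≠ t → 2 * min (A.α t) (A.α r) * exp (-(D.C * |r - t|)) ≤ slope A.B t r ∧
      slope A.B t r ≤ 2 * max (A.α t) (A.α r) * exp (D.C * |r - t|) := by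
    intro r hr
    have hw : ∀ s q, s < q → 2 * min (A.α s) (A.α q) * exp (-(D.C * |q - s|)) ≤ slope A.B s q ∧
        slope A.B s q ≤ 2 * max (A.α s) (A.α q) * exp (D.C * |q - s|) := fun s q h => by
      rw [slope_def_field, abs_of_pos (sub_pos.2 h)]
      obtain ⟨h1, h2⟩ := hb s q h
      exact ⟨le_trans (by gcongr; exact min_le_left _ _) h1,
        h2.trans (by gcongr; exact le_max_right _ _)⟩
    rcases hr.lt_or_gt with h | h
    · rw [slope_comm, min_comm, max_comm, abs_sub_comm]; exact hw r t h
    · exact hw t r h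
  refine tendsto_of_tendsto_of_tendsto_of_le_of_le' hlo hhi ?_ ?_
  · filter_upwards [self_mem_nhdsWithin] with r hr using (hboth r hr).1
  · filter_upwards [self_mem_nhdsWithin] with r hr using (hboth r hr).2

end Approx
end WaveData

/-- A function with negative derivative at the right end or inside cannot be maximal there. -/
theorem not_max_of_deriv_neg {φ : ℝ → ℝ} {a b t d : ℝ} (hat : a < t) (htb : t ≤ b)
    (hd : HasDerivAt φ d t) (hneg : d < 0) : ∃ s ∈ Icc a b, φ t < φ s := by
  have h1 := hd.hasDerivWithinAt (s := Iio t)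
  rw [hasDerivWithinAt_iff_tendsto_slope' (by simp)] at h1
  obtain ⟨s, hs, hs'⟩ := ((h1.eventually_lt_const hneg).and (Ioo_mem_nhdsLT hat)).exists
  refine ⟨s, ⟨hs'.1.le, hs'.2.le.trans htb⟩, ?_⟩
  rw [slope_def_field] at hs
  have h2 : s - t < 0 := by linarith [hs'.2]
  have := (div_lt_iff_of_neg h2).1 hs
  linarith

theorem abs_add_one_add_abs_sub_one {d : ℤ} (hd : d ≠ 0) :
    |(d : ℝ) + 1| + |(d : ℝ) - 1| = 2 * |(d : ℝ)| := by
  rcases lt_or_gt_of_ne hd with h | h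
  · have : (d : ℝ) ≤ -1 := by exact_mod_cast (by omega : d ≤ -1)
    rw [abs_of_nonpos (by linarith), abs_of_nonpos (by linarith), abs_of_nonpos (by linarith)]
    ring
  · have : (1 : ℝ) ≤ d := by exact_mod_cast h
    rw [abs_of_nonneg (by linarith), abs_of_nonneg (by linarith), abs_of_nonneg (by linarith)]
    ring

/-- The concave modulus of continuity used in the two-point maximum principle. -/
def modulus (K ρ h d : ℝ) : ℝ := 4 * K * ρ * (|d| * h) - K * (|d| * h) ^ 2

theorem modulus_add_modulus (K ρ h : ℝ) {d : ℤ} (hd : d ≠ 0) :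
    modulus K ρ h (d + 1) + modulus K ρ h (d - 1) = 2 * modulus K ρ h d - 2 * K * h ^ 2 := by
  simp only [modulus, mul_pow, sq_abs]
  linear_combination 4 * K * ρ * h * abs_add_one_add_abs_sub_one hd

theorem abs_modulus_sub_le {K ρ h d e : ℝ} (hK : 0 ≤ K) (hh : 0 ≤ h) (hd : |d| * h ≤ ρ)
    (he : |e| * h ≤ ρ) (hde : |d - e| ≤ 1) :
    |modulus K ρ h d - modulus K ρ h e| ≤ 4 * K * ρ * h := by
  have h1 : |(|d| - |e|)| ≤ 1 := (abs_abs_sub_abs_le_abs_sub d e).trans hde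
  have h0 : 0 ≤ |d| * h := by positivity
  have h0' : 0 ≤ |e| * h := by positivity
  have e1 : modulus K ρ h d - modulus K ρ h e
      = (|d| - |e|) * (K * h * (4 * ρ - (|d| * h + |e| * h))) := by
    simp only [modulus]; ring
  have h2 : 0 ≤ K * h * (4 * ρ - (|d| * h + |e| * h)) :=
    mul_nonneg (by positivity) (by linarith)
  rw [e1, abs_mul, abs_of_nonneg h2]
  calc _ ≤ 1 * (K * h * (4 * ρ)) := by
        refine mul_le_mul h1 ?_ h2 zero_le_one
        gcongr
        linarith
    _ = _ := by ring

/-- An upper bound for a discrete diffusion in divergence form in terms of one-sided bounds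
for the two increments. -/
theorem diffusion_le {ap am c E h X Y p m V Z : ℝ} (hh : 0 < h) (hc : 0 < c) (hap : c ≤ ap)
    (ham : c ≤ am) (hE : |ap - am| ≤ E * h) (hp : p ≤ X) (hm : m ≤ Y)
    (hX : |X| ≤ V * h) (hXY : X + Y ≤ -(Z * h ^ 2)) (hZ : 0 ≤ Z) :
    (ap * p + am * m) / h ^ 2 ≤ -(c * Z) + E * V := by
  rw [div_le_iff₀ (by positivity)]
  have h1 : ap * p ≤ ap * X := mul_le_mul_of_nonneg_left hp (by linarith)
  have h2 : am * m ≤ am * Y := mul_le_mul_of_nonneg_left hm (by linarith)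
  have h3 : am * (X + Y) ≤ am * (-(Z * h ^ 2)) := mul_le_mul_of_nonneg_left hXY (by linarith)
  have h4 : c * (Z * h ^ 2) ≤ am * (Z * h ^ 2) :=
    mul_le_mul_of_nonneg_right ham (by positivity)
  have h5 : (ap - am) * X ≤ (E * h) * (V * h) := by
    calc _ ≤ |(ap - am) * X| := le_abs_self _
      _ = |ap - am| * |X| := abs_mul _ _
      _ ≤ _ := mul_le_mul hE hX (abs_nonneg _) ((abs_nonneg _).trans hE)
  nlinarith

set_option maxHeartbeats 1000000 in
/-- Two-point maximum principle for a discrete parabolic equation on a finite window. -/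
theorem two_point {q ap am f : ℤ → ℝ → ℝ} {h ρ c E F Q K N N' t₁ t₂ : ℝ} {n : ℕ} {i₀ : ℤ}
    (hh : 0 < h) (hρ : n * h = ρ) (ht : t₁ ≤ t₂) (hc : 0 < c) (hN0 : 0 ≤ N)
    (hd : ∀ k t, HasDerivAt (q k) ((ap k t * (q (k + 1) t - q k t)
      + am k t * (q (k - 1) t - q k t)) / h ^ 2 + f k t) t)
    (hb : ∀ k : ℤ, |k - i₀| ≤ 2 * n → ∀ t ∈ Icc t₁ t₂, |q k t| ≤ Q ∧ c ≤ ap k t ∧ c ≤ am k t ∧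
      |ap k t - am k t| ≤ E * h ∧ |f k t| ≤ F)
    (hN : 2 * Q ≤ N * ρ ^ 2) (hN' : 2 * Q ≤ N' * (t₂ - t₁)) (hEρ : 16 * (E * ρ) ≤ c)
    (hKN : N ≤ K) (hK : 3 * N * c + 2 * F + N' < 3 * K * c) :
    ∀ d : ℤ, |d| ≤ n → q i₀ t₂ - q (i₀ - d) t₂ ≤ modulus K ρ h d := by
  have hK0 : 0 ≤ K := hN0.trans hKN
  have hρ0 : 0 ≤ ρ := by rw [← hρ]; positivity
  set Ψ : ℤ × ℤ → ℝ → ℝ := fun p t => q p.1 t - q (p.1 - p.2) t - modulus K ρ h p.2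
    - N * ((p.1 - i₀) * h) ^ 2 - N' * (t₂ - t) with hΨ
  set I : Finset (ℤ × ℤ) := Finset.Icc (i₀ - n) (i₀ + n) ×ˢ Finset.Icc (-(n : ℤ)) n with hI
  have hmem : ∀ i d : ℤ, (i, d) ∈ I ↔ |i - i₀| ≤ n ∧ |d| ≤ n := by
    intro i d
    simp only [hI, Finset.mem_product, Finset.mem_Icc, abs_le]
    constructor <;> rintro ⟨⟨_, _⟩, _, _⟩ <;> refine ⟨⟨?_, ?_⟩, ?_, ?_⟩ <;> omega
  have hcont : ∀ p, Continuous (Ψ p) := by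
    intro p
    have c1 : ∀ k, Continuous (q k) := fun k =>
      continuous_iff_continuousAt.2 fun t => (hd k t).continuousAt
    simp only [hΨ]; fun_prop
  choose τ hτ hτmax using fun p => isCompact_Icc.exists_isMaxOn (nonempty_Icc.2 ht)
    (hcont p).continuousOn
  have hne : I.Nonempty := ⟨(i₀, 0), (hmem _ _).2 ⟨by simp, by simp⟩⟩
  obtain ⟨⟨i, d⟩, hid, hmax⟩ := I.exists_max_image (fun p => Ψ p (τ p)) hne
  have hmax' : ∀ p ∈ I, ∀ t ∈ Icc t₁ t₂, Ψ p t ≤ Ψ (i, d) (τ (i, d)) := fun p hp t ht =>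
    (hτmax p ht).trans (hmax p hp)
  suffices hle : Ψ (i, d) (τ (i, d)) ≤ 0 by
    intro e he
    have := (hmax' (i₀, e) ((hmem _ _).2 ⟨by simp, he⟩) t₂ ⟨ht, le_rfl⟩).trans hle
    simp only [hΨ] at this
    nlinarith
  by_contra! hpos
  set t := τ (i, d)
  have htI : t ∈ Icc t₁ t₂ := hτ _
  obtain ⟨hi, hdn⟩ := (hmem _ _).1 hid
  have hi' : |(i : ℝ) - i₀| ≤ n := by exact_mod_cast hi
  have hd' : |(d : ℝ)| ≤ n := by exact_mod_cast hdn
  obtain ⟨hqi, bi1, bi2, bi3, bi4⟩ := hb i (by omega) t htI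
  have hjw : |i - d - i₀| ≤ 2 * n := by
    rw [abs_le] at hi hdn ⊢; omega
  obtain ⟨hqj, bj1, bj2, bj3, bj4⟩ := hb (i - d) hjw t htI
  rw [abs_le] at hqi hqj bi4 bj4
  have hdρ : |(d : ℝ)| * h ≤ ρ := by rw [← hρ]; gcongr
  have hmod0 : 0 ≤ modulus K ρ h d := by
    have h0 : 0 ≤ |(d : ℝ)| * h := by positivity
    simp only [modulus]
    nlinarith [mul_nonneg (mul_nonneg hK0 h0) (sub_nonneg.2 hdρ), mul_nonneg (mul_nonneg hK0 h0) hρ0]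
  have hNi : 0 ≤ N * (((i : ℝ) - i₀) * h) ^ 2 := by positivity
  have hN'0 : 0 ≤ N' * (t₂ - t) := by
    rcases eq_or_lt_of_le (htI.2) with h | h
    · rw [h]; simp
    · have : 0 < t₂ - t₁ := by linarith [htI.1]
      exact mul_nonneg (nonneg_of_mul_nonneg_left (by linarith : 0 ≤ N' * (t₂ - t₁)) this)
        (by linarith)
  have hpos' : 0 < q i t - q (i - d) t - modulus K ρ h d - N * (((i : ℝ) - i₀) * h) ^ 2
    - N' * (t₂ - t) := hpos
  have hd0 : d ≠ 0 := by
    rintro rfl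
    simp only [sub_zero] at hpos'
    linarith
  have hilt : |i - i₀| < n := by
    refine lt_of_le_of_ne hi fun he => ?_
    have he' : |(i : ℝ) - i₀| = n := by exact_mod_cast he
    have : (((i : ℝ) - i₀) * h) ^ 2 = ρ ^ 2 := by rw [mul_pow, ← sq_abs, he', ← hρ, mul_pow]
    rw [this] at hpos'
    linarith
  have hdlt : |d| < n := by
    refine lt_of_le_of_ne hdn fun he => ?_
    have he' : |(d : ℝ)| = n := by exact_mod_cast he
    have : modulus K ρ h d = 3 * K * ρ ^ 2 := by simp only [modulus, he', hρ]; ring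
    rw [this] at hpos'
    nlinarith [mul_le_mul_of_nonneg_right hKN (sq_nonneg ρ)]
  have htlt : t₁ < t := by
    refine lt_of_le_of_ne htI.1 fun he => ?_
    rw [← he] at hpos' hqi hqj
    linarith
  have hn1 : |(i : ℝ) - i₀| + 1 ≤ n := by exact_mod_cast hilt
  have hn2 : |(d : ℝ)| + 1 ≤ n := by exact_mod_cast hdlt
  have hd1 : |(d : ℝ) + 1| * h ≤ ρ := by
    rw [← hρ]; gcongr; exact ((abs_add_le _ _).trans (by simp)).trans hn2
  have hd2 : |(d : ℝ) - 1| * h ≤ ρ := by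
    rw [← hρ]; gcongr; exact ((abs_sub _ _).trans (by simp)).trans hn2
  have m1 := hmax' (i + 1, d + 1) ((hmem _ _).2 (by rw [abs_lt] at *; constructor <;> rw [abs_le] <;> omega)) t htI
  have m2 := hmax' (i - 1, d - 1) ((hmem _ _).2 (by rw [abs_lt] at *; constructor <;> rw [abs_le] <;> omega)) t htI
  have m3 := hmax' (i, d - 1) ((hmem _ _).2 (by rw [abs_lt] at *; constructor <;> rw [abs_le] <;> omega)) t htI
  have m4 := hmax' (i, d + 1) ((hmem _ _).2 (by rw [abs_lt] at *; constructor <;> rw [abs_le] <;> omega)) t htI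
  simp only [hΨ] at m1 m2 m3 m4
  push_cast at m1 m2 m3 m4
  rw [show i + 1 - (d + 1) = i - d by ring] at m1
  rw [show i - 1 - (d - 1) = i - d by ring] at m2
  rw [show i - (d - 1) = i - d + 1 by ring] at m3
  rw [show i - (d + 1) = i - d - 1 by ring] at m4
  have hmm := modulus_add_modulus K ρ h hd0
  have hs1 := abs_modulus_sub_le (K := K) (e := d) hK0 hh.le hd1 hdρ (by simp)
  have hs2 := abs_modulus_sub_le (K := K) (e := d) hK0 hh.le hd2 hdρ (by simp)
  have hquad : |N * ((((i : ℝ) + 1 - i₀) * h) ^ 2 - (((i : ℝ) - i₀) * h) ^ 2)| ≤ 2 * N * ρ * h := by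
    have : N * ((((i : ℝ) + 1 - i₀) * h) ^ 2 - (((i : ℝ) - i₀) * h) ^ 2)
      = N * h * h * (2 * (i - i₀) + 1) := by ring
    rw [this, abs_mul, abs_of_nonneg (by positivity)]
    have : |2 * ((i : ℝ) - i₀) + 1| ≤ 2 * n := by
      rw [abs_le] at *
      have := abs_le.1 (show |(i : ℝ) - i₀| ≤ n - 1 by linarith)
      constructor <;> linarith
    calc _ ≤ N * h * h * (2 * n) := by gcongr
      _ = _ := by rw [← hρ]; ring
  have k1 := diffusion_le (V := 4 * K * ρ + 2 * N * ρ) (Z := 2 * (K - N)) hh hc bi1 bi2 bi3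
    (p := q (i + 1) t - q i t) (m := q (i - 1) t - q i t)
    (X := (modulus K ρ h (d + 1) - modulus K ρ h d)
      + N * ((((i : ℝ) + 1 - i₀) * h) ^ 2 - (((i : ℝ) - i₀) * h) ^ 2))
    (Y := (modulus K ρ h (d - 1) - modulus K ρ h d)
      + N * ((((i : ℝ) - 1 - i₀) * h) ^ 2 - (((i : ℝ) - i₀) * h) ^ 2))
    (by linarith) (by linarith) ((abs_add_le _ _).trans (by linarith)) (by linarith)
    (by linarith)
  have k2 := diffusion_le (V := 4 * K * ρ) (Z := 2 * K) hh hc bj1 bj2 bj3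
    (p := -(q (i - d + 1) t - q (i - d) t)) (m := -(q (i - d - 1) t - q (i - d) t))
    (X := modulus K ρ h (d - 1) - modulus K ρ h d)
    (Y := modulus K ρ h (d + 1) - modulus K ρ h d)
    (by linarith) (by linarith) hs2 (by linarith) (by linarith)
  have hder := (((((hd i t).sub (hd (i - d) t)).sub_const (modulus K ρ h d)).sub_const
    (N * (((i : ℝ) - i₀) * h) ^ 2)).sub (((hasDerivAt_id t).const_sub t₂).const_mul N'))
  obtain ⟨s, hs, hs'⟩ := not_max_of_deriv_neg htlt htI.2 hder (by
    have e1 : (ap (i - d) t * -(q (i - d + 1) t - q (i - d) t)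
      + am (i - d) t * -(q (i - d - 1) t - q (i - d) t)) / h ^ 2 =
      -((ap (i - d) t * (q (i - d + 1) t - q (i - d) t)
      + am (i - d) t * (q (i - d - 1) t - q (i - d) t)) / h ^ 2) := by ring
    rw [e1] at k2
    have b1 : E * ρ * (8 * K + 2 * N) ≤ c / 16 * (8 * K + 2 * N) :=
      mul_le_mul_of_nonneg_right (by linarith) (by positivity)
    have b3 : c * N ≤ c * K := mul_le_mul_of_nonneg_left hKN hc.le
    have b4 : 0 ≤ c * N := mul_nonneg hc.le hN0
    linarith [bi4.2, bj4.1])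
  exact absurd (hmax' (i, d) hid s hs) (not_le.2 hs')

/-- Uniform bound for the discrete gradient of solutions of a discrete parabolic equation. -/
theorem exists_step_bound {ρ τ c E F Q : ℝ} (hρ : 0 < ρ) (hτ : 0 < τ) (hc : 0 < c) (hE : 0 ≤ E)
    (hF : 0 ≤ F) (hQ : 0 ≤ Q) :
    ∃ Λ, 0 ≤ Λ ∧ ∃ h₀ > 0, ∀ (q ap am f : ℤ → ℝ → ℝ) (h : ℝ) (i₀ : ℤ) (t : ℝ), 0 < h → h ≤ h₀ →
      (∀ k t, HasDerivAt (q k) ((ap k t * (q (k + 1) t - q k t)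
        + am k t * (q (k - 1) t - q k t)) / h ^ 2 + f k t) t) →
      (∀ k : ℤ, |(k : ℝ) - i₀| * h ≤ ρ → ∀ s ∈ Icc (t - τ) t, |q k s| ≤ Q ∧ c ≤ ap k s ∧
        c ≤ am k s ∧ |ap k s - am k s| ≤ E * h ∧ |f k s| ≤ F) →
      |q (i₀ + 1) t - q i₀ t| ≤ Λ * h := by
  set r := min (ρ / 2) (c / (16 * (E + 1)))
  have hr0 : 0 < r := lt_min (by linarith) (by positivity)
  set N := 2 * Q / (r / 2) ^ 2 with hN
  set N' := 2 * Q / τ with hN'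
  set K := N + (2 * F + N') / (3 * c) + 1 with hK
  have hN0 : 0 ≤ N := by positivity
  have hK0 : 0 ≤ K := by positivity
  refine ⟨4 * K * r, by positivity, r / 2, by linarith, ?_⟩
  intro q ap am f h i₀ t hh hh0 hd hb
  set n := ⌊r / h⌋₊
  have hn1 : n * h ≤ r := by
    rw [← le_div_iff₀ hh]; exact Nat.floor_le (by positivity)
  have hn2 : r / 2 ≤ n * h := by
    have := Nat.lt_floor_add_one (r / h)
    rw [div_lt_iff₀ hh] at this
    nlinarith
  have hn0 : 1 ≤ n := by
    rw [Nat.one_le_iff_ne_zero]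
    intro h0
    rw [h0] at hn2; simp at hn2; linarith
  have key : ∀ p : ℤ → ℝ → ℝ, ∀ f' : ℤ → ℝ → ℝ,
      (∀ k t, HasDerivAt (p k) ((ap k t * (p (k + 1) t - p k t)
        + am k t * (p (k - 1) t - p k t)) / h ^ 2 + f' k t) t) →
      (∀ k s, |p k s| = |q k s|) → (∀ k s, |f' k s| = |f k s|) →
      p i₀ t - p (i₀ + 1) t ≤ 4 * K * r * h := by
    intro p f' hp hpa hfa
    have hEρ : 16 * (E * (n * h)) ≤ c := by
      have h1 : n * h ≤ c / (16 * (E + 1)) := hn1.trans (min_le_right _ _)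
      rw [le_div_iff₀ (by positivity)] at h1
      nlinarith
    have := two_point (q := p) (ap := ap) (am := am) (f := f') (h := h) (ρ := n * h) (c := c) (E := E)
      (F := F) (Q := Q) (K := K) (N := N) (N' := N') (t₁ := t - τ) (t₂ := t) (n := n) (i₀ := i₀)
      hh rfl (by linarith) hc hN0 hp (fun k hk s hs => by
        rw [hpa, hfa]
        refine hb k ?_ s hs
        have : |(k : ℝ) - i₀| ≤ 2 * n := by exact_mod_cast hk
        calc _ ≤ 2 * n * h := by gcongr
          _ ≤ 2 * r := by linarith
          _ ≤ ρ := by linarith [min_le_left (ρ / 2) (c / (16 * (E + 1)))])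
      (by
        have : N * (r / 2) ^ 2 = 2 * Q := by rw [hN]; field_simp
        rw [← this]; gcongr)
      (by rw [hN']; apply le_of_eq; field_simp; ring) hEρ
      (by rw [hK]; have : 0 ≤ (2 * F + N') / (3 * c) := by positivity
          linarith)
      (by
        have : (2 * F + N') / (3 * c) * (3 * c) = 2 * F + N' := by field_simp
        rw [hK]; nlinarith)
      (-1) (by simpa using hn0)
    rw [sub_neg_eq_add] at this
    refine this.trans ?_
    simp only [modulus]
    push_cast
    rw [abs_neg, abs_one]
    nlinarith [mul_nonneg hK0 (sq_nonneg h), mul_le_mul_of_nonneg_left hn1 (mul_nonneg hK0 hh.le)]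
  rw [abs_le]
  constructor
  · have := key q f hd (fun _ _ => rfl) (fun _ _ => rfl)
    linarith
  · have := key (fun k s => -q k s) (fun k s => -f k s)
      (fun k s => (hd k s).neg.congr_deriv (by ring)) (fun _ _ => abs_neg _) (fun _ _ => abs_neg _)
    linarith

lemma abs_sub_le_of_step_Ico {a : ℤ → ℝ} {K : ℝ} {i j : ℤ} (hij : i ≤ j)
    (h : ∀ m, i ≤ m → m < j → |a (m + 1) - a m| ≤ K) : |a j - a i| ≤ K * (j - i) := by
  induction j, hij using Int.leInduction with
  | base => simp
  | succ j hij ih =>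
    have h1 := ih fun m h1 h2 => h m h1 (by omega)
    have h2 := h j hij (by omega)
    have := abs_sub_le (a (j + 1)) (a j) (a i)
    push_cast
    linarith

namespace WaveData

variable {D : WaveData}

lemma abs_deriv_g_le (x : ℝ) {u : ℝ} (hu : u ∈ Icc 0 D.M) : |deriv (D.g x) u| ≤ D.L := by
  refine norm_deriv_le_of_lip' (f := D.g x) (x₀ := u) D.L_pos.le ?_
  have : Icc (-1) (D.M + 1) ∈ 𝓝 u := Icc_mem_nhds (by linarith [hu.1]) (by linarith [hu.2])
  filter_upwards [this] with v hv
  exact D.lip x v hv u (mem_of_mem_nhds this)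

namespace Approx

variable (A : D.Approx)

/-- The time derivative of the lattice waves. -/
def W (k : ℕ) (i : ℤ) (t : ℝ) : ℝ := lap (A.h k) (fun j => Phi (A.σ k) (A.u k j t)) i
  + D.G (A.σ k) (i * A.h k) (A.u k i t)

/-- The diffusivity along the lattice waves. -/
def diffu (k : ℕ) (i : ℤ) (t : ℝ) : ℝ := 2 * A.u k i t + 2 * A.σ k ^ 2

lemma hasDerivAt_u (k : ℕ) (i : ℤ) (t : ℝ) : HasDerivAt (A.u k i) (A.W k i t) t :=
  ((A.wave k).sol t i).2

lemma σ_mem (k : ℕ) : 0 < A.σ k ∧ A.σ k ≤ 1 :=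
  ⟨(A.wave k).mesh.1, (A.wave k).mesh.2.1.trans D.σ₀_le⟩

lemma hasDerivAt_Phi (k : ℕ) (i : ℤ) (t : ℝ) :
    HasDerivAt (fun s => Phi (A.σ k) (A.u k i s)) (A.diffu k i t * A.W k i t) t := by
  have h := A.hasDerivAt_u k i t
  refine ((h.fun_pow 2).add (h.const_mul (2 * A.σ k ^ 2))).congr_deriv ?_
  simp only [diffu]
  push_cast
  ring

lemma diffu_abs_le (k : ℕ) (i : ℤ) (t : ℝ) : |A.diffu k i t| ≤ 2 * D.M + 2 := by
  have h := (A.wave k).mem i t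
  have hs := A.σ_mem k
  rw [diffu, abs_of_nonneg (by nlinarith [h.1])]
  nlinarith [h.2]

lemma diffu_step (k : ℕ) (i : ℤ) (t : ℝ) :
    |A.diffu k (i + 1) t - A.diffu k i t| ≤ 2 * D.S * A.h k := by
  have := (A.wave k).step_le i t
  rw [show A.diffu k (i + 1) t - A.diffu k i t = 2 * (A.u k (i + 1) t - A.u k i t) by
    simp only [diffu]; ring, abs_mul, abs_two]
  linarith

lemma le_diffu {k : ℕ} {i : ℤ} {t c : ℝ} (h : c ≤ A.u k i t) : 2 * c ≤ A.diffu k i t := by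
  rw [diffu]; nlinarith [sq_nonneg (A.σ k)]

/-- Interior bound for the time derivative of the lattice waves. -/
lemma exists_W_bound {c R τ : ℝ} (hc : 0 < c) (hR : 0 < R) (hτ : 0 < τ) :
    ∃ C, 0 ≤ C ∧ ∃ h₀ > 0, ∀ (k : ℕ) (i : ℤ) (t : ℝ), A.h k ≤ h₀ →
      (∀ j : ℤ, |(j : ℝ) - i| * A.h k ≤ R → ∀ s ∈ Icc (t - τ) t, c ≤ A.u k j s) →
      |A.W k i t| ≤ C := by
  have hM := D.M_pos
  have hL := D.L_pos
  have hS := D.S_pos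
  obtain ⟨Λ, hΛ, h₀, hh₀, key⟩ := exists_step_bound (ρ := R / 2) (τ := τ) (c := 2 * c)
    (E := 2 * D.S) (F := (2 * D.M + 2) * (D.L + (D.L + 1) * D.S) + 2 * D.S * ((D.L + 1) * D.M))
    (Q := (2 * D.M + 2) * D.S) (by linarith) hτ (by linarith) (by positivity) (by positivity)
    (by positivity)
  refine ⟨Λ + (D.L + 1) * D.M, by positivity, min h₀ (R / 2), lt_min hh₀ (by linarith), ?_⟩
  intro k i t hk hpos
  have hh := A.h_pos k
  have w := A.wave k
  have h1 := key
    (fun j s => (Phi (A.σ k) (A.u k (j + 1) s) - Phi (A.σ k) (A.u k j s)) / A.h k)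
    (fun j s => A.diffu k (j + 1) s) (A.diffu k)
    (fun j s => (A.diffu k (j + 1) s * D.G (A.σ k) ((j + 1 : ℤ) * A.h k) (A.u k (j + 1) s)
      - A.diffu k j s * D.G (A.σ k) (j * A.h k) (A.u k j s)) / A.h k)
    (A.h k) (i - 1) t hh (hk.trans (min_le_left _ _))
    (fun j s => by
      refine (((A.hasDerivAt_Phi k (j + 1) s).sub (A.hasDerivAt_Phi k j s)).div_const
        (A.h k)).congr_deriv ?_
      simp only [W, lap, sub_add_cancel, add_sub_cancel_right]
      field_simp
      ring)
    (fun j hj s hs => by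
      have hj2 : |((j + 1 : ℤ) : ℝ) - i| * A.h k ≤ R := by
        push_cast at hj ⊢
        rw [show (j : ℝ) + 1 - i = j - (i - 1) by ring]
        linarith
      have hj1 : |(j : ℝ) - i| * A.h k ≤ R := by
        push_cast at hj
        have : |(j : ℝ) - i| ≤ |(j : ℝ) - (i - 1)| + 1 := by
          rw [show (j : ℝ) - i = (j - (i - 1)) - 1 by ring]
          exact (abs_sub _ _).trans (by simp)
        have h3 : A.h k ≤ R / 2 := hk.trans (min_le_right _ _)
        nlinarith
      refine ⟨?_, A.le_diffu (hpos _ hj2 s hs), A.le_diffu (hpos _ hj1 s hs),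
        A.diffu_step k j s, ?_⟩
      · rw [abs_div, abs_of_pos hh, div_le_iff₀ hh]
        have e1 := Phi_step w.mesh (w.mem (j + 1) s) (w.mem j s)
        have e2 := w.step_le j s
        calc _ ≤ (2 * D.M + 2) * (D.S * A.h k) := e1.trans (by gcongr)
          _ = _ := by ring
      · rw [abs_div, abs_of_pos hh, div_le_iff₀ hh]
        have e1 := A.G_lip_lattice k s (j + 1) j
        rw [show ((j + 1 : ℤ) : ℝ) * A.h k - j * A.h k = A.h k by push_cast; ring,
          abs_of_pos hh] at e1
        have e2 := A.diffu_abs_le k (j + 1) s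
        have e3 := G_abs_le_Icc w.mesh (x := j * A.h k) (w.mem j s)
        have e4 := A.diffu_step k j s
        rw [show ∀ a b x y : ℝ, a * x - b * y = a * (x - y) + (a - b) * y from
          fun _ _ _ _ => by ring]
        refine (abs_add_le _ _).trans ?_
        rw [abs_mul, abs_mul, add_mul]
        refine add_le_add ?_ ?_
        · calc _ ≤ (2 * D.M + 2) * ((D.L + (D.L + 1) * D.S) * A.h k) := by gcongr
            _ = _ := by ring
        · calc _ ≤ (2 * D.S * A.h k) * ((D.L + 1) * D.M) := by gcongr
            _ = _ := by ring)
  have h2 : lap (A.h k) (fun j => Phi (A.σ k) (A.u k j t)) i = ((Phi (A.σ k) (A.u k (i + 1) t)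
      - Phi (A.σ k) (A.u k i t)) / A.h k - (Phi (A.σ k) (A.u k i t)
      - Phi (A.σ k) (A.u k (i - 1) t)) / A.h k) / A.h k := by
    rw [lap]; field_simp; ring
  simp only [sub_add_cancel] at h1
  rw [W, h2]
  refine (abs_add_le _ _).trans (add_le_add ?_ (G_abs_le_Icc w.mesh (w.mem i t)))
  rw [abs_div, abs_of_pos hh, div_le_iff₀ hh]
  exact h1

/-- Interior Lipschitz bound in space for the time derivative of the lattice waves. -/
lemma exists_W_step {c R τ : ℝ} (hc : 0 < c) (hR : 0 < R) (hτ : 0 < τ) :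
    ∃ Λ, 0 ≤ Λ ∧ ∃ h₀ > 0, ∀ (k : ℕ) (i : ℤ) (t : ℝ), A.h k ≤ h₀ →
      (∀ j : ℤ, |(j : ℝ) - i| * A.h k ≤ R → ∀ s ∈ Icc (t - τ) t, c ≤ A.u k j s) →
      |A.W k (i + 1) t - A.W k i t| ≤ Λ * A.h k := by
  have hM := D.M_pos
  have hL := D.L_pos
  have hS := D.S_pos
  obtain ⟨C, hC, h₁, hh₁, hW⟩ := A.exists_W_bound (c := c) (R := R / 2) (τ := τ / 2) hc
    (by linarith) (by linarith)
  obtain ⟨Λ, hΛ, h₀, hh₀, key⟩ := exists_step_bound (ρ := R / 2) (τ := τ / 2) (c := 2 * c)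
    (E := 0) (F := 2 * C ^ 2 + (2 * D.M + 2) * ((D.L + 1) * C))
    (Q := (2 * D.M + 2) * C) (by linarith) (by linarith) (by linarith) le_rfl (by positivity)
    (by positivity)
  refine ⟨(Λ + 2 * D.S * C) / (2 * c), by positivity, min (min h₀ h₁) (R / 2),
    lt_min (lt_min hh₀ hh₁) (by linarith), ?_⟩
  intro k i t hk hpos
  have hk0 := hk.trans ((min_le_left _ _).trans (min_le_left _ _))
  have hk1 := hk.trans ((min_le_left _ _).trans (min_le_right _ _))
  have hkR := hk.trans (min_le_right _ _)
  have hh := A.h_pos k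
  have w := A.wave k
  have hWb : ∀ j : ℤ, |(j : ℝ) - i| * A.h k ≤ R / 2 → ∀ s ∈ Icc (t - τ / 2) t,
      |A.W k j s| ≤ C := by
    intro j hj s hs
    refine hW k j s hk1 fun m hm r hr => hpos m ?_ r ⟨by linarith [hs.1, hr.1], hr.2.trans hs.2⟩
    have := abs_sub_le (m : ℝ) j i
    nlinarith
  have h1 := key (fun j s => A.diffu k j s * A.W k j s) (A.diffu k) (A.diffu k)
    (fun j s => 2 * A.W k j s ^ 2 + A.diffu k j s
      * ((deriv (D.g (j * A.h k)) (A.u k j s) + A.σ k) * A.W k j s))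
    (A.h k) i t hh hk0
    (fun j s => by
      have d1 : HasDerivAt (A.diffu k j) (2 * A.W k j s) s :=
        ((A.hasDerivAt_u k j s).const_mul 2).add_const _
      have d2 := hasDerivAt_lap (h := A.h k) (fun m => A.hasDerivAt_Phi k m s) j
      have d3 : HasDerivAt (fun r => D.G (A.σ k) (j * A.h k) (A.u k j r))
          ((deriv (D.g (j * A.h k)) (A.u k j s) + A.σ k) * A.W k j s) s := by
        have e1 := (D.g_diff (j * A.h k) (A.u k j s)).hasDerivAt
        have e2 := (e1.comp s (A.hasDerivAt_u k j s)).add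
          ((A.hasDerivAt_u k j s).const_mul (A.σ k))
        refine e2.congr_deriv ?_
        ring
      have d4 : HasDerivAt (A.W k j) _ s := d2.add d3
      refine (d1.mul d4).congr_deriv ?_
      simp only [lap]
      ring)
    (fun j hj s hs => by
      have a1 := hWb j hj s hs
      have a2 := A.diffu_abs_le k j s
      have a3 := A.le_diffu (hpos j (by linarith) s ⟨by linarith [hs.1], hs.2⟩)
      have a4 : |deriv (D.g (j * A.h k)) (A.u k j s) + A.σ k| ≤ D.L + 1 := by
        refine (abs_add_le _ _).trans (add_le_add (abs_deriv_g_le _ (w.mem j s)) ?_)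
        rw [abs_of_pos (A.σ_mem k).1]
        exact (A.σ_mem k).2
      refine ⟨?_, a3, a3, by simp, ?_⟩
      · rw [abs_mul]; gcongr
      · refine (abs_add_le _ _).trans ?_
        rw [abs_mul, abs_mul, abs_mul, abs_pow, abs_two]
        gcongr)
  have b0 : |(i : ℝ) - i| * A.h k ≤ R / 2 := by simp; linarith
  have b1 : |((i + 1 : ℤ) : ℝ) - i| * A.h k ≤ R := by simp; linarith
  have ht : t ∈ Icc (t - τ) t := ⟨by linarith, le_rfl⟩
  have c1 := A.le_diffu (hpos (i + 1) b1 t ht)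
  have c2 := hWb i b0 t ⟨by linarith, le_rfl⟩
  have c3 := A.diffu_step k i t
  have c4 : A.diffu k (i + 1) t * (A.W k (i + 1) t - A.W k i t) =
      (A.diffu k (i + 1) t * A.W k (i + 1) t - A.diffu k i t * A.W k i t)
      - (A.diffu k (i + 1) t - A.diffu k i t) * A.W k i t := by ring
  have c5 : |A.diffu k (i + 1) t * (A.W k (i + 1) t - A.W k i t)|
      ≤ Λ * A.h k + (2 * D.S * A.h k) * C := by
    rw [c4]
    refine (abs_sub _ _).trans (add_le_add h1 ?_)
    rw [abs_mul]
    gcongr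
  rw [abs_mul, abs_of_nonneg (by linarith : 0 ≤ A.diffu k (i + 1) t)] at c5
  have c6 : 2 * c * |A.W k (i + 1) t - A.W k i t| ≤ (Λ + 2 * D.S * C) * A.h k := by
    nlinarith [abs_nonneg (A.W k (i + 1) t - A.W k i t)]
  rw [div_mul_eq_mul_div, le_div_iff₀ (by positivity)]
  linarith

/-- Mixed Lipschitz estimate for the limiting wave inside its support. -/
theorem exists_mixed_lipschitz {x₀ t₀ : ℝ} (h0 : 0 < A.U x₀ t₀) :
    ∃ R > 0, ∃ t₁ < t₀, ∃ Λ, 0 ≤ Λ ∧ ∀ x z s t, |x - x₀| ≤ R → |z - x₀| ≤ R → t₁ ≤ s → t₁ ≤ t →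
      |(A.U z t - A.U z s) - (A.U x t - A.U x s)| ≤ Λ * |z - x| * |t - s| := by
  have hS := D.S_pos
  obtain ⟨t', ht', hlt⟩ := (((A.continuous_U_t x₀).continuousAt (x := t₀)).eventually
    (eventually_gt_nhds h0)).filter_mono nhdsWithin_le_nhds |>.and
    (self_mem_nhdsWithin : Iio t₀ ∈ 𝓝[<] t₀) |>.exists
  set c := A.U x₀ t' / 3 with hc
  have hc0 : 0 < c := by simp only [hc]; linarith
  set R := c / D.S with hR
  have hR0 : 0 < R := by positivity
  set τ := (t₀ - t') / 2 with hτ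
  have hτ0 : 0 < τ := by simp only [hτ]; linarith
  obtain ⟨Λ, hΛ, h₀, hh₀, key⟩ := A.exists_W_step (c := c) (R := R / 2) hc0 (by linarith) hτ0
  refine ⟨R / 4, by linarith, t' + τ, by linarith, Λ, hΛ, ?_⟩
  have main : ∀ x z s t, x ≤ z → s ≤ t → |x - x₀| ≤ R / 4 → |z - x₀| ≤ R / 4 → t' + τ ≤ s →
      |(A.U z t - A.U z s) - (A.U x t - A.U x s)| ≤ Λ * (z - x) * (t - s) := by
    intro x z s t hxz hst hx hz hs
    have hU := fun (y r : ℝ) => A.tendsto_U_floor y r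
    have l1 := (((hU z t).sub (hU z s)).sub ((hU x t).sub (hU x s))).abs
    have l2 := (((A.tendsto_floor z).sub (A.tendsto_floor x)).const_mul Λ).mul_const (t - s)
    refine le_of_tendsto_of_tendsto l1 l2 ?_
    have hh : ∀ᶠ k in (𝒱 : Filter ℕ), A.h k < min h₀ (R / 4) :=
      (A.tendsto_h).eventually_lt_const (lt_min hh₀ (by linarith))
    have hpos : ∀ᶠ k in (𝒱 : Filter ℕ), 2 * c < A.u k ⌊x₀ * A.N k⌋ t' :=
      (hU x₀ t').eventually_const_lt (by simp only [hc]; linarith)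
    filter_upwards [hh, hpos] with k hk hpk
    have w := A.wave k
    have hkp := A.h_pos k
    have hk0 : A.h k ≤ h₀ := hk.le.trans (min_le_left _ _)
    have hk1 : A.h k < R / 4 := hk.trans_le (min_le_right _ _)
    set i₀ := ⌊x₀ * A.N k⌋
    have hP : ∀ j : ℤ, |(j : ℝ) - i₀| * A.h k ≤ R → ∀ r, t' ≤ r → c ≤ A.u k j r := by
      intro j hj r hr
      have e1 := w.lip_x i₀ j t'
      rw [abs_sub_comm (i₀ * A.h k), ← sub_mul, abs_mul, abs_of_pos hkp] at e1
      have e2 := mul_le_mul_of_nonneg_left hj hS.le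
      have e3 : D.S * R = c := by rw [hR]; field_simp
      have e4 := w.mono j hr
      linarith [le_abs_self (A.u k i₀ t' - A.u k j t')]
    have hWs : ∀ j : ℤ, |(j : ℝ) - i₀| * A.h k ≤ R / 2 → ∀ r, t' + τ ≤ r →
        |A.W k (j + 1) r - A.W k j r| ≤ Λ * A.h k := by
      intro j hj r hr
      refine key k j r hk0 fun m hm q hq => hP m ?_ q (by linarith [hq.1])
      have := abs_sub_le (m : ℝ) j i₀
      nlinarith
    have hxl := A.lt_floor k x
    have hzf := A.floor_le k z
    have h0f := A.floor_le k x₀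
    have h0l := A.lt_floor k x₀
    have hij : ⌊x * A.N k⌋ ≤ ⌊z * A.N k⌋ := A.floor_mono k hxz
    have := abs_sub_le_of_step_Ico (a := fun j => A.u k j t - A.u k j s)
      (K := Λ * A.h k * (t - s)) hij (fun m hm1 hm2 => by
        have f1 : (⌊x * A.N k⌋ : ℝ) * A.h k ≤ m * A.h k := by gcongr
        have f2 : (m : ℝ) * A.h k ≤ ⌊z * A.N k⌋ * A.h k := by gcongr
        have hm : |(m : ℝ) - i₀| * A.h k ≤ R / 2 := by
          rw [show |(m : ℝ) - i₀| * A.h k = |((m : ℝ) - i₀) * A.h k| by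
            rw [abs_mul, abs_of_pos hkp], abs_le, sub_mul]
          rw [abs_le] at hx hz
          constructor <;> linarith
        have mv := (convex_Icc s t).norm_image_sub_le_of_norm_hasDerivWithin_le
          (f := fun r => A.u k (m + 1) r - A.u k m r) (C := Λ * A.h k)
          (fun r _ => ((A.hasDerivAt_u k (m + 1) r).sub
            (A.hasDerivAt_u k m r)).hasDerivWithinAt)
          (fun r hr => hWs m hm r (hs.trans hr.1)) (left_mem_Icc.2 hst) (right_mem_Icc.2 hst)
        rw [norm_eq_abs, norm_eq_abs, abs_of_nonneg (by linarith : 0 ≤ t - s)] at mv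
        refine le_trans (le_of_eq ?_) mv
        congr 1
        ring)
    refine this.trans (le_of_eq ?_)
    ring
  intro x z s t hx hz hs ht
  wlog hxz : x ≤ z generalizing x z
  · have := this z x hz hx (le_of_not_ge hxz)
    rwa [abs_sub_comm z x, abs_sub_comm (A.U z t - A.U z s)]
  wlog hst : s ≤ t generalizing s t
  · have := this t s ht hs (le_of_not_ge hst)
    rw [abs_sub_comm t s]
    convert this using 1
    rw [← abs_neg]
    congr 1
    ring
  rw [abs_of_nonneg (sub_nonneg.2 hxz), abs_of_nonneg (sub_nonneg.2 hst)]
  exact main x z s t hxz hst hx hz hs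

end Approx

end WaveData

/-- The symmetric second difference. -/
def secondDiff (ψ : ℝ → ℝ) (y r : ℝ) : ℝ := ψ (y + r) - 2 * ψ y + ψ (y - r)

theorem le_secondDiff {ψ ψ' : ℝ → ℝ} {z h c : ℝ} (hh : 0 ≤ h)
    (hd : ∀ x ∈ Icc (z - h) (z + h), HasDerivAt ψ (ψ' x) x)
    (hm : ∀ a ∈ Icc (z - h) (z + h), ∀ b ∈ Icc (z - h) (z + h), a ≤ b →
      c * (b - a) ≤ ψ' b - ψ' a) : c * h ^ 2 ≤ secondDiff ψ z h := by
  have hF : ∀ s ∈ Icc 0 h, HasDerivAt (fun s => ψ (z + s) + ψ (z - s) - c * s ^ 2)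
      (ψ' (z + s) - ψ' (z - s) - c * (2 * s)) s := by
    intro s hs
    have h1 := (hd (z + s) ⟨by linarith [hs.1], by linarith [hs.2]⟩).comp s
      ((hasDerivAt_id s).const_add z)
    have h2 := (hd (z - s) ⟨by linarith [hs.2], by linarith [hs.1]⟩).comp s
      ((hasDerivAt_id s).const_sub z)
    refine ((h1.add h2).sub (((hasDerivAt_id s).fun_pow 2).const_mul c)).congr_deriv ?_
    simp only [id]; push_cast; ring
  have hmono := monotoneOn_of_deriv_nonneg (convex_Icc 0 h)
    (fun s hs => (hF s hs).continuousAt.continuousWithinAt)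
    (fun s hs => (hF s (interior_subset hs)).differentiableAt.differentiableWithinAt)
    (fun s hs => by
      have hs' := interior_subset hs
      rw [(hF s hs').deriv]
      have := hm (z - s) ⟨by linarith [hs'.2], by linarith [hs'.1]⟩ (z + s)
        ⟨by linarith [hs'.1], by linarith [hs'.2]⟩ (by linarith [hs'.1])
      linarith)
  have := hmono (left_mem_Icc.2 hh) (right_mem_Icc.2 hh) hh
  simp only [add_zero, sub_zero] at this
  rw [secondDiff]
  linarith

theorem abs_secondDiff_moment_sub_le {w : ℝ → ℝ} (hw : Continuous w) {R y r w₀ ε : ℝ}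
    (hr : 0 ≤ r) (h : ∀ x ∈ Icc (y - r) (y + r), |w x - w₀| ≤ ε) :
    |secondDiff (moment w R) y r - w₀ * r ^ 2| ≤ ε * r ^ 2 := by
  have hi : ∀ a b, (-∫ x in b..R, w x) - (-∫ x in a..R, w x) = ∫ x in a..b, w x := by
    intro a b
    have := intervalIntegral.integral_add_adjacent_intervals (hw.intervalIntegrable a b)
      (hw.intervalIntegrable b R) (μ := volume)
    linarith
  have bd : ∀ a ∈ Icc (y - r) (y + r), ∀ b ∈ Icc (y - r) (y + r), a ≤ b →
      (w₀ - ε) * (b - a) ≤ ∫ x in a..b, w x ∧ ∫ x in a..b, w x ≤ (w₀ + ε) * (b - a) := by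
    intro a ha b hb hab
    have hwx : ∀ x ∈ Icc a b, |w x - w₀| ≤ ε := fun x hx =>
      h x ⟨ha.1.trans hx.1, hx.2.trans hb.2⟩
    constructor
    · have := intervalIntegral.integral_mono_on (μ := volume) (f := fun _ => w₀ - ε) hab intervalIntegrable_const
        (hw.intervalIntegrable _ _) fun x hx => by linarith [(abs_le.1 (hwx x hx)).1]
      rw [intervalIntegral.integral_const, smul_eq_mul] at this
      linarith
    · have := intervalIntegral.integral_mono_on (μ := volume) (g := fun _ => w₀ + ε) hab
        (hw.intervalIntegrable _ _) intervalIntegrable_const fun x hx => by linarith [(abs_le.1 (hwx x hx)).2]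
      rw [intervalIntegral.integral_const, smul_eq_mul] at this
      linarith
  have h1 := le_secondDiff (c := w₀ - ε) hr (fun x _ => hasDerivAt_moment hw R x)
    (fun a ha b hb hab => by rw [hi]; exact (bd a ha b hb hab).1)
  have h2 := le_secondDiff (ψ := fun y => -moment w R y) (c := -(w₀ + ε)) hr
    (fun x _ => (hasDerivAt_moment hw R x).neg)
    (fun a ha b hb hab => by
      have := (bd a ha b hb hab).2
      rw [← hi] at this
      linarith)
  simp only [secondDiff] at h1 h2 ⊢
  rw [abs_le]
  constructor <;> linarith

theorem tendsto_secondDiff_moment {w : ℝ → ℝ} (hw : Continuous w) (R y : ℝ) :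
    Tendsto (fun r => secondDiff (moment w R) y r / r ^ 2) (𝓝[>] 0) (𝓝 (w y)) := by
  rw [Metric.tendsto_nhdsWithin_nhds]
  intro ε hε
  obtain ⟨δ, hδ, H⟩ := Metric.continuous_iff.1 hw y (ε / 2) (by linarith)
  refine ⟨δ, hδ, fun r hr hrδ => ?_⟩
  have hr : 0 < r := hr
  rw [dist_eq, sub_zero, abs_of_pos hr] at hrδ
  have h1 := abs_secondDiff_moment_sub_le hw (R := R) (y := y) (w₀ := w y) (ε := ε / 2) hr.le
    (fun x hx => by
      have := H x (by rw [dist_eq, abs_lt]; constructor <;> linarith [hx.1, hx.2])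
      rw [dist_eq] at this
      exact this.le)
  rw [dist_eq, div_sub' (by positivity), abs_div, abs_of_pos (by positivity : 0 < r ^ 2),
    div_lt_iff₀ (by positivity), mul_comm (r ^ 2)]
  have : 0 < ε * r ^ 2 := by positivity
  linarith

/-- A continuous function with vanishing symmetric second derivative lies below its chord. -/
theorem le_chord_of_secondDiff {e : ℝ → ℝ} (he : Continuous e) {a b : ℝ} (hab : a < b)
    (hs : ∀ y ∈ Ioo a b, Tendsto (fun r => secondDiff e y r / r ^ 2) (𝓝[>] 0) (𝓝 0))
    {y : ℝ} (hy : y ∈ Icc a b) : e y ≤ e a + (e b - e a) / (b - a) * (y - a) := by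
  set ℓ := (e b - e a) / (b - a) with hℓ
  suffices H : ∀ ε > 0, e y - (e a + ℓ * (y - a)) ≤ ε * ((b - a) * (b - a)) by
    by_contra! hc
    have hpos : 0 < (b - a) * (b - a) := by have := sub_pos.2 hab; positivity
    set A := (b - a) * (b - a)
    set X := e y - (e a + ℓ * (y - a))
    have hX0 : 0 < X := by linarith
    have := H (X / (2 * A)) (by positivity)
    rw [show X / (2 * A) * A = X / 2 by field_simp] at this
    linarith
  intro ε hε
  set E : ℝ → ℝ := fun x => e x - (e a + ℓ * (x - a)) - ε * ((x - a) * (b - x)) with hE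
  have hEc : ContinuousOn E (Icc a b) := by simp only [hE]; fun_prop
  obtain ⟨x, hx, hmax⟩ := isCompact_Icc.exists_isMaxOn (nonempty_Icc.2 hab.le) hEc
  have hbound : E y ≤ E x := hmax hy
  have hyab : (y - a) * (b - y) ≤ (b - a) * (b - a) :=
    mul_le_mul (by linarith [hy.2]) (by linarith [hy.1]) (by linarith [hy.2]) (by linarith)
  suffices hx0 : E x ≤ 0 by
    simp only [hE] at hbound hx0
    nlinarith
  by_contra! hpos
  have hxa : a < x := lt_of_le_of_ne hx.1 (by rintro rfl; simp [hE] at hpos)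
  have hxb : x < b := lt_of_le_of_ne hx.2 (by
    rintro rfl
    have : ℓ * (x - a) = e x - e a := by rw [hℓ]; field_simp [(sub_pos.2 hab).ne']
    simp only [hE, this] at hpos; linarith)
  have h1 := (hs x ⟨hxa, hxb⟩).eventually_const_lt (show -(2 * ε) < 0 by linarith)
  obtain ⟨r, hr1, hr2⟩ := (h1.and (Ioo_mem_nhdsGT
    (show (0:ℝ) < min (x - a) (b - x) from lt_min (by linarith) (by linarith)))).exists
  have hr3 := hr2.2.trans_le (min_le_left _ _)
  have hr4 := hr2.2.trans_le (min_le_right _ _)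
  have hr0 := hr2.1
  rw [lt_div_iff₀ (by positivity)] at hr1
  have m1 : E (x + r) ≤ E x := hmax ⟨by linarith, by linarith⟩
  have m2 : E (x - r) ≤ E x := hmax ⟨by linarith, by linarith⟩
  simp only [hE, secondDiff] at m1 m2 hr1
  nlinarith

/-- Schwarz: a continuous function whose symmetric second derivative is continuous is
twice differentiable. -/
theorem hasDerivAt_of_secondDiff {P w : ℝ → ℝ} (hP : Continuous P) (hw : Continuous w) {a b : ℝ}
    (hab : a < b)
    (hs : ∀ y ∈ Ioo a b, Tendsto (fun r => secondDiff P y r / r ^ 2) (𝓝[>] 0) (𝓝 (w y))) :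
    ∀ y ∈ Ioo a b, HasDerivAt P (deriv P y) y ∧ HasDerivAt (deriv P) (w y) y := by
  have hm := hasDerivAt_moment hw a
  have hmc : Continuous (moment w a) := continuous_iff_continuousAt.2 fun y => (hm y).continuousAt
  set e : ℝ → ℝ := fun y => P y - moment w a y with he
  have hec : Continuous e := hP.sub hmc
  have hes : ∀ y ∈ Ioo a b, Tendsto (fun r => secondDiff e y r / r ^ 2) (𝓝[>] 0) (𝓝 0) := by
    intro y hy
    have := (hs y hy).sub (tendsto_secondDiff_moment hw a y)
    rw [sub_self] at this
    refine this.congr fun r => ?_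
    simp only [secondDiff, he]; ring
  set ℓ := (e b - e a) / (b - a) with hℓ
  have heq : ∀ y ∈ Ioo a b, e y = e a + ℓ * (y - a) := by
    intro y hy
    refine le_antisymm (le_chord_of_secondDiff hec hab hes (Ioo_subset_Icc_self hy)) ?_
    have := le_chord_of_secondDiff (e := fun y => -e y) hec.neg hab (fun y hy => by
      have := (hes y hy).neg
      rw [neg_zero] at this
      refine this.congr fun r => ?_
      simp only [secondDiff]; ring) (Ioo_subset_Icc_self hy)
    rw [show (-e b - -e a) / (b - a) = -ℓ by rw [hℓ]; ring] at this
    linarith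
  have h1 : ∀ y ∈ Ioo a b, HasDerivAt P ((-∫ x in y..a, w x) + ℓ) y := by
    intro y hy
    have h2 := (hm y).add (((hasDerivAt_id y).sub_const a).const_mul ℓ |>.const_add (e a))
    refine (h2.congr_of_eventuallyEq ?_).congr_deriv (by simp)
    filter_upwards [Ioo_mem_nhds hy.1 hy.2] with x hx
    have := heq x hx
    simp only [he, Pi.add_apply, id] at this ⊢
    linarith
  intro y hy
  refine ⟨(h1 y hy).differentiableAt.hasDerivAt, ?_⟩
  have h3 := ((hasDerivAt_integral_left hw a y).neg.add_const ℓ)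
  refine (h3.congr_of_eventuallyEq ?_).congr_deriv (by simp)
  filter_upwards [Ioo_mem_nhds hy.1 hy.2] with x hx
  exact (h1 x hx).deriv

namespace WaveData

variable {D : WaveData}

namespace Approx

variable (A : D.Approx)

/-- The time derivative of the limiting wave. -/
def V (x t : ℝ) : ℝ := deriv (fun s => A.U x s) t

/-- The time derivative of the averages of the limiting wave against tent functions. -/
def tentRate (R y t r : ℝ) : ℝ := (secondDiff (fun x => A.U x t ^ 2) y r
  + secondDiff (moment (fun x => D.g x (A.U x t)) R) y r) / r ^ 2

/-- The average of the limiting wave against a tent function. -/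
def tentAvg (R y r t : ℝ) : ℝ := secondDiff (moment (fun x => A.U x t) R) y r / r ^ 2

lemma hasDerivAt_tentAvg {R y r t : ℝ} {n : ℤ} (hr : 0 ≤ r) (hy : y + r ≤ R) (ht : t < n * A.per)
    (hR : A.X₀ + n < R) : HasDerivAt (A.tentAvg R y r) (A.tentRate R y t r) t := by
  have h : ∀ z ≤ R, HasDerivAt (fun t => moment (fun x => A.U x t) R z)
      (A.U z t ^ 2 + moment (fun x => D.g x (A.U x t)) R z) t :=
    fun z hz => A.hasDerivAt_mass hz ht hR
  refine ((((h _ hy).sub ((h y (by linarith)).const_mul 2)).add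
    (h (y - r) (by linarith))).div_const (r ^ 2)).congr_deriv ?_
  simp only [tentRate, secondDiff]
  ring

lemma continuous_tentRate (R r : ℝ) : Continuous fun q : ℝ × ℝ => A.tentRate R q.1 q.2 r := by
  have hU := A.continuous_U
  have hI : Continuous fun q : ℝ × ℝ => moment (fun x => D.g x (A.U x q.2)) R q.1 :=
    continuous_integral_upper (((continuous_snd.sub continuous_fst.fst)).mul
      (A.continuous_g_U.comp (continuous_snd.prodMk continuous_fst.snd)))
  have hs : ∀ {F : ℝ × ℝ → ℝ}, Continuous F →
      Continuous fun q : ℝ × ℝ => secondDiff (fun x => F (x, q.2)) q.1 r := fun hF =>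
    ((hF.comp ((continuous_fst.add continuous_const).prodMk continuous_snd)).sub
      (continuous_const.mul hF)).add
      (hF.comp ((continuous_fst.sub continuous_const).prodMk continuous_snd))
  exact ((hs (hU.pow 2)).add (hs hI)).div_const _

/-- Local mixed Lipschitz bound near `x₀` after time `t₁`. -/
def MixedLip (x₀ ρ t₁ Λ : ℝ) : Prop := ∀ x z s t, |x - x₀| ≤ ρ → |z - x₀| ≤ ρ → t₁ ≤ s → t₁ ≤ t →
  |(A.U z t - A.U z s) - (A.U x t - A.U x s)| ≤ Λ * |z - x| * |t - s|

variable {A}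
variable {x₀ ρ t₁ Λ R y r s t : ℝ} {n : ℤ}

lemma MixedLip.tentAvg_sub_le (H : A.MixedLip x₀ ρ t₁ Λ) (hΛ : 0 ≤ Λ) (hy : |y - x₀| ≤ ρ / 2)
    (hr : 0 < r) (hrρ : r ≤ ρ / 2) (hs : t₁ ≤ s) (ht : t₁ ≤ t) :
    |(A.tentAvg R y r t - A.tentAvg R y r s) - (A.U y t - A.U y s)| ≤ Λ * r * |t - s| := by
  have hw : Continuous fun x => A.U x t - A.U x s := (A.continuous_U_x t).sub (A.continuous_U_x s)
  have h1 := abs_secondDiff_moment_sub_le hw (R := R) (y := y) (w₀ := A.U y t - A.U y s)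
    (ε := Λ * r * |t - s|) hr.le (fun x hx => by
      rw [abs_le] at hy
      refine (H y x s t (abs_le.2 ⟨by linarith, by linarith⟩)
        (abs_le.2 ⟨by linarith [hx.1], by linarith [hx.2]⟩) hs ht).trans ?_
      gcongr
      exact abs_le.2 ⟨by linarith [hx.1], by linarith [hx.2]⟩)
  have e : ∀ z, moment (fun x => A.U x t - A.U x s) R z
      = moment (fun x => A.U x t) R z - moment (fun x => A.U x s) R z := by
    intro z
    simp only [moment, mul_sub]
    exact intervalIntegral.integral_sub
      ((continuous_moment (A.continuous_U_x t) z).intervalIntegrable _ _)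
      ((continuous_moment (A.continuous_U_x s) z).intervalIntegrable _ _)
  rw [show (A.tentAvg R y r t - A.tentAvg R y r s) - (A.U y t - A.U y s) =
    (secondDiff (moment (fun x => A.U x t - A.U x s) R) y r - (A.U y t - A.U y s) * r ^ 2)
      / r ^ 2 by simp only [secondDiff, e, tentAvg]; field_simp; ring,
    abs_div, abs_of_pos (by positivity : 0 < r ^ 2), div_le_iff₀ (by positivity)]
  exact h1

lemma MixedLip.tentRate_sub_le (H : A.MixedLip x₀ ρ t₁ Λ) (hΛ : 0 ≤ Λ) (hy : |y - x₀| ≤ ρ / 2)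
    (ht : t₁ < t) (htn : t < n * A.per) (hR : A.X₀ + n < R) (hRx : x₀ + ρ ≤ R) {r' : ℝ}
    (hr : 0 < r) (hrρ : r ≤ ρ / 2) (hr' : 0 < r') (hrρ' : r' ≤ ρ / 2) :
    |A.tentRate R y t r - A.tentRate R y t r'| ≤ Λ * (r + r') := by
  have hy' := (abs_le.1 hy).2
  have hd := (A.hasDerivAt_tentAvg hr.le (by linarith) htn hR).sub
    (A.hasDerivAt_tentAvg (y := y) hr'.le (by linarith) htn hR)
  rw [← hd.deriv]
  refine norm_deriv_le_of_lip' (f := A.tentAvg R y r - A.tentAvg R y r') (x₀ := t)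
    (by positivity) ?_
  filter_upwards [Ioi_mem_nhds ht] with s hs
  have h1 := H.tentAvg_sub_le (R := R) hΛ hy hr hrρ ht.le (le_of_lt hs)
  have h2 := H.tentAvg_sub_le (R := R) hΛ hy hr' hrρ' ht.le (le_of_lt hs)
  rw [norm_eq_abs, norm_eq_abs]
  simp only [Pi.sub_apply]
  rw [abs_le] at h1 h2 ⊢
  constructor <;> linarith

lemma MixedLip.hasDerivAt (H : A.MixedLip x₀ ρ t₁ Λ) (hΛ : 0 ≤ Λ) (hρ : 0 < ρ)
    (hy : |y - x₀| ≤ ρ / 2) (ht : t₁ < t) (htn : t < n * A.per) (hR : A.X₀ + n < R)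
    (hRx : x₀ + ρ ≤ R) : HasDerivAt (fun s => A.U y s) (A.V y t) t ∧
      ∀ r, 0 < r → r ≤ ρ / 2 → |A.tentRate R y t r - A.V y t| ≤ Λ * r := by
  have hc := fun (r r' : ℝ) => H.tentRate_sub_le (r := r) (r' := r') hΛ hy ht htn hR hRx
  have hy' := (abs_le.1 hy).2
  set ρn : ℕ → ℝ := fun n => ρ / 2 * (1 / ((n : ℝ) + 1)) with hρn
  have hρ0 : ∀ n, 0 < ρn n := fun n => by simp only [hρn]; positivity
  have hanti : ∀ {m n}, m ≤ n → ρn n ≤ ρn m := fun h =>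
    mul_le_mul_of_nonneg_left (Nat.one_div_le_one_div h) (by linarith)
  have hρ1 : ∀ n, ρn n ≤ ρ / 2 := fun n => by simpa [hρn] using hanti (Nat.zero_le n)
  have hlim : Tendsto ρn atTop (𝓝 0) := by
    have := (tendsto_one_div_add_atTop_nhds_zero_nat (𝕜 := ℝ)).const_mul (ρ / 2)
    rwa [mul_zero] at this
  have hcs : CauchySeq fun n => A.tentRate R y t (ρn n) := by
    refine cauchySeq_of_le_tendsto_0 (fun n => 2 * Λ * ρn n) (fun n m N hn hm => ?_) (by
      simpa using hlim.const_mul (2 * Λ))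
    refine (hc _ _ (hρ0 n) (hρ1 n) (hρ0 m) (hρ1 m)).trans ?_
    have := mul_le_mul_of_nonneg_left (add_le_add (hanti hn) (hanti hm)) hΛ
    linarith
  obtain ⟨v, hv⟩ := cauchySeq_tendsto_of_complete hcs
  have hrv : ∀ r, 0 < r → r ≤ ρ / 2 → |A.tentRate R y t r - v| ≤ Λ * r := by
    intro r hr hr'
    have l1 := ((tendsto_const_nhds (x := A.tentRate R y t r)).sub hv).abs
    have l2 := ((tendsto_const_nhds (x := r)).add hlim).const_mul Λ
    rw [add_zero] at l2
    exact le_of_tendsto_of_tendsto' l1 l2 fun n => hc _ _ hr hr' (hρ0 n) (hρ1 n)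
  have hd : HasDerivAt (fun s => A.U y s) v t := by
    rw [hasDerivAt_iff_isLittleO, Asymptotics.isLittleO_iff]
    intro ε hε
    set r := min (ρ / 2) (ε / (4 * (Λ + 1)))
    have hr0 : 0 < r := lt_min (by linarith) (by positivity)
    have hrρ : r ≤ ρ / 2 := min_le_left _ _
    have hrε : Λ * r ≤ ε / 4 := by
      have : r ≤ ε / (4 * (Λ + 1)) := min_le_right _ _
      rw [le_div_iff₀ (by positivity)] at this
      nlinarith
    have h1 := A.hasDerivAt_tentAvg (R := R) (y := y) hr0.le (by linarith) htn hR
    rw [hasDerivAt_iff_isLittleO, Asymptotics.isLittleO_iff] at h1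
    filter_upwards [h1 (show 0 < ε / 4 by linarith), Ioi_mem_nhds ht] with s hs1 hs2
    have h2 := H.tentAvg_sub_le (R := R) hΛ hy hr0 hrρ ht.le (le_of_lt hs2)
    have h3 := hrv r hr0 hrρ
    simp only [norm_eq_abs, smul_eq_mul] at hs1 ⊢
    have h4 : |(s - t) * (A.tentRate R y t r - v)| ≤ |s - t| * (ε / 4) := by
      rw [abs_mul]; gcongr; linarith
    have h5 : Λ * r * |s - t| ≤ ε / 4 * |s - t| := by gcongr
    rw [abs_le] at hs1 h2 h4 ⊢
    constructor <;> linarith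
  have hV : A.V y t = v := hd.deriv
  rw [hV]
  exact ⟨hd, hrv⟩

variable (A)

/-- At interior points the wave is differentiable in time with continuous derivative, and the
symmetric second derivative of its square is given by the equation. -/
theorem interior_time {x₀ t₀ : ℝ} (h0 : 0 < A.U x₀ t₀) :
    HasDerivAt (fun s => A.U x₀ s) (A.V x₀ t₀) t₀ ∧
    ContinuousAt (fun q : ℝ × ℝ => A.V q.1 q.2) (x₀, t₀) ∧
    Tendsto (fun r => secondDiff (fun x => A.U x t₀ ^ 2) x₀ r / r ^ 2) (𝓝[>] 0)
      (𝓝 (A.V x₀ t₀ - D.g x₀ (A.U x₀ t₀))) := by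
  obtain ⟨ρ, hρ, t₁, ht₁, Λ, hΛ, H⟩ := A.exists_mixed_lipschitz h0
  obtain ⟨n, R, hn, hR, hRx⟩ := A.exists_bounds t₀ (x₀ + ρ)
  have H : A.MixedLip x₀ ρ t₁ Λ := H
  have key := fun (y t : ℝ) (hy : |y - x₀| ≤ ρ / 2) (ht : t₁ < t) (htn : t < n * A.per) =>
    H.hasDerivAt hΛ hρ hy ht htn hR hRx.le
  have h00 := key x₀ t₀ (by simp; linarith) ht₁ hn
  refine ⟨h00.1, ?_, ?_⟩
  · refine continuousAt_of_locally_uniform_approx_of_continuousAt fun u hu => ?_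
    obtain ⟨ε, hε, hεu⟩ := Metric.mem_uniformity_dist.1 hu
    set r := min (ρ / 2) (ε / (2 * (Λ + 1)))
    have hr0 : 0 < r := lt_min (by linarith) (by positivity)
    have hrε : Λ * r < ε := by
      have : r ≤ ε / (2 * (Λ + 1)) := min_le_right _ _
      rw [le_div_iff₀ (by positivity)] at this
      nlinarith
    refine ⟨Metric.closedBall x₀ (ρ / 2) ×ˢ Ioo t₁ (n * A.per),
      prod_mem_nhds (Metric.closedBall_mem_nhds _ (by linarith)) (Ioo_mem_nhds ht₁ hn),
      fun q => A.tentRate R q.1 q.2 r, (A.continuous_tentRate R r).continuousAt, ?_⟩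
    rintro ⟨y, t⟩ ⟨hy, ht⟩
    refine hεu ?_
    rw [dist_comm]
    exact ((key y t hy ht.1 ht.2).2 r hr0 (min_le_left _ _)).trans_lt hrε
  · have h1 : Tendsto (fun r => A.tentRate R x₀ t₀ r) (𝓝[>] 0) (𝓝 (A.V x₀ t₀)) := by
      rw [tendsto_iff_dist_tendsto_zero]
      have h2 : Tendsto (fun r : ℝ => Λ * r) (𝓝[>] 0) (𝓝 0) := by
        have : Tendsto (fun r : ℝ => Λ * r) (𝓝 0) (𝓝 (Λ * 0)) := tendsto_id.const_mul Λ
        rw [mul_zero] at this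
        exact this.mono_left nhdsWithin_le_nhds
      refine squeeze_zero' (Eventually.of_forall fun _ => dist_nonneg) ?_ h2
      filter_upwards [Ioo_mem_nhdsGT (half_pos hρ)] with r hr
      exact h00.2 r hr.1 hr.2.le
    refine (h1.sub (tendsto_secondDiff_moment (A.continuous_g_U_x t₀) R x₀)).congr fun r => ?_
    simp only [tentRate]
    ring

/-- The space derivative of the square of the limiting wave. -/
def flux (x t : ℝ) : ℝ := deriv (fun y => A.U y t ^ 2) x

lemma hasDerivAt_flux {x t : ℝ} (h : x < A.B t) :
    HasDerivAt (fun y => A.U y t ^ 2) (A.flux x t) x ∧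
    HasDerivAt (fun y => A.flux y t) (A.V x t - D.g x (A.U x t)) x := by
  have hab : x - 1 < (x + A.B t) / 2 := by linarith
  have hpos : ∀ y ∈ Icc (x - 1) ((x + A.B t) / 2), 0 < A.U y t := fun y hy =>
    A.U_pos_iff.2 (by linarith [hy.2])
  have hw : ContinuousOn (fun y => A.V y t - D.g y (A.U y t)) (Icc (x - 1) ((x + A.B t) / 2)) := by
    intro y hy
    refine ContinuousAt.continuousWithinAt (ContinuousAt.sub ?_
      (A.continuous_g_U_x t).continuousAt)
    exact ContinuousAt.comp (f := fun y => (y, t)) (g := fun q : ℝ × ℝ => A.V q.1 q.2)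
      (A.interior_time (hpos y hy)).2.1 (by fun_prop)
  set W := IccExtend hab.le ((Icc (x - 1) ((x + A.B t) / 2)).domRestrict
    fun y => A.V y t - D.g y (A.U y t)) with hW
  have he : ∀ y ∈ Icc (x - 1) ((x + A.B t) / 2), W y = A.V y t - D.g y (A.U y t) :=
    fun y hy => by rw [hW, IccExtend_of_mem _ _ hy, domRestrict_apply]
  have hP : Continuous fun x => A.U x t ^ 2 := (A.continuous_U_x t).pow 2
  have := hasDerivAt_of_secondDiff (w := W) hP
    (continuousOn_iff_continuous_domRestrict.1 hw).Icc_extend' hab (fun y hy => by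
      rw [he y (Ioo_subset_Icc_self hy)]
      exact (A.interior_time (hpos y (Ioo_subset_Icc_self hy))).2.2) x
    ⟨by linarith, by linarith⟩
  rwa [he x ⟨by linarith, by linarith⟩] at this

lemma continuousAt_flux {x₀ t₀ : ℝ} (h : x₀ < A.B t₀) :
    ContinuousAt (fun q : ℝ × ℝ => A.flux q.1 q.2) (x₀, t₀) := by
  set w : ℝ × ℝ → ℝ := fun q => A.V q.1 q.2 - D.g q.1 (A.U q.1 q.2)
  have hwc : ContinuousAt w (x₀, t₀) := (A.interior_time (A.U_pos_iff.2 h)).2.1.sub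
    A.continuous_g_U.continuousAt
  set C := |w (x₀, t₀)| + 1
  have hev : ∀ᶠ q : ℝ × ℝ in 𝓝 (x₀, t₀), |w q| < C ∧ q.1 < A.B q.2 :=
    ((hwc.abs).eventually_lt_const (lt_add_one _)).and
      (isOpen_lt continuous_fst (A.continuous_B.comp continuous_snd) |>.mem_nhds h)
  obtain ⟨δ, hδ, hball⟩ := Metric.eventually_nhds_iff_ball.1 hev
  refine continuousAt_of_locally_uniform_approx_of_continuousAt fun u hu => ?_
  obtain ⟨ε, hε, hεu⟩ := Metric.mem_uniformity_dist.1 hu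
  set r := min (δ / 2) (ε / (2 * C))
  have hr0 : 0 < r := lt_min (by linarith) (by positivity)
  have hrε : C * r < ε := by
    have : r ≤ ε / (2 * C) := min_le_right _ _
    rw [le_div_iff₀ (by positivity)] at this
    linarith
  have hrδ : r ≤ δ / 2 := min_le_left _ _
  refine ⟨Metric.ball (x₀, t₀) (δ / 2), Metric.ball_mem_nhds _ (by linarith),
    fun q => (A.U (q.1 + r) q.2 ^ 2 - A.U q.1 q.2 ^ 2) / r, ?_, ?_⟩
  · have hU := A.continuous_U
    exact (((hU.comp ((continuous_fst.add continuous_const).prodMk continuous_snd)).pow 2).sub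
      (hU.pow 2)).div_const _ |>.continuousAt
  rintro ⟨y, t⟩ hy
  refine hεu ?_
  rw [← ball_prod_same, mem_prod, Metric.mem_ball, Metric.mem_ball, dist_eq,
    abs_lt] at hy
  have hin : ∀ z ∈ Icc y (y + r), |w (z, t)| < C ∧ z < A.B t := by
    intro z hz
    refine hball (z, t) ?_
    rw [← ball_prod_same, mem_prod, Metric.mem_ball, Metric.mem_ball, dist_eq, abs_lt]
    exact ⟨⟨by linarith [hz.1, hy.1.1], by linarith [hz.2, hy.1.2]⟩, by linarith [hy.2]⟩
  have hyy : y ∈ Icc y (y + r) := ⟨le_rfl, by linarith⟩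
  have m1 : ∀ z ∈ Icc y (y + r), |A.flux z t - A.flux y t| ≤ C * r := by
    intro z hz
    have := (convex_Icc y (y + r)).norm_image_sub_le_of_norm_hasDerivWithin_le
      (f := fun z => A.flux z t) (C := C)
      (fun z hz => (A.hasDerivAt_flux (hin z hz).2).2.hasDerivWithinAt)
      (fun z hz => (hin z hz).1.le) hyy hz
    refine this.trans ?_
    rw [norm_eq_abs, abs_of_nonneg (by linarith [hz.1])]
    gcongr
    linarith [hz.2]
  have m2 := (convex_Icc y (y + r)).norm_image_sub_le_of_norm_hasDerivWithin_le
      (f := fun z => A.U z t ^ 2 - A.flux y t * z) (C := C * r)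
      (fun z hz => ((A.hasDerivAt_flux (hin z hz).2).1.sub
        ((hasDerivAt_id z).const_mul (A.flux y t))).hasDerivWithinAt)
      (fun z hz => by rw [mul_one]; exact m1 z hz) hyy ⟨by linarith, le_rfl⟩
  rw [add_sub_cancel_left, norm_eq_abs, norm_eq_abs, abs_of_pos hr0] at m2
  rw [dist_comm, dist_eq]
  dsimp only
  rw [div_sub' hr0.ne', abs_div, abs_of_pos hr0, div_lt_iff₀ hr0]
  calc _ = |A.U (y + r) t ^ 2 - A.flux y t * (y + r) - (A.U y t ^ 2 - A.flux y t * y)| := by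
        congr 1; ring
    _ ≤ C * r * r := m2
    _ < ε * r := by gcongr

lemma hasDerivAt_U {x t : ℝ} (h : x < A.B t) :
    HasDerivAt (fun y => A.U y t) (A.flux x t / (2 * A.U x t)) x := by
  have h1 := (A.hasDerivAt_flux h).1.sqrt (pow_pos (A.U_pos_iff.2 h) 2).ne'
  simpa only [Real.sqrt_sq (A.U_nonneg _ _)] using h1

/-- The second space derivative of the limiting wave. -/
def Uxx (x t : ℝ) : ℝ := ((A.V x t - D.g x (A.U x t)) * (2 * A.U x t)
  - A.flux x t * (2 * (A.flux x t / (2 * A.U x t)))) / (2 * A.U x t) ^ 2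

lemma hasDerivAt_deriv_U {x t : ℝ} (h : x < A.B t) :
    HasDerivAt (deriv fun y => A.U y t) (A.Uxx x t) x := by
  have h1 := (A.hasDerivAt_flux h).2.div ((A.hasDerivAt_U h).const_mul 2)
    (by have := A.U_pos_iff.2 h; positivity)
  refine h1.congr_of_eventuallyEq ?_
  filter_upwards [Iio_mem_nhds h] with y hy
  exact (A.hasDerivAt_U hy).deriv

/-- Inside its support the limiting wave is a classical solution. -/
theorem classical : (∀ x t, x < A.B t → DifferentiableAt ℝ (fun s => A.U x s) t ∧
      DifferentiableAt ℝ (fun y => A.U y t) x ∧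
      DifferentiableAt ℝ (deriv fun y => A.U y t) x ∧
      deriv (fun s => A.U x s) t = deriv (deriv fun y => A.U y t ^ 2) x + D.g x (A.U x t)) ∧
    ContinuousOn (fun q : ℝ × ℝ => deriv (fun y => A.U y q.2) q.1) {q | q.1 < A.B q.2} ∧
    ContinuousOn (fun q : ℝ × ℝ => deriv (deriv fun y => A.U y q.2) q.1) {q | q.1 < A.B q.2} ∧
    ContinuousOn (fun q : ℝ × ℝ => deriv (fun s => A.U q.1 s) q.2) {q | q.1 < A.B q.2} := by
  have hV : ContinuousOn (fun q : ℝ × ℝ => A.V q.1 q.2) {q | q.1 < A.B q.2} := fun q hq =>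
    (A.interior_time (A.U_pos_iff.2 hq)).2.1.continuousWithinAt
  have hF : ContinuousOn (fun q : ℝ × ℝ => A.flux q.1 q.2) {q | q.1 < A.B q.2} := fun q hq =>
    (A.continuousAt_flux hq).continuousWithinAt
  have hU2 : ContinuousOn (fun q : ℝ × ℝ => 2 * A.U q.1 q.2) {q | q.1 < A.B q.2} :=
    (continuous_const.mul A.continuous_U).continuousOn
  have h0 : ∀ q ∈ {q : ℝ × ℝ | q.1 < A.B q.2}, 2 * A.U q.1 q.2 ≠ 0 := fun q hq =>
    (mul_pos two_pos (A.U_pos_iff.2 hq)).ne'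
  refine ⟨fun x t h => ⟨(A.interior_time (A.U_pos_iff.2 h)).1.differentiableAt,
    (A.hasDerivAt_U h).differentiableAt, (A.hasDerivAt_deriv_U h).differentiableAt, ?_⟩,
    (hF.div hU2 h0).congr fun q hq => (A.hasDerivAt_U hq).deriv,
    ContinuousOn.congr ?_ fun q hq => (A.hasDerivAt_deriv_U hq).deriv, hV⟩
  · have : deriv (deriv fun y => A.U y t ^ 2) x = _ := (A.hasDerivAt_flux h).2.deriv
    rw [this, V]
    ring
  · exact (((hV.sub A.continuous_g_U.continuousOn).mul hU2).sub
      (hF.mul (continuousOn_const.mul (hF.div hU2 h0)))).div (hU2.pow 2)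
      fun q hq => pow_ne_zero 2 (h0 q hq)

end Approx

end WaveData

lemma secondDiff_moment_congr {w : ℝ → ℝ} (hw : Continuous w) (R R' y r : ℝ) :
    secondDiff (moment w R) y r = secondDiff (moment w R') y r := by
  have h : ∀ z, moment w R z = moment w R' z + ((∫ x in R'..R, x * w x) - z * ∫ x in R'..R, w x) :=
    fun z => by
      have c : Continuous fun x => (x - z) * w x := by fun_prop
      rw [moment, moment, ← intervalIntegral.integral_const_mul, ← intervalIntegral.integral_sub
        ((by fun_prop : Continuous fun x => x * w x).intervalIntegrable _ _)
        ((by fun_prop : Continuous fun x => z * w x).intervalIntegrable _ _),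
        ← intervalIntegral.integral_add_adjacent_intervals (c.intervalIntegrable z R')
          (c.intervalIntegrable R' R)]
      simp only [sub_mul]
  simp only [secondDiff, h]
  ring

lemma tendsto_moment_of_dominated {w : ℝ → ℝ → ℝ} {p : ℝ → ℝ} {C : ℝ} (hw : ∀ t, Continuous (w t))
    (hC : ∀ t x, |w t x| ≤ C) (hp : ∀ x, Tendsto (fun t => w t x) atTop (𝓝 (p x))) (R y : ℝ) :
    Tendsto (fun t => moment (w t) R y) atTop (𝓝 (moment p R y)) := by
  refine intervalIntegral.tendsto_integral_filter_of_dominated_convergence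
    (fun x => |x - y| * C) (Eventually.of_forall fun t => ?_)
    (Eventually.of_forall fun t => Eventually.of_forall fun x _ => ?_)
    ((by fun_prop : Continuous fun x => |x - y| * C).intervalIntegrable _ _)
    (Eventually.of_forall fun x _ => (hp x).const_mul _)
  · exact ((continuous_id.sub continuous_const).mul (hw t)).aestronglyMeasurable
  · rw [norm_mul]
    exact mul_le_mul_of_nonneg_left (hC t x) (abs_nonneg _)

lemma eq_zero_of_tendsto_deriv {F F' : ℝ → ℝ} {a b : ℝ} (hF : ∀ t, HasDerivAt F (F' t) t)
    (ha : Tendsto F atTop (𝓝 a)) (hb : Tendsto F' atTop (𝓝 b)) : b = 0 := by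
  have h := fun t : ℝ => exists_hasDerivAt_eq_slope F F' (lt_add_one t)
    (continuous_iff_continuousAt.2 fun t => (hF t).continuousAt).continuousOn fun s _ => hF s
  choose ξ hξ hs using h
  have h1 : Tendsto (fun t => F' (ξ t)) atTop (𝓝 b) :=
    hb.comp (tendsto_atTop_mono (fun t => (hξ t).1.le) tendsto_id)
  have h2 := (ha.comp (tendsto_atTop_add_const_right atTop (1 : ℝ) tendsto_id)).sub ha
  rw [sub_self] at h2
  exact tendsto_nhds_unique h1 (h2.congr fun t => by rw [hs]; simp)

namespace WaveData

variable {D : WaveData}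

namespace Approx

variable (A : D.Approx)

/-- The periodic steady state behind the limiting wave. -/
def p (x : ℝ) : ℝ := ⨆ t, A.U x t

lemma bddAbove_U (x : ℝ) : BddAbove (range (A.U x)) :=
  ⟨D.M, forall_mem_range.2 fun t => (A.U_mem x t).2⟩

lemma tendsto_p (x : ℝ) : Tendsto (A.U x) atTop (𝓝 (A.p x)) :=
  tendsto_atTop_ciSup (A.U_mono x) (A.bddAbove_U x)

lemma p_mem (x : ℝ) : A.p x ∈ Icc 0 D.M :=
  isClosed_Icc.mem_of_tendsto (A.tendsto_p x) (Eventually.of_forall (A.U_mem x))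

lemma p_pos (x : ℝ) : 0 < A.p x := by
  obtain ⟨n, hn⟩ := exists_nat_ge x
  refine lt_of_lt_of_le ?_ (le_ciSup (A.bddAbove_U x) (0 + (n : ℤ) * A.per))
  rw [A.U_period_int]
  exact A.U_pos_of_le_zero (by push_cast; linarith)

lemma p_period (x : ℝ) : A.p (x + 1) = A.p x := by
  have h := (A.tendsto_p (x + 1)).comp (tendsto_atTop_add_const_right atTop A.per tendsto_id)
  refine tendsto_nhds_unique (h.congr fun t => ?_) (A.tendsto_p x)
  simp [A.U_period]

lemma continuous_p : Continuous A.p := by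
  have h : ∀ x y, |A.p x - A.p y| ≤ D.S * |x - y| := fun x y =>
    le_of_tendsto' ((A.tendsto_p x).sub (A.tendsto_p y)).abs fun t => A.U_lip x y t
  have hS : 0 ≤ D.S := by have := (abs_nonneg _).trans (h 1 0); simpa using this
  exact (LipschitzWith.of_dist_le_mul (K := ⟨D.S, hS⟩) fun x y => h x y).continuous

lemma continuous_g_p : Continuous fun x => D.g x (A.p x) :=
  D.g_cont.comp (continuous_id.prodMk A.continuous_p)

lemma secondDiff_p (y : ℝ) {r : ℝ} (hr : 0 < r) : secondDiff (fun x => A.p x ^ 2) y r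
    + secondDiff (moment (fun x => D.g x (A.p x)) 0) y r = 0 := by
  have hm : ∀ z, Tendsto (fun t => moment (fun x => A.U x t) 0 z) atTop (𝓝 (moment A.p 0 z)) :=
    tendsto_moment_of_dominated A.continuous_U_x (fun t x => (abs_of_nonneg (A.U_nonneg x t)).trans_le
      (A.U_mem x t).2) A.tendsto_p 0
  have hg : ∀ z, Tendsto (fun t => moment (fun x => D.g x (A.U x t)) 0 z) atTop
      (𝓝 (moment (fun x => D.g x (A.p x)) 0 z)) :=
    tendsto_moment_of_dominated A.continuous_g_U_x (fun t x => (D.g_abs_le x (A.U_mem x t)).trans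
      (mul_le_mul_of_nonneg_left (A.U_mem x t).2 (by linarith [D.one_le_L])))
      (fun x => ((D.g_cont.comp (continuous_const.prodMk continuous_id)).tendsto _).comp
        (A.tendsto_p x)) 0
  have hs : ∀ {w : ℝ → ℝ → ℝ} {q : ℝ → ℝ}, (∀ z, Tendsto (fun t => w t z) atTop (𝓝 (q z))) →
      Tendsto (fun t => secondDiff (w t) y r) atTop (𝓝 (secondDiff q y r)) := fun h =>
    ((h _).sub ((h _).const_mul 2)).add (h _)
  have hU : ∀ z, Tendsto (fun t => A.U z t ^ 2) atTop (𝓝 (A.p z ^ 2)) := fun z =>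
    (A.tendsto_p z).pow 2
  refine eq_zero_of_tendsto_deriv
    (F := fun t => secondDiff (moment (fun x => A.U x t) 0) y r) (fun t => ?_) (hs hm)
    ((hs (w := fun t x => A.U x t ^ 2) hU).add (hs hg))
  obtain ⟨n, R, hn, hR, hyR⟩ := A.exists_bounds t (y + r)
  refine (((A.hasDerivAt_tentAvg hr.le hyR.le hn hR).mul_const (r ^ 2)).congr_deriv ?_)
    |>.congr_of_eventuallyEq (Eventually.of_forall fun s => ?_)
  · rw [tentRate, div_mul_cancel₀ _ (by positivity),
      secondDiff_moment_congr (A.continuous_g_U_x t) R 0]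
  · show _ = secondDiff _ y r / r ^ 2 * r ^ 2
    rw [div_mul_cancel₀ _ (by positivity),
      secondDiff_moment_congr (A.continuous_U_x s) R 0]

lemma hasDerivAt_p_sq (x : ℝ) : HasDerivAt (fun y => A.p y ^ 2) (deriv (fun y => A.p y ^ 2) x) x ∧
    HasDerivAt (deriv fun y => A.p y ^ 2) (-D.g x (A.p x)) x := by
  have hP : Continuous fun y => A.p y ^ 2 := A.continuous_p.pow 2
  refine hasDerivAt_of_secondDiff hP A.continuous_g_p.neg (sub_one_lt x |>.trans (lt_add_one x))
    (fun y _ => ?_) x ⟨sub_one_lt x, lt_add_one x⟩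
  refine (tendsto_secondDiff_moment A.continuous_g_p 0 y).neg.congr' ?_
  filter_upwards [self_mem_nhdsWithin] with r hr
  rw [← neg_div, neg_eq_of_add_eq_zero_left (A.secondDiff_p y hr)]

lemma contDiff_p : ContDiff ℝ 2 A.p := by
  have h : ContDiff ℝ 2 fun y => A.p y ^ 2 := by
    rw [show (2 : WithTop ℕ∞) = 1 + 1 by norm_num, contDiff_succ_iff_deriv]
    refine ⟨fun x => (A.hasDerivAt_p_sq x).1.differentiableAt, by simp, ?_⟩
    rw [contDiff_one_iff_deriv]
    refine ⟨fun x => (A.hasDerivAt_p_sq x).2.differentiableAt, ?_⟩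
    rw [funext fun x => (A.hasDerivAt_p_sq x).2.deriv]
    exact A.continuous_g_p.neg
  have h2 := h.sqrt fun x => (pow_pos (A.p_pos x) 2).ne'
  simpa only [Real.sqrt_sq (A.p_mem _).1] using h2

lemma tendsto_U_sub_p (t : ℝ) : Tendsto (fun x => A.U x t - A.p x) atBot (𝓝 0) := by
  have hu : TendstoUniformlyOn (fun (t x : ℝ) => A.U x t) A.p atTop (Icc 0 1) :=
    Monotone.tendstoUniformlyOn_of_forall_tendsto isCompact_Icc
    (fun t => (A.continuous_U_x t).continuousOn) (fun x _ => A.U_mono x)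
    A.continuous_p.continuousOn fun x _ => A.tendsto_p x
  rw [Metric.tendsto_nhds]
  intro ε hε
  obtain ⟨s, hs⟩ := eventually_atTop.1 (Metric.tendstoUniformlyOn_iff.1 hu ε hε)
  have hper := A.T_pos
  filter_upwards [Iic_mem_atBot ((t - s) / A.per)] with x hx
  have h1 := hs (t + ((-⌊x⌋ : ℤ) : ℝ) * A.per) (by
    have : x ≤ (t - s) / A.per := hx
    rw [le_div_iff₀ hper] at this
    have := mul_le_mul_of_nonneg_right (Int.floor_le x) hper.le
    push_cast
    linarith) (x - ⌊x⌋) ⟨by linarith [Int.floor_le x], by linarith [Int.lt_floor_add_one x]⟩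
  have hp : A.p (x - ⌊x⌋) = A.p x := by
    have h : Function.Periodic A.p 1 := A.p_period
    simpa using h.sub_int_mul_eq ⌊x⌋ (x := x)
  rw [A.U_period_int, hp, dist_comm] at h1
  push_cast at h1
  rwa [sub_neg_eq_add, sub_add_cancel, dist_eq, ← Real.dist_0_eq_abs] at h1

end Approx

end WaveData

/-- Uniform Lipschitz and second-difference bounds for a `C²` function periodic in `x`. -/
theorem exists_reaction_bounds {g : ℝ → ℝ → ℝ} (hg : ContDiff ℝ 2 (Function.uncurry g))
    (hper : ∀ x u, g (x + 1) u = g x u) (M : ℝ) : ∃ L, 1 ≤ L ∧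
    (∀ x, ∀ u ∈ Icc (-1) (M + 1), ∀ v ∈ Icc (-1) (M + 1), |g x u - g x v| ≤ L * |u - v|) ∧
    (∀ x y, ∀ u ∈ Icc (-1) (M + 1), |g x u - g y u| ≤ L * |x - y|) ∧
    ∀ x h, 0 ≤ h → h ≤ 1 → ∀ u ∈ Icc (-1) (M + 1), ∀ b ∈ Icc (-1) (M + 1),
      ∀ d ∈ Icc (-1) (M + 1), |g (x + h) b + g (x - h) d - 2 * g x u|
        ≤ L * |b + d - 2 * u| + L * (h ^ 2 + (b - u) ^ 2 + (d - u) ^ 2) := by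
  set G := Function.uncurry g with hGdef
  set K : Set (ℝ × ℝ) := Icc (-1) 2 ×ˢ Icc (-1) (M + 1)
  have hKc : IsCompact K := isCompact_Icc.prod isCompact_Icc
  have hKv : Convex ℝ K := (convex_Icc _ _).prod (convex_Icc _ _)
  obtain ⟨C₁, h₁⟩ := (hg.of_le (by norm_num : (1 : WithTop ℕ∞) ≤ 2)).locallyLipschitz
    |>.locallyLipschitzOn.exists_lipschitzOnWith_of_compact hKc
  have hG' : ContDiff ℝ 1 (fderiv ℝ G) := hg.fderiv_right (by norm_num)
  obtain ⟨C₂, h₂⟩ := hG'.locallyLipschitz.locallyLipschitzOn.exists_lipschitzOnWith_of_compact hKc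
  obtain ⟨C₃, h₃⟩ := hKc.exists_bound_of_continuousOn hG'.continuous.continuousOn
  set L : ℝ := 1 + C₁ + 2 * C₂ + |C₃| with hL
  have hC₂ := C₂.2
  have hC₃ := abs_nonneg C₃
  have sh : ∀ (x u : ℝ) (n : ℤ), g x u = g (x - n) u := fun x u n => by
    have h : Function.Periodic (fun x => g x u) 1 := fun x => hper x u
    simpa using (h.sub_int_mul_eq n (x := x)).symm
  have fl : ∀ x : ℝ, 0 ≤ x - ⌊x⌋ ∧ x - ⌊x⌋ ≤ 1 := fun x =>
    ⟨by linarith [Int.floor_le x], by linarith [Int.lt_floor_add_one x]⟩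
  have mk : ∀ {x u : ℝ}, -1 ≤ x → x ≤ 2 → u ∈ Icc (-1) (M + 1) → (x, u) ∈ K :=
    fun h h' hu => ⟨⟨h, h'⟩, hu⟩
  have lip : ∀ {q r : ℝ × ℝ}, q ∈ K → r ∈ K → |G q - G r| ≤ L * max |q.1 - r.1| |q.2 - r.2| := by
    intro q r hq hr
    have := h₁.dist_le_mul q hq r hr
    rw [Prod.dist_eq, dist_eq, dist_eq, dist_eq] at this
    exact this.trans (mul_le_mul_of_nonneg_right (by linarith) (le_max_of_le_left (abs_nonneg _)))
  refine ⟨L, by linarith, fun x u hu v hv => ?_, fun x y u hu => ?_,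
    fun x h hh hh1 u hu b hb d hd => ?_⟩
  · rw [sh x u ⌊x⌋, sh x v ⌊x⌋]
    have := lip (mk (x := x - ⌊x⌋) (by linarith [fl x]) (by linarith [fl x]) hu)
      (mk (x := x - ⌊x⌋) (by linarith [fl x]) (by linarith [fl x]) hv)
    simpa [hGdef] using this
  · have lx : ∀ {a b : ℝ}, -1 ≤ a → a ≤ 2 → -1 ≤ b → b ≤ 2 → |g a u - g b u| ≤ L * |a - b| :=
      fun h1 h2 h3 h4 => by simpa [hGdef] using lip (mk h1 h2 hu) (mk h3 h4 hu)
    have hx := fl x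
    have hy := fl y
    rcases le_total |x - y| 1 with h | h
    · rw [sh x u ⌊x⌋, sh y u ⌊x⌋]
      rw [abs_le] at h
      have := lx (a := x - ⌊x⌋) (b := y - ⌊x⌋) (by linarith) (by linarith) (by linarith)
        (by linarith)
      rwa [sub_sub_sub_cancel_right] at this
    · rw [sh x u ⌊x⌋, sh y u ⌊y⌋]
      refine (lx (by linarith) (by linarith) (by linarith) (by linarith)).trans
        (mul_le_mul_of_nonneg_left (le_trans ?_ h) (by linarith))
      rw [abs_le]; constructor <;> linarith
  · rw [sh x u ⌊x⌋, sh (x + h) b ⌊x⌋, sh (x - h) d ⌊x⌋, add_sub_right_comm x h, sub_right_comm]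
    set y := x - ⌊x⌋
    have hy0 : 0 ≤ y ∧ y ≤ 1 := fl x
    have hq : (y, u) ∈ K := mk (by linarith) (by linarith) hu
    have tay : ∀ r ∈ K, |G r - G (y, u) - fderiv ℝ G (y, u) (r - (y, u))|
        ≤ C₂ * ((r.1 - y) ^ 2 + (r.2 - u) ^ 2) := fun r hr => by
      have hs : segment ℝ (y, u) r ⊆ K := hKv.segment_subset hq hr
      have := (convex_segment (y, u) r).norm_image_sub_le_of_norm_hasFDerivWithin_le'
        (φ := fderiv ℝ G (y, u)) (C := C₂ * ‖r - (y, u)‖)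
        (fun z _ => ((hg.differentiable (by norm_num)) z).hasFDerivAt.hasFDerivWithinAt)
        (fun z hz => (h₂.norm_sub_le (hs hz) hq).trans (mul_le_mul_of_nonneg_left
          (norm_sub_le_of_mem_segment hz) hC₂)) (left_mem_segment ..) (right_mem_segment ..)
      refine this.trans ?_
      rw [mul_assoc]
      refine mul_le_mul_of_nonneg_left ?_ hC₂
      rw [Prod.norm_def]
      rcases max_choice ‖(r - (y, u)).1‖ ‖(r - (y, u)).2‖ with e | e <;> rw [e] <;>
        simp only [norm_eq_abs, abs_mul_abs_self, Prod.fst_sub, Prod.snd_sub] <;>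
        nlinarith [sq_nonneg (r.1 - y), sq_nonneg (r.2 - u)]
    have t1 := tay (y + h, b) (mk (by linarith) (by linarith) hb)
    have t2 := tay (y - h, d) (mk (by linarith) (by linarith) hd)
    have t3 : |fderiv ℝ G (y, u) ((y + h, b) - (y, u)) + fderiv ℝ G (y, u) ((y - h, d) - (y, u))|
        ≤ |C₃| * |b + d - 2 * u| := by
      rw [← map_add]
      refine (ContinuousLinearMap.le_opNorm _ _).trans (mul_le_mul
        ((h₃ _ hq).trans (le_abs_self _)) (le_of_eq ?_) (norm_nonneg _) hC₃)
      rw [show ((y + h, b) - (y, u) + ((y - h, d) - (y, u)) : ℝ × ℝ) = (0, b + d - 2 * u) by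
        ext <;> simp <;> ring]
      simp [Prod.norm_def]
    have e1 : |C₃| * |b + d - 2 * u| ≤ L * |b + d - 2 * u| :=
      mul_le_mul_of_nonneg_right (by linarith) (abs_nonneg _)
    have e2 : 2 * C₂ * (h ^ 2 + (b - u) ^ 2 + (d - u) ^ 2)
        ≤ L * (h ^ 2 + (b - u) ^ 2 + (d - u) ^ 2) :=
      mul_le_mul_of_nonneg_right (by linarith) (by positivity)
    have e3 : 0 ≤ C₂ * ((b - u) ^ 2 + (d - u) ^ 2) := by positivity
    simp only [hGdef, Function.uncurry_apply_pair, add_sub_cancel_left, sub_sub_cancel_left,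
      neg_sq] at t1 t2 t3
    rw [abs_le] at t1 t2 t3 ⊢
    constructor <;> linarith

lemma hasDerivAt_comp_max {q q' : ℝ → ℝ} (hq : ∀ z, HasDerivAt q (q' z) z) {s : ℝ}
    (hs : q' s = 0) (z : ℝ) : HasDerivAt (fun z => q (max z s)) (q' (max z s)) z := by
  have h1 : ∀ z ≤ s, HasDerivWithinAt (fun z => q (max z s)) (q' (max z s)) (Iic s) z :=
    fun z hz => by
      rw [max_eq_right hz, hs]
      exact (hasDerivWithinAt_const z _ (q s)).congr (fun y hy => by rw [max_eq_right hy])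
        (by rw [max_eq_right hz])
  have h2 : ∀ z, s ≤ z → HasDerivWithinAt (fun z => q (max z s)) (q' (max z s)) (Ici s) z :=
    fun z hz => by
      rw [max_eq_left hz]
      exact (hq z).hasDerivWithinAt.congr (fun y hy => by rw [max_eq_left hy])
        (by rw [max_eq_left hz])
  rcases lt_trichotomy z s with h | rfl | h
  · exact (h1 z h.le).hasDerivAt (Iic_mem_nhds h)
  · have := (h1 z le_rfl).union (h2 z le_rfl)
    rwa [Iic_union_Ici, hasDerivWithinAt_univ] at this
  · exact (h2 z h.le).hasDerivAt (Ici_mem_nhds h)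

lemma le_secondDiff_comp_max {q q' q'' : ℝ → ℝ} (hq : ∀ z, HasDerivAt q (q' z) z)
    (hq' : ∀ z, HasDerivAt q' (q'' z) z) {s z h k : ℝ} (hs : q' s = 0) (hh : 0 ≤ h)
    (hk : ∀ y ∈ Icc (max (z - h) s) (max (z + h) s), k ≤ q'' y) (hc : s ≤ z - h ∨ k ≤ 0) :
    k * h ^ 2 ≤ secondDiff (fun z => q (max z s)) z h := by
  refine le_secondDiff hh (fun x _ => hasDerivAt_comp_max hq hs x) fun a ha b hb hab => ?_
  have hm : max a s ≤ max b s := max_le_max_right s hab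
  have h1 : k * (max b s - max a s) ≤ q' (max b s) - q' (max a s) := by
    refine (convex_Icc _ _).mul_sub_le_image_sub_of_le_deriv
      (fun y _ => (hq' y).continuousAt.continuousWithinAt)
      (fun y _ => (hq' y).differentiableAt.differentiableWithinAt) (fun y hy => ?_) _
      (left_mem_Icc.2 hm) _ (right_mem_Icc.2 hm) hm
    rw [(hq' y).deriv]
    have hy := interior_subset hy
    exact hk y ⟨(max_le_max_right s ha.1).trans hy.1, hy.2.trans (max_le_max_right s hb.2)⟩
  refine le_trans ?_ h1
  rcases hc with hc | hc
  · rw [max_eq_left (by linarith [hb.1]), max_eq_left (by linarith [ha.1])]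
  · refine mul_le_mul_of_nonpos_left ?_ hc
    rcases max_cases b s with h | h <;> rcases max_cases a s with h' | h' <;> linarith

set_option maxHeartbeats 400000 in
/-- A truncated classical subsolution profile satisfies the lattice subsolution inequalities. -/
theorem exists_lattice_profile {g : ℝ → ℝ → ℝ} {p p' p'' : ℝ → ℝ} {c s l L : ℝ}
    (hp : ∀ z, HasDerivAt p (p' z) z) (hp' : ∀ z, HasDerivAt p' (p'' z) z) (hp'' : Continuous p'')
    (hc : 0 < c) (hsl : s < l) (hs : p' s = 0) (hs' : p'' s ≤ 0) (hl : p l = 0) (ha : p' l < -c)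
    (hpos : ∀ z ∈ Ico s l, 0 < p z) (hg : ∀ x, ∀ z ∈ Icc s l, |g x (p z)| ≤ L * p z)
    (hF : ∀ x, ∀ z ∈ Icc s l, 0 ≤ 2 * p' z ^ 2 + 2 * p z * p'' z + c * p' z + g x (p z)) :
    ∃ σ₁ > 0, ∀ σ, 0 < σ → σ ≤ σ₁ → ∃ h₀ > 0, ∀ h, 0 < h → h ≤ h₀ → ∀ x z, z < l →
      -(c * p' (max z s)) ≤ (secondDiff (fun z => p (min (max z s) l) ^ 2) z h + 2 * σ ^ 2 *
        secondDiff (fun z => p (min (max z s) l)) z h) / h ^ 2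
        + g x (p (min (max z s) l)) + σ * p (min (max z s) l) := by
  have cp : Continuous p := continuous_iff_continuousAt.2 fun z => (hp z).continuousAt
  have cp' : Continuous p' := continuous_iff_continuousAt.2 fun z => (hp' z).continuousAt
  set Ψ : ℝ → ℝ := fun z => 2 * p' z ^ 2 + 2 * p z * p'' z with hΨ
  have cΨ : Continuous Ψ := by fun_prop
  have hq : ∀ z, HasDerivAt (fun z => p z ^ 2) (2 * p z * p' z) z := fun z =>
    ((hp z).fun_pow 2).congr_deriv (by push_cast; ring)
  have hq' : ∀ z, HasDerivAt (fun z => 2 * p z * p' z) (Ψ z) z := fun z =>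
    (((hp z).const_mul 2).mul (hp' z)).congr_deriv (by simp only [hΨ]; ring)
  set a := -p' l with hadef
  have hac : c < a := by linarith
  set γ := (a ^ 2 - c * a) / 4 with hγ
  have hγ0 : 0 < γ := by have : 0 < a * (a - c) := mul_pos (by linarith) (by linarith)
                         linarith
  have near : ∀ᶠ z in 𝓝 l, a ^ 2 + 3 * γ < Ψ z + c * p' z - L * p z ∧ p' z < 0 ∧
      p' z ^ 2 < a ^ 2 + γ := by
    refine ((by fun_prop : Continuous fun z => Ψ z + c * p' z - L * p z).continuousAt.eventually_const_lt
      ?_).and ((cp'.continuousAt.eventually_lt_const (by linarith)).and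
      ((cp'.pow 2).continuousAt.eventually_lt_const ?_))
    · simp only [hΨ, hl, show p' l = -a by ring]; linarith
    · simp only [Pi.pow_apply, show p' l = -a by ring]; linarith
  obtain ⟨d', hd', hnear⟩ := Metric.eventually_nhds_iff.1 near
  set d := min (d' / 2) (l - s) with hd
  have hd0 : 0 < d := lt_min (by linarith) (by linarith)
  have hdd : d ≤ d' / 2 := min_le_left _ _
  have hds : s ≤ l - d := by linarith [min_le_right (d' / 2) (l - s)]
  have hnear : ∀ z ∈ Icc (l - d) (l + d), a ^ 2 + 3 * γ < Ψ z + c * p' z - L * p z ∧ p' z < 0 ∧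
      p' z ^ 2 < a ^ 2 + γ := fun z hz => hnear (by
    rw [dist_eq, abs_lt]; constructor <;> linarith [hz.1, hz.2])
  obtain ⟨ζ, hζ, hζm⟩ := isCompact_Icc.exists_isMinOn (nonempty_Icc.2 hds) cp.continuousOn
  have hδ : 0 < p ζ := hpos ζ ⟨hζ.1, by linarith [hζ.2]⟩
  obtain ⟨C, hC⟩ := isCompact_Icc.exists_bound_of_continuousOn (hp''.continuousOn (s := Icc s (l + d)))
  have hC0 : 0 ≤ C := (norm_nonneg _).trans (hC s ⟨le_rfl, by linarith⟩)
  refine ⟨min (min 1 (γ / (2 * (C + 1)))) (p ζ / (4 * (C + 1))), by positivity,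
    fun σ hσ hσ1 => ?_⟩
  have hσ2 : σ ≤ 1 := hσ1.trans ((min_le_left _ _).trans (min_le_left _ _))
  have hσ3 : 2 * σ ^ 2 * C ≤ γ := by
    have := hσ1.trans ((min_le_left _ _).trans (min_le_right _ _))
    rw [le_div_iff₀ (by positivity)] at this
    nlinarith [mul_nonneg hσ.le hC0]
  have hσ4 : 2 * σ ^ 2 * C ≤ σ * p ζ / 2 := by
    have := hσ1.trans (min_le_right _ _)
    rw [le_div_iff₀ (by positivity)] at this
    nlinarith [mul_nonneg hσ.le hC0, mul_le_mul_of_nonneg_left this hσ.le]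
  set η := min γ (σ * p ζ / 2) with hη
  have hη0 : 0 < η := by positivity
  obtain ⟨δ, hδ0, huc⟩ := Metric.uniformContinuousOn_iff.1
    (isCompact_Icc.uniformContinuousOn_of_continuous (cΨ.continuousOn (s := Icc s (l + d)))) η hη0
  refine ⟨min d (δ / 2), by positivity, fun h hh hhd x z hz => ?_⟩
  have h1 : h ≤ d := hhd.trans (min_le_left _ _)
  have h2 : h ≤ δ / 2 := hhd.trans (min_le_right _ _)
  set Z := max z s with hZ
  have hZI : Z ∈ Icc s l := ⟨le_max_right _ _, max_le hz.le hsl.le⟩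
  rw [min_eq_left hZI.2]
  have win : ∀ y ∈ Icc (max (z - h) s) (max (z + h) s), y ∈ Icc s (l + d) ∧ |y - Z| ≤ h := by
    intro y hy
    have m1 : Z - h ≤ max (z - h) s := by
      rcases max_cases z s with e | e <;> rcases max_cases (z - h) s with e' | e' <;> linarith
    have m2 : max (z + h) s ≤ Z + h := by
      rcases max_cases z s with e | e <;> rcases max_cases (z + h) s with e' | e' <;> linarith
    exact ⟨⟨(le_max_right _ _).trans hy.1, hy.2.trans (max_le (by linarith) (by linarith))⟩,
      abs_le.2 ⟨by linarith [hy.1], by linarith [hy.2]⟩⟩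
  have hZI' : Z ∈ Icc s (l + d) := ⟨hZI.1, by linarith [hZI.2]⟩
  have sd2 : (Ψ Z - η) * h ^ 2 ≤ secondDiff (fun z => p (max z s) ^ 2) z h := by
    refine le_secondDiff_comp_max hq hq' (by rw [hs, mul_zero]) hh.le (fun y hy => ?_) ?_
    · have := huc y (win y hy).1 Z hZI' (by
        rw [dist_eq]; linarith [(win y hy).2])
      rw [dist_eq, abs_lt] at this
      linarith
    · refine or_iff_not_imp_left.2 fun hlt => ?_
      push Not at hlt
      have := huc Z hZI' s ⟨le_rfl, by linarith⟩ (by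
        rw [dist_eq, abs_of_nonneg (by linarith [hZI.1])]
        rcases max_cases z s with e | e <;> linarith)
      rw [dist_eq, abs_lt] at this
      have : Ψ s ≤ 0 := by
        simp only [hΨ, hs]
        nlinarith [hpos s ⟨le_rfl, hsl⟩]
      linarith
  have sd1 : -C * h ^ 2 ≤ secondDiff (fun z => p (max z s)) z h :=
    le_secondDiff_comp_max hp hp' hs hh.le (fun y hy =>
      (abs_le.1 (hC y (win y hy).1)).1) (Or.inr (by linarith))
  have fin : ∀ e : ℝ, (Ψ Z - η) - 2 * σ ^ 2 * C - e ≥ -(c * p' Z) - g x (p Z) - σ * p Z →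
      secondDiff (fun z => p (max z s) ^ 2) z h - e * h ^ 2
        ≤ secondDiff (fun z => p (min (max z s) l) ^ 2) z h →
      secondDiff (fun z => p (max z s)) z h ≤ secondDiff (fun z => p (min (max z s) l)) z h →
      -(c * p' Z) ≤ (secondDiff (fun z => p (min (max z s) l) ^ 2) z h + 2 * σ ^ 2 *
        secondDiff (fun z => p (min (max z s) l)) z h) / h ^ 2 + g x (p Z) + σ * p Z := by
    intro e he e2 e1
    have : (Ψ Z - η) - 2 * σ ^ 2 * C - e ≤
        (secondDiff (fun z => p (min (max z s) l) ^ 2) z h + 2 * σ ^ 2 *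
        secondDiff (fun z => p (min (max z s) l)) z h) / h ^ 2 := by
      rw [le_div_iff₀ (by positivity)]
      have := mul_le_mul_of_nonneg_left (sd1.trans e1) (by positivity : 0 ≤ 2 * σ ^ 2)
      linarith
    linarith
  have hgZ := abs_le.1 (hg x Z hZI)
  have hZd : l - d ≤ Z → (Ψ Z - η) - 2 * σ ^ 2 * C - (a ^ 2 + γ)
      ≥ -(c * p' Z) - g x (p Z) - σ * p Z := fun h => by
    have n := (hnear Z ⟨h, by linarith [hZI.2]⟩).1
    have hp0 : 0 ≤ p Z := by
      rcases hZI.2.eq_or_lt with e | e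
      · rw [e, hl]
      · exact (hpos Z ⟨hZI.1, e⟩).le
    have := mul_nonneg hσ.le hp0
    linarith [min_le_left γ (σ * p ζ / 2)]
  have hmid : ∀ y ≤ z + h, z + h ≤ l → p (min (max y s) l) = p (max y s) := fun y hy hyl => by
    rw [min_eq_left (max_le (by linarith) hsl.le)]
  rcases le_or_gt (z + h) l with hzl | hzl
  · refine fin 0 ?_ (le_of_eq ?_) (le_of_eq ?_)
    · rcases le_total (l - d) Z with e | e
      · have := hZd e
        have : 0 < a ^ 2 + γ := by positivity
        linarith
      · have hF' := hF x Z hZI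
        have : p ζ ≤ p Z := hζm ⟨hZI.1, e⟩
        have := mul_le_mul_of_nonneg_left this hσ.le
        simp only [hΨ]
        linarith [min_le_right γ (σ * p ζ / 2)]
    all_goals
      simp only [secondDiff, hmid _ le_rfl hzl, hmid z (by linarith) hzl,
        hmid (z - h) (by linarith) hzl, zero_mul, sub_zero]
  · have hzs : s ≤ z + h := by linarith
    have hyI : ∀ ξ ∈ Ioo l (z + h), ξ ∈ Icc (l - d) (l + d) := fun ξ hξ =>
      ⟨by linarith [hξ.1], by linarith [hξ.2]⟩
    obtain ⟨ξ, hξ, hξe⟩ := exists_hasDerivAt_eq_slope p p' hzl cp.continuousOn fun y _ => hp y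
    have n := hnear ξ (hyI ξ hξ)
    rw [hl, sub_zero, eq_div_iff (by linarith)] at hξe
    have r1 : p (min (z + h) l) = 0 := by rw [min_eq_right hzl.le, hl]
    have r2 : p (min (max z s) l) = p (max z s) := by rw [min_eq_left hZI.2]
    have r3 : p (min (max (z - h) s) l) = p (max (z - h) s) := by
      rw [min_eq_left (max_le (by linarith) hsl.le)]
    have hp0 : p (z + h) ≤ 0 := by
      rw [← hξe]
      exact mul_nonpos_of_nonpos_of_nonneg n.2.1.le (by linarith)
    refine fin (a ^ 2 + γ) (hZd (by linarith [le_max_left z s])) ?_ ?_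
    · simp only [secondDiff, r1, r2, r3, max_eq_left hzs]
      have : p (z + h) ^ 2 ≤ (a ^ 2 + γ) * h ^ 2 := by
        rw [← hξe, mul_pow]
        exact mul_le_mul n.2.2.le (pow_le_pow_left₀ (by linarith) (by linarith) 2) (sq_nonneg _)
          (by positivity)
      linarith
    · simp only [secondDiff, r1, r2, r3, max_eq_left hzs]
      linarith

/-- A `C²` function on a compact interval vanishing at its left end is the restriction of a `C²`
function on the line. -/
lemma exists_extension {φ : ℝ → ℝ} {a b : ℝ} (hab : a < b) (hφ : ContDiffOn ℝ 2 φ (Icc a b))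
    (h0 : φ a = 0) : ∃ p p' p'' : ℝ → ℝ, (∀ z, HasDerivAt p (p' z) z) ∧
      (∀ z, HasDerivAt p' (p'' z) z) ∧ Continuous p'' ∧ EqOn p φ (Icc a b) ∧
      EqOn p' (derivWithin φ (Icc a b)) (Icc a b) := by
  set I := Icc a b
  have hu : UniqueDiffOn ℝ I := uniqueDiffOn_Icc hab
  have h1 : ContDiffOn ℝ 1 (derivWithin φ I) I := hφ.derivWithin hu (by norm_num)
  have h2 := h1.continuousOn_derivWithin hu le_rfl
  set p'' := IccExtend hab.le (I.domRestrict (derivWithin (derivWithin φ I) I)) with hp''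
  have cp'' : Continuous p'' := (continuousOn_iff_continuous_domRestrict.1 h2).Icc_extend'
  have ep'' : EqOn p'' (derivWithin (derivWithin φ I) I) I := fun z hz => by
    rw [hp'', IccExtend_of_mem _ _ hz]; rfl
  set p' : ℝ → ℝ := fun z => derivWithin φ I a + ∫ t in a..z, p'' t with hp'
  have dp' : ∀ z, HasDerivAt p' (p'' z) z := fun z =>
    (cp''.integral_hasStrictDerivAt a z).hasDerivAt.const_add _
  have cp' : Continuous p' := continuous_iff_continuousAt.2 fun z => (dp' z).continuousAt
  set p : ℝ → ℝ := fun z => ∫ t in a..z, p' t with hp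
  have dp : ∀ z, HasDerivAt p (p' z) z := fun z => (cp'.integral_hasStrictDerivAt a z).hasDerivAt
  have key : ∀ {q r q' : ℝ → ℝ}, (∀ z, HasDerivAt q (q' z) z) → DifferentiableOn ℝ r I →
      EqOn q' (derivWithin r I) I → q a = r a → EqOn q r I := fun hq hr he hi =>
    eq_of_derivWithin_eq (fun z _ => (hq z).differentiableAt.differentiableWithinAt) hr
      (fun z hz => by
        rw [(hq z).hasDerivWithinAt.derivWithin (hu z (Ico_subset_Icc_self hz)),
          he (Ico_subset_Icc_self hz)]) hi
  have e1 := key dp' (h1.differentiableOn (by norm_num)) ep'' (by simp [hp'])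
  exact ⟨p, p', p'', dp, dp', cp'', key dp (hφ.differentiableOn (by norm_num)) e1
    (by simp [hp, h0]), e1⟩

/-- (F2) with a quadratic nonlinearity, for a globally defined profile on the interval to the
right of a maximum. -/
lemma CondF2.exists_profile {f : ℝ → ℝ → ℝ} {κ : ℝ → ℝ} {c l : ℝ} {φ : ℝ → ℝ}
    (h : CondF2 2 f κ c l φ) : ∃ (p p' p'' : ℝ → ℝ) (s : ℝ), (∀ z, HasDerivAt p (p' z) z) ∧
      (∀ z, HasDerivAt p' (p'' z) z) ∧ Continuous p'' ∧ s < l ∧ p' s = 0 ∧ p'' s ≤ 0 ∧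
      p l = 0 ∧ p' l < -c ∧ (∀ z ∈ Ico s l, 0 < p z) ∧ (∀ z ∈ Icc s l, p z ≤ p s) ∧
      ∀ x, ∀ z ∈ Icc s l, 0 ≤ 2 * p' z ^ 2 + 2 * p z * p'' z + c * p' z + f x (p z) * (κ x - p z) := by
  obtain ⟨-, hl, hφ, h0, h1, hpos, ha, hF⟩ := h
  have hab : -l < l := by linarith
  obtain ⟨p, p', p'', dp, dp', cp'', ep, ep'⟩ := exists_extension hab hφ h0
  set I := Icc (-l) l with hI
  have hu : UniqueDiffOn ℝ I := uniqueDiffOn_Icc hab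
  have cp : Continuous p := continuous_iff_continuousAt.2 fun z => (dp z).continuousAt
  obtain ⟨s, hsI, hs⟩ := isCompact_Icc.exists_isMaxOn (nonempty_Icc.2 hab.le) (cp.continuousOn (s := I))
  have hlI : l ∈ I := right_mem_Icc.2 hab.le
  have ps : 0 < p s := by
    have h00 : (0 : ℝ) ∈ Ioo (-l) l := ⟨by linarith, hl⟩
    have h01 := Ioo_subset_Icc_self h00
    exact (hpos 0 h00).trans_le ((ep h01).symm.le.trans (hs h01))
  have hsl : s < l := hsI.2.lt_of_ne fun e => by rw [e, ep hlI, h1] at ps; exact lt_irrefl _ ps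
  have hls : -l < s := hsI.1.lt_of_ne fun e => by
    rw [← e, ep (left_mem_Icc.2 hab.le), h0] at ps; exact lt_irrefl _ ps
  have hmax : IsLocalMax p s := hs.isLocalMax (Icc_mem_nhds hls hsl)
  have ed : deriv p = p' := funext fun z => (dp z).deriv
  have ed' : deriv p' = p'' := funext fun z => (dp' z).deriv
  have hs0 : p' s = 0 := hmax.hasDerivAt_eq_zero (dp s)
  have hsub : Icc s l ⊆ I := Icc_subset_Icc hls.le le_rfl
  refine ⟨p, p', p'', s, dp, dp', cp'', hsl, hs0, ?_, (ep hlI).trans h1, ?_, fun z hz => ?_,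
    fun z hz => hs (hsub hz), fun x z hz => ?_⟩
  · by_contra! hc
    have hmin := isLocalMin_of_deriv_deriv_pos (f := p) (by rwa [ed, ed']) (by rw [ed, hs0])
      cp.continuousAt
    have e1 : p =ᶠ[𝓝 s] fun _ => p s := by
      filter_upwards [hmin, hmax] with z h1 h2 using le_antisymm h2 h1
    have e2 := e1.deriv.deriv_eq
    rw [ed, ed'] at e2
    simp at e2
    linarith
  · rw [ep' hlI]; linarith
  · rw [ep (hsub ⟨hz.1, hz.2.le⟩)]; exact hpos z ⟨hls.trans_le hz.1, hz.2⟩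
  · have hz := hsub hz
    have h3 := hF x z hz
    have e1 : EqOn (derivWithin (fun w => φ w ^ (2 : ℝ)) I) (fun w => 2 * p w * p' w) I := by
      intro w hw
      rw [derivWithin_congr (f := fun w => p w ^ 2) (fun y hy => by simp only [Real.rpow_two, ep hy])
        (by simp only [Real.rpow_two, ep hw]), ((dp w).fun_pow 2).hasDerivWithinAt.derivWithin (hu w hw)]
      simp
    have d2 := ((dp z).const_mul 2).fun_mul (dp' z)
    rw [derivWithin_congr e1 (e1 hz), d2.hasDerivWithinAt.derivWithin (hu z hz), ← ep' hz,
      ← ep hz] at h3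
    linarith

lemma exists_waveData {f : ℝ → ℝ → ℝ} {κ : ℝ → ℝ} {θ c l : ℝ} {φ : ℝ → ℝ} (hF1 : CondF1 f κ θ)
    (hF2 : CondF2 2 f κ c l φ) : ∃ D : WaveData, ∀ x u, D.g x u = f x u * (κ x - u) := by
  obtain ⟨p, p', p'', s, dp, dp', cp'', hsl, hs, hs', hl, ha, hpos, hle, hF⟩ := hF2.exists_profile
  obtain ⟨hf, hκ, fper, κper, f0, hθ, fpos, -⟩ := hF1
  have hgc : ContDiff ℝ 2 (Function.uncurry fun x u => f x u * (κ x - u)) :=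
    hf.mul ((hκ.comp contDiff_fst).sub contDiff_snd)
  set g : ℝ → ℝ → ℝ := fun x u => f x u * (κ x - u) with hg
  have gper : ∀ x u, g (x + 1) u = g x u := fun x u => by simp only [hg, fper, κper]
  have g0 : ∀ x, g x 0 = 0 := fun x => by simp only [hg, f0, zero_mul]
  have ps := hpos s ⟨le_rfl, hsl⟩
  obtain ⟨xm, -, hxm⟩ := isCompact_Icc.exists_isMaxOn (nonempty_Icc.2 zero_le_one)
    (hκ.continuous.continuousOn (s := Icc (0 : ℝ) 1))
  set M := max (max 1 (θ + 1)) (max (p s) (κ xm + 1)) with hM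
  have hM1 : 1 ≤ M := (le_max_left _ _).trans (le_max_left _ _)
  have hMθ : θ < M := (lt_add_one θ).trans_le ((le_max_right _ _).trans (le_max_left _ _))
  have hMp : p s ≤ M := (le_max_left _ _).trans (le_max_right _ _)
  have hMκ : κ xm + 1 ≤ M := (le_max_right _ _).trans (le_max_right _ _)
  obtain ⟨xn, -, hxn⟩ := isCompact_Icc.exists_isMaxOn (nonempty_Icc.2 zero_le_one)
    ((hgc.continuous.comp (continuous_id.prodMk continuous_const)).continuousOn
      (s := Icc (0 : ℝ) 1) (f := fun x => g x M))
  have hδ : 0 < -g xn M := by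
    obtain ⟨y, hy, e⟩ := Function.Periodic.exists_mem_Ico₀ (f := κ) κper one_pos xn
    have : κ xn ≤ κ xm := e ▸ hxm (Ico_subset_Icc_self hy)
    have := mul_pos (fpos xn M hMθ) (show 0 < M - κ xn by linarith)
    simp only [hg]
    linarith
  obtain ⟨L, hL1, lip, lipx, sec⟩ := exists_reaction_bounds hgc gper M
  have hrange : ∀ z ∈ Icc s l, 0 ≤ p z := fun z hz => hz.2.eq_or_lt.elim
    (fun e => by rw [e, hl]) fun e => (hpos z ⟨hz.1, e⟩).le
  obtain ⟨σ₁, hσ₁, hsub⟩ := exists_lattice_profile (g := g) (L := L) dp dp' cp'' hF2.1 hsl hs hs' hl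
    ha hpos (fun x z hz => by
      have h0 := hrange z hz
      have h1 := hle z hz
      have := lip x (p z) ⟨by linarith, by linarith⟩ 0 ⟨by linarith, by linarith⟩
      rwa [g0, sub_zero, sub_zero, abs_of_nonneg h0] at this) hF
  have cp : Continuous p := continuous_iff_continuousAt.2 fun z => (dp z).continuousAt
  have hmem : ∀ z, min (max z s) l ∈ Icc s l := fun z =>
    ⟨le_min (le_max_right _ _) hsl.le, min_le_right _ _⟩
  have hM0 : 0 < M := by linarith
  refine ⟨{ g := g, M := M, L := L, σ₀ := min (min 1 (-g xn M / M)) σ₁, c := c, us := p s, zs := s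
            l := l, φ := fun z => p (min (max z s) l), dφ := fun z => p' (max z s)
            one_le_M := hM1
            one_le_L := hL1
            σ₀_pos := lt_min (lt_min one_pos (div_pos hδ hM0)) hσ₁
            σ₀_le := (min_le_left _ _).trans (min_le_left _ _)
            g_cont := hgc.continuous
            g_diff := fun x u => ((hgc.differentiable (by norm_num)).comp
              ((differentiable_const x).prodMk differentiable_id)) u
            g_per := gper
            g_zero := g0
            g_M := fun x => ?_
            lip := lip
            lipx := lipx
            sec := sec
            c_pos := hF2.1
            us_pos := ps
            us_le := hMp
            φ_nonneg := fun z => hrange _ (hmem z)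
            φ_le := fun z => hle _ (hmem z)
            φ_left := fun z hz => by rw [max_eq_right hz, min_eq_left hsl.le]
            φ_right := fun z hz => by rw [min_eq_right (hz.trans (le_max_left _ _)), hl]
            φ_cont := by fun_prop
            φ_deriv := fun z hz => ?_
            φ_sub := fun σ h0 h1 => ?_ }, fun x u => rfl⟩
  · obtain ⟨y, hy, e⟩ := Function.Periodic.exists_mem_Ico₀ (f := fun x => g x M)
      (fun x => gper x M) one_pos x
    have h1 : g x M ≤ g xn M := e ▸ hxn (Ico_subset_Icc_self hy)
    have h2 := mul_le_mul_of_nonneg_right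
      ((min_le_left _ σ₁).trans (min_le_right 1 (-g xn M / M))) hM0.le
    rw [div_mul_cancel₀ _ hM0.ne'] at h2
    linarith
  · refine (hasDerivAt_comp_max dp hs z).congr_of_eventuallyEq ?_
    filter_upwards [Iio_mem_nhds hz] with y hy
    rw [min_eq_left (max_le (le_of_lt hy) hsl.le)]
  · obtain ⟨h₀, hh₀, H⟩ := hsub σ h0 (h1.trans (min_le_right _ _))
    refine ⟨h₀, hh₀, fun h ha hb x z hz => (H h ha hb x z hz).trans_eq ?_⟩
    simp only [secondDiff]
    ring

/-- Under (F1) and (F2), the porous media equation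
`u_t = (u^m)_{xx} + f(x,u)(κ(x) - u)` admits a periodic sharp traveling wave. -/
theorem exists_periodic_sharp_wave
    (m : ℝ) (hm : 1 < m) (f : ℝ → ℝ → ℝ) (κ : ℝ → ℝ) (θ : ℝ)
    (hF1 : CondF1 f κ θ)
    (c₀ l₀ : ℝ) (φ₀ : ℝ → ℝ) (hF2 : CondF2 m f κ c₀ l₀ φ₀) :
    ∃ (T δs : ℝ) (U : ℝ → ℝ → ℝ) (B p₀ : ℝ → ℝ),
      PeriodicSharpWave m f κ T δs U B p₀ := by
  obtain rfl := hF2.exponent_eq_two hm hF1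
  obtain ⟨D, hg⟩ := exists_waveData hF1 hF2
  obtain ⟨A⟩ := WaveData.exists_approx (D := D) fun σ h0 h1 => by
    obtain ⟨h₀, hh₀, H⟩ := D.φ_sub σ h0 h1
    refine ⟨h₀, hh₀, fun h ha hb x z hz => (H h ha hb x z hz).trans_eq ?_⟩
    simp only [Phi, WaveData.G, add_assoc]
  obtain ⟨tm, -, htm⟩ := isCompact_Icc.exists_isMinOn (nonempty_Icc.2 A.T_pos.le)
    (A.continuous_α.continuousOn (s := Icc 0 A.per))
  obtain ⟨h1, h2, h3, h4⟩ := A.classical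
  have dB : deriv A.B = fun t => 2 * A.α t := funext fun t => (A.hasDerivAt_B t).deriv
  refine ⟨A.per, 2 * A.α tm, A.U, A.B, A.p, A.T_pos, mul_pos two_pos (A.α_pos tm), A.continuous_U,
    A.U_nonneg, contDiff_one_iff_deriv.2 ⟨fun t => (A.hasDerivAt_B t).differentiableAt, ?_⟩,
    A.contDiff_p, A.p_pos, A.p_period, fun x => ?_, A.U_period, fun x t => A.U_pos_iff.2,
    fun x t => A.U_eq_zero_iff.2, fun x t hx => ?_, h2, h3, h4, fun x t hx => ?_,
    fun a τ haτ => A.veryWeakSol hg haτ, A.tendsto_U_sub_p, fun t => ⟨?_, ?_⟩⟩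
  · rw [dB]
    exact A.continuous_α.const_mul 2
  · simp only [Real.rpow_two, (A.hasDerivAt_p_sq x).2.deriv, ← hg, neg_add_cancel]
  · exact ⟨(h1 x t hx).1, (h1 x t hx).2.1, (h1 x t hx).2.2.1⟩
  · simpa only [Real.rpow_two, hg] using (h1 x t hx).2.2.2
  · norm_num [dB, (A.hasDerivWithinAt_U_B t).derivWithin (uniqueDiffWithinAt_Iic _)]
  · obtain ⟨y, hy, e⟩ := Function.Periodic.exists_mem_Ico₀ A.α_period A.T_pos t
    simp only [dB, e]
    exact mul_le_mul_of_nonneg_left (htm (Ico_subset_Icc_self hy)) two_pos.le
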